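/- General Néron Desingularization (Popescu's Theorem): Let φ : A → B be a regular morphism of Noetherian commutative rings, let C be a finitely generated A-algebra, and let ψ : C → B be a morphism of A-algebras. Then ψ factors through a finitely generated A-algebra D which is smooth over A; that is, there exist A-algebra morphisms σ : C → D and τ : D → B with ψ = τ ∘ σ. -/

import Mathlib

/-!
# General Néron Desingularization (Popescu's Theorem)
-/

universe u

/-- A commutative ring is a regular local ring if it is Noetherian, local, and its maximal
ideal can be generated by `d` elements where `d` is its Krull dimension. -/
def IsRegularLocalRingP (R : Type u) [CommRing R] : Prop :=
  IsNoetherianRing R ∧ ∃ h : IsLocalRing R, ∃ s : Finset R,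
    Ideal.span (s : Set R) = @IsLocalRing.maximalIdeal R _ h ∧
    ((s.card : ℕ∞) : WithBot ℕ∞) = ringKrullDim R

/-- A commutative ring is regular if it is Noetherian and all of its localizations at prime
ideals are regular local rings. -/
def IsRegularRingP (R : Type u) [CommRing R] : Prop :=
  IsNoetherianRing R ∧
    ∀ (p : Ideal R) [p.IsPrime], IsRegularLocalRingP (Localization.AtPrime p)

/-- The residue field `κ(p) = Frac (A / p)` of a prime ideal `p`, together with the canonical
map `A → κ(p)`. -/
noncomputable def residueFieldHom {A : Type u} [CommRing A] (p : Ideal A) [p.IsPrime] :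
    A →+* FractionRing (A ⧸ p) :=
  (algebraMap (A ⧸ p) (FractionRing (A ⧸ p))).comp (Ideal.Quotient.mk p)

/-- A ring morphism `φ : A → B` between Noetherian rings is regular if it is flat and for
every prime ideal `p` of `A` and every finite field extension `K` of the residue field
`κ(p) = Frac (A / p)`, the ring `B ⊗[A] K` is geometrically regular. -/
def RingHomIsRegular {A B : Type u} [CommRing A] [CommRing B] (φ : A →+* B) : Prop :=
  (letI : Algebra A B := φ.toAlgebra; Module.Flat A B) ∧
  ∀ (p : Ideal A) [p.IsPrime] (K : Type u) [Field K]
    [Algebra (FractionRing (A ⧸ p)) K] [FiniteDimensional (FractionRing (A ⧸ p)) K],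
    letI : Algebra A B := φ.toAlgebra
    letI : Algebra A K :=
      ((algebraMap (FractionRing (A ⧸ p)) K).comp (residueFieldHom p)).toAlgebra
    IsRegularRingP (TensorProduct A B K)

set_option linter.all false

namespace GND

/-- `FS f b`: the localization `B_b` is formally smooth over `R` via `f`. -/
def FS {R B : Type u} [CommRing R] [CommRing B] (f : R →+* B) (b : B) : Prop :=
  ∀ (T T' : Type u) [CommRing T] [CommRing T'] (q : T →+* T'), Function.Surjective q →
    (∀ x y, q x = 0 → q y = 0 → x * y = 0) →
    ∀ (φ : R →+* T) (g : B →+* T'), g.comp f = q.comp φ → IsUnit (g b) →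
      ∃ g' : B →+* T, q.comp g' = g ∧ g'.comp f = φ

variable {R B C D S : Type u} [CommRing R] [CommRing B] [CommRing C] [CommRing D] [CommRing S]

theorem isUnit_of_sq_zero {T T' : Type*} [CommRing T] [CommRing T'] (q : T →+* T')
    (hq : Function.Surjective q) (hs : ∀ x y, q x = 0 → q y = 0 → x * y = 0) {x : T}
    (hx : IsUnit (q x)) : IsUnit x := by
  obtain ⟨y', hy'⟩ := hx.exists_right_inv
  obtain ⟨y, rfl⟩ := hq y'
  have h0 : q (1 - x * y) = 0 := by simp [hy']
  have h1 := hs _ _ h0 h0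
  exact IsUnit.of_mul_eq_one (y * (2 - x * y)) (by linear_combination -h1)

theorem FS.mono {f : R →+* B} {b c : B} (h : FS f b) (hbc : b ∣ c) : FS f c := by
  intro T T' _ _ q hq hs φ g hg hu
  exact h T T' q hq hs φ g hg (isUnit_of_dvd_unit (map_dvd g hbc) hu)

theorem FS.of_pow {f : R →+* B} {b : B} {n : ℕ} (h : FS f (b ^ n)) : FS f b := by
  intro T T' _ _ q hq hs φ g hg hu
  exact h T T' q hq hs φ g hg (by rw [map_pow]; exact hu.pow n)

theorem FS.of_one {f : R →+* B} (h : FS f 1) (b : B) : FS f b := h.mono (one_dvd b)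

theorem FS.comp {f : R →+* B} {g : B →+* C} {b : B} {c : C} (hf : FS f b) (hg : FS g c) :
    FS (g.comp f) (g b * c) := by
  intro T T' _ _ q hq hs φ k hk hu
  rw [map_mul] at hu
  obtain ⟨h1, h2⟩ := IsUnit.mul_iff.mp hu
  obtain ⟨k1, hk1, hk1'⟩ := hf T T' q hq hs φ (k.comp g) (by rw [← hk]; rfl) h1
  obtain ⟨k2, hk2, hk2'⟩ := hg T T' q hq hs k1 k hk1.symm h2
  exact ⟨k2, hk2, by rw [← RingHom.comp_assoc, hk2', hk1']⟩

/-- transfer along a map that is a local isomorphism -/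
theorem FS.transfer {f : R →+* B} {b : B} (h : FS f b) (s : B →+* C)
    (hex : ∀ (T : Type u) [CommRing T] (g : B →+* T), IsUnit (g b) →
      ∃ g' : C →+* T, g'.comp s = g)
    (hun : ∀ c : C, ∃ n : ℕ, ∃ y, s b ^ n * c = s y) : FS (s.comp f) (s b) := by
  intro T T' _ _ q hq hs φ k hk hu
  obtain ⟨k1, hk1, hk1'⟩ := h T T' q hq hs φ (k.comp s) (by rw [← hk]; rfl) hu
  have hu1 : IsUnit (k1 b) := by
    apply isUnit_of_sq_zero q hq hs
    rw [← RingHom.comp_apply, hk1]; exact hu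
  obtain ⟨k2, hk2⟩ := hex T k1 hu1
  refine ⟨k2, ?_, by rw [← RingHom.comp_assoc, hk2, hk1']⟩
  ext c
  obtain ⟨n, y, hy⟩ := hun c
  have e1 : k (s b) ^ n * k c = k (s y) := by rw [← map_pow, ← map_mul, hy]
  have e2 : k (s b) ^ n * q (k2 c) = k (s y) := by
    have : k2 (s b ^ n * c) = k2 (s y) := by rw [hy]
    have h3 : ∀ z, q (k2 (s z)) = k (s z) := fun z => by
      have := RingHom.congr_fun hk1 z
      rw [← hk2] at this; exact this
    have h4 := congrArg q this
    rw [map_mul, map_pow, map_mul, map_pow, h3, h3] at h4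
    exact h4
  exact (hu.pow n).mul_left_cancel (e2.trans e1.symm)

/-- transfer along a surjection with kernel killed by powers of `b` -/
theorem FS.transfer_surj {f : R →+* B} {b : B} (h : FS f b) (s : B →+* C)
    (hs : Function.Surjective s) (hk : ∀ x, s x = 0 → ∃ n : ℕ, b ^ n * x = 0) :
    FS (s.comp f) (s b) := by
  refine h.transfer s ?_ ?_
  · intro T _ g hg
    refine ⟨RingHom.liftOfSurjective s hs ⟨g, ?_⟩, ?_⟩
    · intro x hx
      obtain ⟨n, hn⟩ := hk x hx
      have := congrArg g hn
      rw [map_mul, map_pow, map_zero] at this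
      exact (hg.pow n).mul_right_eq_zero.mp this
    · exact RingHom.liftOfRightInverse_comp _ _ _ _
  · intro c
    obtain ⟨y, rfl⟩ := hs c
    exact ⟨0, y, by simp⟩

theorem FS.away (b : B) : FS (algebraMap B (Localization.Away b)) 1 := by
  intro T T' _ _ q hq hs φ g hg _
  have hu : IsUnit (φ b) := by
    apply isUnit_of_sq_zero q hq hs
    rw [← RingHom.comp_apply, ← hg]
    exact (IsLocalization.Away.algebraMap_isUnit (S := Localization.Away b) b).map g
  refine ⟨IsLocalization.Away.lift b hu, ?_, IsLocalization.Away.lift_comp b hu⟩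
  apply IsLocalization.ringHom_ext (Submonoid.powers b)
  rw [RingHom.comp_assoc, IsLocalization.Away.lift_comp b hu, hg]

theorem FS.id : FS (RingHom.id R) 1 := by
  intro T T' _ _ q hq hs φ g hg _
  exact ⟨φ, by rw [← hg]; rfl, rfl⟩

theorem FS.of_equiv {f : R →+* B} {b : B} (h : FS f b) (e : B ≃+* C) :
    FS ((e : B →+* C).comp f) (e b) :=
  h.transfer_surj (e : B →+* C) e.surjective (fun x hx => ⟨0, by
    have : x = 0 := e.injective (by simpa using hx)
    simp [this]⟩)

/-- polynomial rings -/
theorem FS.mvPolynomial (ι : Type) : FS (MvPolynomial.C : R →+* MvPolynomial ι R) 1 := by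
  intro T T' _ _ q hq hs φ g hg _
  choose x hx using fun i => hq (g (MvPolynomial.X i))
  refine ⟨MvPolynomial.eval₂Hom φ x, ?_, ?_⟩
  · apply MvPolynomial.ringHom_ext
    · intro r
      have := RingHom.congr_fun hg r
      simpa using this.symm
    · intro i; simp [hx]
  · ext r; simp

theorem FS.comp' {f : R →+* B} {g : B →+* C} {b : B} {c : C} (hf : FS f b) (hg : FS g c) {d : C}
    (h1 : g b * c ∣ d) : FS (g.comp f) d := (hf.comp hg).mono h1

/-- Taylor expansion -/
theorem taylor {ι : Type} [Fintype ι] {T : Type*} [CommRing T] (φ : R →+* T) (x h : ι → T)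
    (p : MvPolynomial ι R) : ∃ q : ι → ι → T,
    MvPolynomial.eval₂ φ (fun i => x i + h i) p = MvPolynomial.eval₂ φ x p +
      ∑ i, MvPolynomial.eval₂ φ x (MvPolynomial.pderiv i p) * h i + ∑ i, ∑ j, q i j * (h i * h j) := by
  classical
  induction p using MvPolynomial.induction_on with
  | C a => exact ⟨0, by simp⟩
  | add p p' hp hp' =>
    obtain ⟨q, hq⟩ := hp
    obtain ⟨q', hq'⟩ := hp'
    refine ⟨fun i j => q i j + q' i j, ?_⟩
    simp only [MvPolynomial.eval₂_add, hq, hq', map_add, add_mul, Finset.sum_add_distrib]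
    ring
  | mul_X p k hp =>
    obtain ⟨q, hq⟩ := hp
    refine ⟨fun i j => q i j * (x k + h k) + if j = k then MvPolynomial.eval₂ φ x (MvPolynomial.pderiv i p) else 0, ?_⟩
    have e1 : ∀ i, MvPolynomial.eval₂ φ x (MvPolynomial.pderiv i (p * MvPolynomial.X k)) * h i =
        MvPolynomial.eval₂ φ x (MvPolynomial.pderiv i p) * h i * x k +
        if i = k then MvPolynomial.eval₂ φ x p * h i else 0 := by
      intro i
      by_cases hik : i = k
      · subst hik; simp; ring
      · simp [MvPolynomial.pderiv_X_of_ne (Ne.symm hik), hik]; ring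
    simp only [MvPolynomial.eval₂_mul, MvPolynomial.eval₂_X, hq, e1, add_mul, Finset.sum_add_distrib,
      Finset.sum_ite_eq', Finset.mem_univ, if_true, ite_mul, zero_mul]
    have e2 : ∀ i j, q i j * (x k + h k) * (h i * h j) = q i j * (h i * h j) * (x k + h k) := by
      intros; ring
    have e3 : ∀ i, MvPolynomial.eval₂ φ x (MvPolynomial.pderiv i p) * (h i * h k) =
        MvPolynomial.eval₂ φ x (MvPolynomial.pderiv i p) * h i * h k := by intros; ring
    simp only [e2, e3, ← Finset.sum_mul]
    ring

theorem taylor_sq_zero {ι : Type} [Fintype ι] {T : Type*} [CommRing T] (φ : R →+* T) (x h : ι → T)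
    (h0 : ∀ i j, h i * h j = 0)
    (p : MvPolynomial ι R) :
    MvPolynomial.eval₂ φ (fun i => x i + h i) p = MvPolynomial.eval₂ φ x p +
      ∑ i, MvPolynomial.eval₂ φ x (MvPolynomial.pderiv i p) * h i := by
  obtain ⟨q, hq⟩ := taylor φ x h p
  simp [hq, h0]

end GND

namespace GND
open MvPolynomial

theorem mem_map_away {P : Type*} [CommRing P] (J K : Ideal P) (b : P)
    {z : Localization.Away (Ideal.Quotient.mk K b)}
    (hz : z ∈ J.map ((algebraMap _ (Localization.Away (Ideal.Quotient.mk K b))).comp (Ideal.Quotient.mk K))) :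
    ∃ n : ℕ, ∃ j ∈ J, algebraMap _ (Localization.Away (Ideal.Quotient.mk K b)) (Ideal.Quotient.mk K b) ^ n * z =
      algebraMap _ (Localization.Away (Ideal.Quotient.mk K b)) (Ideal.Quotient.mk K j) := by
  rw [← Ideal.map_map] at hz
  obtain ⟨⟨⟨a, ha⟩, ⟨s, n, rfl⟩⟩, h⟩ := (IsLocalization.mem_map_algebraMap_iff (Submonoid.powers (Ideal.Quotient.mk K b)) _).mp hz
  obtain ⟨j, hj, rfl⟩ := (Ideal.mem_map_iff_of_surjective _ Ideal.Quotient.mk_surjective).mp ha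
  refine ⟨n, j, hj, ?_⟩
  rw [← h, mul_comm]; simp

theorem away_eq_zero {P : Type*} [CommRing P] (K : Ideal P) (b x : P)
    (h : algebraMap _ (Localization.Away (Ideal.Quotient.mk K b)) (Ideal.Quotient.mk K x) = 0) :
    ∃ n : ℕ, b ^ n * x ∈ K := by
  rw [← map_zero (algebraMap (P ⧸ K) (Localization.Away (Ideal.Quotient.mk K b))),
    IsLocalization.eq_iff_exists (Submonoid.powers (Ideal.Quotient.mk K b))] at h
  obtain ⟨⟨c, n, rfl⟩, hc⟩ := h
  refine ⟨n, ?_⟩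
  rw [← Ideal.Quotient.eq_zero_iff_mem]
  simpa using hc

theorem retraction {R R' P : Type u} [CommRing R] [CommRing R'] [CommRing P] (f : R →+* P)
    (J K : Ideal P) (hJK : J ^ 2 ≤ K) (p : R →+* R') (hp : Function.Surjective p)
    (hker : ∀ r, p r = 0 → f r ∈ K) (f' : R' →+* P ⧸ J)
    (hf' : f'.comp p = (Ideal.Quotient.mk J).comp f) (b : P)
    (h : FS f' (Ideal.Quotient.mk J b)) :
    ∃ s : P ⧸ J →+* Localization.Away (Ideal.Quotient.mk K b),
      (∀ x : P, algebraMap _ (Localization.Away (Ideal.Quotient.mk K b)) (Ideal.Quotient.mk K x) -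
        s (Ideal.Quotient.mk J x) ∈ J.map ((algebraMap _ (Localization.Away (Ideal.Quotient.mk K b))).comp (Ideal.Quotient.mk K))) ∧
      ∀ r, s (Ideal.Quotient.mk J (f r)) = algebraMap _ (Localization.Away (Ideal.Quotient.mk K b)) (Ideal.Quotient.mk K (f r)) := by
  set L := Localization.Away (Ideal.Quotient.mk K b)
  set ι : P →+* L := (algebraMap _ L).comp (Ideal.Quotient.mk K) with hι
  set I := J.map ι with hI
  have hιK : ∀ x ∈ K, ι x = 0 := fun x hx => by
    simp [hι, Ideal.Quotient.eq_zero_iff_mem.mpr hx]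
  have hII : I ^ 2 = ⊥ := by
    rw [hI, ← Ideal.map_pow, eq_bot_iff, Ideal.map_le_iff_le_comap]
    intro x hx
    exact hιK x (hJK hx)
  let φ : R' →+* L := RingHom.liftOfSurjective p hp ⟨ι.comp f, fun r hr => hιK _ (hker r hr)⟩
  have hφ : φ.comp p = ι.comp f := RingHom.liftOfRightInverse_comp _ _ _ _
  let g : P ⧸ J →+* L ⧸ I := Ideal.Quotient.lift J ((Ideal.Quotient.mk I).comp ι) (fun x hx =>
    Ideal.Quotient.eq_zero_iff_mem.mpr (Ideal.mem_map_of_mem _ hx))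
  have hg : g.comp (Ideal.Quotient.mk J) = (Ideal.Quotient.mk I).comp ι := by ext x; rfl
  obtain ⟨s, hs1, hs2⟩ := h L (L ⧸ I) (Ideal.Quotient.mk I) Ideal.Quotient.mk_surjective
    (by
      intro x y hx hy
      rw [Ideal.Quotient.eq_zero_iff_mem] at hx hy
      have : x * y ∈ I ^ 2 := by rw [sq]; exact Ideal.mul_mem_mul hx hy
      rw [hII] at this; exact this) φ g
    (by
      rw [← RingHom.cancel_right hp, RingHom.comp_assoc, hf', RingHom.comp_assoc, hφ,
        ← RingHom.comp_assoc, hg]; rfl)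
    (by
      show IsUnit (Ideal.Quotient.mk I (ι b))
      exact (IsLocalization.Away.algebraMap_isUnit (S := L) (Ideal.Quotient.mk K b)).map _)
  refine ⟨s, ?_, ?_⟩
  · intro x
    rw [← Ideal.Quotient.eq_zero_iff_mem, map_sub, sub_eq_zero]
    have := RingHom.congr_fun hs1 (Ideal.Quotient.mk J x)
    exact this.symm
  · intro r
    have h1 := RingHom.congr_fun hf' r
    have h2 := RingHom.congr_fun hs2 (p r)
    have h3 := RingHom.congr_fun hφ r
    simp only [RingHom.comp_apply] at h1 h2 h3
    rw [← h1, h2, h3]; rfl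

variable {R : Type u} [CommRing R] {ι : Type} [Fintype ι]

/-- quasi-standard elements for `P/J` -/
def QS (J : Ideal (MvPolynomial ι R)) (b : MvPolynomial ι R) : Prop :=
  ∃ j : ι → MvPolynomial ι R, (∀ i, j i ∈ J) ∧ ∀ f ∈ J, b * f - ∑ i, pderiv i f * j i ∈ J ^ 2

theorem QS.add {J : Ideal (MvPolynomial ι R)} {b c : MvPolynomial ι R} (hb : QS J b) (hc : QS J c) :
    QS J (b + c) := by
  obtain ⟨j, hj, h⟩ := hb
  obtain ⟨j', hj', h'⟩ := hc
  refine ⟨fun i => j i + j' i, fun i => J.add_mem (hj i) (hj' i), fun f hf => ?_⟩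
  have := (J ^ 2).add_mem (h f hf) (h' f hf)
  convert this using 1
  simp only [mul_add, Finset.sum_add_distrib]; ring

theorem QS.mul {J : Ideal (MvPolynomial ι R)} {b : MvPolynomial ι R} (c : MvPolynomial ι R) (hb : QS J b) :
    QS J (c * b) := by
  obtain ⟨j, hj, h⟩ := hb
  refine ⟨fun i => c * j i, fun i => J.mul_mem_left _ (hj i), fun f hf => ?_⟩
  have := (J ^ 2).mul_mem_left c (h f hf)
  convert this using 1
  rw [mul_sub, Finset.mul_sum]
  congr 1
  · ring
  · exact Finset.sum_congr rfl fun i _ => by ring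

theorem QS.of_mem {J : Ideal (MvPolynomial ι R)} {b : MvPolynomial ι R} (hb : b ∈ J) : QS J b :=
  ⟨0, by simp, fun f hf => by simpa [sq] using Ideal.mul_mem_mul hb hf⟩

/-- checking `QS` on generators -/
theorem QS.of_gens {J : Ideal (MvPolynomial ι R)} {b : MvPolynomial ι R} (F : Set (MvPolynomial ι R))
    (hF : Ideal.span F = J) (j : ι → MvPolynomial ι R) (hj : ∀ i, j i ∈ J)
    (h : ∀ f ∈ F, b * f - ∑ i, pderiv i f * j i ∈ J ^ 2) : QS J b := by
  refine ⟨j, hj, fun f hf => ?_⟩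
  rw [← hF] at hf
  induction hf using Submodule.span_induction with
  | mem x hx => exact h x hx
  | zero => simp
  | add x y _ _ hx hy =>
    convert (J ^ 2).add_mem hx hy using 1
    simp only [map_add, add_mul, Finset.sum_add_distrib]; ring
  | smul a x hx' hx =>
    have hxJ : x ∈ J := hF ▸ hx'
    have h1 := (J ^ 2).mul_mem_left a hx
    have h2 : ∑ i, x * pderiv i a * j i ∈ J ^ 2 := Ideal.sum_mem _ fun i _ => by
      rw [sq, mul_assoc]
      exact Ideal.mul_mem_mul hxJ (J.mul_mem_left _ (hj i))
    convert (J ^ 2).sub_mem h1 h2 using 1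
    simp only [smul_eq_mul, Derivation.leibniz, add_mul, Finset.sum_add_distrib, mul_sub, Finset.mul_sum]
    rw [sub_sub]
    congr 1
    · ring
    · congr 1
      · exact Finset.sum_congr rfl fun i _ => by ring

theorem finset_pow_bound {P : Type*} [CommRing P] {α : Type*} [Fintype α] (b : P) (Q : α → P → Prop)
    (hQ : ∀ a x, Q a x → Q a (b * x)) (h : ∀ a, ∃ n : ℕ, Q a (b ^ n)) : ∃ n : ℕ, ∀ a, Q a (b ^ n) := by
  choose n hn using h
  refine ⟨∑ a, n a, fun a => ?_⟩
  have : ∀ k, Q a (b ^ (k + n a)) := by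
    intro k
    induction k with
    | zero => simpa using hn a
    | succ k ih =>
      have := hQ a _ ih
      rwa [← pow_succ', show k + n a + 1 = k + 1 + n a by ring] at this
  have h2 := this (∑ a, n a - n a)
  rwa [Nat.sub_add_cancel (Finset.single_le_sum (f := n) (fun _ _ => Nat.zero_le _) (Finset.mem_univ a))] at h2

theorem QS_of_FS {J : Ideal (MvPolynomial ι R)} (hJ : J.FG) {b : MvPolynomial ι R}
    (h : FS ((Ideal.Quotient.mk J).comp C) (Ideal.Quotient.mk J b)) : ∃ n : ℕ, QS J (b ^ n) := by
  classical
  set K := J ^ 2 with hK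
  obtain ⟨s, hs1, hs2⟩ := retraction (C : R →+* (MvPolynomial ι R)) J K le_rfl
    (RingHom.id R) Function.surjective_id (fun r hr => by
      have : r = 0 := hr
      simp [this]) ((Ideal.Quotient.mk J).comp C) rfl b h
  set L := Localization.Away (Ideal.Quotient.mk K b)
  set e : (MvPolynomial ι R) →+* L := (algebraMap _ L).comp (Ideal.Quotient.mk K) with he
  have hbe : ∀ i : ι, ∃ n : ℕ, ∃ j ∈ J, e (b ^ n) * (e (X i) - s (Ideal.Quotient.mk J (X i))) = e j := by
    intro i
    obtain ⟨n, j, hj, h⟩ := mem_map_away J K b (hs1 (X i))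
    refine ⟨n, j, hj, ?_⟩
    rw [map_pow]; exact h
  obtain ⟨n, hn⟩ := finset_pow_bound b (fun i x => ∃ j ∈ J, e x * (e (X i) - s (Ideal.Quotient.mk J (X i))) = e j)
    (fun i x ⟨j, hj, hx⟩ => ⟨b * j, J.mul_mem_left _ hj, by rw [map_mul, mul_assoc, hx, map_mul]⟩) hbe
  choose j hj hjn using hn
  -- key identity
  have key : ∀ f ∈ J, e (b ^ n * f - ∑ i, pderiv i f * j i) = 0 := by
    intro f hf
    have hI0 : ∀ i k, (s (Ideal.Quotient.mk J (X i)) - e (X i)) * (s (Ideal.Quotient.mk J (X k)) - e (X k)) = 0 := by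
      intro i k
      have h1 : (s (Ideal.Quotient.mk J (X i)) - e (X i)) * (s (Ideal.Quotient.mk J (X k)) - e (X k)) ∈ (J.map e) ^ 2 := by
        rw [sq]
        refine Ideal.mul_mem_mul ?_ ?_
        · rw [← neg_sub]; exact (J.map e).neg_mem (hs1 _)
        · rw [← neg_sub]; exact (J.map e).neg_mem (hs1 _)
      rw [← Ideal.map_pow] at h1
      have h2 : (J ^ 2).map e ≤ ⊥ := by
        rw [Ideal.map_le_iff_le_comap]
        intro x hx
        show e x = 0
        rw [← hK] at hx
        simp [he, Ideal.Quotient.eq_zero_iff_mem.mpr hx]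
      exact h2 h1
    have ht := taylor_sq_zero (e.comp C) (fun i => e (X i)) (fun i => s (Ideal.Quotient.mk J (X i)) - e (X i)) hI0 f
    simp only [add_sub_cancel] at ht
    have ee : ∀ p : (MvPolynomial ι R), eval₂ (e.comp C) (fun i => e (X i)) p = e p := by
      intro p
      have : eval₂Hom (e.comp C) (fun i => e (X i)) = e := by
        apply MvPolynomial.ringHom_ext <;> simp
      exact RingHom.congr_fun this p
    have es : ∀ p : (MvPolynomial ι R), eval₂ (e.comp C) (fun i => s (Ideal.Quotient.mk J (X i))) p = s (Ideal.Quotient.mk J p) := by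
      intro p
      have : eval₂Hom (e.comp C) (fun i => s (Ideal.Quotient.mk J (X i))) = s.comp (Ideal.Quotient.mk J) := by
        apply MvPolynomial.ringHom_ext
        · intro r; simp only [coe_eval₂Hom, eval₂_C]; exact (hs2 r).symm
        · simp
      exact RingHom.congr_fun this p
    rw [es, ee, Ideal.Quotient.eq_zero_iff_mem.mpr hf, map_zero] at ht
    simp only [ee] at ht
    rw [map_sub, map_mul, map_sum]
    have : e (b ^ n) * (e f + ∑ i, e (pderiv i f) * (s (Ideal.Quotient.mk J (X i)) - e (X i))) = 0 := by
      rw [← ht, mul_zero]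
    rw [mul_add, Finset.mul_sum] at this
    rw [← this, sub_eq_add_neg, ← Finset.sum_neg_distrib]
    congr 1
    refine Finset.sum_congr rfl fun i _ => ?_
    rw [map_mul, ← hjn]; ring
  obtain ⟨F, hF⟩ := hJ
  have h3 : ∀ f : F, ∃ m : ℕ, b ^ m * (b ^ n * f - ∑ i, pderiv i (f : (MvPolynomial ι R)) * j i) ∈ K := fun f =>
    away_eq_zero K b _ (key f (hF ▸ Ideal.subset_span f.2))
  obtain ⟨m, hm⟩ := finset_pow_bound b (fun (f : F) x => x * (b ^ n * f - ∑ i, pderiv i (f : (MvPolynomial ι R)) * j i) ∈ K)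
    (fun f x hx => by rw [mul_assoc]; exact K.mul_mem_left _ hx) h3
  refine ⟨m + n, QS.of_gens (F : Set (MvPolynomial ι R)) hF (fun i => b ^ m * j i) (fun i => J.mul_mem_left _ (hj i)) fun f hf => ?_⟩
  have := hm ⟨f, hf⟩
  convert this using 1
  rw [mul_sub, Finset.mul_sum, pow_add]
  congr 1
  · ring
  · exact Finset.sum_congr rfl fun i _ => by ring

theorem FS_of_QS {J : Ideal (MvPolynomial ι R)} {b : MvPolynomial ι R} (h : QS J b) :
    FS ((Ideal.Quotient.mk J).comp C) (Ideal.Quotient.mk J b) := by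
  intro T T' _ _ q hq hs φ g hg hu
  obtain ⟨j, hj, hb⟩ := h
  choose c hc using fun i => hq (g (Ideal.Quotient.mk J (X i)))
  set e : MvPolynomial ι R →+* T := eval₂Hom φ c with he
  have hqe : q.comp e = g.comp (Ideal.Quotient.mk J) := by
    apply MvPolynomial.ringHom_ext
    · intro r
      have := RingHom.congr_fun hg r
      simpa [he] using this.symm
    · intro i; simp [he, hc]
  have hqe' : ∀ x, q (e x) = g (Ideal.Quotient.mk J x) := RingHom.congr_fun hqe
  have hJ0 : ∀ x ∈ J, q (e x) = 0 := fun x hx => by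
    rw [hqe', Ideal.Quotient.eq_zero_iff_mem.mpr hx, map_zero]
  have hJ2 : ∀ x ∈ J ^ 2, e x = 0 := by
    intro x hx
    have : J ^ 2 ≤ RingHom.ker e := by
      rw [sq, Ideal.mul_le]
      intro r hr s' hs'
      rw [RingHom.mem_ker, map_mul]
      exact hs _ _ (hJ0 r hr) (hJ0 s' hs')
    exact this hx
  have hub : IsUnit (e b) := isUnit_of_sq_zero q hq hs (by rw [hqe']; exact hu)
  obtain ⟨u, hu'⟩ := hub.exists_right_inv
  let h' : ι → T := fun i => - (u * e (j i))
  have hh' : ∀ i, q (h' i) = 0 := fun i => by simp [h', hJ0 _ (hj i)]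
  let e' : MvPolynomial ι R →+* T := eval₂Hom φ (fun i => c i + h' i)
  have he' : ∀ f ∈ J, e' f = 0 := by
    intro f hf
    have ht := taylor_sq_zero φ c h' (fun i k => hs _ _ (hh' i) (hh' k)) f
    show eval₂ φ (fun i => c i + h' i) f = 0
    rw [ht]
    show e f + ∑ i, e (pderiv i f) * h' i = 0
    have h2 := hJ2 _ (hb f hf)
    rw [map_sub, map_mul, map_sum, sub_eq_zero] at h2
    have h3 : ∑ i, e (pderiv i f) * h' i = - (u * ∑ i, e (pderiv i f * j i)) := by
      rw [Finset.mul_sum, ← Finset.sum_neg_distrib]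
      refine Finset.sum_congr rfl fun i _ => ?_
      rw [map_mul]; simp only [h']; ring
    rw [h3, ← h2]
    linear_combination -(e f) * hu'
  refine ⟨Ideal.Quotient.lift J e' he', ?_, ?_⟩
  · apply Ideal.Quotient.ringHom_ext
    apply MvPolynomial.ringHom_ext
    · intro r
      have := RingHom.congr_fun hg r
      simpa [e'] using this.symm
    · intro i; simp [e', hc, hh']
  · ext r; simp [e']

/-- Presentations of finite type algebras. -/
theorem exists_presentation {R A : Type u} [CommRing R] [CommRing A] (i : R →+* A) (h : i.FiniteType) :
    ∃ (n : ℕ) (p : MvPolynomial (Fin n) R →+* A), Function.Surjective p ∧ p.comp C = i := by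
  let _ := i.toAlgebra
  have : Algebra.FiniteType R A := h
  obtain ⟨n, f, hf⟩ := Algebra.FiniteType.iff_quotient_mvPolynomial''.mp this
  exact ⟨n, f, hf, by ext r; simp [← MvPolynomial.algebraMap_eq]; rfl⟩

theorem finiteType_of_presentation {R A : Type u} [CommRing R] [CommRing A] (i : R →+* A)
    (p : MvPolynomial ι R →+* A) (hp : Function.Surjective p) (hpi : p.comp C = i) : i.FiniteType := by
  rw [← hpi]
  refine RingHom.FiniteType.comp_surjective ?_ hp
  have : Algebra.FiniteType R (MvPolynomial ι R) := inferInstance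
  have h := (RingHom.finiteType_algebraMap (A := R) (B := MvPolynomial ι R)).mpr this
  rwa [MvPolynomial.algebraMap_eq] at h

theorem FS_iff_QS [IsNoetherianRing R] {A : Type u} [CommRing A] {i : R →+* A}
    (p : MvPolynomial ι R →+* A) (hp : Function.Surjective p) (hpi : p.comp C = i) (b : MvPolynomial ι R) :
    FS i (p b) ↔ ∃ n : ℕ, QS (RingHom.ker p) (b ^ n) := by
  let e := RingHom.quotientKerEquivOfSurjective hp
  have he : (e : (MvPolynomial ι R ⧸ RingHom.ker p) →+* A).comp (Ideal.Quotient.mk _) = p := by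
    ext x <;> simp [e]
  have he' : ∀ x, e (Ideal.Quotient.mk _ x) = p x := RingHom.congr_fun he
  have he'' : ∀ x, e.symm (p x) = Ideal.Quotient.mk _ x := fun x => by rw [← he', e.symm_apply_apply]
  constructor
  · intro h
    have h1 := h.of_equiv e.symm
    apply QS_of_FS (IsNoetherian.noetherian _)
    have e1 : (e.symm : A →+* (MvPolynomial ι R ⧸ RingHom.ker p)).comp i = (Ideal.Quotient.mk (RingHom.ker p)).comp C := by
      rw [← hpi]; ext r; exact he'' _
    have e2 : e.symm (p b) = Ideal.Quotient.mk _ b := he'' b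
    rwa [e1, e2] at h1
  · rintro ⟨n, h⟩
    have h1 := (FS_of_QS h).of_equiv e
    have e1 : (e : (MvPolynomial ι R ⧸ RingHom.ker p) →+* A).comp ((Ideal.Quotient.mk (RingHom.ker p)).comp C) = i := by
      rw [← RingHom.comp_assoc, he, hpi]
    have e2 : e (Ideal.Quotient.mk _ (b ^ n)) = p b ^ n := by
      rw [← map_pow]; exact he' _
    rw [e1, e2] at h1
    exact h1.of_pow

/-- the smooth locus ideal -/
theorem FS.add [IsNoetherianRing R] {A : Type u} [CommRing A] {i : R →+* A} (hi : i.FiniteType) {a b : A}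
    (ha : FS i a) (hb : FS i b) : FS i (a + b) := by
  obtain ⟨n, p, hp, hpi⟩ := exists_presentation i hi
  obtain ⟨a, rfl⟩ := hp a
  obtain ⟨b, rfl⟩ := hp b
  obtain ⟨k, hk⟩ := (FS_iff_QS p hp hpi a).mp ha
  obtain ⟨l, hl⟩ := (FS_iff_QS p hp hpi b).mp hb
  rw [← map_add, FS_iff_QS p hp hpi]
  refine ⟨k + l, ?_⟩
  let I : Ideal (MvPolynomial (Fin n) R) :=
    { carrier := {x | QS (RingHom.ker p) x}
      add_mem' := fun h h' => h.add h'
      zero_mem' := QS.of_mem (Ideal.zero_mem _)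
      smul_mem' := fun c x h => h.mul c }
  exact Ideal.add_pow_mem_of_pow_mem_of_le (I := I) hk hl (by omega)

def smIdeal [IsNoetherianRing R] {A : Type u} [CommRing A] (i : R →+* A) (hi : i.FiniteType) : Ideal A where
  carrier := {a | FS i a}
  add_mem' := fun h h' => FS.add hi h h'
  zero_mem' := by
    intro T T' _ _ q hq hs φ g hg hu
    rw [map_zero, isUnit_zero_iff] at hu
    have : Subsingleton T' := subsingleton_of_zero_eq_one hu
    have hT : Subsingleton T := by
      have := hs 1 1 (Subsingleton.elim _ _) (Subsingleton.elim _ _)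
      exact subsingleton_of_zero_eq_one (by simpa using this.symm)
    refine ⟨⟨⟨⟨fun _ => 0, Subsingleton.elim _ _⟩, fun _ _ => Subsingleton.elim _ _⟩, Subsingleton.elim _ _,
      fun _ _ => Subsingleton.elim _ _⟩, ?_, ?_⟩
    · ext x; exact Subsingleton.elim _ _
    · ext x; exact Subsingleton.elim _ _
  smul_mem' := fun c x h => FS.mono h (Dvd.intro_left c rfl)

end GND

namespace GND
open MvPolynomial

variable {R : Type u} [CommRing R] {ι : Type} [Fintype ι]

/-- strictly standard data -/
def SStd (J : Ideal (MvPolynomial ι R)) (π : R) : Prop :=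
  ∃ (m : ℕ) (F : Fin m → MvPolynomial ι R) (G : Matrix ι (Fin m) (MvPolynomial ι R)),
    (∀ l, F l ∈ J) ∧ (∀ f ∈ J, C π * f ∈ Ideal.span (Set.range F) ⊔ J ^ 2) ∧
    ∀ j l, ∑ i, pderiv i (F j) * G i l - C π * (1 : Matrix (Fin m) (Fin m) (MvPolynomial ι R)) j l ∈ J

theorem SStd.mul {J : Ideal (MvPolynomial ι R)} {π : R} (h : SStd J π) (r : R) : SStd J (r * π) := by
  obtain ⟨m, F, G, h1, h2, h3⟩ := h
  refine ⟨m, F, fun i l => C r * G i l, h1, fun f hf => ?_, fun j l => ?_⟩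
  · rw [map_mul, mul_assoc]; exact Ideal.mul_mem_left _ _ (h2 f hf)
  · convert J.mul_mem_left (C r) (h3 j l) using 1
    rw [mul_sub, Finset.mul_sum, map_mul]
    congr 1
    · exact Finset.sum_congr rfl fun i _ => by ring
    · ring

theorem pderiv_mem_of_mem_sq {J : Ideal (MvPolynomial ι R)} {f : MvPolynomial ι R} (hf : f ∈ J ^ 2) (i : ι) :
    pderiv i f ∈ J := by
  rw [sq] at hf
  induction hf using Submodule.mul_induction_on' with
  | mem_mul_mem a ha b hb =>
    rw [Derivation.leibniz]
    exact J.add_mem (J.mul_mem_right _ ha) (J.mul_mem_right _ hb)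
  | add x _ y _ hx hy => rw [map_add]; exact J.add_mem hx hy

theorem sum_mul_mem_sq {J : Ideal (MvPolynomial ι R)} {α : Type*} (s : Finset α) (a b : α → MvPolynomial ι R)
    (ha : ∀ i, a i ∈ J) (hb : ∀ i, b i ∈ J) : ∑ i ∈ s, a i * b i ∈ J ^ 2 :=
  Ideal.sum_mem _ fun i _ => by rw [sq]; exact Ideal.mul_mem_mul (ha i) (hb i)

theorem QS_of_SStd {J : Ideal (MvPolynomial ι R)} {π : R} (h : SStd J π) : QS J (C (π ^ 2)) := by
  obtain ⟨m, F, G, h1, h2, h3⟩ := h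
  let j : ι → MvPolynomial ι R := fun i => ∑ l, G i l * F l
  have hj : ∀ i, j i ∈ J := fun i => Ideal.sum_mem _ fun l _ => J.mul_mem_left _ (h1 l)
  -- derivation property of Δ f = ∑ ∂_i f * j i
  let Δ : MvPolynomial ι R → MvPolynomial ι R := fun f => ∑ i, pderiv i f * j i
  have hΔF : ∀ l, Δ (F l) - C π * F l ∈ J ^ 2 := by
    intro l
    have : Δ (F l) - C π * F l = ∑ k, (∑ i, pderiv i (F l) * G i k - C π * (1 : Matrix (Fin m) (Fin m) (MvPolynomial ι R)) l k) * F k := by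
      simp only [Δ, j, sub_mul, Finset.sum_sub_distrib, Finset.sum_mul, Finset.mul_sum]
      congr 1
      · rw [Finset.sum_comm]
        exact Finset.sum_congr rfl fun i _ => Finset.sum_congr rfl fun k _ => by ring
      · simp [Matrix.one_apply]
    rw [this]
    exact sum_mul_mem_sq _ _ _ (fun k => h3 l k) h1
  have hΔadd : ∀ x y, Δ (x + y) = Δ x + Δ y := fun x y => by
    simp [Δ, add_mul, Finset.sum_add_distrib]
  have hΔmul : ∀ x y, Δ (x * y) = x * Δ y + y * Δ x := fun x y => by
    simp only [Δ, Derivation.leibniz, add_mul, Finset.sum_add_distrib, Finset.mul_sum, smul_eq_mul]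
    congr 1 <;> exact Finset.sum_congr rfl fun i _ => by ring
  have hΔJ : ∀ x, Δ x ∈ J := fun x => Ideal.sum_mem _ fun i _ => J.mul_mem_left _ (hj i)
  have hΔspan : ∀ f ∈ Ideal.span (Set.range F), Δ f - C π * f ∈ J ^ 2 := by
    intro f hf
    have hsub : Ideal.span (Set.range F) ≤ J := Ideal.span_le.mpr (by rintro _ ⟨l, rfl⟩; exact h1 l)
    induction hf using Submodule.span_induction with
    | mem x hx => obtain ⟨l, rfl⟩ := hx; exact hΔF l
    | zero =>
      have : Δ 0 = 0 := by simp [Δ]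
      simp [this]
    | add x y _ _ hx hy =>
      convert (J ^ 2).add_mem hx hy using 1
      rw [hΔadd]; ring
    | smul a x hx' hx =>
      have e := (J ^ 2).mul_mem_left a hx
      have e2 : x * Δ a ∈ J ^ 2 := by rw [sq]; exact Ideal.mul_mem_mul (hsub hx') (hΔJ a)
      convert (J ^ 2).add_mem e e2 using 1
      rw [smul_eq_mul, hΔmul]; ring
  have hΔsq : ∀ f ∈ J ^ 2, Δ f ∈ J ^ 2 := fun f hf =>
    sum_mul_mem_sq _ _ _ (fun i => pderiv_mem_of_mem_sq hf i) hj
  refine ⟨fun i => C π * j i, fun i => J.mul_mem_left _ (hj i), fun f hf => ?_⟩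
  obtain ⟨g, hg, q, hq, hgq⟩ := Submodule.mem_sup.mp (h2 f hf)
  have e1 : ∑ i, pderiv i f * (C π * j i) = C π * Δ f := by
    simp only [Δ, Finset.mul_sum]; exact Finset.sum_congr rfl fun i _ => by ring
  have e2 : C π * Δ f = Δ (C π * f) := by rw [hΔmul]; simp [Δ]
  rw [e1, e2, ← hgq, hΔadd]
  have e3 := hΔspan g hg
  have e4 := hΔsq q hq
  have : C (π ^ 2) * f - (Δ g + Δ q) = - (Δ g - C π * g) - Δ q + C π * q := by
    rw [sq, map_mul]; linear_combination -C π * hgq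
  rw [this]
  exact (J ^ 2).add_mem ((J ^ 2).sub_mem ((J ^ 2).neg_mem e3) e4) ((J ^ 2).mul_mem_left _ hq)

/-- entries in an ideal -/
def Ent {P : Type*} [CommRing P] {m n : Type*} (I : Ideal P) (M : Matrix m n P) : Prop := ∀ i j, M i j ∈ I

section ent
variable {P : Type*} [CommRing P] {m n k : Type*} [Fintype m] [Fintype n] [Fintype k] {I I' : Ideal P}
theorem Ent.mul_right {M : Matrix m n P} (h : Ent I M) (A : Matrix n k P) : Ent I (M * A) := fun i j => by
  rw [Matrix.mul_apply]; exact Ideal.sum_mem _ fun l _ => I.mul_mem_right _ (h i l)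
theorem Ent.mul {M : Matrix m n P} (h : Ent I M) {N : Matrix n k P} (h' : Ent I' N) : Ent (I * I') (M * N) := fun i j => by
  rw [Matrix.mul_apply]; exact Ideal.sum_mem _ fun l _ => Ideal.mul_mem_mul (h i l) (h' l j)
end ent

theorem elkik_core {J : Ideal (MvPolynomial ι R)} {m : ℕ} (f : Fin m → MvPolynomial ι R)
    (hf : Ideal.span (Set.range f) = J) (b : R)
    (G : Matrix ι (Fin m) (MvPolynomial ι R))
    (h : ∀ j, C b * f j - ∑ i, pderiv i (f j) * ∑ l, G i l * f l ∈ J ^ 2) :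
    ∃ (ε : Matrix (Fin m) (Fin m) (MvPolynomial ι R)) (G' : Matrix ι (Fin m) (MvPolynomial ι R)),
      (Matrix.of fun j i => pderiv i (f j)) * G' = ε ∧
      Ent (J ^ 2) (ε * (Matrix.scalar (Fin m) (C (b ^ 3)) - ε)) ∧
      (∀ j, (∑ l, ε j l * f l) - C (b ^ 3) * f j ∈ J ^ 2) := by
  set Jac : Matrix (Fin m) ι (MvPolynomial ι R) := Matrix.of fun j i => pderiv i (f j) with hJac
  set π : Matrix (Fin m) (Fin m) (MvPolynomial ι R) := Matrix.scalar (Fin m) (C b) with hπ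
  set E := Jac * G with hE
  have hcomm : Commute π E := Matrix.scalar_commute _ (fun _ => Commute.all _ _) _
  have hfJ : ∀ j, f j ∈ J := fun j => hf ▸ Ideal.subset_span ⟨j, rfl⟩
  -- E f ≡ b f
  have hEf : ∀ j, (∑ l, E j l * f l) - C b * f j ∈ J ^ 2 := by
    intro j
    have : ∑ l, E j l * f l = ∑ i, pderiv i (f j) * ∑ l, G i l * f l := by
      simp only [hE, Matrix.mul_apply, hJac, Matrix.of_apply, Finset.sum_mul, Finset.mul_sum]
      rw [Finset.sum_comm]
      exact Finset.sum_congr rfl fun i _ => Finset.sum_congr rfl fun k _ => by ring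
    rw [this, ← neg_sub]; exact (J ^ 2).neg_mem (h j)
  have h1 : Ent J ((π - E) * Jac) := by
    intro j i
    have e := pderiv_mem_of_mem_sq (hEf j) i
    simp only [map_sub, map_sum, Derivation.leibniz, smul_eq_mul, Finset.sum_add_distrib, pderiv_C, mul_zero, add_zero] at e
    have e2 : ∑ l, f l * pderiv i (E j l) ∈ J := Ideal.sum_mem _ fun l _ => J.mul_mem_right _ (hfJ l)
    have e3 := J.sub_mem e2 e
    convert e3 using 1
    rw [Matrix.sub_mul, Matrix.sub_apply, hπ, Matrix.scalar_apply, Matrix.diagonal_mul, Matrix.mul_apply]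
    simp only [hJac, Matrix.of_apply]
    ring
  have h2 : Ent J ((π - E) * E) := by
    rw [hE, ← Matrix.mul_assoc, ← hE]; exact h1.mul_right G
  set ε := 3 * π * E ^ 2 - 2 * E ^ 3 with hε
  have hc3 : Matrix.scalar (Fin m) (C (b ^ 3)) = π ^ 3 := by rw [hπ, ← map_pow, map_pow C]
  have h22 : Ent (J ^ 2) (((π - E) * E) * ((π - E) * E)) := by rw [sq]; exact h2.mul h2
  refine ⟨ε, G * (3 * π * E - 2 * E ^ 2), ?_, ?_, ?_⟩
  · rw [← Matrix.mul_assoc, ← hE, hε, mul_sub]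
    have a1 : E * (3 * π * E) = 3 * π * E ^ 2 := by
      rw [← mul_assoc, ← mul_assoc, ((Commute.ofNat_right E 3)).eq, mul_assoc 3 E π, ← hcomm.eq, sq]; noncomm_ring
    have a2 : E * (2 * E ^ 2) = 2 * E ^ 3 := by noncomm_ring
    rw [a1, a2]
  · rw [hc3]
    have : ε * (π ^ 3 - ε) = (((π - E) * E) * ((π - E) * E)) * (3 * π ^ 2 + 4 * π * E - 4 * E ^ 2) := by
      -- commutative computation
      let A : Subalgebra ℤ (Matrix (Fin m) (Fin m) (MvPolynomial ι R)) := Algebra.adjoin ℤ {π, E}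
      have hA : ∀ x ∈ A, ∀ y ∈ A, x * y = y * x := by
        intro x hx y hy
        have : Algebra.adjoin ℤ {π, E} ≤ Subalgebra.centralizer ℤ ({π, E} : Set _) := by
          rw [Algebra.adjoin_le_iff]
          rintro z (rfl | rfl)
          · rintro w (rfl | rfl)
            · rfl
            · exact hcomm.eq.symm
          · rintro w (rfl | rfl)
            · exact hcomm.eq
            · rfl
        have h3 : Algebra.adjoin ℤ {π, E} ≤ Subalgebra.centralizer ℤ ((Algebra.adjoin ℤ {π, E} : Subalgebra ℤ _) : Set _) := by
          rw [Algebra.adjoin_le_iff]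
          intro z hz w hw
          exact ((this hw) z hz).symm
        exact (h3 hy) x hx
      let _ : CommRing A := { (inferInstance : Ring A) with mul_comm := fun x y => Subtype.ext (hA x x.2 y y.2) }
      let p : A := ⟨π, Algebra.subset_adjoin (by simp)⟩
      let q : A := ⟨E, Algebra.subset_adjoin (by simp)⟩
      have key : (3 * p * q ^ 2 - 2 * q ^ 3) * (p ^ 3 - (3 * p * q ^ 2 - 2 * q ^ 3)) =
        (((p - q) * q) * ((p - q) * q)) * (3 * p ^ 2 + 4 * p * q - 4 * q ^ 2) := by ring
      exact congrArg Subtype.val key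
    rw [this]
    exact h22.mul_right _
  · intro j
    -- use mulVec modulo J^2
    have hmv : ∀ (M : Matrix (Fin m) (Fin m) (MvPolynomial ι R)) (v : Fin m → MvPolynomial ι R), (∀ j, v j ∈ J ^ 2) → ∀ j, (M.mulVec v) j ∈ J ^ 2 := by
      intro M v hv j
      rw [Matrix.mulVec, dotProduct]
      exact Ideal.sum_mem _ fun l _ => (J ^ 2).mul_mem_left (M j l) (hv l)
    have hv0 : ∀ j, (E.mulVec f - (π.mulVec f)) j ∈ J ^ 2 := by
      intro j
      have := hEf j
      convert this using 1
      simp [hπ, Matrix.mulVec, dotProduct]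
    have hfin : (fun j => (∑ l, ε j l * f l) - C (b ^ 3) * f j) =
        (π * E + π ^ 2 - 2 * E ^ 2).mulVec (E.mulVec f - π.mulVec f) := by
      have e0 : (fun j => (∑ l, ε j l * f l) - C (b ^ 3) * f j) = (ε - π ^ 3).mulVec f := by
        rw [← hc3, Matrix.sub_mulVec]
        ext1 j
        simp [Matrix.mulVec, dotProduct]
      rw [e0, ← Matrix.sub_mulVec, Matrix.mulVec_mulVec]
      congr 1
      rw [hε]
      have hc := hcomm.eq
      have e1 : E * π = π * E := hc.symm
      simp only [add_mul, mul_sub, sub_mul]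
      have e2 : π * E * π = π ^ 2 * E := by rw [mul_assoc, e1]; noncomm_ring
      have e3 : 2 * E ^ 2 * π = 2 * π * E ^ 2 := by
        rw [mul_assoc, sq, mul_assoc E E π, e1, ← mul_assoc E π, e1]; noncomm_ring
      rw [e2, e3]; noncomm_ring
    rw [congrFun hfin j]
    exact hmv _ _ hv0 j

/-- Elkik's standardization. -/
theorem elkik {J : Ideal (MvPolynomial ι R)} (hJ : J.FG) (b : R) (hQS : QS J (C b)) :
    ∃ (m : ℕ) (J' : Ideal (MvPolynomial (ι ⊕ Fin m) R)) , SStd J' (b ^ 6) ∧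
      (∀ x ∈ J, rename Sum.inl x ∈ J') ∧
      (∀ x ∈ J', aeval (Sum.elim X (fun _ => (0 : MvPolynomial ι R))) x ∈ J) := by
  obtain ⟨m, f, hf⟩ := Submodule.fg_iff_exists_fin_generating_family.mp hJ
  obtain ⟨j, hj, hjb⟩ := hQS
  have hex : ∀ i, ∃ c : Fin m → MvPolynomial ι R, j i = ∑ l, c l * f l := by
    intro i
    have h1 : j i ∈ Submodule.span (MvPolynomial ι R) (Set.range f) := by rw [hf]; exact hj i
    obtain ⟨c, hc⟩ := (Submodule.mem_span_range_iff_exists_fun _).mp h1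
    exact ⟨c, by simpa using hc.symm⟩
  choose G hG using hex
  have hfJ : ∀ j, f j ∈ J := fun j => by rw [← hf]; exact Submodule.subset_span ⟨j, rfl⟩
  obtain ⟨ε, G', hε, hε2, hεf⟩ := elkik_core f hf b (Matrix.of G) (fun k => by
    have := hjb (f k) (hfJ k)
    simpa only [Matrix.of_apply, ← hG] using this)
  set w := b ^ 3 with hw
  set δ := Matrix.scalar (Fin m) (C w) - ε with hδ
  let r : MvPolynomial ι R →ₐ[R] (MvPolynomial (ι ⊕ Fin m) R) := rename Sum.inl
  let t : Fin m → (MvPolynomial (ι ⊕ Fin m) R) := fun l => X (Sum.inr l)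
  let dt : Fin m → (MvPolynomial (ι ⊕ Fin m) R) := fun k => ∑ l, r (δ k l) * t l
  let F : Fin m → (MvPolynomial (ι ⊕ Fin m) R) := fun k => r (f k) + dt k
  let J' : Ideal (MvPolynomial (ι ⊕ Fin m) R) := J.map r.toRingHom ⊔ Ideal.span (Set.range dt)
  have hrJ : ∀ x ∈ J, r x ∈ J' := fun x hx => Ideal.mem_sup_left (Ideal.mem_map_of_mem r.toRingHom hx)
  have hrJ2 : ∀ x ∈ J ^ 2, r x ∈ J' ^ 2 := fun x hx => by
    have h1 : (J.map r.toRingHom) ^ 2 ≤ J' ^ 2 := Ideal.pow_right_mono le_sup_left 2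
    rw [← Ideal.map_pow] at h1
    exact h1 (Ideal.mem_map_of_mem r.toRingHom hx)
  have hdt : ∀ k, dt k ∈ J' := fun k => Ideal.mem_sup_right (Ideal.subset_span ⟨k, rfl⟩)
  have hrC : ∀ a, r (C a) = C a := fun a => by simp [r]
  -- Gröbner part
  have hwf : ∀ k, C w * r (f k) ∈ Ideal.span (Set.range F) ⊔ J' ^ 2 := by
    intro k
    have e1 : ∑ l, r (ε k l) * F l ∈ Ideal.span (Set.range F) :=
      Ideal.sum_mem _ fun l _ => Ideal.mul_mem_left _ _ (Ideal.subset_span ⟨l, rfl⟩)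
    have e2 : ∑ l, r (ε k l) * dt l ∈ J' ^ 2 := by
      have : ∑ l, r (ε k l) * dt l = ∑ a, r ((ε * δ) k a) * t a := by
        simp only [dt, Matrix.mul_apply, map_sum, map_mul]
        simp_rw [Finset.mul_sum, Finset.sum_mul]
        rw [Finset.sum_comm]
        exact Finset.sum_congr rfl fun i _ => Finset.sum_congr rfl fun k _ => by ring
      rw [this]
      exact Ideal.sum_mem _ fun a _ => Ideal.mul_mem_right _ _ (hrJ2 _ (hε2 k a))
    have e3 := hrJ2 _ (hεf k)
    have e4 : C w * r (f k) = ∑ l, r (ε k l) * F l + (- (∑ l, r (ε k l) * dt l) - r (∑ l, ε k l * f l - C w * f k)) := by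
      simp only [F, mul_add, Finset.sum_add_distrib, map_sub, map_sum, map_mul, hrC]
      ring
    rw [e4]
    exact Submodule.add_mem_sup e1 ((J' ^ 2).sub_mem ((J' ^ 2).neg_mem e2) e3)
  have hF : ∀ k, C w * F k ∈ Ideal.span (Set.range F) ⊔ J' ^ 2 := fun k =>
    Ideal.mul_mem_left _ _ (Ideal.mem_sup_left (Ideal.subset_span ⟨k, rfl⟩))
  have hwJ' : ∀ x ∈ J', C w * x ∈ Ideal.span (Set.range F) ⊔ J' ^ 2 := by
    have : J' ≤ Submodule.comap (LinearMap.mulLeft (MvPolynomial (ι ⊕ Fin m) R) (C w)) (Ideal.span (Set.range F) ⊔ J' ^ 2) := by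
      apply sup_le
      · rw [← hf, Ideal.submodule_span_eq, Ideal.map_span, Ideal.span_le]
        rintro _ ⟨_, ⟨k, rfl⟩, rfl⟩
        exact hwf k
      · rw [Ideal.span_le]
        rintro _ ⟨k, rfl⟩
        have e := Ideal.sub_mem _ (hF k) (hwf k)
        have e2 : C w * F k - C w * r (f k) = C w * dt k := by simp only [F]; ring
        rw [e2] at e
        exact e
    exact fun x hx => this hx
  -- Jacobian part
  let N : Matrix (Fin m) ι (MvPolynomial (ι ⊕ Fin m) R) := Matrix.of fun k i => ∑ l, r (pderiv i (δ k l)) * t l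
  have hpr : ∀ (i : ι) (x : MvPolynomial ι R), pderiv (Sum.inl i) (r x) = r (pderiv i x) := fun i x =>
    pderiv_rename Sum.inl_injective i x
  have hpr' : ∀ (l : Fin m) (x : MvPolynomial ι R), pderiv (Sum.inr l) (r x) = 0 := fun l x => by
    classical
    apply pderiv_eq_zero_of_notMem_vars
    intro h
    have := vars_rename (Sum.inl : ι → ι ⊕ Fin m) x h
    simp at this
  have hdFx : ∀ k i, pderiv (Sum.inl i) (F k) = r (pderiv i (f k)) + N k i := by
    intro k i
    simp only [F, dt, map_add, hpr, map_sum, Derivation.leibniz, N, Matrix.of_apply, smul_eq_mul, t]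
    congr 1
    refine Finset.sum_congr rfl fun l _ => ?_
    rw [pderiv_X_of_ne (by simp)]; ring
  have hdFt : ∀ k l, pderiv (Sum.inr l) (F k) = r (δ k l) := by
    classical
    intro k l
    simp only [F, dt, map_add, hpr', map_sum, Derivation.leibniz, smul_eq_mul, t, zero_add, mul_zero, add_zero]
    rw [Finset.sum_eq_single l]
    · simp
    · intro a _ ha
      rw [pderiv_X_of_ne (by simpa using ha)]; simp
    · simp
  -- matrices over (MvPolynomial (ι ⊕ Fin m) R)
  let rm : ∀ {a c : Type}, Matrix a c (MvPolynomial ι R) → Matrix a c (MvPolynomial (ι ⊕ Fin m) R) := fun M => M.map r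
  have hrm : ∀ {a c d : Type} [Fintype c] (M : Matrix a c (MvPolynomial ι R)) (N : Matrix c d (MvPolynomial ι R)),
      rm (M * N) = rm M * rm N := fun M N => Matrix.map_mul (f := r.toRingHom)
  have hεN : Ent J' (rm ε * N) := by
    intro k i
    have e1 : ∀ a, r (pderiv i ((ε * δ) k a)) ∈ J' := fun a => hrJ _ (pderiv_mem_of_mem_sq (hε2 k a) i)
    have e2 : (rm ε * N) k i = ∑ a, r (pderiv i ((ε * δ) k a)) * t a - ∑ l, r (pderiv i (ε k l)) * dt l := by
      simp only [Matrix.mul_apply, rm, Matrix.map_apply, N, Matrix.of_apply, dt, Finset.mul_sum, map_sum,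
        Derivation.leibniz, smul_eq_mul, Finset.sum_mul, map_add, map_mul, add_mul]
      rw [eq_sub_iff_add_eq]
      simp_rw [← Finset.sum_add_distrib]
      rw [Finset.sum_comm]
      refine Finset.sum_congr rfl fun a _ => ?_
      refine Finset.sum_congr rfl fun c _ => ?_
      ring
    rw [e2]
    exact J'.sub_mem (Ideal.sum_mem _ fun a _ => J'.mul_mem_right _ (e1 a))
      (Ideal.sum_mem _ fun l _ => J'.mul_mem_left _ (hdt l))
  let W : Matrix (Fin m) (Fin m) (MvPolynomial (ι ⊕ Fin m) R) := Matrix.scalar (Fin m) (C w)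
  let GT : Matrix (Fin m) (Fin m) (MvPolynomial (ι ⊕ Fin m) R) := W - N * rm G'
  refine ⟨m, J', ⟨m, F, Matrix.of (Sum.elim (fun i l => C w * rm G' i l) (fun k l => GT k l)), ?_, ?_, ?_⟩, hrJ, ?_⟩
  · intro k; exact J'.add_mem (hrJ _ (hfJ k)) (hdt k)
  · intro x hx
    rw [show b ^ 6 = w * w by rw [hw]; ring, map_mul, mul_assoc]
    exact Ideal.mul_mem_left _ _ (hwJ' x hx)
  · intro k l
    have e1 : ∑ i, pderiv i (F k) * (Matrix.of (Sum.elim (fun i l => C w * rm G' i l) (fun k l => GT k l)) : Matrix (ι ⊕ Fin m) (Fin m) (MvPolynomial (ι ⊕ Fin m) R)) i l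
       = ((C w : MvPolynomial (ι ⊕ Fin m) R) • ((rm (Matrix.of fun j i => pderiv i (f j)) + N) * rm G') + rm δ * GT : Matrix (Fin m) (Fin m) (MvPolynomial (ι ⊕ Fin m) R)) k l := by
      rw [Fintype.sum_sum_type]
      simp only [hdFx, hdFt, Matrix.of_apply, Sum.elim_inl, Sum.elim_inr, Matrix.add_apply, Matrix.smul_apply,
        Matrix.mul_apply, rm, Matrix.map_apply, smul_eq_mul, Finset.mul_sum]
      congr 1
      exact Finset.sum_congr rfl fun i _ => by ring
    have e2 : (C w : MvPolynomial (ι ⊕ Fin m) R) • ((rm (Matrix.of fun j i => pderiv i (f j)) + N) * rm G') + rm δ * GT = W * W + rm ε * N * rm G' := by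
      have a1 : rm (Matrix.of fun j i => pderiv i (f j)) * rm G' = rm ε := by rw [← hrm, hε]
      have a2 : rm δ = W - rm ε := by
        ext1 i k
        by_cases hik : i = k
        · subst hik; simp [rm, hδ, W, hrC]
        · simp [rm, hδ, W, hik]
      have a3 : ∀ M : Matrix (Fin m) (Fin m) (MvPolynomial (ι ⊕ Fin m) R), (C w : MvPolynomial (ι ⊕ Fin m) R) • M = W * M := by
        intro M; ext1 i k; simp [W]
      have a4 : rm ε * W = W * rm ε := ((Matrix.scalar_commute _ (fun _ => Commute.all _ _) _).eq).symm
      rw [Matrix.add_mul, a1, a3, a2]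
      simp only [GT]
      simp only [mul_add, mul_sub, sub_mul, a4]
      rw [Matrix.mul_assoc (rm ε) N]
      abel
    rw [e1, e2]
    have e3 : (W * W + rm ε * N * rm G') k l - C (b ^ 6) * (1 : Matrix (Fin m) (Fin m) (MvPolynomial (ι ⊕ Fin m) R)) k l = (rm ε * N * rm G') k l := by
      have : W * W = (C (b ^ 6) : MvPolynomial (ι ⊕ Fin m) R) • (1 : Matrix (Fin m) (Fin m) (MvPolynomial (ι ⊕ Fin m) R)) := by
        rw [show b ^ 6 = w * w by rw [hw]; ring, ← map_mul, ← map_mul]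
        ext1 i k; by_cases hik : i = k
        · subst hik; simp
        · simp [hik]
      rw [this]; simp
    rw [e3]
    exact (hεN.mul_right _) k l
  · have : J' ≤ J.comap (aeval (Sum.elim X (fun _ => (0 : MvPolynomial ι R))) : (MvPolynomial (ι ⊕ Fin m) R) →ₐ[R] _).toRingHom := by
      apply sup_le
      · rw [Ideal.map_le_iff_le_comap]
        intro x hx
        show aeval (Sum.elim X (fun _ => (0 : MvPolynomial ι R))) (rename Sum.inl x) ∈ J
        rw [aeval_rename, Sum.elim_comp_inl, aeval_X_left_apply]
        exact hx
      · rw [Ideal.span_le]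
        rintro _ ⟨k, rfl⟩
        show aeval (Sum.elim X (fun _ => (0 : MvPolynomial ι R))) (dt k) ∈ J
        simp [dt, t]
    exact fun x hx => this hx

end GND

namespace GND
open MvPolynomial

variable {R S P T T' B R' Λ A Q L Q' A' Cb Λ' L' F K k k1 k2 Λ1 Λ2 N0 C' D1 D2 R1 R2 B0 R0 : Type u} [CommRing R] [CommRing S] [CommRing P] [CommRing T] [CommRing T'] [CommRing B] [CommRing R'] [CommRing Λ] [CommRing A] [CommRing Q] [CommRing L] [CommRing Q'] [CommRing A'] [CommRing Cb] [CommRing Λ'] [CommRing L'] [CommRing F] [CommRing K] [CommRing k] [CommRing k1] [CommRing k2] [CommRing Λ1] [CommRing Λ2] [CommRing N0] [CommRing C'] [CommRing D1] [CommRing D2] [CommRing R1] [CommRing R2] [CommRing B0] [CommRing R0]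

theorem FS.formallySmooth  [Algebra R S]
    (h : FS (algebraMap R S) 1) : Algebra.FormallySmooth R S := by
  apply Algebra.FormallySmooth.of_comp_surjective
  intro B _ _ I hI g
  obtain ⟨g', h1, h2⟩ := h B (B ⧸ I) (Ideal.Quotient.mk I) Ideal.Quotient.mk_surjective (by
    intro x y hx hy
    rw [Ideal.Quotient.eq_zero_iff_mem] at hx hy
    have : x * y ∈ I ^ 2 := by rw [sq]; exact Ideal.mul_mem_mul hx hy
    rw [hI] at this; exact this) (algebraMap R B) g.toRingHom (by ext r; simp) (by simp)
  refine ⟨{ g' with commutes' := fun r => RingHom.congr_fun h2 r }, ?_⟩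
  ext x
  exact RingHom.congr_fun h1 x

theorem FS.of_formallySmooth  [Algebra R S]
    [Algebra.FormallySmooth R S] : FS (algebraMap R S) 1 := by
  intro T T' _ _ q hq hs φ g hg _
  letI : Algebra R T := φ.toAlgebra
  letI : Algebra R T' := (q.comp φ).toAlgebra
  let qa : T →ₐ[R] T' := { q with commutes' := fun r => rfl }
  let ga : S →ₐ[R] T' := { g with commutes' := fun r => RingHom.congr_fun hg r }
  have hnil : IsNilpotent (RingHom.ker (qa : T →+* T')) := ⟨2, by
    rw [sq, Ideal.zero_eq_bot, ← le_bot_iff, Ideal.mul_le]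
    intro x hx y hy
    exact hs x y hx hy⟩
  refine ⟨(Algebra.FormallySmooth.liftOfSurjective ga qa hq hnil : S →ₐ[R] T), ?_, ?_⟩
  · have := Algebra.FormallySmooth.comp_liftOfSurjective ga qa hq hnil
    ext x
    exact AlgHom.congr_fun this x
  · ext r
    exact AlgHom.commutes _ r

theorem FS.to_away  {f : R →+* S} {b : S} (h : FS f b) :
    FS ((algebraMap S (Localization.Away b)).comp f) 1 := by
  refine (h.comp (FS.away b)).mono ?_
  rw [mul_one]
  exact (IsLocalization.Away.algebraMap_isUnit (S := Localization.Away b) b).dvd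

/-- flatness consequence -/
theorem flat_ann [IsNoetherianRing P]
    (h : R →+* P) (hflat : h.Flat) (p : P →+* S) (hp : Function.Surjective p) (Δ : S)
    (hFS : FS (p.comp h) Δ) (α β δ : R) (hR : ∀ x : R, α * x = 0 → ∃ n : ℕ, δ ^ n * (β * x) = 0)
    (x : S) (hx : p (h α) * x = 0) : ∃ n : ℕ, (p (h δ) * Δ) ^ n * (p (h β) * x) = 0 := by
  obtain ⟨D0, hD0⟩ := hp Δ
  letI : Algebra R P := h.toAlgebra
  letI : Algebra R S := (p.comp h).toAlgebra
  have hfl : Module.Flat R P := hflat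
  have : Algebra.FormallySmooth R (Localization.Away Δ) := by
    apply FS.formallySmooth
    rw [IsScalarTower.algebraMap_eq R S (Localization.Away Δ)]
    exact hFS.to_away
  have hflP : Module.Flat R (Localization.Away D0) := by
    have : Module.Flat P (Localization.Away D0) := IsLocalization.flat _ (Submonoid.powers D0)
    exact Module.Flat.trans R P (Localization.Away D0)
  have hN : IsNoetherianRing (Localization.Away D0) := IsLocalization.isNoetherianRing (Submonoid.powers D0) _ inferInstance
  let pa : P →ₐ[R] S := { p with commutes' := fun r => rfl }
  have hu : IsUnit (algebraMap S (Localization.Away Δ) (p D0)) := by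
    rw [hD0]; exact IsLocalization.Away.algebraMap_isUnit (S := Localization.Away Δ) Δ
  let F0 : Localization.Away D0 →+* Localization.Away Δ := IsLocalization.Away.lift (g := (algebraMap S (Localization.Away Δ)).comp p) D0 hu
  have hF0 : ∀ x, F0 (algebraMap P _ x) = algebraMap S _ (p x) := fun x => IsLocalization.Away.lift_eq D0 hu x
  let F : Localization.Away D0 →ₐ[R] Localization.Away Δ := { F0 with
    commutes' := fun r => by
      rw [IsScalarTower.algebraMap_apply R P (Localization.Away D0), IsScalarTower.algebraMap_apply R S (Localization.Away Δ)]
      exact hF0 _ }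
  have hFs : Function.Surjective F := by
    intro z
    obtain ⟨n, s, hs⟩ := IsLocalization.Away.surj Δ z
    obtain ⟨s', rfl⟩ := hp s
    refine ⟨IsLocalization.mk' _ s' (⟨D0 ^ n, Submonoid.mem_powers_iff _ _ |>.mpr ⟨n, rfl⟩⟩ : Submonoid.powers D0), ?_⟩
    have hun : IsUnit (algebraMap S (Localization.Away Δ) Δ ^ n) := (IsLocalization.Away.algebraMap_isUnit (S := Localization.Away Δ) Δ).pow n
    apply hun.mul_left_cancel
    rw [mul_comm _ z, hs]
    have e1 : algebraMap S (Localization.Away Δ) Δ ^ n = F0 (algebraMap P _ (D0 ^ n)) := by rw [hF0, map_pow, hD0, map_pow]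
    rw [e1]
    show F0 _ * F0 _ = _
    rw [← map_mul, IsLocalization.mk'_spec'_mk]; exact hF0 _
  have hflS : Module.Flat R (Localization.Away Δ) :=
    Algebra.FormallySmooth.flat_of_algHom_of_isNoetherianRing F hFs
  set x' := algebraMap S (Localization.Away Δ) x with hx'
  have hx0 : α • x' = 0 := by
    rw [Algebra.smul_def, IsScalarTower.algebraMap_apply R S (Localization.Away Δ), hx', ← map_mul]
    show algebraMap S _ (p (h α) * x) = 0
    rw [hx, map_zero]
  obtain ⟨κ, a, y, hay1, hay2⟩ := Module.Flat.isTrivialRelation_of_sum_smul_eq_zero (R := R) (M := Localization.Away Δ) (f := fun _ : Unit => α) (x := fun _ => x') (by simpa using hx0)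
  have hay2' : ∀ j, α * a () j = 0 := fun j => by simpa using hay2 j
  obtain ⟨n, hn⟩ := finset_pow_bound δ (fun j z => z * (β * a () j) = 0) (fun j z hz => by rw [mul_assoc, hz, mul_zero])
    (fun j => hR _ (hay2' j))
  have h3 : (δ ^ n * β) • x' = 0 := by
    have : x' = ∑ j, a () j • y j := hay1 ()
    rw [this, Finset.smul_sum]
    refine Finset.sum_eq_zero fun j _ => ?_
    rw [← mul_smul, mul_assoc, hn j, zero_smul]
  rw [Algebra.smul_def, IsScalarTower.algebraMap_apply R S (Localization.Away Δ), hx', ← map_mul,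
    ← map_zero (algebraMap S (Localization.Away Δ)), IsLocalization.eq_iff_exists (Submonoid.powers Δ)] at h3
  obtain ⟨⟨_, k, rfl⟩, hk⟩ := h3
  have hk' : Δ ^ k * (p (h (δ ^ n * β)) * x) = 0 := by
    rw [mul_zero] at hk; exact hk
  refine ⟨n + k, ?_⟩
  rw [map_mul, map_mul, map_pow, map_pow] at hk'
  rw [mul_pow, pow_add, pow_add]
  linear_combination (p (h δ)) ^ k * Δ ^ n * hk'

theorem flat_C  (ι : Type) : (C : R →+* MvPolynomial ι R).Flat := by
  rw [← MvPolynomial.algebraMap_eq, RingHom.flat_algebraMap_iff]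
  infer_instance

theorem det_one_add {P : Type*} [CommRing P] {n : Type*} [Fintype n] [DecidableEq n] (π : P) (M : Matrix n n P)
    (h : ∀ i j, ∃ c, M i j = (1 : Matrix n n P) i j + π * c) : ∃ c, M.det = 1 + π * c := by
  have : Ideal.Quotient.mk (Ideal.span {π}) M.det = Ideal.Quotient.mk (Ideal.span {π}) 1 := by
    rw [RingHom.map_det]
    have : (Ideal.Quotient.mk (Ideal.span {π})).mapMatrix M = 1 := by
      ext i j
      obtain ⟨c, hc⟩ := h i j
      rw [RingHom.mapMatrix_apply, Matrix.map_apply, hc, map_add, map_mul,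
        Ideal.Quotient.eq_zero_iff_mem.mpr (Ideal.mem_span_singleton_self π), zero_mul, add_zero]
      by_cases hij : i = j
      · subst hij; simp
      · simp [hij]
    rw [this, Matrix.det_one, map_one]
  rw [Ideal.Quotient.eq, Ideal.mem_span_singleton] at this
  obtain ⟨c, hc⟩ := this
  exact ⟨c, by rw [← hc]; ring⟩

section
variable {R : Type u} [CommRing R] {ι : Type} [Fintype ι] {m : ℕ}
  (F : Fin m → MvPolynomial ι R) (G : ι → Fin m → MvPolynomial ι R) (π : R)

noncomputable def nv {T : Type u} [CommRing T] (φ : R →+* T) (X : ι → T) (y : Fin m → T) (w : ι → T) (l : Fin m) : T :=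
  y l - ∑ k, eval₂ φ X (pderiv k (F l)) * w k

noncomputable def nu {T : Type u} [CommRing T] (φ : R →+* T) (X : ι → T) (y : Fin m → T) (w : ι → T) (i : ι) : T :=
  φ π * w i + ∑ l, eval₂ φ X (G i l) * nv F φ X y w l

noncomputable def npp (j l : Fin m) : MvPolynomial ι R :=
  (∑ i, pderiv i (F j) * G i l) - C π * (1 : Matrix (Fin m) (Fin m) (MvPolynomial ι R)) j l

theorem nv_map  (θ : T →+* T') (φ : R →+* T) (X : ι → T) (y : Fin m → T) (w : ι → T) (l : Fin m) :
    θ (nv F φ X y w l) = nv F (θ.comp φ) (fun i => θ (X i)) (fun i => θ (y i)) (fun i => θ (w i)) l := by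
  simp only [nv, map_sub, map_sum, map_mul, hom_eval₂]; try rfl

theorem nu_map  (θ : T →+* T') (φ : R →+* T) (X : ι → T) (y : Fin m → T) (w : ι → T) (l : ι) :
    θ (nu F G π φ X y w l) = nu F G π (θ.comp φ) (fun i => θ (X i)) (fun i => θ (y i)) (fun i => θ (w i)) l := by
  simp only [nu, map_add, map_sum, map_mul, hom_eval₂, nv_map]; rfl

theorem jac_nu  (φ : R →+* T) (X : ι → T) (y : Fin m → T) (w : ι → T) (j : Fin m) :
    ∑ i, eval₂ φ X (pderiv i (F j)) * nu F G π φ X y w i =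
      φ π * y j + ∑ l, eval₂ φ X (npp F G π j l) * nv F φ X y w l := by
  have h1 : ∀ l, eval₂ φ X (npp F G π j l) * nv F φ X y w l =
      (∑ i, eval₂ φ X (pderiv i (F j)) * (eval₂ φ X (G i l) * nv F φ X y w l)) - φ π * ((1 : Matrix (Fin m) (Fin m) T) j l * nv F φ X y w l) := by
    intro l
    have : eval₂ φ X ((1 : Matrix (Fin m) (Fin m) (MvPolynomial ι R)) j l) = (1 : Matrix (Fin m) (Fin m) T) j l := by
      by_cases h : j = l
      · subst h; simp
      · simp [h]
    have h2 : eval₂ φ X (npp F G π j l) = (∑ i, eval₂ φ X (pderiv i (F j)) * eval₂ φ X (G i l)) - φ π * (1 : Matrix (Fin m) (Fin m) T) j l := by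
      rw [npp, eval₂_sub, eval₂_sum, eval₂_mul, eval₂_C, this]
      simp only [eval₂_mul]
    rw [h2, sub_mul, Finset.sum_mul, mul_assoc]
    congr 1
    exact Finset.sum_congr rfl fun i _ => by ring
  simp_rw [h1, Finset.sum_sub_distrib]
  rw [Finset.sum_comm]
  have h3 : ∑ l, φ π * ((1 : Matrix (Fin m) (Fin m) T) j l * nv F φ X y w l) = φ π * nv F φ X y w j := by
    rw [← Finset.mul_sum]; simp [Matrix.one_apply]
  rw [h3]
  simp_rw [nu, mul_add, Finset.sum_add_distrib, ← Finset.mul_sum]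
  rw [nv, mul_sub, Finset.mul_sum]
  have : ∑ i, eval₂ φ X (pderiv i (F j)) * (φ π * w i) = ∑ i, φ π * (eval₂ φ X (pderiv i (F j)) * w i) :=
    Finset.sum_congr rfl fun i _ => by ring
  rw [this]; ring

abbrev nE (ι : Type) (m : ℕ) (D : Type u) [CommRing D] := MvPolynomial (ι ⊕ (Fin m ⊕ ι)) D

variable {D : Type u} [CommRing D] (d0 : R →+* D)

noncomputable abbrev nX (m : ℕ) (D : Type u) [CommRing D] (i : ι) : nE ι m D := X (Sum.inl i)
noncomputable abbrev nY (ι : Type) {m : ℕ} (D : Type u) [CommRing D] (i : Fin m) : nE ι m D := X (Sum.inr (Sum.inl i))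
noncomputable abbrev nW (m : ℕ) (D : Type u) [CommRing D] (i : ι) : nE ι m D := X (Sum.inr (Sum.inr i))

noncomputable abbrev nU (i : ι) : nE ι m D := nu F G π (C.comp d0) (nX m D) (nY ι D) (nW m D) i

theorem nU_map  (θ : nE ι m D →+* T') (l : ι) :
    θ (nU F G π d0 l) = nu F G π (θ.comp (C.comp d0)) (fun i => θ (nX m D i)) (fun i => θ (nY ι D i)) (fun i => θ (nW m D i)) l :=
  nu_map ..

theorem newton_Q (j : Fin m) : ∃ Q : nE ι m D,
    eval₂ (C.comp d0) (fun i => nX m D i - C (d0 π ^ 3) * nU F G π d0 i) (F j) =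
      eval₂ (C.comp d0) (nX m D) (F j) - C (d0 π ^ 3) * (C (d0 π) * nY ι D j +
        ∑ l, eval₂ (C.comp d0) (nX m D) (npp F G π j l) * nv F (C.comp d0) (nX m D) (nY ι D) (nW m D) l) + C (d0 π ^ 6) * Q := by
  obtain ⟨q, hq⟩ := taylor (C.comp d0 : R →+* nE ι m D) (nX m D) (fun i => -(C (d0 π ^ 3) * nU F G π d0 i)) (F j)
  refine ⟨∑ a, ∑ b, q a b * (nU F G π d0 a * nU F G π d0 b), ?_⟩
  simp_rw [sub_eq_add_neg (X (Sum.inl _) : nE ι m D)]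
  rw [hq]
  have h1 := jac_nu F G π (C.comp d0 : R →+* nE ι m D) (nX m D) (nY ι D) (nW m D) j
  have h2 : ∑ i, eval₂ (C.comp d0 : R →+* nE ι m D) (nX m D) (pderiv i (F j)) * -(C (d0 π ^ 3) * nU F G π d0 i) =
     - C (d0 π ^ 3) * ∑ i, eval₂ (C.comp d0 : R →+* nE ι m D) (nX m D) (pderiv i (F j)) * nU F G π d0 i := by
    rw [Finset.mul_sum]; exact Finset.sum_congr rfl fun i _ => by ring
  have h3 : ∑ a, ∑ b, q a b * (-(C (d0 π ^ 3) * nU F G π d0 a) * -(C (d0 π ^ 3) * nU F G π d0 b)) =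
      C (d0 π ^ 6) * ∑ a, ∑ b, q a b * (nU F G π d0 a * nU F G π d0 b) := by
    simp_rw [Finset.mul_sum]
    refine Finset.sum_congr rfl fun a _ => Finset.sum_congr rfl fun b _ => ?_
    simp only [map_pow]; ring
  rw [h2, h3, h1]
  simp only [RingHom.comp_apply]
  ring

noncomputable def nQ (j : Fin m) : nE ι m D := (newton_Q F G π d0 j).choose

noncomputable def nL (d : ι → D) (i : ι) : nE ι m D := nX m D i - C (d0 π ^ 3) * nU F G π d0 i - C (d i)
noncomputable def nH (e' : Fin m → D) (j : Fin m) : nE ι m D := C (d0 π * e' j) + nY ι D j - C (d0 π ^ 2) * nQ F G π d0 j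

/-- (★★) -/
theorem newton_pre (d : ι → D) (e' : Fin m → D) (he : ∀ j, eval₂ d0 d (F j) = d0 π ^ 5 * e' j)
    {T : Type u} [CommRing T] (θ : nE ι m D →+* T) (hθ : ∀ i, θ (nL F G π d0 d i) = 0) (j : Fin m) :
    eval₂ (θ.comp (C.comp d0)) (fun i => θ (nX m D i)) (F j) =
      θ (C (d0 π ^ 4)) * θ (nH F G π d0 e' j) + θ (C (d0 π ^ 3)) * ∑ l, eval₂ (θ.comp (C.comp d0)) (fun i => θ (nX m D i)) (npp F G π j l) *
        nv F (θ.comp (C.comp d0)) (fun i => θ (nX m D i)) (fun i => θ (nY ι D i)) (fun i => θ (nW m D i)) l := by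
  have h := congrArg θ (newton_Q F G π d0 j).choose_spec
  change _ = θ (_ + C (d0 π ^ 6) * nQ F G π d0 j) at h
  have h1 : eval₂ (θ.comp (C.comp d0)) (fun i => θ (nX m D i - C (d0 π ^ 3) * nU F G π d0 i)) (F j) = θ (C (d0 π ^ 5 * e' j)) := by
    have : (fun i => θ (nX m D i - C (d0 π ^ 3) * nU F G π d0 i)) = fun i => (θ.comp C) (d i) := by
      funext i
      have := hθ i
      rw [nL, map_sub, sub_eq_zero] at this
      exact this
    rw [this, ← RingHom.comp_assoc, ← he]
    exact (hom_eval₂ (F j) d0 (θ.comp C) d).symm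
  rw [hom_eval₂] at h
  change eval₂ (θ.comp (C.comp d0)) (fun i => θ (nX m D i - C (d0 π ^ 3) * nU F G π d0 i)) (F j) = _ at h
  rw [h1] at h
  simp only [map_add, map_sub, map_mul, map_sum, hom_eval₂, nv_map, nH, map_pow] at h ⊢
  linear_combination -h

noncomputable def nRel (d : ι → D) (e' : Fin m → D) : ι ⊕ Fin m → nE ι m D := Sum.elim (nL F G π d0 d) (nH F G π d0 e')

open Classical in
theorem newton_jac (d : ι → D) (e' : Fin m → D) : ∃ Δ c : nE ι m D, Δ = 1 + C (d0 π) * c ∧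
    QS (Ideal.span (Set.range (nRel F G π d0 d e'))) Δ := by
  let M : Matrix (ι ⊕ Fin m) (ι ⊕ Fin m) (nE ι m D) := Matrix.of fun r s => pderiv (Sum.map id Sum.inl s) (nRel F G π d0 d e' r)
  have hM : ∀ i j, ∃ c, M i j = (1 : Matrix (ι ⊕ Fin m) (ι ⊕ Fin m) (nE ι m D)) i j + C (d0 π) * c := by
    have hpow : ∀ (s : ι ⊕ (Fin m ⊕ ι)) (k : ℕ) (x : nE ι m D), pderiv s (C (d0 π ^ (k+1)) * x) = C (d0 π) * (C (d0 π ^ k) * pderiv s x) := by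
      intro s k x
      rw [pderiv_C_mul, pow_succ', C_mul, mul_assoc]
    rintro (i | i) (j | j)
    · refine ⟨-(C (d0 π ^ 2) * pderiv (Sum.inl j) (nU F G π d0 i)), ?_⟩
      simp only [M, Matrix.of_apply, nRel, Sum.elim_inl, Sum.map_inl, id, nL, map_sub, hpow, pderiv_C, pderiv_X, Matrix.one_apply, Pi.single_apply, Sum.inl.injEq]
      ring
    · refine ⟨-(C (d0 π ^ 2) * pderiv (Sum.inr (Sum.inl j)) (nU F G π d0 i)), ?_⟩
      simp only [M, Matrix.of_apply, nRel, Sum.elim_inl, Sum.map_inr, id, nL, map_sub, hpow, pderiv_C, pderiv_X, Matrix.one_apply, Pi.single_apply, reduceCtorEq, if_false]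
      ring
    · refine ⟨-(C (d0 π ^ 1) * pderiv (Sum.inl j) (nQ F G π d0 i)), ?_⟩
      simp only [M, Matrix.of_apply, nRel, Sum.elim_inr, Sum.map_inl, id, nH, map_sub, map_add, hpow, pderiv_C, pderiv_X, Matrix.one_apply, Pi.single_apply, reduceCtorEq, if_false]
      ring
    · refine ⟨-(C (d0 π ^ 1) * pderiv (Sum.inr (Sum.inl j)) (nQ F G π d0 i)), ?_⟩
      simp only [M, Matrix.of_apply, nRel, Sum.elim_inr, Sum.map_inr, id, nH, map_sub, map_add, hpow, pderiv_C, pderiv_X, Matrix.one_apply, Pi.single_apply, Sum.inr.injEq, Sum.inl.injEq]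
      ring
  obtain ⟨c, hc⟩ := det_one_add _ M hM
  refine ⟨M.det, c, hc, ?_⟩
  have hmem : ∀ t, nRel F G π d0 d e' t ∈ Ideal.span (Set.range (nRel F G π d0 d e')) := fun t => Ideal.subset_span ⟨t, rfl⟩
  refine QS.of_gens _ rfl (fun v => Sum.elim (fun i => ∑ t, M.adjugate (Sum.inl i) t * nRel F G π d0 d e' t)
    (Sum.elim (fun i => ∑ t, M.adjugate (Sum.inr i) t * nRel F G π d0 d e' t) (fun _ => 0)) v) ?_ ?_
  · rintro (i | i | i)
    · exact Ideal.sum_mem _ fun t _ => Ideal.mul_mem_left _ _ (hmem t)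
    · exact Ideal.sum_mem _ fun t _ => Ideal.mul_mem_left _ _ (hmem t)
    · exact Ideal.zero_mem _
  · rintro _ ⟨r, rfl⟩
    have h1 : ∑ s, M r s * ∑ t, M.adjugate s t * nRel F G π d0 d e' t = M.det * nRel F G π d0 d e' r := by
      have := congrFun (congrArg (fun N : Matrix (ι ⊕ Fin m) (ι ⊕ Fin m) (nE ι m D) => N.mulVec (nRel F G π d0 d e')) M.mul_adjugate) r
      simp only [← Matrix.mulVec_mulVec, Matrix.smul_mulVec, Matrix.one_mulVec, Pi.smul_apply, smul_eq_mul] at this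
      rw [← this]; rfl
    rw [Fintype.sum_sum_type] at h1
    rw [Fintype.sum_sum_type, Fintype.sum_sum_type, ← h1]
    simp [M]
end

theorem exists_quot  (I : Ideal R) : ∃ (B : Type u) (_ : CommRing B) (p : R →+* B),
    Function.Surjective p ∧ ∀ x, p x = 0 ↔ x ∈ I :=
  ⟨R ⧸ I, inferInstance, Ideal.Quotient.mk I, Ideal.Quotient.mk_surjective, fun x => Ideal.Quotient.eq_zero_iff_mem⟩

theorem exists_factor  (p : R →+* B) (hp : Function.Surjective p)
    (g : R →+* T) (h : ∀ x, p x = 0 → g x = 0) : ∃ g' : B →+* T, g'.comp p = g :=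
  ⟨RingHom.liftOfRightInverse p (Function.surjInv hp) (Function.rightInverse_surjInv hp) ⟨g, fun x hx => h x hx⟩,
    RingHom.liftOfRightInverse_comp p (Function.surjInv hp) (Function.rightInverse_surjInv hp) ⟨g, fun x hx => h x hx⟩⟩

theorem newton  {ι : Type} [Fintype ι] {J : Ideal (MvPolynomial ι R)} {π : R} (hS : SStd J π)
    {D Λ : Type u} [CommRing D] [CommRing Λ] [IsNoetherianRing D] (d0 : R →+* D) (τ : D →+* Λ) (lam : ι → Λ)
    (hlam : ∀ f ∈ J, eval₂ (τ.comp d0) lam f = 0) (d : ι → D) (hd : ∀ f ∈ J, ∃ e, eval₂ d0 d f = d0 π ^ 5 * e)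
    (ν : ι → Λ) (hν : ∀ i, lam i = τ (d i) + τ (d0 π) ^ 5 * ν i)
    (hΛ : ∀ x : Λ, τ (d0 π) ^ 2 * x = 0 → τ (d0 π) * x = 0) :
    ∃ (B : Type u) (_ : CommRing B) (β : D →+* B) (σ : ι → B) (τ' : B →+* Λ) (γ : B),
      β.FiniteType ∧ τ'.comp β = τ ∧ (∀ i, τ' (σ i) = lam i) ∧ (∀ f ∈ J, eval₂ (β.comp d0) σ f = 0) ∧
      (FS d0 (d0 π) → FS (β.comp d0) (β (d0 π))) ∧ (∃ c, γ = 1 + β (d0 π) * c) ∧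
      ∀ (S : Type u) [CommRing S] (s : S →+* D) (δ : D), FS s δ →
        (∀ x : D, d0 π ^ 2 * x = 0 → ∃ n : ℕ, δ ^ n * (d0 π * x) = 0) → FS (β.comp s) (β δ * γ) := by
  have hSS := hS
  obtain ⟨m, F, G0, hFJ, hπJ, hpp0⟩ := hS
  obtain ⟨G, hpp⟩ : ∃ G : ι → Fin m → MvPolynomial ι R, ∀ j l, npp F G π j l ∈ J := ⟨G0, hpp0⟩
  clear hpp0
  clear G0
  choose e' he using fun j => hd (F j) (hFJ j)
  obtain ⟨Δ, cΔ, hΔ, hQS⟩ := newton_jac F G π d0 d e'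
  -- the ideal
  obtain ⟨I, hI⟩ : ∃ I, I = Ideal.span (Set.range (nRel F G π d0 d e')) := ⟨_, rfl⟩
  rw [← hI] at hQS
  have hIL : ∀ i, nL F G π d0 d i ∈ I := fun i => hI ▸ Ideal.subset_span ⟨Sum.inl i, rfl⟩
  have hIH : ∀ i, nH F G π d0 e' i ∈ I := fun i => hI ▸ Ideal.subset_span ⟨Sum.inr i, rfl⟩
  obtain ⟨B, _, p, hp, hpI⟩ := exists_quot I
  have hker : RingHom.ker p = I := by ext x; exact hpI x
  have hFS : FS (p.comp C) (p Δ) := (FS_iff_QS p hp rfl Δ).mpr ⟨1, by rwa [pow_one, hker]⟩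
  let xe : MvPolynomial ι R →+* B := eval₂Hom (p.comp (C.comp d0)) (fun i => p (nX m D i))
  obtain ⟨JB, hJB⟩ : ∃ JB, JB = J.map xe := ⟨_, rfl⟩
  let b : D →+* B := p.comp C
  have hxJ : ∀ f ∈ J, xe f ∈ JB := fun f hf => hJB ▸ Ideal.mem_map_of_mem xe hf
  -- JB ⊂ π^3
  have h3 : ∀ x ∈ JB, ∃ z, x = b (d0 π) ^ 3 * z := by
    have : JB ≤ Ideal.span {b (d0 π) ^ 3} := by
      rw [hJB, Ideal.map_le_iff_le_comap]
      intro f hf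
      obtain ⟨e, he⟩ := hd f hf
      obtain ⟨Q, _, qq, hqq, hqI⟩ := exists_quot (Ideal.span {b (d0 π) ^ 3})
      rw [Ideal.mem_comap, ← hqI]
      have hq0 : qq (b (d0 π) ^ 3) = 0 := (hqI _).mpr (Ideal.mem_span_singleton_self _)
      change qq (eval₂ _ _ f) = 0
      rw [hom_eval₂]
      have : (fun i => qq (p (nX m D i))) = fun i => (qq.comp b) (d i) := by
        funext i
        have h1 : p (nL F G π d0 d i) = 0 := (hpI _).mpr (hIL i)
        have h2 := congrArg qq h1
        simp only [nL, map_sub, map_mul, map_zero] at h2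
        have h4 : qq (p (C (d0 π ^ 3))) = 0 := by
          rw [← hq0]; simp [b]
        rw [h4, zero_mul, sub_zero, sub_eq_zero] at h2
        exact h2
      rw [this]
      have h5 := hom_eval₂ f d0 (qq.comp b) d
      have h6 : (qq.comp b).comp d0 = qq.comp (p.comp (C.comp d0)) := rfl
      rw [h6] at h5
      change eval₂ (qq.comp (p.comp (C.comp d0))) (fun i => (qq.comp b) (d i)) f = 0
      have h7 : eval₂ (qq.comp (p.comp (C.comp d0))) (fun i => (qq.comp b) (d i)) f = (qq.comp b) (eval₂ d0 d f) := h5.symm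
      rw [h7, he]
      have : (qq.comp b) (d0 π ^ 5 * e) = qq (b (d0 π) ^ 3) * (qq.comp b) (d0 π ^ 2 * e) := by
        simp only [map_mul, map_pow, RingHom.comp_apply]; ring
      rw [this, hq0, zero_mul]
    intro x hx
    exact Ideal.mem_span_singleton'.mp (this hx) |>.imp fun z hz => by rw [← hz, mul_comm]
  -- F ∈ π^3 JB
  have hF3 : ∀ j, xe (F j) ∈ Ideal.span {b (d0 π) ^ 3} * JB := by
    intro j
    have h := newton_pre F G π d0 d e' he p (fun i => (hpI _).mpr (hIL i)) j
    have hH : p (nH F G π d0 e' j) = 0 := (hpI _).mpr (hIH j)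
    rw [hH, mul_zero, zero_add] at h
    change xe (F j) = _ at h
    rw [h]
    refine Ideal.mul_mem_mul ?_ (Ideal.sum_mem _ fun l _ => Ideal.mul_mem_right _ _ (hxJ _ (hpp j l)))
    have : p (C (d0 π ^ 3)) = b (d0 π) ^ 3 := by simp [b]
    rw [this]; exact Ideal.mem_span_singleton_self _
  have hN : IsNoetherianRing (nE ι m D) := inferInstance
  have hNB : IsNoetherianRing B := isNoetherianRing_of_surjective _ _ p hp
  have h4 : Ideal.span {b (d0 π)} * JB ≤ Ideal.span {b (d0 π) ^ 3} * JB := by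
    rw [hJB, ← Set.image_singleton (f := fun x => x), Set.image_id', Ideal.span_singleton_mul_le_iff, ← hJB]
    intro x hx
    rw [hJB] at hx
    refine Submodule.span_induction (p := fun x _ => b (d0 π) * x ∈ Ideal.span {b (d0 π) ^ 3} * JB) ?_ ?_ ?_ ?_ hx
    · rintro _ ⟨f, hf, rfl⟩
      have h1 := Ideal.mem_map_of_mem xe (hπJ f hf)
      rw [map_mul] at h1
      have h2 : xe (C π) = b (d0 π) := by simp [xe, b]
      rw [h2] at h1
      refine (?_ : Ideal.map xe _ ≤ _) h1
      rw [Ideal.map_sup, Ideal.map_span, sup_le_iff, Ideal.span_le, Ideal.map_pow, ← hJB, sq]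
      constructor
      · rintro _ ⟨_, ⟨j, rfl⟩, rfl⟩; exact hF3 j
      · refine Ideal.mul_mono_left ?_
        intro x hx
        obtain ⟨z, rfl⟩ := h3 x hx
        exact Ideal.mul_mem_right _ _ (Ideal.mem_span_singleton_self _)
    · simp
    · intro x y _ _ hx hy; rw [mul_add]; exact Ideal.add_mem _ hx hy
    · intro a x _ hx; rw [smul_eq_mul, mul_left_comm]; exact Ideal.mul_mem_left _ _ hx
  obtain ⟨g, hg1, hg2⟩ := Submodule.exists_sub_one_mem_and_smul_eq_zero_of_fg_of_le_smul (Ideal.span {b (d0 π) ^ 2}) (Ideal.span {b (d0 π)} * JB)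
    (IsNoetherian.noetherian _) (by
      refine h4.trans ?_
      rw [smul_eq_mul, ← mul_assoc, Ideal.span_singleton_mul_span_singleton, ← pow_succ])
  have hgx : ∀ x ∈ JB, g * (b (d0 π) * x) = 0 := fun x hx =>
    hg2 _ (Ideal.mul_mem_mul (Ideal.mem_span_singleton_self _) hx)
  obtain ⟨B', _, p', hp', hp'J⟩ := exists_quot JB
  -- map to Λ
  let θ : nE ι m D →+* Λ := eval₂Hom τ (Sum.elim lam (Sum.elim
    (fun j => τ (d0 π) * ∑ k, eval₂ (τ.comp d0) lam (pderiv k (F j)) * ν k) (fun i => τ (d0 π) * ν i)))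
  have θX : ∀ i, θ (nX m D i) = lam i := fun i => by simp [θ]
  have θY : ∀ j, θ (nY ι D j) = τ (d0 π) * ∑ k, eval₂ (τ.comp d0) lam (pderiv k (F j)) * ν k := fun i => by simp [θ]
  have θW : ∀ i, θ (nW m D i) = τ (d0 π) * ν i := fun i => by simp [θ]
  have θC : ∀ x, θ (C x) = τ x := fun x => by simp [θ]
  have θC' : θ.comp (C.comp d0) = τ.comp d0 := by ext r; simp [θ]
  have θv : ∀ l, nv F (θ.comp (C.comp d0)) (fun i => θ (nX m D i)) (fun i => θ (nY ι D i)) (fun i => θ (nW m D i)) l = 0 := by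
    intro l
    simp only [nv, θC', θX, θY, θW, Finset.mul_sum]
    rw [sub_eq_zero]
    exact Finset.sum_congr rfl fun k _ => by ring
  have θL : ∀ i, θ (nL F G π d0 d i) = 0 := by
    intro i
    simp only [nL, map_sub, map_mul, nu_map, nU_map, θC]
    rw [nu]
    simp only [θv, mul_zero, Finset.sum_const_zero]
    simp only [θC', θX, θW]
    rw [hν i, RingHom.comp_apply, map_pow]; ring
  have hΛ' : ∀ (n : ℕ) (x : Λ), τ (d0 π) ^ (n + 1) * x = 0 → τ (d0 π) * x = 0 := by
    intro n
    induction n with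
    | zero => intro x hx; simpa using hx
    | succ n ih =>
      intro x hx
      apply hΛ
      have := ih (τ (d0 π) * x) (by rw [← hx]; ring)
      rw [← this]; ring
  have θH : ∀ j, θ (nH F G π d0 e' j) = 0 := by
    intro j
    have h := newton_pre F G π d0 d e' he θ θL j
    simp only [θv, mul_zero, Finset.sum_const_zero, add_zero] at h
    simp only [θC', θX, θC] at h
    rw [hlam _ (hFJ j), map_pow] at h
    have h2 : θ (nH F G π d0 e' j) = τ (d0 π) * (τ (e' j) + ∑ k, eval₂ (τ.comp d0) lam (pderiv k (F j)) * ν k - τ (d0 π) * θ (nQ F G π d0 j)) := by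
      simp only [nH, map_add, map_sub, map_mul, θC, θY, map_pow]; ring
    rw [h2]
    apply hΛ' 4
    rw [h2] at h
    rw [h]; ring
  obtain ⟨τB, hτB⟩ := exists_factor p hp θ (by
    intro x hx
    rw [hpI, hI] at hx
    refine (?_ : Ideal.span (Set.range (nRel F G π d0 d e')) ≤ RingHom.ker θ) hx
    rw [Ideal.span_le]
    rintro _ ⟨(i | i), rfl⟩
    · exact θL i
    · exact θH i)
  have hτB' : ∀ x, τB (p x) = θ x := fun x => RingHom.congr_fun hτB x
  obtain ⟨τ', hτ'⟩ := exists_factor p' hp' τB (by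
    intro x hx
    rw [hp'J, hJB] at hx
    refine (?_ : Ideal.map xe J ≤ RingHom.ker τB) hx
    rw [Ideal.map_le_iff_le_comap]
    intro f hf
    change τB (eval₂ _ _ f) = 0
    rw [hom_eval₂, ← hlam f hf]
    congr 1
    · rw [← θC', ← hτB]; rfl
    · funext i; rw [← θX, ← hτB]; rfl)
  have hτ'' : ∀ x, τ' (p' (p x)) = θ x := fun x => by rw [← hτB']; exact RingHom.congr_fun hτ' (p x)
  have hJ0 : ∀ f ∈ J, eval₂ ((p'.comp b).comp d0) (fun i => p' (p (nX m D i))) f = 0 := by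
    intro f hf
    have h1 := (hp'J _).mpr (hxJ f hf)
    change p' (eval₂ _ _ f) = 0 at h1
    rw [hom_eval₂] at h1
    exact h1
  refine ⟨B', inferInstance, p'.comp b, fun i => p' (p (nX m D i)), τ', p' (p Δ * g), ?_, ?_, ?_, hJ0, ?_, ?_, ?_⟩
  · exact finiteType_of_presentation (p'.comp b) (p'.comp p) (hp'.comp hp) rfl
  · ext x; exact (hτ'' _).trans (θC x)
  · intro i; exact (hτ'' _).trans (θX i)
  · -- smooth at π
    intro hD T T' _ _ q hq hs φ g' hg' hu
    have hπu : IsUnit (φ π) := isUnit_of_sq_zero q hq hs (by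
      have : q (φ π) = g' ((p'.comp b) (d0 π)) := (RingHom.congr_fun hg' π).symm
      rwa [this])
    obtain ⟨a, ha⟩ := hπu.exists_right_inv
    obtain ⟨gD, hgD1, hgD2⟩ := hD T T' q hq hs φ (g'.comp (p'.comp b)) (by rw [← hg']; rfl) hu
    have hA : FS ((Ideal.Quotient.mk J).comp C) (Ideal.Quotient.mk J (C π)) := by
      have := FS_of_QS (QS_of_SStd hSS)
      rw [C_pow, map_pow] at this
      exact this.of_pow
    let gA : MvPolynomial ι R →+* T' := eval₂Hom (g'.comp ((p'.comp b).comp d0)) (fun i => g' (p' (p (nX m D i))))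
    obtain ⟨gA', hgA'⟩ : ∃ gA' : MvPolynomial ι R ⧸ J →+* T', gA'.comp (Ideal.Quotient.mk J) = gA := by
      refine exists_factor _ Ideal.Quotient.mk_surjective gA ?_
      intro f hf
      rw [Ideal.Quotient.eq_zero_iff_mem] at hf
      have := congrArg g' (hJ0 f hf)
      rw [hom_eval₂, map_zero] at this
      exact this
    obtain ⟨xA, hxA1, hxA2⟩ := hA T T' q hq hs φ gA' (by
      rw [← RingHom.comp_assoc, hgA', ← hg']; ext r; simp [gA]) (by
      have : gA' (Ideal.Quotient.mk J (C π)) = g' ((p'.comp b) (d0 π)) := by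
        rw [← RingHom.comp_apply, hgA']; simp [gA]
      rwa [this])
    obtain ⟨x, hx⟩ : ∃ x : ι → T, x = fun i => xA (Ideal.Quotient.mk J (X i)) := ⟨_, rfl⟩
    have hxe : ∀ f, eval₂ φ x f = xA (Ideal.Quotient.mk J f) := by
      intro f
      have : eval₂Hom φ x = xA.comp (Ideal.Quotient.mk J) := by
        apply MvPolynomial.ringHom_ext
        · intro r; simpa using (RingHom.congr_fun hxA2 r).symm
        · intro i; simp [hx]
      exact RingHom.congr_fun this f
    have hxJ0 : ∀ f ∈ J, eval₂ φ x f = 0 := fun f hf => by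
      rw [hxe, Ideal.Quotient.eq_zero_iff_mem.mpr hf, map_zero]
    have hqx : ∀ i, q (x i) = g' (p' (p (nX m D i))) := by
      intro i
      have h1 := RingHom.congr_fun hxA1 (Ideal.Quotient.mk J (X i))
      have h2 := RingHom.congr_fun hgA' (X i)
      rw [hx]
      refine h1.trans (h2.trans ?_)
      simp [gA]
    choose y0 hy0 using fun j => hq (g' (p' (p (nY ι D j))))
    choose w0 hw0 using fun j => hq (g' (p' (p (nW m D j))))
    obtain ⟨Dl, hDl⟩ : ∃ Dl : ι → T, Dl = fun i => x i - gD (d i) - φ π ^ 3 * nu F G π φ x y0 w0 i := ⟨_, rfl⟩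
    have hqφ : q.comp φ = (g'.comp (p'.comp p)).comp (C.comp d0) := hg'.symm
    have hDl0 : ∀ i, q (Dl i) = 0 := by
      intro i
      have h1 : g' (p' (p (nL F G π d0 d i))) = 0 := by rw [(hpI _).mpr (hIL i), map_zero, map_zero]
      rw [← h1]
      change _ = (g'.comp (p'.comp p)) (nL F G π d0 d i)
      rw [hDl]
      simp only [nL, map_sub, map_mul, nu_map, nU_map, hqx, hy0, hw0, hqφ]
      have h2 : q (gD (d i)) = (g'.comp (p'.comp p)) (C (d i)) := RingHom.congr_fun hgD1 (d i)
      have h3 : q (φ π ^ 3) = (g'.comp (p'.comp p)) (C (d0 π ^ 3)) := by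
        rw [map_pow]
        have : q (φ π) = (g'.comp (p'.comp p)) (C (d0 π)) := RingHom.congr_fun hqφ π
        rw [this]; simp
      rw [h2, h3]
      simp only [RingHom.comp_apply]
      ring
    let y : Fin m → T := fun j => y0 j + ∑ k, eval₂ φ x (pderiv k (F j)) * (Dl k * a ^ 4)
    let w : ι → T := fun i => w0 i + Dl i * a ^ 4
    have hv : ∀ l, nv F φ x y w l = nv F φ x y0 w0 l := by
      intro l
      simp only [nv, y, w, mul_add, Finset.sum_add_distrib]; ring
    have hnu : ∀ i, φ π ^ 3 * nu F G π φ x y w i = φ π ^ 3 * nu F G π φ x y0 w0 i + Dl i := by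
      intro i
      simp only [nu, hv, w]
      have : φ π ^ 4 * a ^ 4 = 1 := by rw [← mul_pow, ha, one_pow]
      linear_combination Dl i * this
    let ξ : nE ι m D →+* T := eval₂Hom gD (Sum.elim x (Sum.elim y w))
    have ξX : ∀ i, ξ (nX m D i) = x i := fun i => by simp [ξ]
    have ξY : ∀ j, ξ (nY ι D j) = y j := fun i => by simp [ξ]
    have ξW : ∀ i, ξ (nW m D i) = w i := fun i => by simp [ξ]
    have ξC : ∀ x, ξ (C x) = gD x := fun x => by simp [ξ]
    have ξC' : ξ.comp (C.comp d0) = φ := by rw [← hgD2]; ext r; simp [ξ]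
    have ξL : ∀ i, ξ (nL F G π d0 d i) = 0 := by
      intro i
      have h1 : gD (d0 π) = φ π := RingHom.congr_fun hgD2 π
      simp only [nL, map_sub, map_mul, nu_map, nU_map, ξC, ξC', ξX, ξY, ξW, map_pow, h1, hnu, hDl]
      ring
    have ξH : ∀ j, ξ (nH F G π d0 e' j) = 0 := by
      intro j
      have h := newton_pre F G π d0 d e' he ξ ξL j
      simp only [ξC', ξX] at h
      have h0 : ∀ l, eval₂ φ x (npp F G π j l) = 0 := fun l => hxJ0 _ (hpp j l)
      simp only [h0, zero_mul, Finset.sum_const_zero, mul_zero, add_zero, hxJ0 _ (hFJ j)] at h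
      have h1 : IsUnit (ξ (C (d0 π ^ 4))) := by
        have : gD (d0 π) = φ π := RingHom.congr_fun hgD2 π
        rw [ξC, map_pow, this]; exact hπu.pow 4
      exact (h1.mul_right_eq_zero).mp h.symm
    obtain ⟨ξB, hξB⟩ := exists_factor p hp ξ (by
      intro x hx
      rw [hpI, hI] at hx
      refine (?_ : Ideal.span (Set.range (nRel F G π d0 d e')) ≤ RingHom.ker ξ) hx
      rw [Ideal.span_le]
      rintro _ ⟨(i | i), rfl⟩
      · exact ξL i
      · exact ξH i)
    have hξB' : ∀ x, ξB (p x) = ξ x := fun x => RingHom.congr_fun hξB x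
    obtain ⟨ξ', hξ'⟩ := exists_factor p' hp' ξB (by
      intro z hz
      rw [hp'J, hJB] at hz
      refine (?_ : Ideal.map xe J ≤ RingHom.ker ξB) hz
      rw [Ideal.map_le_iff_le_comap]
      intro f hf
      change ξB (eval₂ _ _ f) = 0
      rw [hom_eval₂, ← hxJ0 f hf]
      congr 1
      · rw [← ξC', ← hξB]; rfl
      · funext i; rw [← ξX, ← hξB]; rfl)
    have hξ'' : ∀ x, ξ' (p' (p x)) = ξ x := fun x => by rw [← hξB']; exact RingHom.congr_fun hξ' (p x)
    refine ⟨ξ', ?_, ?_⟩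
    · have : (q.comp ξ').comp (p'.comp p) = g'.comp (p'.comp p) := by
        apply MvPolynomial.ringHom_ext
        · intro r
          change q (ξ' (p' (p _))) = _
          rw [hξ'', ξC]; exact RingHom.congr_fun hgD1 r
        · rintro (i | i | i)
          · change q (ξ' (p' (p _))) = _
            rw [hξ'', ξX]; exact hqx i
          · change q (ξ' (p' (p _))) = _
            rw [hξ'', ξY]
            simp only [y, map_add, map_sum, map_mul, hDl0, zero_mul, mul_zero, Finset.sum_const_zero, add_zero]
            exact hy0 i
          · change q (ξ' (p' (p _))) = _
            rw [hξ'', ξW]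
            simp only [w, map_add, map_mul, hDl0, zero_mul, add_zero]
            exact hw0 i
      ext z
      obtain ⟨z, rfl⟩ := (hp'.comp hp) z
      exact RingHom.congr_fun this z
    · ext r
      exact (hξ'' _).trans ((ξC _).trans (RingHom.congr_fun hgD2 r))
  · obtain ⟨c', hc'⟩ := Ideal.mem_span_singleton'.mp hg1
    have : g = 1 + b (d0 π) * (b (d0 π) * c') := by rw [← sub_eq_iff_eq_add', ← hc']; ring
    refine ⟨p' (p cΔ + b (d0 π) * c' + b (d0 π) * b (d0 π) * p cΔ * c'), ?_⟩
    rw [this, hΔ]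
    simp only [map_mul, map_add, map_one, b, RingHom.comp_apply]
    ring
  · intro S _ s δ hsδ hann
    have h1 := hsδ.comp hFS
    have h2 : FS (b.comp s) (b δ * p Δ * g) := h1.mono (Dvd.intro _ rfl)
    have h3 := h2.transfer_surj p' hp' (by
      intro x hx
      have hx' := (hp'J x).mp hx
      obtain ⟨z, hz⟩ := h3 x hx'
      have h5 := hgx x hx'
      obtain ⟨n, hn⟩ := flat_ann (C : D →+* nE ι m D) (flat_C _) p hp (p Δ) hFS (d0 π ^ 2) (d0 π) δ hann (g * (b (d0 π) ^ 2 * z)) (by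
        rw [← h5, hz, map_pow, map_pow]; simp only [b, RingHom.comp_apply]; ring)
      refine ⟨n + 1, ?_⟩
      have hn' : (b δ * p Δ) ^ n * (b (d0 π) * (g * (b (d0 π) ^ 2 * z))) = 0 := hn
      rw [hz, pow_succ, mul_pow]
      linear_combination (b δ * p Δ) * g ^ n * hn')
    rw [map_mul p' (p Δ), ← mul_assoc]
    rw [map_mul, map_mul] at h3
    exact h3

/-- `d` is a derivation of `P` over `f : R → P`. -/
structure IsDer {R P : Type*} [CommRing R] [CommRing P] (f : R →+* P) (d : P → P) : Prop where
  add : ∀ x y, d (x + y) = d x + d y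
  mul : ∀ x y, d (x * y) = x * d y + y * d x
  base : ∀ r, d (f r) = 0

section
variable {R P : Type*} [CommRing R] [CommRing P] {f : R →+* P}

theorem IsDer.zero {d : P → P} (h : IsDer f d) : d 0 = 0 := by simpa using h.base 0

theorem IsDer.smul {d : P → P} (h : IsDer f d) (a : P) : IsDer f (fun x => a * d x) :=
  ⟨fun x y => by rw [h.add]; ring, fun x y => by rw [h.mul]; ring, fun r => by rw [h.base]; ring⟩

theorem IsDer.sub {d d' : P → P} (h : IsDer f d) (h' : IsDer f d') : IsDer f (fun x => d x - d' x) :=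
  ⟨fun x y => by rw [h.add, h'.add]; ring, fun x y => by rw [h.mul, h'.mul]; ring,
    fun r => by rw [h.base, h'.base]; ring⟩

theorem IsDer.sum {α : Type*} (s : Finset α) {d : α → P → P} (h : ∀ a, IsDer f (d a)) :
    IsDer f (fun x => ∑ a ∈ s, d a x) :=
  ⟨fun x y => by simp only [(h _).add, Finset.sum_add_distrib],
   fun x y => by simp only [(h _).mul, Finset.sum_add_distrib, Finset.mul_sum],
   fun r => by simp only [(h _).base, Finset.sum_const_zero]⟩

theorem IsDer.map_neg {d : P → P} (h : IsDer f d) (x : P) : d (-x) = - d x := by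
  have := h.add x (-x); rw [add_neg_cancel, h.zero] at this
  linear_combination -this

theorem IsDer.map_sub {d : P → P} (h : IsDer f d) (x y : P) : d (x - y) = d x - d y := by
  rw [sub_eq_add_neg, h.add, h.map_neg, sub_eq_add_neg]

theorem IsDer.map_sum {d : P → P} (h : IsDer f d) {α : Type*} (s : Finset α) (x : α → P) :
    d (∑ a ∈ s, x a) = ∑ a ∈ s, d (x a) := by
  classical
  induction s using Finset.induction_on with
  | empty => simpa using h.zero
  | insert a s ha ih => rw [Finset.sum_insert ha, h.add, ih, Finset.sum_insert ha]
end

/-- Nakayama at a prime. -/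
theorem nak {P : Type*} [CommRing P] (J N 𝔓 : Ideal P) [𝔓.IsPrime] (hJ : J.FG)
    (h : ∀ x ∈ J, ∃ s, s ∉ 𝔓 ∧ s * x ∈ N ⊔ 𝔓 * J) : ∃ s, s ∉ 𝔓 ∧ ∀ x ∈ J, s * x ∈ N := by
  classical
  obtain ⟨n, g, hg⟩ := Submodule.fg_iff_exists_fin_generating_family.1 hJ
  have hgJ : ∀ i, g i ∈ J := fun i => by rw [← hg]; exact Submodule.subset_span ⟨i, rfl⟩
  choose s hs hsg using fun i => h (g i) (hgJ i)
  obtain ⟨t, ht⟩ : ∃ t, t = ∏ i, s i := ⟨_, rfl⟩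
  have ht𝔓 : t ∉ 𝔓 := by
    rw [ht]; intro hh
    obtain ⟨i, _, hi⟩ := (Ideal.IsPrime.prod_mem_iff (p := 𝔓)).1 hh
    exact hs i hi
  have htg : ∀ i, t * g i ∈ N ⊔ 𝔓 * J := fun i => by
    rw [ht, ← Finset.mul_prod_erase _ _ (Finset.mem_univ i), mul_right_comm]
    exact Ideal.mul_mem_right _ _ (hsg i)
  have : ∀ i, ∃ p : Fin n → P, (∀ j, p j ∈ 𝔓) ∧ t * g i - ∑ j, p j * g j ∈ N := by
    intro i
    obtain ⟨a, ha, b, hb, hab⟩ := Submodule.mem_sup.1 (htg i)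
    have : b ∈ 𝔓 • Submodule.span P (Set.range g) := by rw [hg]; exact hb
    obtain ⟨v, hv, hvb⟩ := (Submodule.mem_ideal_smul_span_iff_exists_sum 𝔓 g b).1 this
    refine ⟨v, hv, ?_⟩
    rw [Finsupp.sum_fintype _ _ (by simp)] at hvb
    simp only [smul_eq_mul] at hvb
    rw [hvb, ← hab]; simpa using ha
  choose p hp hpN using this
  obtain ⟨M, hM⟩ : ∃ M : Matrix (Fin n) (Fin n) P, M = Matrix.scalar (Fin n) t - Matrix.of p := ⟨_, rfl⟩
  refine ⟨M.det, ?_, ?_⟩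
  · intro hh
    have h1 : (Ideal.Quotient.mk 𝔓) M.det = (Ideal.Quotient.mk 𝔓) t ^ n := by
      rw [RingHom.map_det, hM]
      have : (Ideal.Quotient.mk 𝔓).mapMatrix (Matrix.scalar (Fin n) t - Matrix.of p) = Matrix.scalar (Fin n) (Ideal.Quotient.mk 𝔓 t) := by
        ext i j
        simp [Matrix.diagonal_apply, Ideal.Quotient.eq_zero_iff_mem.2 (hp i j)]
        split_ifs <;> simp
      rw [this]; simp
    rw [Ideal.Quotient.eq_zero_iff_mem.2 hh] at h1
    have := h1.symm
    have h2 : (Ideal.Quotient.mk 𝔓) t = 0 := eq_zero_of_pow_eq_zero this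
    exact ht𝔓 (Ideal.Quotient.eq_zero_iff_mem.1 h2)
  · have key : ∀ i, M.det * g i ∈ N := by
      intro i
      have h1 : (M.adjugate * M).mulVec g i = M.det * g i := by
        rw [Matrix.adjugate_mul]; simp [Matrix.smul_mulVec]
      rw [← h1, ← Matrix.mulVec_mulVec]
      show ∑ j, M.adjugate i j * M.mulVec g j ∈ N
      refine Ideal.sum_mem N fun j _ => N.mul_mem_left _ ?_
      have : M.mulVec g j = t * g j - ∑ k, p j k * g k := by
        rw [hM, Matrix.sub_mulVec]; simp [Matrix.mulVec, dotProduct, Matrix.diagonal_apply]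
      rw [this]; exact hpN j
    intro x hx
    have hx' : x ∈ Submodule.span P (Set.range g) := by rw [hg]; exact hx
    refine Submodule.span_induction (p := fun x _ => M.det * x ∈ N) ?_ ?_ ?_ ?_ hx'
    · rintro _ ⟨i, rfl⟩; exact key i
    · simp
    · intro x y _ _ h1 h2; rw [mul_add]; exact N.add_mem h1 h2
    · intro a x _ h1; rw [smul_eq_mul, mul_left_comm]; exact N.mul_mem_left _ h1

/-- Local structure of smooth quotients. -/
theorem LF {R P : Type*} [CommRing R] [CommRing P] [IsNoetherianRing P] (f : R →+* P)
    (J 𝔓 ϖ : Ideal P) [𝔓.IsPrime] (hJ : J ≤ 𝔓)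
    (H : ∀ x ∈ J, (∀ d, IsDer f d → d x ∈ 𝔓) → ∃ s, s ∉ 𝔓 ∧ s * x ∈ ϖ ⊔ 𝔓 * J) :
    ∃ (ι : Type) (_ : Fintype ι) (_ : DecidableEq ι) (F : ι → P) (d : ι → P → P) (c : P),
      (∀ l, F l ∈ J) ∧ (∀ j, IsDer f (d j)) ∧ c ∉ 𝔓 ∧
      (∀ x ∈ J, c * x ∈ Ideal.span (Set.range F) ⊔ ϖ) ∧
      ∀ j l, d j (F l) = if j = l then c else 0 := by
  classical
  have main : ∀ N : Ideal P, ∀ (ι : Type) (_ : Fintype ι) (_ : DecidableEq ι) (F : ι → P) (d : ι → P → P) (c : P),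
      Ideal.span (Set.range F) = N →
      (∀ l, F l ∈ J) → (∀ j, IsDer f (d j)) → c ∉ 𝔓 →
      (∀ j l, d j (F l) = if j = l then c else 0) →
      ∃ (ι : Type) (_ : Fintype ι) (_ : DecidableEq ι) (F : ι → P) (d : ι → P → P) (c : P),
      (∀ l, F l ∈ J) ∧ (∀ j, IsDer f (d j)) ∧ c ∉ 𝔓 ∧
      (∀ x ∈ J, c * x ∈ Ideal.span (Set.range F) ⊔ ϖ) ∧
      ∀ j l, d j (F l) = if j = l then c else 0 := by
    intro N
    induction N using WellFoundedGT.induction with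
    | ind N ih =>
    intro ι _ _ F d c hN hF hd hc hdF
    by_cases hex : ∀ x ∈ J, ∃ s, s ∉ 𝔓 ∧ s * x ∈ (N ⊔ ϖ) ⊔ 𝔓 * J
    · obtain ⟨s, hs, hsJ⟩ := nak J (N ⊔ ϖ) 𝔓 (IsNoetherian.noetherian J) hex
      refine ⟨ι, inferInstance, inferInstance, F, fun j x => s * d j x, s * c, hF, fun j => (hd j).smul s, ?_, ?_, ?_⟩
      · exact fun h => (Ideal.IsPrime.mem_or_mem ‹_› h).elim hs hc
      · intro x hx; rw [hN, mul_right_comm]; exact Ideal.mul_mem_right _ _ (hsJ x hx)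
      · intro j l; simp only [hdF]; split_ifs <;> simp
    · push Not at hex
      obtain ⟨x, hxJ, hx⟩ := hex
      obtain ⟨x', hx'⟩ : ∃ x', x' = c * x - ∑ j, d j x * F j := ⟨_, rfl⟩
      have hsumN : ∑ j, d j x * F j ∈ N := Ideal.sum_mem _ fun j _ => Ideal.mul_mem_left _ _ (by
        rw [← hN]; exact Ideal.subset_span ⟨j, rfl⟩)
      have hNJ : N ≤ J := by rw [← hN, Ideal.span_le]; rintro _ ⟨i, rfl⟩; exact hF i
      have hx'J : x' ∈ J := by
        rw [hx']; exact J.sub_mem (J.mul_mem_left _ hxJ) (hNJ hsumN)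
      have hdx' : ∀ j, d j x' ∈ J := by
        intro j
        have : d j x' = x * d j c - ∑ l, F l * d j (d l x) := by
          rw [hx', (hd j).map_sub, (hd j).mul, (hd j).map_sum]
          simp only [(hd j).mul, hdF, Finset.sum_add_distrib]
          simp
          ring
        rw [this]
        exact J.sub_mem (J.mul_mem_right _ hxJ) (Ideal.sum_mem _ fun l _ => J.mul_mem_right _ (hF l))
      have : ∃ d0, IsDer f d0 ∧ d0 x' ∉ 𝔓 := by
        by_contra hcon
        push Not at hcon
        obtain ⟨s, hs, hsx⟩ := H x' hx'J hcon
        refine hx (s * c) (fun h => (Ideal.IsPrime.mem_or_mem ‹_› h).elim hs hc) ?_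
        have : s * c * x = s * x' + s * ∑ j, d j x * F j := by rw [hx']; ring
        rw [this, sup_assoc]
        refine Ideal.add_mem _ ((le_sup_right : _ ≤ N ⊔ _) hsx) ((le_sup_left : N ≤ _) (N.mul_mem_left _ hsumN))
      obtain ⟨d0, hd0, hd0x⟩ := this
      obtain ⟨d', hd'⟩ : ∃ d' : P → P, d' = fun y => c * d0 y - ∑ l, d0 (F l) * d l y := ⟨_, rfl⟩
      have hd'D : IsDer f d' := by
        rw [hd']; exact (hd0.smul c).sub (IsDer.sum _ fun l => (hd l).smul _)
      have hd'F : ∀ l, d' (F l) = 0 := by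
        intro l; rw [hd']; simp [hdF]; ring
      have he : d' x' ∉ 𝔓 := by
        rw [hd']; intro h
        have h1 : c * d0 x' ∈ 𝔓 := by
          have := 𝔓.add_mem h (Ideal.sum_mem 𝔓 (t := Finset.univ) (f := fun l => d0 (F l) * d l x')
            fun l _ => 𝔓.mul_mem_left _ (hJ (hdx' l)))
          simpa using this
        exact (Ideal.IsPrime.mem_or_mem ‹_› h1).elim hc hd0x
      refine ih (Ideal.span (Set.range (fun o : Option ι => o.elim x' F))) ?_ (Option ι) inferInstance inferInstance
        (fun o => o.elim x' F) (fun o => o.elim (fun y => c * d' y) (fun j y => d' x' * d j y - d j x' * d' y))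
        (d' x' * c) rfl ?_ ?_ ?_ ?_
      · rw [← hN]
        refine lt_of_le_of_ne (Ideal.span_mono ?_) ?_
        · rintro _ ⟨i, rfl⟩; exact ⟨some i, rfl⟩
        · intro heq
          have : x' ∈ N := by
            rw [← hN, heq]; exact Ideal.subset_span ⟨none, rfl⟩
          refine hx c hc ?_
          rw [sup_assoc]; refine (le_sup_left : N ≤ _) ?_
          have h2 : c * x = x' + ∑ j, d j x * F j := by rw [hx']; ring
          rw [h2]; exact N.add_mem this hsumN
      · rintro (_ | l)
        · exact hx'J
        · exact hF l
      · rintro (_ | l)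
        · exact hd'D.smul c
        · exact ((hd l).smul _).sub (hd'D.smul _)
      · exact fun h => (Ideal.IsPrime.mem_or_mem ‹_› h).elim he hc
      · rintro (_ | j) (_ | l)
        · simp; ring
        · simp [hd'F]
        · simp; ring
        · simp [hd'F, hdF]
  exact main _ PEmpty inferInstance inferInstance (fun i => i.elim) (fun i => i.elim) 1 rfl (fun i => i.elim) (fun i => i.elim)
    (fun h => Ideal.IsPrime.ne_top ‹_› ((Ideal.eq_top_iff_one _).2 h)) (fun i => i.elim)

theorem der_lift  {f : R →+* P} (hf : FS f 1) {ι : Type} [Fintype ι] [DecidableEq ι]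
    (F : ι → P) (d : ι → P → P) (c : P) (hd : ∀ j, IsDer f (d j)) (hdF : ∀ j l, d j (F l) = if j = l then c else 0)
    {T T' : Type u} [CommRing T] [CommRing T'] (q : T →+* T') (hq : Function.Surjective q)
    (hs : ∀ x y, q x = 0 → q y = 0 → x * y = 0) (φ : R →+* T) (g : P →+* T') (hg : g.comp f = q.comp φ)
    (hc : IsUnit (g c)) (w : ι → T) (hw : ∀ l, q (w l) = g (F l)) :
    ∃ g' : P →+* T, q.comp g' = g ∧ g'.comp f = φ ∧ ∀ l, g' (F l) = w l := by
  obtain ⟨gh, h1, h2⟩ := hf T T' q hq hs φ g hg (by simp)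
  have h1' : ∀ x, q (gh x) = g x := fun x => by rw [← h1]; rfl
  have hu : IsUnit (gh c) := isUnit_of_sq_zero q hq hs (by rw [h1']; exact hc)
  obtain ⟨a, ha⟩ := hu.exists_right_inv
  have hz : ∀ j, q (w j - gh (F j)) = 0 := fun j => by rw [map_sub, hw, h1', sub_self]
  obtain ⟨e, he⟩ : ∃ e : P → T, e = fun x => ∑ j, (w j - gh (F j)) * a * gh (d j x) := ⟨_, rfl⟩
  have hqe : ∀ x, q (e x) = 0 := fun x => by
    rw [he]; simp [hz, h1', hw]
  refine ⟨{ toFun := fun x => gh x + e x, map_one' := ?_, map_mul' := ?_, map_zero' := ?_, map_add' := ?_ }, ?_, ?_, ?_⟩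
  · have : ∀ j, d j 1 = 0 := fun j => by simpa using (hd j).base 1
    simp [he, this]
  · intro x y
    have h3 : e (x * y) = gh x * e y + gh y * e x := by
      rw [he]; simp only [(hd _).mul, map_add, map_mul, Finset.mul_sum, ← Finset.sum_add_distrib]
      refine Finset.sum_congr rfl fun j _ => by ring
    rw [h3, map_mul]
    linear_combination - hs _ _ (hqe x) (hqe y)
  · simp [he, (hd _).zero]
  · intro x y
    have h3 : e (x + y) = e x + e y := by
      rw [he]; simp only [(hd _).add, map_add, mul_add, ← Finset.sum_add_distrib]
    rw [h3, map_add]; ring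
  · ext x; simp [hqe, h1']
  · ext r
    have : gh (f r) = φ r := by rw [← h2]; rfl
    simp [he, (hd _).base, this]
  · intro l
    have : e (F l) = w l - gh (F l) := by
      rw [he]; simp only [hdF]
      rw [Finset.sum_eq_single l]
      · simp [mul_assoc, mul_comm a, ha]
      · intro j _ hj; simp [hj]
      · simp
    simp [this]

/-- quotient by an ideal with Jacobian data is FS. -/
theorem FS_of_LF  {f : R →+* P} (hf : FS f 1) {ι : Type} [Fintype ι] [DecidableEq ι]
    (F : ι → P) (d : ι → P → P) (c : P) (hd : ∀ j, IsDer f (d j)) (hdF : ∀ j l, d j (F l) = if j = l then c else 0)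
    (p : P →+* B) (hp : Function.Surjective p) (hF : ∀ l, p (F l) = 0)
    (hker : ∀ x, p x = 0 → c * x ∈ Ideal.span (Set.range F)) : FS (p.comp f) (p c) := by
  intro T T' _ _ q hq hs φ g hg hc
  obtain ⟨g', h1, h2, h3⟩ := der_lift hf F d c hd hdF q hq hs φ (g.comp p) (by rw [← hg]; rfl) hc (fun _ => 0)
    (fun l => by simp [hF])
  have hu : IsUnit (g' c) := isUnit_of_sq_zero q hq hs (by rw [← RingHom.comp_apply, h1]; exact hc)
  have hz : ∀ x ∈ Ideal.span (Set.range F), g' x = 0 := by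
    intro x hx
    have : Ideal.span (Set.range F) ≤ RingHom.ker g' := by
      rw [Ideal.span_le]; rintro _ ⟨i, rfl⟩; exact h3 i
    exact this hx
  obtain ⟨g2, hg2⟩ := exists_factor p hp g' (fun x hx => by
    have := hz _ (hker x hx)
    rw [map_mul] at this
    exact (hu.mul_right_eq_zero).1 this)
  refine ⟨g2, ?_, ?_⟩
  · ext b; obtain ⟨x, rfl⟩ := hp b
    have := RingHom.congr_fun h1 x
    rw [← hg2] at this; exact this
  · rw [← RingHom.comp_assoc, hg2, h2]

/-- If all derivations of `P` over `R` send `x` to `𝔓`, so do derivations to any module-like ideal. -/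
theorem der_values  {f : R →+* P} (hf : FS f 1) (𝔓 : Ideal P) (x : P)
    (hx : ∀ d, IsDer f d → d x ∈ 𝔓) {T : Type u} [CommRing T] (i : P →+* T) (I : Ideal T) (e : P → T)
    (heI : ∀ y, e y ∈ I) (hadd : ∀ y z, e (y + z) = e y + e z) (hmul : ∀ y z, e (y * z) = i y * e z + i z * e y)
    (hbase : ∀ r, e (f r) = 0) : e x ∈ 𝔓.map i * I := by
  letI := f.toAlgebra
  letI := i.toAlgebra
  letI : Algebra R T := (i.comp f).toAlgebra
  haveI : IsScalarTower R P T := IsScalarTower.of_algebraMap_eq fun _ => rfl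
  haveI : Algebra.FormallySmooth R P := FS.formallySmooth hf
  let e1 : P →ₗ[R] T := LinearMap.mk ⟨e, hadd⟩ (fun r y => by
    show e (f r * y) = i (f r) * e y
    simp [hmul, hbase])
  let E : Derivation R P T := Derivation.mk' e1 (fun y z => by
    show e (y * z) = i y * e z + i z * e y
    exact hmul y z)
  obtain ⟨s, hs⟩ := (Module.projective_def' (R := P) (P := Ω[P⁄R])).1 inferInstance
  have hs' : ∀ ω, Finsupp.linearCombination P id (s ω) = ω := fun ω => LinearMap.congr_fun hs ω
  have key : e x = ∑ ω ∈ (s (KaehlerDifferential.D R P x)).support,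
      i (s (KaehlerDifferential.D R P x) ω) * E.liftKaehlerDifferential ω := by
    have h1 : e x = E.liftKaehlerDifferential (KaehlerDifferential.D R P x) := by
      rw [Derivation.liftKaehlerDifferential_comp_D]; rfl
    rw [h1]; conv_lhs => rw [← hs' (KaehlerDifferential.D R P x)]
    rw [Finsupp.linearCombination_apply, Finsupp.sum, map_sum]
    refine Finset.sum_congr rfl fun ω _ => ?_
    rw [map_smul]; rfl
  have hI : ∀ ω, E.liftKaehlerDifferential ω ∈ I := by
    intro ω
    have : ω ∈ Submodule.span P (Set.range (KaehlerDifferential.D R P)) := by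
      rw [KaehlerDifferential.span_range_derivation]; trivial
    refine Submodule.span_induction (p := fun ω _ => E.liftKaehlerDifferential ω ∈ I) ?_ ?_ ?_ ?_ this
    · rintro _ ⟨y, rfl⟩; rw [Derivation.liftKaehlerDifferential_comp_D]; exact heI y
    · simp
    · intro a b _ _ ha hb; rw [map_add]; exact I.add_mem ha hb
    · intro a b _ hb; rw [map_smul]; exact I.mul_mem_left (i a) hb
  rw [key]
  refine Ideal.sum_mem _ fun ω _ => Ideal.mul_mem_mul (Ideal.mem_map_of_mem _ ?_) (hI ω)
  let π : Ω[P⁄R] →ₗ[P] P := (Finsupp.lapply ω).comp s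
  have := hx (fun y => π (KaehlerDifferential.D R P y)) ⟨fun y z => by simp, fun y z => by simp, fun r => by
    have : KaehlerDifferential.D R P (f r) = 0 := Derivation.map_algebraMap _ r
    simp [this]⟩
  exact this

theorem H_core  {f : R →+* P} (hf : FS f 1) (J 𝔓 : Ideal P) (x : P)
    (hx : ∀ d, IsDer f d → d x ∈ 𝔓) {T : Type u} [CommRing T] (i s : P →+* T)
    (h1 : ∀ y, i y - s y ∈ J.map i) (h2 : ∀ a ∈ J, ∀ b ∈ J, i a * i b = 0) (h3 : ∀ r, s (f r) = i (f r))
    (h4 : s x = 0) : i x ∈ (𝔓 * J).map i := by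
  have hsq : ∀ a ∈ J.map i, ∀ b ∈ J.map i, a * b = 0 := by
    intro a ha b hb
    have : a * b ∈ (J * J).map i := by rw [Ideal.map_mul]; exact Ideal.mul_mem_mul ha hb
    have h0 : (J * J).map i ≤ ⊥ := by
      rw [Ideal.map_le_iff_le_comap, Ideal.mul_le]
      intro a ha b hb; rw [Ideal.mem_comap, map_mul, h2 a ha b hb]; simp
    simpa using h0 this
  have := der_values hf 𝔓 x hx i (J.map i) (fun y => i y - s y) h1 (fun y z => by simp only [map_add]; ring)
    (fun y z => by
      have := hsq _ (h1 y) _ (h1 z)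
      simp only [map_mul]; linear_combination -this) (fun r => by rw [h3, sub_self])
  rw [Ideal.map_mul]; simpa [h4] using this

theorem H_of_FS  {f : R →+* P} (hf : FS f 1)
    (J 𝔓 ϖ : Ideal P) [𝔓.IsPrime] (hJ : J ≤ 𝔓) (p : R →+* R') (hp : Function.Surjective p)
    (hker : ∀ r, p r = 0 → f r ∈ ϖ) (pB : P →+* B) (hpB : Function.Surjective pB) (hpJ : ∀ x, pB x = 0 ↔ x ∈ J)
    (f' : R' →+* B) (hf' : f'.comp p = pB.comp f) (b : P) (hb : b ∉ 𝔓) (h : FS f' (pB b)) :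
    ∀ x ∈ J, (∀ d, IsDer f d → d x ∈ 𝔓) → ∃ s, s ∉ 𝔓 ∧ s * x ∈ ϖ ⊔ 𝔓 * J := by
  intro x hxJ hx
  have hk : J = RingHom.ker pB := by ext y; rw [RingHom.mem_ker, hpJ]
  let e : B ≃+* P ⧸ J := ((Ideal.quotEquivOfEq hk).trans (RingHom.quotientKerEquivOfSurjective hpB)).symm
  have he : ∀ y, e (pB y) = Ideal.Quotient.mk J y := by
    intro y; rw [RingEquiv.symm_apply_eq]; rfl
  obtain ⟨s, hs1, hs2⟩ := retraction f J (J ^ 2 ⊔ ϖ) le_sup_left p hp (fun r hr => (le_sup_right : ϖ ≤ _) (hker r hr))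
    ((e : B →+* P ⧸ J).comp f') (by rw [RingHom.comp_assoc, hf']; ext r; exact he (f r)) b
    (by have := FS.of_equiv h e; rw [he] at this; exact this)
  have := H_core hf J 𝔓 x hx ((algebraMap _ (Localization.Away (Ideal.Quotient.mk (J ^ 2 ⊔ ϖ) b))).comp (Ideal.Quotient.mk _))
    (s.comp (Ideal.Quotient.mk J)) hs1 (fun a ha c hc => by
      have h0 : Ideal.Quotient.mk (J ^ 2 ⊔ ϖ) (a * c) = 0 := by
        rw [Ideal.Quotient.eq_zero_iff_mem]
        refine (le_sup_left : J ^ 2 ≤ _) ?_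
        rw [sq]; exact Ideal.mul_mem_mul ha hc
      rw [← map_mul, RingHom.comp_apply, h0, map_zero]) hs2 (by
      rw [RingHom.comp_apply, Ideal.Quotient.eq_zero_iff_mem.2 hxJ, map_zero])
  obtain ⟨n, j, hj, hnj⟩ := mem_map_away (𝔓 * J) _ b this
  have h0 : algebraMap _ (Localization.Away (Ideal.Quotient.mk (J ^ 2 ⊔ ϖ) b)) (Ideal.Quotient.mk (J ^ 2 ⊔ ϖ) (b ^ n * x - j)) = 0 := by
    simp only [map_sub, map_mul, map_pow]; rw [sub_eq_zero]; exact hnj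
  obtain ⟨m, hm⟩ := away_eq_zero _ _ _ h0
  refine ⟨b ^ (m + n), fun h => hb (Ideal.IsPrime.mem_of_pow_mem ‹_› _ h), ?_⟩
  have hle : J ^ 2 ⊔ ϖ ≤ ϖ ⊔ 𝔓 * J := by
    refine sup_le ?_ le_sup_left
    rw [sq]; exact (Ideal.mul_mono_left hJ).trans le_sup_right
  have h5 : b ^ (m + n) * x = b ^ m * (b ^ n * x - j) + b ^ m * j := by ring
  rw [h5]
  exact Ideal.add_mem _ (hle hm) ((le_sup_right : 𝔓 * J ≤ _) (Ideal.mul_mem_left _ _ hj))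

theorem pow_tors {Λ : Type*} [CommRing Λ] (p : Λ) (h : ∀ x, p ^ 2 * x = 0 → p * x = 0) (n : ℕ) (x : Λ)
    (hx : p ^ (n + 1) * x = 0) : p * x = 0 := by
  induction n with
  | zero => simpa using hx
  | succ n ih =>
    apply ih
    have := h (p ^ n * x) (by rw [← hx]; ring)
    rw [← this]; ring

/-- the ring `P[z]/(F - ϖ^5 z)` and its smoothness. -/
theorem blowS [IsNoetherianRing P] (h : R →+* P) (hFS : FS h 1)
    (hflat : h.Flat) (π : R) (hπ : ∀ x : R, π * x = 0 → x = 0)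
    {ι : Type} [Fintype ι] [DecidableEq ι] (F : ι → P) (d : ι → P → P) (c : P) (hd : ∀ j, IsDer h (d j))
    (hdF : ∀ j l, d j (F l) = if j = l then c else 0) :
    ∃ (S : Type u) (_ : CommRing S) (p : MvPolynomial ι P →+* S), Function.Surjective p ∧
      (∀ l, p (C (F l)) = p (C (h π)) ^ 5 * p (X l)) ∧
      (∀ (T : Type u) [CommRing T] (g : MvPolynomial ι P →+* T), (∀ l, g (C (F l)) = g (C (h π)) ^ 5 * g (X l)) →
        ∃ g' : S →+* T, g'.comp p = g) ∧
      FS ((p.comp C).comp h) (p (C c)) ∧ ∀ x : S, p (C (h π)) * x = 0 → ∃ n : ℕ, p (C c) ^ n * x = 0 := by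
  obtain ⟨S, _, p, hp, hpk⟩ := exists_quot (Ideal.span (Set.range fun l : ι => (C (F l) - C (h π) ^ 5 * X l : MvPolynomial ι P)))
  have hrel : ∀ l, p (C (F l)) = p (C (h π)) ^ 5 * p (X l) := by
    intro l; rw [← sub_eq_zero, ← map_pow, ← map_mul, ← map_sub, hpk]; exact Ideal.subset_span ⟨l, rfl⟩
  have hlift : ∀ (T : Type u) [CommRing T] (g : MvPolynomial ι P →+* T), (∀ l, g (C (F l)) = g (C (h π)) ^ 5 * g (X l)) →
        ∃ g' : S →+* T, g'.comp p = g := by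
    intro T _ g hg
    refine exists_factor p hp g fun x hx => ?_
    have : Ideal.span (Set.range fun l : ι => (C (F l) - C (h π) ^ 5 * X l : MvPolynomial ι P)) ≤ RingHom.ker g := by
      rw [Ideal.span_le]; rintro _ ⟨l, rfl⟩; simp [RingHom.mem_ker, hg]
    exact this ((hpk x).1 hx)
  have hS : FS ((p.comp C).comp h) (p (C c)) := by
    intro T T' _ _ q hq hs φ g hg hc
    choose z hz using fun l => hq (g (p (X l)))
    obtain ⟨g1, h1, h2, h3⟩ := der_lift hFS F d c hd hdF q hq hs φ (g.comp (p.comp C)) (by rw [← hg]; rfl) hc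
      (fun l => φ π ^ 5 * z l) (fun l => by
        have h0 : q (φ π) = g (p (C (h π))) := (RingHom.congr_fun hg π).symm
        simp [hz, h0, hrel])
    obtain ⟨g', hg'⟩ := hlift T (eval₂Hom g1 z) (fun l => by
      have h0 : g1 (h π) = φ π := RingHom.congr_fun h2 π
      simp [h3, h0])
    refine ⟨g', ?_, ?_⟩
    · have : (q.comp g').comp p = g.comp p := by
        rw [RingHom.comp_assoc, hg']
        ext x
        · simpa using RingHom.congr_fun h1 x
        · simp [hz]
      ext s; obtain ⟨x, rfl⟩ := hp s; exact RingHom.congr_fun this x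
    · ext r
      have := RingHom.congr_fun hg' (C (h r))
      simp at this
      simp [this]; exact RingHom.congr_fun h2 r
  refine ⟨S, inferInstance, p, hp, hrel, hlift, hS, ?_⟩
  intro x hx
  have hfl : ((C : P →+* MvPolynomial ι P).comp h).Flat := RingHom.Flat.comp hflat (flat_C ι)
  obtain ⟨n, hn⟩ := flat_ann ((C : P →+* MvPolynomial ι P).comp h) hfl p hp (p (C c)) hS π 1 1
    (fun x hx => ⟨0, by simpa using hπ x hx⟩) x hx
  exact ⟨n, by simpa using hn⟩

theorem lemmaD [IsNoetherianRing P]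
    (h : R →+* P) (hFS : FS h 1) (hflat : h.Flat) (π : R) (hπ : ∀ x : R, π * x = 0 → x = 0)
    (pB : P →+* B) (hpB : Function.Surjective pB) (ρ : R →+* R') (hρ : Function.Surjective ρ)
    (hρk : ∀ r, ρ r = 0 → π ^ 6 ∣ r) (f' : R' →+* B) (hf' : f'.comp ρ = pB.comp h)
    (ev : P →+* Λ) (hev : ∀ x, pB x = 0 → ∃ μ, ev x = ev (h π) ^ 6 * μ)
    (hΛ : ∀ x, ev (h π) ^ 2 * x = 0 → ev (h π) * x = 0) :
    ∃ (D : Type u) (_ : CommRing D) (β : P →+* D) (τ : D →+* Λ), β.FiniteType ∧ τ.comp β = ev ∧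
      (∀ x, pB x = 0 → ∃ e, β x = β (h π) ^ 5 * e) ∧ FS β (β (h π)) ∧
      ∀ (𝔔 : Ideal Λ) [𝔔.IsPrime] (b : P), ev (h π) ∈ 𝔔 → FS f' (pB b) → ev b ∉ 𝔔 →
        ∃ δ, τ δ ∉ 𝔔 ∧ FS (β.comp h) δ ∧ ∀ x : D, β (h π) * x = 0 → ∃ n : ℕ, δ ^ n * x = 0 := by
  classical
  obtain ⟨J, hJ⟩ : ∃ J, J = RingHom.ker pB := ⟨_, rfl⟩
  have hJm : ∀ x, pB x = 0 ↔ x ∈ J := fun x => by rw [hJ, RingHom.mem_ker]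
  obtain ⟨m, hh, hg⟩ := Submodule.fg_iff_exists_fin_generating_family.1 (IsNoetherian.noetherian J)
  have hhJ : ∀ l, pB (hh l) = 0 := fun l => by rw [hJm, ← hg]; exact Submodule.subset_span ⟨l, rfl⟩
  have hcomb : ∀ x, pB x = 0 → ∃ a : Fin m → P, x = ∑ l, a l * hh l := by
    intro x hx
    have : x ∈ Submodule.span P (Set.range hh) := by rw [hg]; exact (hJm x).1 hx
    obtain ⟨a, ha⟩ := (Submodule.mem_span_range_iff_exists_fun P).1 this
    exact ⟨a, by rw [← ha]; simp⟩
  choose μ hμ using fun l => hev (hh l) (hhJ l)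
  obtain ⟨ϖ, hϖ⟩ : ∃ ϖ, ϖ = h π := ⟨_, rfl⟩
  simp only [← hϖ] at hev hΛ hμ ⊢
  obtain ⟨τE, hτE⟩ : ∃ τE : MvPolynomial (Fin m) P →+* Λ, τE = eval₂Hom ev (fun l => ev ϖ * μ l) := ⟨_, rfl⟩
  have hτC : ∀ x, τE (C x) = ev x := fun x => by rw [hτE]; simp
  have hτX : ∀ l, τE (X l) = ev ϖ * μ l := fun x => by rw [hτE]; simp
  obtain ⟨I0, hI0⟩ : ∃ I0 : Ideal (MvPolynomial (Fin m) P), I0 = Ideal.span (Set.range fun l => C (hh l) - C ϖ ^ 5 * X l) := ⟨_, rfl⟩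
  let I : Ideal (MvPolynomial (Fin m) P) :=
    { carrier := {x | τE x = 0 ∧ ∃ N : ℕ, C ϖ ^ N * x ∈ I0}
      zero_mem' := ⟨by simp, 0, by simp⟩
      add_mem' := by
        rintro x y ⟨hx, N, hN⟩ ⟨hy, M, hM⟩
        refine ⟨by simp [hx, hy], N + M, ?_⟩
        have : C ϖ ^ (N + M) * (x + y) = C ϖ ^ M * (C ϖ ^ N * x) + C ϖ ^ N * (C ϖ ^ M * y) := by ring
        rw [this]; exact I0.add_mem (I0.mul_mem_left _ hN) (I0.mul_mem_left _ hM)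
      smul_mem' := by
        rintro a x ⟨hx, N, hN⟩
        refine ⟨by simp [hx], N, ?_⟩
        rw [smul_eq_mul, mul_left_comm]; exact I0.mul_mem_left _ hN }
  have hmI : ∀ x, x ∈ I ↔ (τE x = 0 ∧ ∃ N : ℕ, C ϖ ^ N * x ∈ I0) := fun x => Iff.rfl
  obtain ⟨D, _, pD, hpD, hpDk⟩ := exists_quot I
  simp only [hmI] at hpDk
  clear_value I
  clear hmI I
  have hrel : ∀ l, pD (C (hh l)) = pD (C ϖ) ^ 5 * pD (X l) := by
    intro l; rw [← sub_eq_zero, ← map_pow, ← map_mul, ← map_sub, hpDk]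
    refine ⟨?_, 0, ?_⟩
    · simp only [map_sub, map_mul, map_pow, hτC, hτX, hμ]; ring
    · rw [hI0, pow_zero, one_mul]; exact Ideal.subset_span (Set.mem_range_self l)
  obtain ⟨τ, hτ⟩ := exists_factor pD hpD τE fun x hx => ((hpDk x).1 hx).1
  have hτ' : ∀ x, τ (pD x) = τE x := fun x => RingHom.congr_fun hτ x
  have htors : ∀ (x : D) (N : ℕ), pD (C ϖ) ^ N * x = 0 → τ x = 0 → x = 0 := by
    intro x N hx hx'
    obtain ⟨e, rfl⟩ := hpD x
    rw [← map_pow, ← map_mul, hpDk] at hx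
    obtain ⟨_, M, hM⟩ := hx
    rw [hpDk]
    exact ⟨by rw [← hτ', hx'], M + N, by rw [pow_add, mul_assoc]; exact hM⟩
  -- generators of kernel killed
  have hI0k : ∀ (T : Type u) [CommRing T] (g : MvPolynomial (Fin m) P →+* T),
      (∀ l, g (C (hh l)) = g (C ϖ) ^ 5 * g (X l)) → ∀ x ∈ I0, g x = 0 := by
    intro T _ g hg x hx
    have : I0 ≤ RingHom.ker g := by
      rw [hI0, Ideal.span_le]; rintro _ ⟨l, rfl⟩; simp [RingHom.mem_ker, hg]
    exact this hx
  have hDlift : ∀ (T : Type u) [CommRing T] (g : MvPolynomial (Fin m) P →+* T),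
      (∀ l, g (C (hh l)) = g (C ϖ) ^ 5 * g (X l)) → (∀ x, g (C ϖ) * x = 0 → x = 0) → ∃ g' : D →+* T, g'.comp pD = g := by
    intro T _ g hg hn
    refine exists_factor pD hpD g fun x hx => ?_
    obtain ⟨_, N, hN⟩ := (hpDk x).1 hx
    have := hI0k T g hg _ hN
    rw [map_mul, map_pow] at this
    clear hN
    induction N with
    | zero => simpa using this
    | succ N ih =>
      apply ih; apply hn; rw [← this]; ring
  refine ⟨D, inferInstance, pD.comp C, τ, ?_, ?_, ?_, ?_, ?_⟩
  · exact finiteType_of_presentation (pD.comp C) pD hpD rfl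
  · rw [← RingHom.comp_assoc, hτ, hτE]; ext x; simp
  · intro x hx
    obtain ⟨a, rfl⟩ := hcomb x hx
    refine ⟨∑ l, pD (C (a l)) * pD (X l), ?_⟩
    simp only [RingHom.comp_apply, map_sum, map_mul, hrel, Finset.mul_sum]
    exact Finset.sum_congr rfl fun l _ => by ring
  · have h1 : FS (RingHom.id P) ϖ := FS.of_one FS.id _
    refine FS.transfer h1 (pD.comp C) ?_ ?_
    · intro T _ g hg
      obtain ⟨u, hu⟩ := hg.exists_right_inv
      obtain ⟨g', hg'⟩ := hDlift T (eval₂Hom g (fun l => u ^ 5 * g (hh l))) (fun l => by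
        simp only [coe_eval₂Hom, eval₂_C, eval₂_X]
        linear_combination (-(g (hh l)) * (1 + g ϖ * u + (g ϖ * u) ^ 2 + (g ϖ * u) ^ 3 + (g ϖ * u) ^ 4)) * hu) (fun x hx => by
        simp only [coe_eval₂Hom, eval₂_C] at hx
        exact (hg.mul_right_eq_zero).1 hx)
      refine ⟨g', ?_⟩
      rw [← RingHom.comp_assoc, hg']; ext x; simp
    · intro y
      obtain ⟨e, rfl⟩ := hpD y
      induction e using MvPolynomial.induction_on with
      | C a => exact ⟨0, a, by simp⟩
      | add a b ha hb =>
        obtain ⟨n, y, hy⟩ := ha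
        obtain ⟨k, z, hz⟩ := hb
        refine ⟨n + k, ϖ ^ k * y + ϖ ^ n * z, ?_⟩
        simp only [map_add, map_mul, map_pow] at *
        rw [← hy, ← hz]; ring
      | mul_X a l ha =>
        obtain ⟨n, y, hy⟩ := ha
        refine ⟨n + 5, y * hh l, ?_⟩
        simp only [RingHom.comp_apply, map_mul] at *
        rw [← hy, hrel]; ring
  · intro 𝔔 _ b hπ𝔔 hb hb𝔔
    have hJ𝔓 : J ≤ 𝔔.comap ev := by
      intro x hx
      obtain ⟨y, hy⟩ := hev x ((hJm x).2 hx)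
      rw [Ideal.mem_comap, hy]
      exact 𝔔.mul_mem_right _ (Ideal.pow_mem_of_mem _ hπ𝔔 _ (by norm_num))
    obtain ⟨ι, _, _, F, d, c, hF, hd, hc, hcJ, hdF⟩ := LF h J (𝔔.comap ev) (Ideal.span {ϖ ^ 6}) hJ𝔓
      (H_of_FS hFS J (𝔔.comap ev) (Ideal.span {ϖ ^ 6}) hJ𝔓 ρ hρ (fun r hr => by
        obtain ⟨y, rfl⟩ := hρk r hr
        rw [map_mul, map_pow, ← hϖ]; exact Ideal.mul_mem_right _ _ (Ideal.subset_span rfl)) pB hpB hJm f' hf' b hb𝔔 hb)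
    obtain ⟨S, _, pS, hpS, hSrel, hSlift, hSFS, hSn⟩ := blowS h hFS hflat π hπ F d c hd hdF
    simp only [← hϖ] at hSrel hSlift hSn
    have hcoef : ∀ i, ∃ (bb : ι → P) (q : P), c * hh i = ∑ l, bb l * F l + ϖ ^ 6 * q := by
      intro i
      obtain ⟨x, hx, y, hy, hxy⟩ := Submodule.mem_sup.1 (hcJ (hh i) ((hJm _).1 (hhJ i)))
      obtain ⟨a, ha⟩ := (Submodule.mem_span_range_iff_exists_fun P).1 hx
      obtain ⟨q, rfl⟩ := Ideal.mem_span_singleton'.1 hy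
      refine ⟨a, q, ?_⟩
      rw [← hxy, ← ha]; simp [mul_comm]
    choose bb q hbq using hcoef
    choose a ha using fun l => hcomb (F l) ((hJm _).2 (hF l))
    -- ζ
    obtain ⟨ζ, hζ⟩ : ∃ ζ : ι → D, ζ = fun l => ∑ i, pD (C (a l i)) * pD (X i) := ⟨_, rfl⟩
    have hζF : ∀ l, pD (C (F l)) = pD (C ϖ) ^ 5 * ζ l := by
      intro l; rw [hζ]; conv_lhs => rw [ha l]
      simp only [map_sum, map_mul, hrel, Finset.mul_sum]
      exact Finset.sum_congr rfl fun l _ => by ring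
    have hζτ : ∀ l, ∃ y, τ (ζ l) = ev ϖ * y := by
      intro l; rw [hζ]; refine ⟨∑ i, ev (a l i) * μ i, ?_⟩
      simp only [map_sum, map_mul, hτ', hτC, hτX, Finset.mul_sum]
      exact Finset.sum_congr rfl fun l _ => by ring
    obtain ⟨s, hs⟩ := hSlift D (eval₂Hom (pD.comp C) ζ) (fun l => by simp [hζF])
    have hsC : ∀ x, s (pS (C x)) = pD (C x) := fun x => by
      have := RingHom.congr_fun hs (C x); simpa using this
    have hsX : ∀ x, s (pS (X x)) = ζ x := fun x => by
      have := RingHom.congr_fun hs (X x); simpa using this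
    -- c z_i
    have hcz : ∀ i, pD (C c) * pD (X i) = s (∑ l, pS (C (bb i l)) * pS (X l) + pS (C (ϖ * q i))) := by
      intro i
      rw [← sub_eq_zero]
      choose ys hys using hζτ
      have e1 : ∑ l, pD (C (bb i l)) * (pD (C ϖ) ^ 5 * ζ l) = pD (C ϖ) ^ 5 * ∑ l, pD (C (bb i l)) * ζ l := by
        rw [Finset.mul_sum]; exact Finset.sum_congr rfl fun l _ => by ring
      have e2 : ∑ l, ev (bb i l) * (ev ϖ * ys l) = ev ϖ * ∑ l, ev (bb i l) * ys l := by
        rw [Finset.mul_sum]; exact Finset.sum_congr rfl fun l _ => by ring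
      have hz5 : pD (C ϖ) ^ 5 * (pD (C c) * pD (X i) - s (∑ l, pS (C (bb i l)) * pS (X l) + pS (C (ϖ * q i)))) = 0 := by
        simp only [map_add, map_sum, map_mul, hsC, hsX]
        have h1 : pD (C (c * hh i)) = pD (C (∑ l, bb i l * F l + ϖ ^ 6 * q i)) := by rw [hbq]
        simp only [map_add, map_sum, map_mul, map_pow, hrel, hζF] at h1
        rw [e1] at h1
        linear_combination h1
      refine htors _ 5 hz5 ?_
      have h2 := congrArg τ hz5
      simp only [map_add, map_sum, map_mul, hsC, hsX, map_sub, map_pow, hτ', hτC, hτX, hys, map_zero, e2] at h2 ⊢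
      have h3 := pow_tors (ev ϖ) hΛ 5 (ev c * μ i - (∑ l, ev (bb i l) * ys l + ev (q i))) (by linear_combination h2)
      linear_combination h3
    have hun : ∀ x : D, ∃ n : ℕ, ∃ y, s (pS (C c)) ^ n * x = s y := by
      intro y
      obtain ⟨e, rfl⟩ := hpD y
      induction e using MvPolynomial.induction_on with
      | C a => exact ⟨0, pS (C a), by simp [hsC]⟩
      | add a b ha hb =>
        obtain ⟨n, y, hy⟩ := ha
        obtain ⟨k, z, hz⟩ := hb
        refine ⟨n + k, pS (C c) ^ k * y + pS (C c) ^ n * z, ?_⟩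
        simp only [map_add, map_mul, map_pow] at *
        rw [← hy, ← hz]; ring
      | mul_X a l ha =>
        obtain ⟨n, y, hy⟩ := ha
        refine ⟨n + 1, y * (∑ k, pS (C (bb l k)) * pS (X k) + pS (C (ϖ * q l))), ?_⟩
        rw [map_mul, map_mul, ← hcz, ← hy, ← hsC]; ring
    -- localization
    obtain ⟨L, _, loc, hcu, hLz, hLfac⟩ : ∃ (L : Type u) (_ : CommRing L) (loc : S →+* L), IsUnit (loc (pS (C c))) ∧
        (∀ x, loc (pS (C ϖ)) * x = 0 → x = 0) ∧ ((∀ (T : Type u) [CommRing T] (g : S →+* T), IsUnit (g (pS (C c))) →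
          ∃ g' : L →+* T, g'.comp loc = g) ∧ ∀ x, loc x = 0 → ∃ n : ℕ, pS (C c) ^ n * x = 0) := by
      have hker : ∀ x, algebraMap S (Localization.Away (pS (C c))) x = 0 → ∃ n : ℕ, pS (C c) ^ n * x = 0 := by
        intro x hx
        obtain ⟨⟨_, n, rfl⟩, hn⟩ := (IsLocalization.map_eq_zero_iff (Submonoid.powers (pS (C c))) _ x).1 hx
        exact ⟨n, hn⟩
      refine ⟨Localization.Away (pS (C c)), inferInstance, algebraMap _ _, IsLocalization.Away.algebraMap_isUnit _, ?_, ?_, hker⟩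
      · intro x hx
        obtain ⟨⟨y, s⟩, hy⟩ := IsLocalization.surj (Submonoid.powers (pS (C c))) x
        have hsu := IsLocalization.map_units (Localization.Away (pS (C c))) s
        have h1 : algebraMap S (Localization.Away (pS (C c))) (pS (C ϖ) * y) = 0 := by
          rw [map_mul, ← hy, ← mul_assoc, hx, zero_mul]
        obtain ⟨n, hn⟩ := hker _ h1
        obtain ⟨k, hk⟩ := hSn (pS (C c) ^ n * y) (by rw [← hn]; ring)
        have hy0 : algebraMap S (Localization.Away (pS (C c))) y = 0 := by
          have h2 := congrArg (algebraMap S (Localization.Away (pS (C c)))) hk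
          rw [← mul_assoc, ← pow_add, map_mul, map_pow, map_zero] at h2
          exact (((IsLocalization.Away.algebraMap_isUnit (pS (C c))).pow _).mul_right_eq_zero).1 h2
        rw [hy0] at hy
        exact (hsu.mul_left_eq_zero).1 hy
      · intro T _ g hg
        exact ⟨IsLocalization.Away.lift (pS (C c)) hg, IsLocalization.Away.lift_comp _ _⟩
    obtain ⟨u, hu⟩ := hcu.exists_right_inv
    obtain ⟨r, hr⟩ := hDlift L (eval₂Hom (loc.comp (pS.comp C)) (fun i => u * loc (∑ l, pS (C (bb i l)) * pS (X l) + pS (C (ϖ * q i)))))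
      (fun i => by
        simp only [coe_eval₂Hom, eval₂_C, eval₂_X, RingHom.comp_apply]
        have h1 : loc (pS (C (c * hh i))) = loc (pS (C (∑ l, bb i l * F l + ϖ ^ 6 * q i))) := by rw [hbq]
        simp only [map_add, map_sum, map_mul, map_pow, hSrel] at h1 ⊢
        have e1 : ∑ l, loc (pS (C (bb i l))) * (loc (pS (C ϖ)) ^ 5 * loc (pS (X l))) = loc (pS (C ϖ)) ^ 5 * ∑ l, loc (pS (C (bb i l))) * loc (pS (X l)) := by
          rw [Finset.mul_sum]; exact Finset.sum_congr rfl fun l _ => by ring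
        rw [e1] at h1
        linear_combination u * h1 - loc (pS (C (hh i))) * hu) (fun x hx => hLz x (by simpa using hx))
    have hrC : ∀ x, r (pD (C x)) = loc (pS (C x)) := fun x => by
      have := RingHom.congr_fun hr (C x); simpa using this
    have hrs : r.comp s = loc := by
      have : (r.comp s).comp pS = loc.comp pS := by
        ext x
        · simp [hsC, hrC]
        · simp only [RingHom.comp_apply, hsX]
          have h5 : loc (pS (C ϖ)) ^ 5 * (r (ζ x) - loc (pS (X x))) = 0 := by
            have h6 := congrArg r (hζF x)
            have h7 := congrArg loc (hSrel x)
            simp only [map_mul, map_pow, hrC] at h6 h7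
            linear_combination h7 - h6
          rw [← sub_eq_zero]
          refine hLz _ (hLz _ (hLz _ (hLz _ (hLz _ ?_))))
          rw [← h5]; ring
      ext x; obtain ⟨x, rfl⟩ := hpS x; exact RingHom.congr_fun this x
    refine ⟨s (pS (C c)), ?_, ?_, ?_⟩
    · rw [hsC, hτ', hτC]; exact hc
    · have := FS.transfer hSFS s ?_ hun
      · have he : s.comp ((pS.comp C).comp h) = (pD.comp C).comp h := by
          ext x; simp [hsC]
        rwa [he] at this
      · intro T _ g hg
        obtain ⟨g', hg'⟩ := hLfac.1 T g hg
        exact ⟨g'.comp r, by rw [RingHom.comp_assoc, hrs, hg']⟩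
    · intro x hx
      obtain ⟨n, y, hy⟩ := hun x
      have h1 : loc (pS (C ϖ)) * loc y = 0 := by
        rw [← hrs, RingHom.comp_apply, RingHom.comp_apply, ← map_mul, hsC, ← hy]
        have : pD (C ϖ) * (s (pS (C c)) ^ n * x) = 0 := by
          rw [mul_left_comm]; rw [RingHom.comp_apply] at hx; rw [hx, mul_zero]
        rw [this, map_zero]
      obtain ⟨k, hk⟩ := hLfac.2 y (hLz _ h1)
      refine ⟨k + n, ?_⟩
      rw [pow_add, mul_assoc, hy, ← map_pow, ← map_mul, hk, map_zero]

/-- smooth over `R` at a prime of `Λ`. -/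
def SmAt {R A Λ : Type u} [CommRing R] [CommRing A] [CommRing Λ] (i : R →+* A) (ψ : A →+* Λ) (𝔔 : Ideal Λ) : Prop :=
  ∃ b, FS i b ∧ ψ b ∉ 𝔔

theorem linEq  {n : ℕ} (a : Fin n → A) (c : A) :
    ∃ (B : Type u) (_ : CommRing B) (j : A →+* B) (y : Fin n → B), j.FiniteType ∧ j c = ∑ l, j (a l) * y l ∧
      (∀ k, FS j (j (a k))) ∧ ∀ (T : Type u) [CommRing T] (ψ : A →+* T) (v : Fin n → T), ψ c = ∑ l, ψ (a l) * v l →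
        ∃ ψ' : B →+* T, ψ'.comp j = ψ ∧ ∀ l, ψ' (y l) = v l := by
  classical
  obtain ⟨B, _, p, hp, hpk⟩ := exists_quot (Ideal.span {(C c - ∑ l, C (a l) * X l : MvPolynomial (Fin n) A)})
  have hrel : p (C c) = ∑ l, p (C (a l)) * p (X l) := by
    rw [← sub_eq_zero]; simp only [← map_mul, ← map_sum, ← map_sub]; rw [hpk]; exact Ideal.subset_span rfl
  have hlift : ∀ (T : Type u) [CommRing T] (ψ : A →+* T) (v : Fin n → T), ψ c = ∑ l, ψ (a l) * v l →
        ∃ ψ' : B →+* T, ψ'.comp (p.comp C) = ψ ∧ ∀ l, ψ' (p (X l)) = v l := by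
    intro T _ ψ v hv
    obtain ⟨g, hg⟩ := exists_factor p hp (eval₂Hom ψ v) (fun x hx => by
      have : Ideal.span {(C c - ∑ l, C (a l) * X l : MvPolynomial (Fin n) A)} ≤ RingHom.ker (eval₂Hom ψ v) := by
        rw [Ideal.span_le]; rintro _ rfl; simp [RingHom.mem_ker, hv]
      exact this ((hpk x).1 hx))
    refine ⟨g, ?_, ?_⟩
    · rw [← RingHom.comp_assoc, hg]; ext x; simp
    · intro l; have := RingHom.congr_fun hg (X l); simpa using this
  refine ⟨B, inferInstance, p.comp C, fun l => p (X l), finiteType_of_presentation _ p hp rfl, hrel, ?_, hlift⟩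
  intro k T T' _ _ q hq hs φ g hg hu
  have hg' : ∀ x, g (p (C x)) = q (φ x) := fun x => RingHom.congr_fun hg x
  choose z hz using fun l => hq (g (p (X l)))
  have hu' : IsUnit (φ (a k)) := isUnit_of_sq_zero q hq hs (by rw [← hg']; exact hu)
  obtain ⟨u, huu⟩ := hu'.exists_right_inv
  obtain ⟨e, he⟩ : ∃ e, e = φ c - ∑ l, φ (a l) * z l := ⟨_, rfl⟩
  have hqe : q e = 0 := by
    rw [he, map_sub, map_sum]; simp only [map_mul, hz, ← hg']; rw [hrel, map_sum]; simp
  obtain ⟨g', h1, h2⟩ := hlift T φ (fun l => z l + if l = k then u * e else 0) (by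
    simp only [mul_add, Finset.sum_add_distrib, mul_ite, mul_zero, Finset.sum_ite_eq', Finset.mem_univ, if_true]
    linear_combination e * huu.symm + he.symm)
  refine ⟨g', ?_, h1⟩
  have : (q.comp g').comp p = g.comp p := by
    ext x
    · simp only [RingHom.comp_apply, hg']
      exact congrArg q (RingHom.congr_fun h1 x)
    · simp only [RingHom.comp_apply, h2, map_add, hz]
      split_ifs <;> simp [hqe]
  ext s; obtain ⟨x, rfl⟩ := hp s; exact RingHom.congr_fun this x

theorem FS.comp_base  {i : R →+* A} {j : A →+* B} {b : A}
    (h : FS i b) (h' : FS j (j b)) : FS (j.comp i) (j b) := by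
  have := FS.comp h h'
  exact FS.of_pow (n := 2) (by rwa [sq])

theorem mem_smIdeal [IsNoetherianRing R] (i : R →+* A) (hi : i.FiniteType) (b : A) :
    b ∈ smIdeal i hi ↔ FS i b := Iff.rfl

theorem noeth_of_ft [IsNoetherianRing R] (i : R →+* A) (hi : i.FiniteType) :
    IsNoetherianRing A := by
  obtain ⟨n, p, hp, _⟩ := exists_presentation i hi
  exact isNoetherianRing_of_surjective _ _ p hp

/-- generators of the smooth locus ideal -/
theorem sm_gens [IsNoetherianRing R] (i : R →+* A) (hi : i.FiniteType) :
    ∃ (n : ℕ) (a : Fin n → A), (∀ k, FS i (a k)) ∧ ∀ b, FS i b → ∃ c : Fin n → A, b = ∑ k, a k * c k := by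
  haveI := noeth_of_ft i hi
  obtain ⟨n, a, ha⟩ := Submodule.fg_iff_exists_fin_generating_family.1 (IsNoetherian.noetherian (smIdeal i hi))
  refine ⟨n, a, fun k => ?_, fun b hb => ?_⟩
  · rw [← mem_smIdeal i hi, ← ha]; exact Submodule.subset_span ⟨k, rfl⟩
  · have : b ∈ Submodule.span A (Set.range a) := by rw [ha]; exact hb
    obtain ⟨c, hc⟩ := (Submodule.mem_span_range_iff_exists_fun A).1 this
    exact ⟨c, by rw [← hc]; simp [mul_comm]⟩

/-- (6) make `π` smooth -/
theorem A1 [IsNoetherianRing Q] (i : Q →+* A) (hi : i.FiniteType)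
    (ψ : A →+* Λ) (π : Q) (hπ : ∃ N : ℕ, ψ (i π) ^ N ∈ Ideal.span (ψ '' {b | FS i b})) :
    ∃ (B : Type u) (_ : CommRing B) (j : A →+* B) (ψ' : B →+* Λ), j.FiniteType ∧ ψ'.comp j = ψ ∧
      FS (j.comp i) (j (i π)) ∧ ∀ (𝔔 : Ideal Λ) [𝔔.IsPrime], SmAt i ψ 𝔔 → SmAt (j.comp i) ψ' 𝔔 := by
  obtain ⟨N, hN⟩ := hπ
  obtain ⟨n, a, ha, hgen⟩ := sm_gens i hi
  have hle : Ideal.span (ψ '' {b | FS i b}) ≤ Ideal.span (Set.range fun k => ψ (a k)) := by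
    rw [Ideal.span_le]; rintro _ ⟨b, hb, rfl⟩
    obtain ⟨c, rfl⟩ := hgen b hb
    rw [map_sum]; refine Ideal.sum_mem _ fun k _ => ?_
    rw [map_mul]; exact Ideal.mul_mem_right _ _ (Ideal.subset_span ⟨k, rfl⟩)
  obtain ⟨v, hv⟩ := (Submodule.mem_span_range_iff_exists_fun Λ).1 (hle hN)
  obtain ⟨B, _, j, y, hj, hjc, hjF, hjl⟩ := linEq a (i π ^ N)
  obtain ⟨ψ', h1, h2⟩ := hjl Λ ψ v (by rw [map_pow, ← hv]; simp [mul_comm])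
  have hB : ∀ k, FS (j.comp i) (j (a k)) := fun k => FS.comp_base (ha k) (hjF k)
  refine ⟨B, inferInstance, j, ψ', hj, h1, ?_, ?_⟩
  · have hft : (j.comp i).FiniteType := hj.comp hi
    have : j (i π ^ N) ∈ smIdeal (j.comp i) hft := by
      rw [hjc]; refine Ideal.sum_mem _ fun k _ => Ideal.mul_mem_right _ _ (hB k)
    rw [mem_smIdeal, map_pow] at this
    exact this.of_pow
  · rintro 𝔔 _ ⟨b, hb, hb𝔔⟩
    obtain ⟨c, rfl⟩ := hgen b hb
    have : ∃ k, ψ (a k) ∉ 𝔔 := by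
      by_contra hcon; push Not at hcon
      apply hb𝔔; rw [map_sum]; refine Ideal.sum_mem _ fun k _ => ?_
      rw [map_mul]; exact Ideal.mul_mem_right _ _ (hcon k)
    obtain ⟨k, hk⟩ := this
    refine ⟨j (a k), hB k, ?_⟩
    rw [← RingHom.comp_apply, h1]; exact hk

/-- (0) -/
theorem step0 [IsNoetherianRing Q] (i : Q →+* A) (hi : i.FiniteType)
    (ψ : A →+* Λ) (h : ∀ (𝔔 : Ideal Λ) [𝔔.IsPrime], SmAt i ψ 𝔔) :
    ∃ (B : Type u) (_ : CommRing B) (j : A →+* B) (ψ' : B →+* Λ), j.FiniteType ∧ ψ'.comp j = ψ ∧ FS (j.comp i) 1 := by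
  have : Ideal.span (ψ '' {b | FS i b}) = ⊤ := by
    by_contra hne
    obtain ⟨M, hM, hle⟩ := Ideal.exists_le_maximal _ hne
    haveI := hM.isPrime
    obtain ⟨b, hb, hbM⟩ := h M
    exact hbM (hle (Ideal.subset_span ⟨b, hb, rfl⟩))
  obtain ⟨B, _, j, ψ', h1, h2, h3, _⟩ := A1 i hi ψ 1 ⟨0, by rw [this]; trivial⟩
  exact ⟨B, inferInstance, j, ψ', h1, h2, by simpa using h3⟩

/-- `loc : Λ → L` is a localization at `M`. -/
structure IsLoc {Λ L : Type u} [CommRing Λ] [CommRing L] (loc : Λ →+* L) (M : Submonoid Λ) : Prop where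
  unit : ∀ x, x ∈ M → IsUnit (loc x)
  surj : ∀ y, ∃ v z, v ∈ M ∧ loc v * y = loc z
  ker : ∀ x, loc x = 0 → ∃ w, w ∈ M ∧ w * x = 0

theorem IsLoc.of_isLocalization  [Algebra Λ L] (M : Submonoid Λ) [IsLocalization M L] :
    IsLoc (algebraMap Λ L) M := by
  refine ⟨fun x hx => IsLocalization.map_units L ⟨x, hx⟩, fun y => ?_, fun x hx => ?_⟩
  · obtain ⟨⟨z, v⟩, hz⟩ := IsLocalization.surj M y
    exact ⟨v, z, v.2, by rw [← hz, mul_comm]⟩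
  · obtain ⟨w, hw⟩ := (IsLocalization.map_eq_zero_iff M L x).1 hx
    exact ⟨w, w.2, hw⟩

/-- (7) spreading out. -/
theorem spread [IsNoetherianRing A]
    (ψ : A →+* Λ) (q : Submonoid Λ) (loc : Λ →+* L) (hloc : IsLoc loc q)
    (j : A →+* B) (hj : j.FiniteType) (θ : B →+* L) (hθ : θ.comp j = loc.comp ψ) :
    ∃ (D : Type u) (_ : CommRing D) (κ : A →+* D) (ψ' : D →+* Λ), κ.FiniteType ∧ ψ'.comp κ = ψ ∧
      (∀ (R : Type u) [CommRing R] (i : R →+* A), FS (j.comp i) 1 → ∃ b, FS (κ.comp i) b ∧ ψ' b ∈ q) ∧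
      ∀ a, j a = 0 → FS κ (κ a) := by
  classical
  obtain ⟨n, pB, hpB, hpj⟩ := exists_presentation j hj
  have hpC : ∀ a, pB (C a) = j a := fun a => RingHom.congr_fun hpj a
  have hθ' : ∀ a, θ (j a) = loc (ψ a) := fun a => RingHom.congr_fun hθ a
  -- common denominators
  obtain ⟨v, z, hv, hz⟩ : ∃ (v : Λ) (z : Fin n → Λ), v ∈ q ∧ ∀ i, loc v * θ (pB (X i)) = loc (z i) := by
    choose vv zz hvv hzz using fun i => hloc.surj (θ (pB (X i)))
    refine ⟨∏ i, vv i, fun i => (∏ k ∈ Finset.univ.erase i, vv k) * zz i, ?_, ?_⟩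
    · exact prod_mem fun i _ => hvv i
    · intro i
      rw [← Finset.mul_prod_erase _ _ (Finset.mem_univ i), map_mul, map_mul, ← hzz]; ring
  obtain ⟨κ1, hκ1⟩ : ∃ κ1 : MvPolynomial (Option (Fin n)) A →+* Polynomial B,
    κ1 = eval₂Hom (Polynomial.C.comp j) (fun o => o.elim Polynomial.X (fun i => Polynomial.X * Polynomial.C (pB (X i)))) := ⟨_, rfl⟩
  have hκC : ∀ a, κ1 (C a) = Polynomial.C (j a) := fun a => by rw [hκ1]; simp
  have hκV : κ1 (X none) = Polynomial.X := by rw [hκ1]; simp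
  have hκZ : ∀ i, κ1 (X (some i)) = Polynomial.X * Polynomial.C (pB (X i)) := fun i => by rw [hκ1]; simp
  obtain ⟨m, k, hk⟩ := Submodule.fg_iff_exists_fin_generating_family.1 (IsNoetherian.noetherian (RingHom.ker κ1))
  have hkk : ∀ l, κ1 (k l) = 0 := fun l => by
    have : k l ∈ RingHom.ker κ1 := by rw [← hk]; exact Submodule.subset_span ⟨l, rfl⟩
    exact this
  have hkg : ∀ x, κ1 x = 0 → ∃ a : Fin m → MvPolynomial (Option (Fin n)) A, x = ∑ l, a l * k l := by
    intro x hx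
    have : x ∈ Submodule.span (MvPolynomial (Option (Fin n)) A) (Set.range k) := by rw [hk]; exact hx
    obtain ⟨a, ha⟩ := (Submodule.mem_span_range_iff_exists_fun (MvPolynomial (Option (Fin n)) A)).1 this
    exact ⟨a, by rw [← ha]; simp⟩
  -- homogenization
  have hhom : ∀ f : MvPolynomial (Fin n) A, ∃ (N : ℕ) (F : MvPolynomial (Option (Fin n)) A),
      κ1 F = Polynomial.C (pB f) * Polynomial.X ^ N ∧ ∀ (T : Type u) [CommRing T] (g : MvPolynomial (Option (Fin n)) A →+* T) (u : T),
        g (X none) * u = 1 → g F = g (X none) ^ N * eval₂ (g.comp C) (fun i => g (X (some i)) * u) f := by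
    intro f
    induction f using MvPolynomial.induction_on with
    | C a => exact ⟨0, C a, by simp [hκC, hpC], fun T _ g u hu => by simp⟩
    | add a b ha hb =>
      obtain ⟨N, F, h1, h2⟩ := ha
      obtain ⟨M, G, h3, h4⟩ := hb
      refine ⟨N + M, X none ^ M * F + X none ^ N * G, ?_, fun T _ g u hu => ?_⟩
      · simp only [map_add, map_mul, map_pow, hκV, h1, h3]; ring
      · simp only [map_add, map_mul, map_pow, h2 T g u hu, h4 T g u hu, eval₂_add]; ring
    | mul_X a i ha =>
      obtain ⟨N, F, h1, h2⟩ := ha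
      refine ⟨N + 1, F * X (some i), ?_, fun T _ g u hu => ?_⟩
      · simp only [map_mul, hκZ, h1]; ring
      · simp only [map_mul, h2 T g u hu, eval₂_mul, eval₂_X]
        linear_combination (- g (X none) ^ N * eval₂ (g.comp C) (fun i => g (X (some i)) * u) a * g (X (some i))) * hu
  -- evaluation in Λ
  obtain ⟨ev, hev⟩ : ∃ ev : MvPolynomial (Option (Fin n)) A →+* Λ, ev = eval₂Hom ψ (fun o => o.elim v z) := ⟨_, rfl⟩
  have hevk : ∀ x, κ1 x = 0 → loc (ev x) = 0 := by
    have : loc.comp ev = (Polynomial.eval₂RingHom θ (loc v)).comp κ1 := by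
      rw [hev, hκ1]; ext o
      · simp [hθ']
      · cases o
        · simp
        · simp [← hz]; try ring
    intro x hx
    have := RingHom.congr_fun this x
    rw [RingHom.comp_apply, RingHom.comp_apply, hx, map_zero] at this; exact this
  choose ww hww hwk using fun l => hloc.ker _ (hevk (k l) (hkk l))
  obtain ⟨w, hw⟩ : ∃ w, w = ∏ l, ww l := ⟨_, rfl⟩
  have hwq : w ∈ q := by
    rw [hw]; exact prod_mem fun i _ => hww i
  have hwk' : ∀ l, w * ev (k l) = 0 := fun l => by
    rw [hw, ← Finset.mul_prod_erase _ _ (Finset.mem_univ l), mul_right_comm, hwk, zero_mul]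
  obtain ⟨D, _, pD, hpD, hpDk⟩ := exists_quot (Ideal.span (Set.range fun l => (X () * C (k l) : MvPolynomial Unit (MvPolynomial (Option (Fin n)) A))))
  have hrel : ∀ l, pD (X ()) * pD (C (k l)) = 0 := by
    intro l; rw [← map_mul, hpDk]; exact Ideal.subset_span ⟨l, rfl⟩
  have hrel' : ∀ x, κ1 x = 0 → pD (X ()) * pD (C x) = 0 := by
    intro x hx
    obtain ⟨a, rfl⟩ := hkg x hx
    simp only [map_sum, map_mul, Finset.mul_sum]
    refine Finset.sum_eq_zero fun l _ => ?_
    rw [mul_left_comm, hrel, mul_zero]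
  have hlift : ∀ (T : Type u) [CommRing T] (g : MvPolynomial (Option (Fin n)) A →+* T) (t : T), (∀ l, t * g (k l) = 0) →
      ∃ g' : D →+* T, g'.comp (pD.comp C) = g ∧ g' (pD (X ())) = t := by
    intro T _ g t ht
    obtain ⟨g', hg'⟩ := exists_factor pD hpD (eval₂Hom g (fun _ => t)) (fun x hx => by
      have : Ideal.span (Set.range fun l => (X () * C (k l) : MvPolynomial Unit (MvPolynomial (Option (Fin n)) A))) ≤ RingHom.ker (eval₂Hom g (fun _ => t)) := by
        rw [Ideal.span_le]; rintro _ ⟨l, rfl⟩; simp [RingHom.mem_ker, ht]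
      exact this ((hpDk x).1 hx))
    refine ⟨g', ?_, ?_⟩
    · rw [← RingHom.comp_assoc, hg']; ext x <;> simp
    · have := RingHom.congr_fun hg' (X ()); simpa using this
  obtain ⟨ψ', hψ1, hψ2⟩ := hlift Λ ev w hwk'
  have hft1 : (C : A →+* MvPolynomial (Option (Fin n)) A).FiniteType :=
    finiteType_of_presentation _ (RingHom.id _) Function.surjective_id rfl
  refine ⟨D, inferInstance, (pD.comp C).comp C, ψ', (finiteType_of_presentation (pD.comp C) pD hpD rfl).comp hft1, ?_, ?_, ?_⟩
  · rw [← RingHom.comp_assoc, hψ1, hev]; ext a; simp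
  · intro R _ i hFS
    refine ⟨pD (C (X none)) * pD (X ()), ?_, ?_⟩
    · intro T T' _ _ Q hQ hs φ g hg hgu
      rw [map_mul] at hgu
      have hgV := isUnit_of_mul_isUnit_left hgu
      have hgW := isUnit_of_mul_isUnit_right hgu
      obtain ⟨uV, huV⟩ := hgV.exists_right_inv
      obtain ⟨gB, hgB⟩ := exists_factor pB hpB (eval₂Hom (g.comp ((pD.comp C).comp C)) (fun i => g (pD (C (X (some i)))) * uV)) (fun f hf => by
        obtain ⟨N, F, h1, h2⟩ := hhom f
        have h3 := h2 T' (g.comp (pD.comp C)) uV huV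
        rw [hf, Polynomial.C_0, zero_mul] at h1
        have h4 : g (pD (X ())) * g (pD (C F)) = 0 := by rw [← map_mul, hrel' F h1, map_zero]
        have h5 := (hgW.mul_right_eq_zero).1 h4
        simp only [RingHom.comp_apply] at h3
        rw [h5] at h3
        exact ((hgV.pow N).mul_right_eq_zero).1 h3.symm)
      have hgBC : ∀ a, gB (j a) = g (pD (C (C a))) := fun a => by
        have := RingHom.congr_fun hgB (C a); simpa [hpC] using this
      have hgBX : ∀ i, gB (pB (X i)) = g (pD (C (X (some i)))) * uV := fun i => by
        have := RingHom.congr_fun hgB (X i); simpa using this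
      obtain ⟨G, hG1, hG2⟩ := hFS T T' Q hQ hs φ gB (by
        ext r; simp only [RingHom.comp_apply, hgBC]
        exact RingHom.congr_fun hg r) (by simp)
      have hG1' : ∀ x, Q (G x) = gB x := fun x => RingHom.congr_fun hG1 x
      obtain ⟨vh, hvh⟩ := hQ (g (pD (C (X none))))
      obtain ⟨wh, hwh⟩ := hQ (g (pD (X ())))
      obtain ⟨g', hg'1, hg'2⟩ := hlift T ((Polynomial.eval₂RingHom G vh).comp κ1) wh (fun l => by
        rw [RingHom.comp_apply, hkk, map_zero, mul_zero])
      refine ⟨g', ?_, ?_⟩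
      · have : (Q.comp g').comp pD = g.comp pD := by
          have e1 : ∀ x, g' (pD (C x)) = Polynomial.eval₂RingHom G vh (κ1 x) := fun x => RingHom.congr_fun hg'1 x
          ext x
          · simp [e1, hκC, hG1', hgBC]
          · cases x with
            | none => simp [e1, hκV, hvh]
            | some i =>
              simp only [RingHom.comp_apply, e1, hκZ]
              simp [hG1', hgBX, hvh]
              linear_combination (g (pD (C (X (some i))))) * huV
          · simp [hg'2, hwh]
        ext s; obtain ⟨x, rfl⟩ := hpD s; exact RingHom.congr_fun this x
      · ext r
        have e1 : ∀ x, g' (pD (C x)) = Polynomial.eval₂RingHom G vh (κ1 x) := fun x => RingHom.congr_fun hg'1 x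
        simp only [RingHom.comp_apply, e1, hκC]
        simpa using RingHom.congr_fun hG2 r
    · rw [map_mul, hψ2]
      have : ψ' (pD (C (X none))) = v := by
        have := RingHom.congr_fun hψ1 (X none); simpa [hev] using this
      rw [this]
      exact mul_mem hv hwq
  · intro a ha T T' _ _ Q hQ hs φ g hg hgu
    have hW : g (pD (X ())) = 0 := by
      have := hrel' (C a) (by rw [hκC, ha, Polynomial.C_0])
      have := congrArg g this
      rw [map_mul, map_zero] at this
      exact (hgu.mul_left_eq_zero).1 this
    choose zh hzh using fun o => hQ (g (pD (C (X o))))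
    obtain ⟨g', hg'1, hg'2⟩ := hlift T (eval₂Hom φ zh) 0 (fun l => by simp)
    have e1 : ∀ x, g' (pD (C x)) = eval₂Hom φ zh x := fun x => RingHom.congr_fun hg'1 x
    refine ⟨g', ?_, ?_⟩
    · have : (Q.comp g').comp pD = g.comp pD := by
        ext x
        · simp [e1]; exact (RingHom.congr_fun hg x).symm
        · simp [e1, hzh]
        · simp [hg'2, hW]
      ext s; obtain ⟨x, rfl⟩ := hpD s; exact RingHom.congr_fun this x
    · ext r; simp [e1]

/-- the property needed at the bottom of the recursion. -/
def BaseP {R Q L : Type u} [CommRing R] [CommRing Q] [CommRing L] (f : R →+* Q) (lam : Q →+* L) : Prop :=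
  ∀ (A : Type u) [CommRing A] (i : Q →+* A) (ψ : A →+* L), i.FiniteType → ψ.comp i = lam →
    ∃ (B : Type u) (_ : CommRing B) (j : A →+* B) (θ : B →+* L), j.FiniteType ∧ θ.comp j = ψ ∧
      FS ((j.comp i).comp f) 1

def ResC {R Q A Λ : Type u} [CommRing R] [CommRing Q] [CommRing A] [CommRing Λ] (f : R →+* Q) (i : Q →+* A)
    (ψ : A →+* Λ) (q : Ideal Λ) : Prop :=
  ∃ (D : Type u) (_ : CommRing D) (κ : A →+* D) (ψD : D →+* Λ), κ.FiniteType ∧ ψD.comp κ = ψ ∧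
    ∀ (𝔔 : Ideal Λ) [𝔔.IsPrime], (SmAt i ψ 𝔔 ∨ 𝔔 = q) → SmAt ((κ.comp i).comp f) ψD 𝔔

theorem res_nil 
    [IsNoetherianRing Q] (f : R →+* Q) (hf : FS f 1) (i : Q →+* A) (hi : i.FiniteType) (ψ : A →+* Λ)
    (q : Ideal Λ) [q.IsPrime] (loc : Λ →+* L) (hloc : IsLoc loc q.primeCompl)
    (hq : ∀ x ∈ q, IsNilpotent (loc x)) (hB : BaseP f ((loc.comp ψ).comp i)) : ResC f i ψ q := by
  classical
  have hA : IsNoetherianRing A := noeth_of_ft i hi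
  have hcomp : ∀ {D : Type u} [CommRing D] (s : Q →+* D) (b : D), FS s b → FS (s.comp f) b := fun s b h => by
    have := FS.comp hf h; rwa [map_one, one_mul] at this
  by_cases hsm : SmAt i ψ q
  · refine ⟨A, inferInstance, RingHom.id A, ψ, RingHom.FiniteType.id A, RingHom.comp_id _, ?_⟩
    intro 𝔔 _ h
    have : SmAt i ψ 𝔔 := by
      rcases h with h | rfl
      · exact h
      · exact hsm
    obtain ⟨b, hb, hb'⟩ := this
    exact ⟨b, hcomp _ _ (by rwa [RingHom.id_comp]), hb'⟩
  obtain ⟨n, a, ha, hag⟩ := sm_gens i hi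
  have haq : ∀ k, IsNilpotent (loc (ψ (a k))) := fun k => hq _ (by
    by_contra hh; exact hsm ⟨a k, ha k, hh⟩)
  choose e he using haq
  obtain ⟨A', _, p, hp, hpk⟩ := exists_quot (Ideal.span (Set.range fun k => a k ^ e k))
  obtain ⟨ψ', hψ'⟩ := exists_factor p hp (loc.comp ψ) (fun x hx => by
    have : Ideal.span (Set.range fun k => a k ^ e k) ≤ RingHom.ker (loc.comp ψ) := by
      rw [Ideal.span_le]; rintro _ ⟨l, rfl⟩; simp [RingHom.mem_ker, he]
    exact this ((hpk x).1 hx))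
  obtain ⟨B, _, j, θ, hj, hθ, hFS⟩ := hB A' (p.comp i) ψ' ((RingHom.FiniteType.of_surjective p hp).comp hi)
    (by rw [← RingHom.comp_assoc, hψ'])
  obtain ⟨D, _, κ, ψD, hκ, hψD, h1, h2⟩ := spread ψ q.primeCompl loc hloc (j.comp p)
    (hj.comp (RingHom.FiniteType.of_surjective p hp)) θ (by rw [← RingHom.comp_assoc, hθ, hψ'])
  refine ⟨D, inferInstance, κ, ψD, hκ, hψD, ?_⟩
  intro 𝔔 _ h
  rcases h with ⟨b, hb, hb'⟩ | rfl
  · obtain ⟨c, hc⟩ := hag b hb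
    obtain ⟨k, hk⟩ : ∃ k, ψ (a k) ∉ 𝔔 := by
      by_contra hh; push Not at hh
      apply hb'; rw [hc, map_sum]
      exact sum_mem fun k _ => by rw [map_mul]; exact Ideal.mul_mem_right _ _ (hh k)
    have h3 := h2 (a k ^ e k) (by
      rw [RingHom.comp_apply, (hpk _).2 (Ideal.subset_span ⟨k, rfl⟩), map_zero])
    rw [map_pow] at h3
    refine ⟨κ (a k), hcomp _ _ (FS.comp_base (ha k) h3.of_pow), ?_⟩
    rw [← RingHom.comp_apply, hψD]; exact hk
  · obtain ⟨b, hb, hb'⟩ := h1 R (i.comp f) hFS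
    exact ⟨b, hb, hb'⟩

/-- `p : R[T] → R'` is the truncation `R[T]/T^N`. -/
structure Trunc {R R' : Type u} [CommRing R] [CommRing R'] (N : ℕ) (p : Polynomial R →+* R') : Prop where
  surj : Function.Surjective p
  ker : ∀ x, p x = 0 ↔ Polynomial.X ^ N ∣ x

/-- Inductive hypothesis for the resolution recursion. -/
inductive BH : {R Q L : Type u} → [CommRing R] → [CommRing Q] → [CommRing L] → (R →+* Q) → (Q →+* L) → List L → Prop
  | nil {R Q L : Type u} [CommRing R] [CommRing Q] [CommRing L] (f : R →+* Q) (lam : Q →+* L)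
      (hL : ∀ x : L, IsUnit x ∨ IsNilpotent x) (hB : BaseP f lam) : BH f lam []
  | cons {R Q L : Type u} [CommRing R] [CommRing Q] [CommRing L] (f : R →+* Q) (lam : Q →+* L) (t : L) (l : List L)
      (h : ∀ (N : ℕ) (hN : 0 < N) (R' Q' L' : Type u) [CommRing R'] [CommRing Q'] [CommRing L'] (pR : Polynomial R →+* R')
        (pQ : Polynomial Q →+* Q') (pL : L →+* L') (f' : R' →+* Q') (lam' : Q' →+* L'), Trunc N pR → Trunc N pQ →
        Function.Surjective pL → (∀ x, pL x = 0 ↔ t ^ N ∣ x) → f'.comp pR = pQ.comp (Polynomial.mapRingHom f) →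
        lam'.comp pQ = pL.comp (Polynomial.eval₂RingHom lam t) → BH f' lam' (l.map pL)) : BH f lam (t :: l)

/-- push-out squares -/
structure PO {Q A Q' A' : Type u} [CommRing Q] [CommRing A] [CommRing Q'] [CommRing A'] (i : Q →+* A) (g : Q →+* Q')
    (j : A →+* A') (i' : Q' →+* A') : Prop where
  comm : j.comp i = i'.comp g
  univ : ∀ (T : Type u) [CommRing T] (α : A →+* T) (β : Q' →+* T), α.comp i = β.comp g → ∃ γ : A' →+* T, γ.comp j = α ∧ γ.comp i' = β
  epi : ∀ (T : Type u) [CommRing T] (γ γ' : A' →+* T), γ.comp j = γ'.comp j → γ.comp i' = γ'.comp i' → γ = γ'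

theorem PO.fs  {i : Q →+* A} {g : Q →+* Q'}
    {j : A →+* A'} {i' : Q' →+* A'} (h : PO i g j i') {b : A} (hb : FS i b) : FS i' (j b) := by
  intro T T' _ _ p hp hs φ γ hγ hu
  obtain ⟨α, h1, h2⟩ := hb T T' p hp hs (φ.comp g) (γ.comp j) (by
    rw [RingHom.comp_assoc, h.comm, ← RingHom.comp_assoc, hγ, RingHom.comp_assoc]) hu
  obtain ⟨γ', h3, h4⟩ := h.univ T α φ h2
  refine ⟨γ', h.epi T' _ _ ?_ ?_, h4⟩
  · rw [RingHom.comp_assoc, h3, h1]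
  · rw [RingHom.comp_assoc, h4, hγ]

theorem PO.flat  {i : Q →+* A} {g : Q →+* Q'}
    {j : A →+* A'} {i' : Q' →+* A'} (h : PO i g j i') (hi : i.Flat) : i'.Flat := by
  letI := i.toAlgebra
  letI := g.toAlgebra
  letI : Algebra Q A' := (i'.comp g).toAlgebra
  have hfl : Module.Flat Q A := hi
  have e0 : i = algebraMap Q A := rfl
  have e1 : g = algebraMap Q Q' := rfl
  let j' : A →ₐ[Q] A' := { j with commutes' := fun r => RingHom.congr_fun h.comm r }
  let i'' : Q' →ₐ[Q] A' := { i' with commutes' := fun r => rfl }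
  let e : TensorProduct Q Q' A →ₐ[Q] A' := Algebra.TensorProduct.lift i'' j' (fun _ _ => Commute.all _ _)
  obtain ⟨γ, h1, h2⟩ := h.univ (TensorProduct Q Q' A) (Algebra.TensorProduct.includeRight : A →ₐ[Q] TensorProduct Q Q' A).toRingHom
    (algebraMap Q' (TensorProduct Q Q' A)) (by
      ext r
      have := (Algebra.TensorProduct.includeRight : A →ₐ[Q] TensorProduct Q Q' A).commutes r
      simp only [RingHom.comp_apply]
      exact this.trans (Algebra.TensorProduct.algebraMap_apply r))
  have h3 : (e : TensorProduct Q Q' A →+* A').comp γ = RingHom.id A' := by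
    apply h.epi
    · rw [RingHom.comp_assoc, h1]; ext a; simp [e, j']
    · rw [RingHom.comp_assoc, h2]; ext a; simp [e, i'', Algebra.TensorProduct.algebraMap_apply]
  have h4 : ∀ x, γ (e x) = x := by
    intro x
    induction x using TensorProduct.induction_on with
    | zero => simp
    | add x y hx hy => rw [map_add, map_add, hx, hy]
    | tmul x y =>
      have e2 : e (x ⊗ₜ y) = i' x * j y := by simp [e, i'', j']
      have e3 : γ (i' x) = x ⊗ₜ 1 := by rw [← RingHom.comp_apply, h2]; rfl
      have e4 : γ (j y) = 1 ⊗ₜ y := by rw [← RingHom.comp_apply, h1]; rfl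
      rw [e2, map_mul, e3, e4]; simp
  have hb : Function.Bijective (e : TensorProduct Q Q' A →+* A') :=
    ⟨fun x y hxy => by rw [← h4 x, ← h4 y]; exact congrArg γ hxy, fun y => ⟨γ y, RingHom.congr_fun h3 y⟩⟩
  have : i' = (e : TensorProduct Q Q' A →+* A').comp (algebraMap Q' (TensorProduct Q Q' A)) := by
    ext x; simp [e, i'', Algebra.TensorProduct.algebraMap_apply]
  rw [this]
  refine RingHom.Flat.comp ?_ (RingHom.Flat.of_bijective hb)
  rw [RingHom.flat_algebraMap_iff]; infer_instance

theorem PO.poly  (i : Q →+* A) :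
    PO i (Polynomial.C : Q →+* Polynomial Q) (Polynomial.C : A →+* Polynomial A) (Polynomial.mapRingHom i) := by
  refine ⟨by ext; simp, fun T _ α β h => ⟨Polynomial.eval₂RingHom α (β Polynomial.X), ?_, ?_⟩, fun T _ γ γ' h1 h2 => ?_⟩
  · ext; simp
  · ext x
    · simpa using RingHom.congr_fun h x
    · simp
  · refine Polynomial.ringHom_ext' h1 ?_
    have := RingHom.congr_fun h2 Polynomial.X
    simpa using this

theorem PO.quot  (i : Q →+* A) (g : Q →+* Q')
    (hg : Function.Surjective g) (j : A →+* A') (hj : Function.Surjective j) (i' : Q' →+* A') (hc : j.comp i = i'.comp g)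
    (hk : ∀ x, j x = 0 → x ∈ Ideal.span (i '' {r | g r = 0})) : PO i g j i' := by
  refine ⟨hc, fun T _ α β h => ?_, fun T _ γ γ' h1 h2 => ?_⟩
  · obtain ⟨γ, hγ⟩ := exists_factor j hj α (fun x hx => by
      have : Ideal.span (i '' {r | g r = 0}) ≤ RingHom.ker α := by
        rw [Ideal.span_le]; rintro _ ⟨r, hr, rfl⟩
        have h2 := RingHom.congr_fun h r
        rw [RingHom.comp_apply, RingHom.comp_apply, Set.mem_setOf.1 hr, map_zero] at h2
        exact h2
      exact this (hk x hx))
    refine ⟨γ, hγ, ?_⟩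
    ext x; obtain ⟨r, rfl⟩ := hg x
    have h1 := RingHom.congr_fun h r
    have h2 := RingHom.congr_fun hc r
    have h3 := RingHom.congr_fun hγ (i r)
    simp only [RingHom.comp_apply] at *
    rw [← h2, h3, h1]
  · ext x; obtain ⟨r, rfl⟩ := hj x; exact RingHom.congr_fun h1 r

theorem exists_trunc (R : Type u) [CommRing R] (N : ℕ) : ∃ (R' : Type u) (_ : CommRing R') (p : Polynomial R →+* R'), Trunc N p := by
  obtain ⟨R', _, p, hp, hpk⟩ := exists_quot (Ideal.span {(Polynomial.X ^ N : Polynomial R)})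
  exact ⟨R', inferInstance, p, hp, fun x => by rw [hpk, Ideal.mem_span_singleton]⟩

theorem Trunc.map  (f : R →+* Q) {N : ℕ}
    {p : Polynomial R →+* R'} {p' : Polynomial Q →+* Q'} (h : Trunc N p) (h' : Trunc N p') :
    ∃ f' : R' →+* Q', f'.comp p = p'.comp (Polynomial.mapRingHom f) := by
  obtain ⟨f', hf'⟩ := exists_factor p h.surj (p'.comp (Polynomial.mapRingHom f)) (fun x hx => by
    obtain ⟨y, rfl⟩ := (h.ker x).1 hx
    rw [RingHom.comp_apply, map_mul, map_pow, h'.ker]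
    simp)
  exact ⟨f', hf'⟩

theorem Trunc.po  (f : R →+* Q) {N : ℕ}
    {p : Polynomial R →+* R'} {p' : Polynomial Q →+* Q'} (h : Trunc N p) (h' : Trunc N p') (f' : R' →+* Q')
    (hf' : f'.comp p = p'.comp (Polynomial.mapRingHom f)) : PO (Polynomial.mapRingHom f) p p' f' := by
  refine PO.quot _ p h.surj p' h'.surj f' hf'.symm fun x hx => ?_
  obtain ⟨y, rfl⟩ := (h'.ker x).1 hx
  refine Ideal.mul_mem_right _ _ (Ideal.subset_span ⟨Polynomial.X ^ N, ?_, by simp⟩)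
  exact (h.ker _).2 dvd_rfl

theorem tors_stab [IsNoetherianRing Λ] (t : Λ) : ∃ s : ℕ, ∀ (k : ℕ) (x : Λ), t ^ k * x = 0 → t ^ s * x = 0 := by
  obtain ⟨s, hs⟩ := monotone_stabilizes_iff_noetherian.2 (inferInstance : IsNoetherian Λ Λ)
    ⟨fun n => LinearMap.ker (LinearMap.mulLeft Λ (t ^ n)), fun a b hab x hx => by
      simp only [LinearMap.mem_ker, LinearMap.mulLeft_apply] at *
      rw [← Nat.sub_add_cancel hab, pow_add, mul_assoc, hx, mul_zero]⟩
  refine ⟨s, fun k x hx => ?_⟩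
  have h1 : x ∈ LinearMap.ker (LinearMap.mulLeft Λ (t ^ (s + k))) := by
    rw [LinearMap.mem_ker, LinearMap.mulLeft_apply, pow_add, mul_assoc, hx, mul_zero]
  have h2 : LinearMap.ker (LinearMap.mulLeft Λ (t ^ s)) = LinearMap.ker (LinearMap.mulLeft Λ (t ^ (s + k))) :=
    hs (s + k) (Nat.le_add_right _ _)
  rw [← h2] at h1
  simpa using h1

theorem res_prep [IsNoetherianRing Q] [IsNoetherianRing Λ]
    (i : Q →+* A) (hi : i.FiniteType) (ψ : A →+* Λ) (t : Λ) (ht : ∀ (𝔔 : Ideal Λ) [𝔔.IsPrime], ¬ SmAt i ψ 𝔔 → t ∈ 𝔔) :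
    ∃ (n : ℕ) (B : Type u) (_ : CommRing B) (pB : MvPolynomial (Fin n) (Polynomial Q) →+* B) (ψB : B →+* Λ) (aB : A →+* B)
      (m : ℕ) (J' : Ideal (MvPolynomial (Fin n ⊕ Fin m) (Polynomial Q))) (e : ℕ), 0 < e ∧ Function.Surjective pB ∧
      aB.comp i = (pB.comp C).comp Polynomial.C ∧ ψB.comp aB = ψ ∧ ψB (pB (C Polynomial.X)) = t ∧
      (∀ (𝔔 : Ideal Λ) [𝔔.IsPrime], SmAt i ψ 𝔔 → SmAt (pB.comp C) ψB 𝔔) ∧ SStd J' (Polynomial.X ^ e) ∧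
      (∀ x ∈ RingHom.ker pB, rename Sum.inl x ∈ J') ∧
      (∀ x ∈ J', aeval (Sum.elim X (fun _ => (0 : MvPolynomial (Fin n) (Polynomial Q)))) x ∈ RingHom.ker pB) ∧
      ∀ x : Λ, (t ^ e) ^ 2 * x = 0 → t ^ e * x = 0 := by
  have hi1 : (Polynomial.mapRingHom i).FiniteType := by
    refine RingHom.FiniteType.of_comp_finiteType (f := Polynomial.C) ?_
    have : (Polynomial.mapRingHom i).comp Polynomial.C = Polynomial.C.comp i := by ext; simp
    rw [this]
    refine RingHom.FiniteType.comp ?_ hi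
    have : Algebra.FiniteType A (Polynomial A) := inferInstance
    rw [← Polynomial.algebraMap_eq]; exact (RingHom.finiteType_algebraMap).2 this
  have hsm : ∀ (𝔔 : Ideal Λ), SmAt i ψ 𝔔 → SmAt (Polynomial.mapRingHom i) (Polynomial.eval₂RingHom ψ t) 𝔔 := by
    rintro 𝔔 ⟨b, hb, hb'⟩
    exact ⟨Polynomial.C b, (PO.poly i).fs hb, by simpa using hb'⟩
  obtain ⟨B, _, j, ψB, hj, hψB, hFS, hS⟩ := A1 (Polynomial.mapRingHom i) hi1 (Polynomial.eval₂RingHom ψ t) Polynomial.X (by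
    have : t ∈ (Ideal.span ((Polynomial.eval₂RingHom ψ t) '' {b | FS (Polynomial.mapRingHom i) b})).radical := by
      rw [Ideal.radical_eq_sInf, Submodule.mem_sInf]
      rintro 𝔔 ⟨h1, h2⟩
      by_contra hh
      have : SmAt i ψ 𝔔 := by by_contra h3; exact hh (ht 𝔔 h3)
      obtain ⟨b, hb, hb'⟩ := hsm 𝔔 this
      exact hb' (h1 (Ideal.subset_span ⟨b, hb, rfl⟩))
    obtain ⟨N, hN⟩ := this
    exact ⟨N, by simpa using hN⟩)
  obtain ⟨n, pB, hpB, hpj⟩ := exists_presentation _ (hj.comp hi1)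
  have e1 : j (Polynomial.mapRingHom i Polynomial.X) = pB (C Polynomial.X) := (RingHom.congr_fun hpj Polynomial.X).symm
  rw [e1] at hFS
  obtain ⟨k, hk⟩ := (FS_iff_QS pB hpB hpj _).1 hFS
  rw [← map_pow] at hk
  obtain ⟨m, J', h1, h2, h3⟩ := elkik (IsNoetherian.noetherian (RingHom.ker pB)) _ hk
  obtain ⟨s, hs⟩ := tors_stab t
  refine ⟨n, B, inferInstance, pB, ψB, j.comp Polynomial.C, m, J', (s + 1) + k * 6, by omega, hpB, ?_, ?_, ?_, ?_, ?_, h2, h3, ?_⟩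
  · rw [hpj]; ext r; simp
  · rw [← RingHom.comp_assoc, hψB]; ext; simp
  · rw [← e1, ← RingHom.comp_apply, hψB]; simp
  · intro 𝔔 _ h; rw [hpj]; exact hS 𝔔 (hsm 𝔔 h)
  · rw [pow_add, pow_mul]; exact h1.mul _
  · intro x hx
    rw [← pow_mul] at hx
    have := hs _ x hx
    rw [add_assoc, pow_add, mul_comm (t ^ s), mul_assoc, this, mul_zero]

theorem eval_retr  {n m : ℕ} (s : Q →+* T) (w : Fin n → T)
    (f : MvPolynomial (Fin n ⊕ Fin m) Q) :
    eval₂ s (Sum.elim w (fun _ => 0)) f = eval₂ s w (aeval (Sum.elim X (fun _ => (0 : MvPolynomial (Fin n) Q))) f) := by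
  have : eval₂Hom s (Sum.elim w (fun _ => 0)) = (eval₂Hom s w).comp
      ((aeval (Sum.elim X (fun _ => (0 : MvPolynomial (Fin n) Q))) : MvPolynomial (Fin n ⊕ Fin m) Q →ₐ[Q] MvPolynomial (Fin n) Q) :
        MvPolynomial (Fin n ⊕ Fin m) Q →+* MvPolynomial (Fin n) Q) := by
    ext x
    · simp
    · cases x <;> simp
  exact RingHom.congr_fun this f

theorem abs_pres [IsNoetherianRing S]  (c : S →+* Cb) (hc : c.FiniteType)
    (pΛ : Λ →+* Λ') (hpΛ : Function.Surjective pΛ) (ψC : Cb →+* Λ') (ev0 : S →+* Λ) (h : ψC.comp c = pΛ.comp ev0) :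
    ∃ (P : Type u) (_ : CommRing P) (_ : IsNoetherianRing P) (CP : S →+* P) (pP : P →+* Cb) (ev : P →+* Λ), Function.Surjective pP ∧
      pP.comp CP = c ∧ CP.FiniteType ∧ FS CP 1 ∧ CP.Flat ∧ ev.comp CP = ev0 ∧ pΛ.comp ev = ψC.comp pP := by
  obtain ⟨n', pP, hpP, hpc⟩ := exists_presentation c hc
  choose u hu using fun k => hpΛ (ψC (pP (X k)))
  refine ⟨MvPolynomial (Fin n') S, inferInstance, inferInstance, C, pP, eval₂Hom ev0 u, hpP, hpc,
    finiteType_of_presentation _ (RingHom.id _) Function.surjective_id rfl, FS.mvPolynomial _, flat_C _, ?_, ?_⟩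
  · ext; simp
  · refine MvPolynomial.ringHom_ext (fun x => ?_) (fun k => ?_)
    · have h1 := RingHom.congr_fun hpc x
      have h2 := RingHom.congr_fun h x
      simp only [RingHom.comp_apply] at h1 h2 ⊢
      rw [h1, h2]; simp
    · simp [hu]

theorem res_core 
    [IsNoetherianRing Q] (f : R →+* Q) (hf : FS f 1) (hfl : f.Flat) (lam : Q →+* Λ) (t : Λ) {n m : ℕ}
    (J : Ideal (MvPolynomial (Fin n) (Polynomial Q))) (J' : Ideal (MvPolynomial (Fin n ⊕ Fin m) (Polynomial Q))) (e : ℕ)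
    (he : 0 < e) (hS : SStd J' (Polynomial.X ^ e)) (hinl : ∀ x ∈ J, rename Sum.inl x ∈ J')
    (hinr : ∀ x ∈ J', aeval (Sum.elim X (fun _ => (0 : MvPolynomial (Fin n) (Polynomial Q)))) x ∈ J)
    (hΛ : ∀ x : Λ, (t ^ e) ^ 2 * x = 0 → t ^ e * x = 0)
    (v : Fin n → Λ) (hv : ∀ g ∈ J, eval₂ (Polynomial.eval₂RingHom lam t) v g = 0)
    (pR : Polynomial R →+* R') (hpR : Trunc (e * 6) pR)
    (c : MvPolynomial (Fin n) (Polynomial Q) →+* Cb) (hc : c.FiniteType) (hcJ : ∀ g ∈ J, c g = 0)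
    (f' : R' →+* Cb) (hf' : f'.comp pR = (c.comp C).comp (Polynomial.mapRingHom f))
    (pΛ : Λ →+* Λ') (hpΛ : Function.Surjective pΛ) (hpΛk : ∀ x, pΛ x = 0 → ∃ μ, x = (t ^ e) ^ 6 * μ)
    (ψC : Cb →+* Λ') (hψC : ψC.comp c = pΛ.comp (eval₂Hom (Polynomial.eval₂RingHom lam t) v)) :
    ∃ (D : Type u) (_ : CommRing D) (κ : MvPolynomial (Fin n) (Polynomial Q) →+* D) (ψD : D →+* Λ), κ.FiniteType ∧
      (∀ g ∈ J, κ g = 0) ∧ ψD.comp κ = eval₂Hom (Polynomial.eval₂RingHom lam t) v ∧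
      FS ((κ.comp C).comp (Polynomial.mapRingHom f)) (κ (C (Polynomial.X ^ e))) ∧
      ∀ (𝔔 : Ideal Λ) [𝔔.IsPrime], t ∈ 𝔔 → (∃ b x, FS f' b ∧ pΛ x = ψC b ∧ x ∉ 𝔔) →
        SmAt ((κ.comp C).comp (Polynomial.mapRingHom f)) ψD 𝔔 := by
  obtain ⟨evT, hevT⟩ : ∃ evT : Polynomial Q →+* Λ, evT = Polynomial.eval₂RingHom lam t := ⟨_, rfl⟩
  rw [← hevT] at hv hψC ⊢
  have hevX : evT Polynomial.X = t := by rw [hevT]; simp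
  obtain ⟨P, _, _, CP, pP, ev, hpP, hpc, hCPft, hCPfs, hCPfl, hevC0, hpev⟩ := abs_pres c hc pΛ hpΛ ψC _ hψC
  have hpc' : ∀ x, pP (CP x) = c x := fun x => RingHom.congr_fun hpc x
  have hevC : ∀ x, ev (CP x) = eval₂ evT v x := fun x => RingHom.congr_fun hevC0 x
  obtain ⟨CC, hCC⟩ : ∃ CC : Polynomial Q →+* P, CC = CP.comp C := ⟨_, rfl⟩
  have hCC' : ∀ x, CC x = CP (C x) := fun x => by rw [hCC]; rfl
  have hFSCC : FS CC 1 := by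
    have := FS.comp (FS.mvPolynomial (R := Polynomial Q) (Fin n)) hCPfs
    rw [map_one, one_mul] at this; rw [hCC]; exact this
  have hFSm : FS (Polynomial.mapRingHom f) 1 := by
    have := (PO.poly f).fs hf; rwa [map_one] at this
  have hpre : ∀ {D : Type u} [CommRing D] (s : Polynomial Q →+* D) (b : D), FS s b → FS (s.comp (Polynomial.mapRingHom f)) b := fun s b h => by
    have := FS.comp hFSm h; rwa [map_one, one_mul] at this
  have hflat : (CC.comp (Polynomial.mapRingHom f)).Flat := by
    rw [hCC]
    exact ((PO.poly f).flat hfl).comp ((flat_C _).comp hCPfl)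
  have hhπ : (CC.comp (Polynomial.mapRingHom f)) (Polynomial.X ^ e) = CC (Polynomial.X ^ e) := by simp
  have hevπ : ev (CC (Polynomial.X ^ e)) = t ^ e := by rw [hCC', hevC, eval₂_C, map_pow, hevX]
  obtain ⟨D, _, β, τ, hβ, hτβ, hD1, hD2, hD3⟩ := lemmaD (CC.comp (Polynomial.mapRingHom f)) (hpre _ _ hFSCC) hflat
    (Polynomial.X ^ e) (fun x hx => (Polynomial.monic_X_pow e).isRegular.left (by simpa using hx)) pP hpP pR hpR.surj
    (fun r hr => by rw [← pow_mul]; exact (hpR.ker r).1 hr) f' (by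
      rw [hf', ← RingHom.comp_assoc, hCC, ← RingHom.comp_assoc, hpc]) ev (fun x hx => by
      rw [hhπ, hevπ]
      apply hpΛk
      have := RingHom.congr_fun hpev x
      rw [RingHom.comp_apply, RingHom.comp_apply, hx, map_zero] at this; exact this) (by rw [hhπ, hevπ]; exact hΛ)
  rw [hhπ] at hD1 hD2 hD3
  rw [hevπ] at hD3
  have hτβ' : ∀ x, τ (β x) = ev x := fun x => RingHom.congr_fun hτβ x
  have : IsNoetherianRing D := noeth_of_ft β hβ
  have hτd0 : τ.comp (β.comp CC) = evT := by
    ext x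
    · simp [hτβ', hCC', hevC]
    · simp [hτβ', hCC', hevC]
  have hτπ : τ ((β.comp CC) (Polynomial.X ^ e)) = t ^ e := by rw [RingHom.comp_apply, hτβ', hevπ]
  have hβC : ∀ g : MvPolynomial (Fin n) (Polynomial Q), eval₂ (β.comp CC) (fun k => β (CP (X k))) g = β (CP g) := by
    intro g
    have : eval₂Hom (β.comp CC) (fun k => β (CP (X k))) = β.comp CP := by
      refine MvPolynomial.ringHom_ext (fun x => ?_) (fun k => ?_)
      · simp [hCC']
      · simp
    exact RingHom.congr_fun this g
  obtain ⟨B, _, β2, σ, τ', γ, hβ2, hτ', hσ, hσJ, hN1, ⟨c', hc'⟩, hN2⟩ := newton hS (β.comp CC) τ (Sum.elim v (fun _ => 0))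
    (fun g hg => by rw [hτd0, eval_retr]; exact hv _ (hinr g hg))
    (Sum.elim (fun k => β (CP (X k))) (fun _ => 0)) (fun g hg => by
      rw [eval_retr, hβC]
      exact hD1 _ (by rw [hpc']; exact hcJ _ (hinr g hg))) (fun _ => 0) (fun k => by
      cases k with
      | inl k => simp [hτβ', hevC]
      | inr k => simp) (by rw [hτπ]; exact hΛ)
  have hτ'' : ∀ x, τ' (β2 x) = τ x := fun x => RingHom.congr_fun hτ' x
  obtain ⟨κ, hκ⟩ : ∃ κ : MvPolynomial (Fin n) (Polynomial Q) →+* B, κ = eval₂Hom (β2.comp (β.comp CC)) (fun k => σ (Sum.inl k)) := ⟨_, rfl⟩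
  have hκC : κ.comp C = β2.comp (β.comp CC) := by rw [hκ]; ext <;> simp
  have hκC' : ∀ x, κ (C x) = β2 (β (CC x)) := fun x => RingHom.congr_fun hκC x
  have hCft : ∀ {T : Type u} [CommRing T] (k : ℕ), (C : T →+* MvPolynomial (Fin k) T).FiniteType := fun k =>
    finiteType_of_presentation _ (RingHom.id _) Function.surjective_id rfl
  refine ⟨B, inferInstance, κ, τ', ?_, ?_, ?_, ?_, ?_⟩
  · refine RingHom.FiniteType.of_comp_finiteType (f := C) ?_
    rw [hκC, hCC]
    exact hβ2.comp (hβ.comp (hCPft.comp (hCft _)))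
  · intro g hg
    have := hσJ _ (hinl g hg)
    rw [eval₂_rename] at this
    rw [hκ]; exact this
  · refine MvPolynomial.ringHom_ext (fun x => ?_) (fun k => ?_)
    · rw [RingHom.comp_apply, hκC', hτ'', hτβ', hCC', hevC]; simp
    · rw [hκ]; simp [hσ]
  · rw [hκC, hκC']
    apply hpre
    refine hN1 ?_
    have := FS.comp hFSCC hD2
    rwa [map_one, one_mul] at this
  · rintro 𝔔 _ ht ⟨b, x, hb, hx, hx'⟩
    obtain ⟨b, rfl⟩ := hpP b
    have hmem : t ^ e ∈ 𝔔 := Ideal.pow_mem_of_mem _ ht _ he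
    obtain ⟨δ, hδ1, hδ2, hδ3⟩ := hD3 𝔔 b hmem hb (by
      intro hh
      obtain ⟨μ, hμ⟩ := hpΛk (x - ev b) (by
        rw [map_sub, hx, sub_eq_zero]; exact (RingHom.congr_fun hpev b).symm)
      apply hx'
      have : x = ev b + (t ^ e) ^ 6 * μ := by rw [← hμ]; ring
      rw [this]
      exact Ideal.add_mem _ hh (Ideal.mul_mem_right _ _ (Ideal.pow_mem_of_mem _ hmem _ (by norm_num))))
    refine ⟨β2 δ * γ, ?_, ?_⟩
    · have := hN2 _ _ δ hδ2 (fun x hx => hδ3 _ (by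
        rw [RingHom.comp_apply] at hx ⊢; rw [← hx]; ring))
      rw [hκC, RingHom.comp_assoc, RingHom.comp_assoc]; exact this
    · rw [map_mul, hτ'', hc']
      intro hh
      rcases Ideal.IsPrime.mem_or_mem ‹_› hh with hh | hh
      · exact hδ1 hh
      · apply Ideal.IsPrime.ne_top (I := 𝔔) inferInstance
        rw [Ideal.eq_top_iff_one]
        have e1 : τ' (1 + β2 ((β.comp CC) (Polynomial.X ^ e)) * c') - t ^ e * τ' c' = 1 := by
          rw [map_add, map_mul, hτ'', hτπ, map_one]; ring
        rw [← e1]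
        exact Ideal.sub_mem _ hh (Ideal.mul_mem_right _ _ hmem)

theorem FS.polyC (R : Type u) [CommRing R] : FS (Polynomial.C : R →+* Polynomial R) 1 := by
  intro T T' _ _ p hp hs φ g hg _
  obtain ⟨x, hx⟩ := hp (g Polynomial.X)
  refine ⟨Polynomial.eval₂RingHom φ x, ?_, ?_⟩
  · ext r
    · simpa using (RingHom.congr_fun hg r).symm
    · simp [hx]
  · ext; simp

theorem IsLoc.mem_of  {loc : Λ →+* L} {q : Ideal Λ} [hq : q.IsPrime]
    (h : IsLoc loc q.primeCompl) {x : Λ} (hx : x ∈ q) : ¬ IsUnit (loc x) := by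
  intro hu
  obtain ⟨y, hy⟩ := hu.exists_right_inv
  obtain ⟨v, z, hv, hz⟩ := h.surj y
  obtain ⟨w, hw, hw'⟩ := h.ker (x * z - v) (by
    rw [map_sub, map_mul, ← hz, mul_left_comm, hy, mul_one, sub_self])
  have : w * v ∈ q := by
    have e : w * v = w * z * x := by linear_combination -hw'
    rw [e]; exact Ideal.mul_mem_left _ _ hx
  rcases hq.mem_or_mem this with h1 | h1
  · exact hw h1
  · exact hv h1

theorem mem_map_surj  (p : Λ →+* Λ') (hp : Function.Surjective p) (q : Ideal Λ)
    (hk : ∀ x, p x = 0 → x ∈ q) (x : Λ) : p x ∈ q.map p ↔ x ∈ q := by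
  refine ⟨fun h => ?_, fun h => Ideal.mem_map_of_mem _ h⟩
  obtain ⟨y, hy, hy'⟩ := (Ideal.mem_map_iff_of_surjective p hp).1 h
  have := hk (x - y) (by rw [map_sub, hy', sub_self])
  have e : x = (x - y) + y := by ring
  rw [e]; exact Ideal.add_mem _ this hy

theorem IsLoc.quot  {loc : Λ →+* L} {q : Ideal Λ} [hq : q.IsPrime]
    (h : IsLoc loc q.primeCompl) (t : Λ) (pΛ : Λ →+* Λ') (hpΛ : Function.Surjective pΛ) (hk : ∀ x, pΛ x = 0 ↔ t ∣ x)
    (ht : t ∈ q) (pL : L →+* L') (hpL : Function.Surjective pL) (hkL : ∀ x, pL x = 0 ↔ loc t ∣ x) (loc' : Λ' →+* L')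
    (hc : loc'.comp pΛ = pL.comp loc) [hq' : (q.map pΛ).IsPrime] : IsLoc loc' (q.map pΛ).primeCompl := by
  have hm := mem_map_surj pΛ hpΛ q (fun x hx => by
    obtain ⟨y, rfl⟩ := (hk x).1 hx; exact Ideal.mul_mem_right _ _ ht)
  have hc' : ∀ x, loc' (pΛ x) = pL (loc x) := fun x => RingHom.congr_fun hc x
  refine ⟨fun x hx => ?_, fun y => ?_, fun x hx => ?_⟩
  · obtain ⟨x, rfl⟩ := hpΛ x
    rw [hc']
    exact (h.unit x (fun h1 => hx ((hm x).2 h1))).map pL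
  · obtain ⟨y, rfl⟩ := hpL y
    obtain ⟨v, z, hv, hz⟩ := h.surj y
    exact ⟨pΛ v, pΛ z, fun h1 => hv ((hm v).1 h1), by rw [hc', hc', ← hz, map_mul]⟩
  · obtain ⟨x, rfl⟩ := hpΛ x
    rw [hc'] at hx
    obtain ⟨y, hy⟩ := (hkL _).1 hx
    obtain ⟨v, z, hv, hz⟩ := h.surj y
    obtain ⟨w, hw, hw'⟩ := h.ker (v * x - t * z) (by
      rw [map_sub, map_mul, map_mul, hy, ← hz]; ring)
    refine ⟨pΛ (w * v), fun h1 => ?_, ?_⟩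
    · rcases hq.mem_or_mem ((hm _).1 h1) with h2 | h2
      · exact hw h2
      · exact hv h2
    · rw [← map_mul, hk]
      exact ⟨w * z, by linear_combination hw'⟩

theorem res_cons [IsNoetherianRing Q]
    [IsNoetherianRing Λ] (f : R →+* Q) (hf : FS f 1) (hfl : f.Flat) (lam : Q →+* Λ) (q : Ideal Λ) [hq : q.IsPrime] (loc : Λ →+* L)
    (hloc : IsLoc loc q.primeCompl) (t : Λ) (l : List Λ) (i : Q →+* A) (hi : i.FiniteType) (ψ : A →+* Λ) (hψ : ψ.comp i = lam)
    (hl : ∀ s ∈ t :: l, s ∈ q ∧ ∀ (𝔔 : Ideal Λ) [𝔔.IsPrime], ¬ SmAt i ψ 𝔔 → s ∈ 𝔔)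
    (ih : ∀ (N : ℕ) (hN : 0 < N) (R' Q' L' : Type u) [CommRing R'] [CommRing Q'] [CommRing L'] (pR : Polynomial R →+* R')
        (pQ : Polynomial Q →+* Q') (pL : L →+* L') (f' : R' →+* Q') (lam' : Q' →+* L'), Trunc N pR → Trunc N pQ →
        Function.Surjective pL → (∀ x, pL x = 0 ↔ (loc t) ^ N ∣ x) → f'.comp pR = pQ.comp (Polynomial.mapRingHom f) →
        lam'.comp pQ = pL.comp (Polynomial.eval₂RingHom (loc.comp lam) (loc t)) →
        ∀ (Λ' A' : Type u) [CommRing Λ'] [CommRing A'] [IsNoetherianRing Λ'] [IsNoetherianRing Q'] (q' : Ideal Λ') [q'.IsPrime]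
          (loc' : Λ' →+* L') (l1 : List Λ') (i' : Q' →+* A') (ψ' : A' →+* Λ'), IsLoc loc' q'.primeCompl → l1.map loc' = (l.map loc).map pL →
          FS f' 1 → f'.Flat → i'.FiniteType → loc'.comp (ψ'.comp i') = lam' →
          (∀ s ∈ l1, s ∈ q' ∧ ∀ (𝔔 : Ideal Λ') [𝔔.IsPrime], ¬ SmAt i' ψ' 𝔔 → s ∈ 𝔔) → ResC f' i' ψ' q') :
    ResC f i ψ q := by
  obtain ⟨n, B, _, pB, ψB, aB, m, J', e, he, hpB, haB, hψB, hψt, hSm, hS, hinl, hinr, hΛ⟩ :=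
    res_prep i hi ψ t (hl t (by simp)).2
  have htq := (hl t (by simp)).1
  obtain ⟨N, hN⟩ : ∃ N, N = e * 6 := ⟨_, rfl⟩
  have hN0 : 0 < N := by omega
  obtain ⟨R', _, pR, hpR⟩ := exists_trunc R N
  obtain ⟨Q', _, pQ, hpQ⟩ := exists_trunc Q N
  obtain ⟨f', hf'⟩ := hpR.map f hpQ
  have hpo := hpR.po f hpQ f' hf'
  obtain ⟨Λ', _, pΛ, hpΛ, hpΛk⟩ := exists_quot (Ideal.span {t ^ N})
  obtain ⟨L', _, pL, hpL, hpLk⟩ := exists_quot (Ideal.span {(loc t) ^ N})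
  simp only [Ideal.mem_span_singleton] at hpΛk hpLk
  obtain ⟨loc', hloc'⟩ := exists_factor pΛ hpΛ (pL.comp loc) (fun x hx => by
    rw [RingHom.comp_apply, hpLk, ← map_pow]; exact map_dvd _ ((hpΛk x).1 hx))
  have hmem : ∀ 𝔔 : Ideal Λ, t ∈ 𝔔 → ∀ x, pΛ x = 0 → x ∈ 𝔔 := fun 𝔔 h x hx => by
    obtain ⟨y, rfl⟩ := (hpΛk x).1 hx
    exact Ideal.mul_mem_right _ _ (Ideal.pow_mem_of_mem _ h _ hN0)
  have hprime : ∀ (𝔔 : Ideal Λ) [𝔔.IsPrime], t ∈ 𝔔 → (𝔔.map pΛ).IsPrime := fun 𝔔 _ h =>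
    Ideal.map_isPrime_of_surjective hpΛ (fun x hx => hmem 𝔔 h x hx)
  have hq' := hprime q htq
  have hL' : IsLoc loc' (q.map pΛ).primeCompl :=
    hloc.quot (t ^ N) pΛ hpΛ hpΛk (Ideal.pow_mem_of_mem _ htq _ hN0) pL hpL (by rw [map_pow]; exact hpLk) loc' hloc'
  obtain ⟨Ab, _, pA, hpA, hpAk⟩ := exists_quot (Ideal.span {pB (C (Polynomial.X ^ N))})
  obtain ⟨i', hi'⟩ := exists_factor pQ hpQ.surj (pA.comp (pB.comp C)) (fun x hx => by
    obtain ⟨y, rfl⟩ := (hpQ.ker x).1 hx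
    simp only [RingHom.comp_apply]
    rw [hpAk, map_mul, map_mul]
    exact Ideal.mul_mem_right _ _ (Ideal.mem_span_singleton_self _))
  have hψtN : ψB (pB (C (Polynomial.X ^ N))) = t ^ N := by rw [map_pow, map_pow, map_pow, hψt]
  obtain ⟨ψ', hψ'⟩ := exists_factor pA hpA (pΛ.comp ψB) (fun x hx => by
    obtain ⟨y, rfl⟩ := Ideal.mem_span_singleton.1 ((hpAk x).1 hx)
    rw [RingHom.comp_apply, map_mul, hψtN, hpΛk]; exact Dvd.intro _ rfl)
  have hpoA : PO (pB.comp C) pQ pA i' := by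
    refine PO.quot _ _ hpQ.surj _ hpA _ hi'.symm fun x hx => ?_
    obtain ⟨y, rfl⟩ := Ideal.mem_span_singleton.1 ((hpAk x).1 hx)
    refine Ideal.mul_mem_right _ _ (Ideal.subset_span ⟨Polynomial.X ^ N, ?_, rfl⟩)
    exact (hpQ.ker _).2 dvd_rfl
  have hψ'' : ∀ x, ψ' (pA x) = pΛ (ψB x) := fun x => RingHom.congr_fun hψ' x
  have hSm' : ∀ (𝔔 : Ideal Λ) (𝔔' : Ideal Λ') [𝔔.IsPrime], (∀ x, pΛ x ∈ 𝔔' → x ∈ 𝔔) → SmAt i ψ 𝔔 → SmAt i' ψ' 𝔔' := by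
    intro 𝔔 𝔔' _ h1 h2
    obtain ⟨b, hb, hb'⟩ := hSm 𝔔 h2
    exact ⟨pA b, hpoA.fs hb, fun h3 => hb' (h1 _ (by rwa [← hψ'']))⟩
  have hev : eval₂Hom (Polynomial.eval₂RingHom lam t) (fun k => ψB (pB (X k))) = ψB.comp pB := by
    refine MvPolynomial.ringHom_ext (fun x => ?_) (fun k => by simp)
    have : Polynomial.eval₂RingHom lam t = (ψB.comp pB).comp C := by
      ext r
      · have h1 := RingHom.congr_fun haB r
        have h2 := RingHom.congr_fun hψ r
        have h3 := RingHom.congr_fun hψB (i r)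
        simp only [RingHom.comp_apply] at h1 h2 h3
        simp [← h1, h3, h2]
      · simp [hψt]
    rw [eval₂Hom_C, this]; rfl
  have hNΛ' : IsNoetherianRing Λ' := isNoetherianRing_of_surjective Λ Λ' pΛ hpΛ
  have hNQ' : IsNoetherianRing Q' := isNoetherianRing_of_surjective (Polynomial Q) Q' pQ hpQ.surj
  have hCft : ∀ {T : Type u} [CommRing T] (k : ℕ), (C : T →+* MvPolynomial (Fin k) T).FiniteType := fun k =>
    finiteType_of_presentation _ (RingHom.id _) Function.surjective_id rfl
  have hPft : (Polynomial.C : Q →+* Polynomial Q).FiniteType := by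
    have : Algebra.FiniteType Q (Polynomial Q) := inferInstance
    rw [← Polynomial.algebraMap_eq]; exact (RingHom.finiteType_algebraMap).2 this
  have hi'ft : i'.FiniteType := by
    refine RingHom.FiniteType.of_comp_finiteType (f := pQ) ?_
    rw [hi']
    exact (RingHom.FiniteType.of_surjective _ hpA).comp ((RingHom.FiniteType.of_surjective _ hpB).comp (hCft _))
  obtain ⟨Cb, _, κb, ψb, hκb, hψb, hres⟩ := ih N hN0 R' Q' L' pR pQ pL f' (loc'.comp (ψ'.comp i')) hpR hpQ hpL hpLk hf' (by
      rw [RingHom.comp_assoc, RingHom.comp_assoc, hi']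
      have e1 : Polynomial.eval₂RingHom (loc.comp lam) (loc t) = loc.comp ((ψB.comp pB).comp C) := by
        rw [← hev]; ext r <;> simp
      rw [e1]
      refine RingHom.ext fun x => ?_
      have h1 := hψ'' (pB (C x))
      have h2 := RingHom.congr_fun hloc' (ψB (pB (C x)))
      simp only [RingHom.comp_apply] at h1 h2 ⊢
      rw [h1, h2])
    Λ' Ab (q.map pΛ) loc' (l.map pΛ) i' ψ' hL' (by
      rw [List.map_map, List.map_map]
      apply List.map_congr_left
      intro x _; exact RingHom.congr_fun hloc' x) (by
        have := hpo.fs ((PO.poly f).fs hf); rwa [map_one, map_one] at this) (hpo.flat ((PO.poly f).flat hfl)) hi'ft rfl (by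
      intro s hs
      obtain ⟨s, hs', rfl⟩ := List.mem_map.1 hs
      refine ⟨Ideal.mem_map_of_mem _ (hl s (by simp [hs'])).1, fun 𝔔 _ h => ?_⟩
      exact (hl s (by simp [hs'])).2 (𝔔.comap pΛ) (fun h1 => h (hSm' _ _ (fun x hx => hx) h1)))
  have hevx : ∀ x, eval₂ (Polynomial.eval₂RingHom lam t) (fun k => ψB (pB (X k))) x = ψB (pB x) := fun x => RingHom.congr_fun hev x
  obtain ⟨D, _, κ, ψD, hκ, hκJ, hψD, hFS, hD⟩ := res_core f hf hfl lam t (RingHom.ker pB) J' e he hS hinl hinr hΛ (fun k => ψB (pB (X k)))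
    (fun g hg => by rw [hevx, (RingHom.mem_ker).1 hg, map_zero])
    pR (hN ▸ hpR) (κb.comp (pA.comp pB)) (hκb.comp ((RingHom.FiniteType.of_surjective _ hpA).comp (RingHom.FiniteType.of_surjective _ hpB)))
    (fun g hg => by simp only [RingHom.comp_apply]; rw [(RingHom.mem_ker).1 hg, map_zero, map_zero]) ((κb.comp i').comp f') (by
      rw [RingHom.comp_assoc, RingHom.comp_assoc, hf', ← RingHom.comp_assoc _ _ i', hi']; rfl)
    pΛ hpΛ (fun x hx => by
      obtain ⟨y, hy⟩ := (hpΛk x).1 hx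
      exact ⟨y, by rw [hy, hN, pow_mul]⟩) ψb (by
      rw [hev, ← RingHom.comp_assoc, hψb, ← RingHom.comp_assoc, hψ']; rfl)
  obtain ⟨κ', hκ'⟩ := exists_factor pB hpB κ (fun x hx => hκJ x hx)
  have hκa : (κ'.comp aB).comp i = (κ.comp C).comp Polynomial.C := by
    rw [RingHom.comp_assoc, haB, ← hκ']; rfl
  have hκaf : ((κ'.comp aB).comp i).comp f = ((κ.comp C).comp (Polynomial.mapRingHom f)).comp Polynomial.C := by
    rw [hκa]; ext r; simp
  have hψDx : ∀ x, ψD (κ x) = ψB (pB x) := fun x => (RingHom.congr_fun hψD x).trans (hevx x)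
  have hψDκ : ψD.comp κ' = ψB := by
    ext x; obtain ⟨y, rfl⟩ := hpB x
    rw [← hψDx]; exact congrArg ψD (RingHom.congr_fun hκ' y)
  have hup : ∀ b, FS ((κ.comp C).comp (Polynomial.mapRingHom f)) b → FS (((κ'.comp aB).comp i).comp f) b := fun b hb => by
    rw [hκaf]
    have := (FS.polyC R).comp hb
    rwa [map_one, one_mul] at this
  refine ⟨D, inferInstance, κ'.comp aB, ψD, ?_, ?_, ?_⟩
  · refine RingHom.FiniteType.of_comp_finiteType (f := i) ?_
    rw [hκa]; exact (hκ.comp (hCft _)).comp hPft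
  · rw [← RingHom.comp_assoc, hψDκ, hψB]
  · intro 𝔔 h𝔔 h
    by_cases ht : t ∈ 𝔔
    · have h1 := hprime 𝔔 ht
      have hmm := mem_map_surj pΛ hpΛ 𝔔 (hmem 𝔔 ht)
      obtain ⟨b, hb, hb'⟩ := hres (𝔔.map pΛ) (by
        rcases h with h | h
        · exact Or.inl (hSm' _ _ (fun x hx => (hmm x).1 hx) h)
        · right; rw [h])
      obtain ⟨x, hx⟩ := hpΛ (ψb b)
      obtain ⟨d, hd, hd'⟩ := hD 𝔔 ht ⟨b, x, hb, hx, fun h2 => hb' (by rw [← hx]; exact (hmm x).2 h2)⟩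
      exact ⟨d, hup d hd, hd'⟩
    · refine ⟨_, hup _ hFS, ?_⟩
      rw [hψDx, map_pow, map_pow, map_pow, hψt]
      exact fun h1 => ht (h𝔔.mem_of_pow_mem _ h1)

theorem res  {f : R →+* Q} {lam : Q →+* L} {l' : List L} (h : BH f lam l') :
    ∀ (Λ A : Type u) [CommRing Λ] [CommRing A] [IsNoetherianRing Λ] [IsNoetherianRing Q] (q : Ideal Λ) [q.IsPrime]
      (loc : Λ →+* L) (l : List Λ) (i : Q →+* A) (ψ : A →+* Λ), IsLoc loc q.primeCompl → l.map loc = l' →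
      FS f 1 → f.Flat → i.FiniteType → loc.comp (ψ.comp i) = lam →
      (∀ s ∈ l, s ∈ q ∧ ∀ (𝔔 : Ideal Λ) [𝔔.IsPrime], ¬ SmAt i ψ 𝔔 → s ∈ 𝔔) → ResC f i ψ q := by
  induction h with
  | nil f lam hL hB =>
    intro Λ A _ _ _ _ q _ loc l i ψ hloc _ hf hfl hi hlam _
    refine res_nil f hf i hi ψ q loc hloc (fun x hx => ?_) ?_
    · exact (hL (loc x)).resolve_left (hloc.mem_of hx)
    · rw [RingHom.comp_assoc, hlam]; exact hB
  | cons f lam t l' h ih =>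
    intro Λ A _ _ _ _ q _ loc l i ψ hloc hl hf hfl hi hlam hs
    cases l with
    | nil => simp at hl
    | cons t0 l0 =>
      simp only [List.map_cons, List.cons.injEq] at hl
      obtain ⟨rfl, rfl⟩ := hl
      refine res_cons f hf hfl _ q loc hloc t0 l0 i hi ψ rfl hs ?_
      rw [hlam]
      intro N hN R' Q' L' _ _ _ pR pQ pL f' lam' h1 h2 h3 h4 h5 h6
      exact ih N hN R' Q' L' pR pQ pL f' lam' h1 h2 h3 h4 h5 h6

theorem HH {F P κ : Type u} [CommRing F] [CommRing P] [Field κ] {f : F →+* P} (hf : FS f 1) (χ : P →+* κ)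
    (hχ : ∀ y, ∃ a b, χ b ≠ 0 ∧ y * χ b = χ a) (hκ : FS (χ.comp f) 1) (x : P) (hx : χ x = 0)
    (hd : ∀ d, IsDer f d → χ (d x) = 0) : ∃ s, χ s ≠ 0 ∧ s * x ∈ (RingHom.ker χ) ^ 2 := by
  have hprime : (RingHom.ker χ).IsPrime := RingHom.ker_isPrime χ
  obtain ⟨𝔓, h𝔓⟩ : ∃ 𝔓, 𝔓 = RingHom.ker χ := ⟨_, rfl⟩
  rw [← h𝔓] at hprime ⊢
  have hm : ∀ y, y ∈ 𝔓 ↔ χ y = 0 := fun y => by rw [h𝔓, RingHom.mem_ker]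
  have hloc := IsLoc.of_isLocalization (Λ := P) (L := Localization.AtPrime 𝔓) 𝔓.primeCompl
  obtain ⟨S, _, loc, hloc, hlift⟩ : ∃ (S : Type u) (_ : CommRing S) (loc : P →+* S), IsLoc loc 𝔓.primeCompl ∧
      ∃ χ' : S →+* κ, χ'.comp loc = χ :=
    ⟨Localization.AtPrime 𝔓, inferInstance, algebraMap _ _, hloc,
      IsLocalization.lift (M := 𝔓.primeCompl) (g := χ) (fun y => (isUnit_iff_ne_zero.2 (fun h => y.2 ((hm _).2 h)))),
      IsLocalization.lift_comp _⟩
  obtain ⟨χ', hχ'⟩ := hlift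
  have hχ'' : ∀ y, χ' (loc y) = χ y := fun y => RingHom.congr_fun hχ' y
  have hker : ∀ y, χ' y = 0 → y ∈ 𝔓.map loc := by
    intro y hy
    obtain ⟨v, z, hv, hz⟩ := hloc.surj y
    have h1 : χ z = 0 := by rw [← hχ'', ← hz, map_mul, hy, mul_zero]
    obtain ⟨u, hu⟩ := hloc.unit v hv
    have : y = ↑u⁻¹ * loc z := by rw [← hz, ← hu, Units.inv_mul_cancel_left]
    rw [this]; exact Ideal.mul_mem_left _ _ (Ideal.mem_map_of_mem _ ((hm z).2 h1))
  have hker2 : ∀ y ∈ 𝔓.map loc, χ' y = 0 := by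
    intro y hy
    have : 𝔓.map loc ≤ RingHom.ker χ' := by
      rw [Ideal.map_le_iff_le_comap]; intro z hz; rw [Ideal.mem_comap, RingHom.mem_ker, hχ'']; exact (hm z).1 hz
    exact this hy
  obtain ⟨T, _, pT, hpT, hpTk⟩ := exists_quot ((𝔓.map loc) ^ 2)
  obtain ⟨θ, hθ⟩ := exists_factor pT hpT χ' (fun y hy => hker2 y (Ideal.pow_le_self (by norm_num) ((hpTk y).1 hy)))
  have hθ' : ∀ y, θ (pT y) = χ' y := fun y => RingHom.congr_fun hθ y
  have hθs : Function.Surjective θ := by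
    intro y
    obtain ⟨a, b, hb, hab⟩ := hχ y
    obtain ⟨u, hu⟩ := hloc.unit b (fun h => hb ((hm b).1 h))
    refine ⟨pT (↑u⁻¹ * loc a), ?_⟩
    have h3 : χ b * χ' ↑u⁻¹ = 1 := by rw [← hχ'', ← hu, ← map_mul, Units.mul_inv, map_one]
    rw [hθ', map_mul, hχ'', ← hab]; linear_combination y * h3
  have hθk : ∀ a b, θ a = 0 → θ b = 0 → a * b = 0 := by
    intro a b ha hb
    obtain ⟨a, rfl⟩ := hpT a
    obtain ⟨b, rfl⟩ := hpT b
    rw [← map_mul, hpTk, pow_two]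
    exact Ideal.mul_mem_mul (hker _ (by rw [← hθ', ha])) (hker _ (by rw [← hθ', hb]))
  obtain ⟨σ, hσ1, hσ2⟩ := hκ T κ θ hθs hθk ((pT.comp loc).comp f) (RingHom.id κ) (by
    rw [RingHom.id_comp, ← RingHom.comp_assoc, ← RingHom.comp_assoc, hθ, hχ']) (by simp)
  have hσ1' : ∀ y, θ (σ y) = y := fun y => RingHom.congr_fun hσ1 y
  have := H_core hf 𝔓 𝔓 x (fun d hd' => (hm _).2 (hd d hd')) (pT.comp loc) (σ.comp χ) (fun y => by
      obtain ⟨w, hw⟩ := hpT ((pT.comp loc) y - (σ.comp χ) y)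
      rw [← hw, ← Ideal.map_map]
      apply Ideal.mem_map_of_mem
      apply hker
      rw [← hθ', hw, map_sub]
      simp only [RingHom.comp_apply]
      rw [hθ', hσ1', hχ'', sub_self]) (fun a ha b hb => by
      apply hθk
      · rw [RingHom.comp_apply, hθ', hχ'']; exact (hm a).1 ha
      · rw [RingHom.comp_apply, hθ', hχ'']; exact (hm b).1 hb) (fun r => RingHom.congr_fun hσ2 r) (by
      rw [RingHom.comp_apply, hx, map_zero])
  have h1 : (𝔓 * 𝔓).map (pT.comp loc) = ⊥ := by
    rw [← Ideal.map_map, eq_bot_iff, Ideal.map_le_iff_le_comap]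
    intro y hy
    rw [Ideal.mem_comap, Ideal.mem_bot, hpTk, ← Ideal.map_pow, pow_two]; exact hy
  rw [h1, Ideal.mem_bot, RingHom.comp_apply, hpTk, ← Ideal.map_pow] at this
  have h2 : ∀ y ∈ (𝔓 ^ 2).map loc, ∃ s, s ∉ 𝔓 ∧ ∃ z ∈ 𝔓 ^ 2, loc s * y = loc z := by
    intro y hy
    induction hy using Submodule.span_induction with
    | mem y hy => obtain ⟨z, hz, rfl⟩ := hy; exact ⟨1, 𝔓.primeCompl.one_mem, z, hz, by simp⟩
    | zero => exact ⟨1, 𝔓.primeCompl.one_mem, 0, zero_mem _, by simp⟩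
    | add y y' _ _ h h' =>
      obtain ⟨s, hs, z, hz, e⟩ := h
      obtain ⟨s', hs', z', hz', e'⟩ := h'
      refine ⟨s * s', 𝔓.primeCompl.mul_mem hs hs', s' * z + s * z', add_mem (Ideal.mul_mem_left _ _ hz) (Ideal.mul_mem_left _ _ hz'), ?_⟩
      simp only [map_mul, map_add]; rw [← e, ← e']; ring
    | smul a y _ h =>
      obtain ⟨s, hs, z, hz, e⟩ := h
      obtain ⟨v, w, hv, hw⟩ := hloc.surj a
      refine ⟨v * s, 𝔓.primeCompl.mul_mem hv hs, w * z, Ideal.mul_mem_left _ _ hz, ?_⟩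
      simp only [map_mul, smul_eq_mul]; rw [← e, ← hw]; ring
  obtain ⟨s, hs, z, hz, e⟩ := h2 _ this
  obtain ⟨w, hw, hw'⟩ := hloc.ker (s * x - z) (by rw [map_sub, map_mul, e, sub_self])
  refine ⟨w * s, fun h => ?_, ?_⟩
  · rcases hprime.mem_or_mem ((hm _).2 h) with h | h
    · exact hw h
    · exact hs h
  · have : w * s * x = w * z := by linear_combination hw'
    rw [this]; exact Ideal.mul_mem_left _ _ hz

theorem field_fs (F K : Type u) [Field F] [PerfectField F] [Field K] [Algebra F K] : Algebra.FormallySmooth F K := by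
  classical
  letI alg : Algebra (MvPolynomial K F) K := (aeval (R := F) (fun x : K => x)).toRingHom.toAlgebra
  have hal : ∀ y, algebraMap (MvPolynomial K F) K y = aeval (R := F) (fun x : K => x) y := fun y => rfl
  haveI : IsScalarTower F (MvPolynomial K F) K := IsScalarTower.of_algebraMap_eq (fun r => by
    rw [hal, MvPolynomial.algebraMap_eq, aeval_C])
  have hsurj : Function.Surjective (algebraMap (MvPolynomial K F) K) := fun y => ⟨X y, by rw [hal, aeval_X]⟩
  refine ⟨inferInstance, (Algebra.FormallySmooth.kerCotangentToTensor_injective_iff (P := MvPolynomial K F) hsurj).1 ?_⟩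
  rw [injective_iff_map_eq_zero]
  intro z hz
  obtain ⟨x, rfl⟩ := Ideal.toCotangent_surjective _ z
  rw [KaehlerDifferential.kerCotangentToTensor_toCotangent] at hz
  rw [Ideal.toCotangent_eq_zero]
  obtain ⟨x, hx⟩ := x
  rw [RingHom.mem_ker] at hx
  simp only at hz ⊢
  have hpd : ∀ i, algebraMap (MvPolynomial K F) K (pderiv i x) = 0 := by
    intro i
    have := congrArg (fun w => TensorProduct.rid (MvPolynomial K F) K (LinearMap.lTensor K (pderiv (R := F) i).liftKaehlerDifferential w)) hz
    simp only [LinearMap.lTensor_tmul, Derivation.liftKaehlerDifferential_comp_D, TensorProduct.rid_tmul, map_zero] at this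
    rw [Algebra.smul_def, mul_one] at this
    exact this
  obtain ⟨s, x, rfl⟩ := exists_finset_rename x
  obtain ⟨K0, hK0⟩ : ∃ K0 : IntermediateField F K, K0 = IntermediateField.adjoin F (s : Set K) := ⟨_, rfl⟩
  have hsK : ∀ i : {a // a ∈ s}, (i : K) ∈ K0 := fun i => by
    rw [hK0]; exact IntermediateField.subset_adjoin _ _ i.2
  haveI : Algebra.EssFiniteType F K0 := by
    rw [IntermediateField.essFiniteType_iff]; exact ⟨s, hK0.symm⟩
  have hfsK : FS (algebraMap F K0) 1 := FS.of_formallySmooth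
  obtain ⟨χ, hχ⟩ : ∃ χ : MvPolynomial {a // a ∈ s} F →ₐ[F] K0, χ = aeval (fun i : {a // a ∈ s} => (⟨i, hsK i⟩ : K0)) := ⟨_, rfl⟩
  have hχK : ∀ y, ((χ y : K0) : K) = algebraMap (MvPolynomial K F) K (rename Subtype.val y) := by
    intro y
    rw [hal, aeval_rename, hχ]
    have : (K0.val.comp (aeval (fun i : {a // a ∈ s} => (⟨i, hsK i⟩ : K0)))) = aeval (R := F) ((fun x : K => x) ∘ Subtype.val : {a // a ∈ s} → K) := by
      apply MvPolynomial.algHom_ext; intro i; simp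
    exact congrArg (fun g => g y) this
  have hχ0 : ∀ y, χ y = 0 ↔ algebraMap (MvPolynomial K F) K (rename Subtype.val y) = 0 := by
    intro y; rw [← hχK]; simp
  obtain ⟨t, ht1, ht2⟩ := HH (f := (C : F →+* MvPolynomial {a // a ∈ s} F)) (FS.of_formallySmooth) (χ : _ →+* K0) (by
      rintro ⟨y, hy⟩
      rw [hK0, ← Subtype.range_val (s := (s : Set K)), IntermediateField.mem_adjoin_range_iff] at hy
      obtain ⟨a, b, hab⟩ := hy
      by_cases hb : χ b = 0
      · refine ⟨0, 1, by simp, ?_⟩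
        have : y = 0 := by
          rw [hab]
          have h2 := hχK b
          rw [hb, hal, aeval_rename] at h2
          have h3 : aeval (fun i : (s : Set K) => (i : K)) b = 0 := h2.symm
          rw [h3, div_zero]
        subst this; simp; rfl
      · refine ⟨a, b, hb, ?_⟩
        apply Subtype.ext
        have h2 := hχK b
        have h3 := hχK a
        have hb' : ((χ b : K0) : K) ≠ 0 := by simpa using hb
        rw [hal, aeval_rename] at h2 h3
        show y * (χ b : K0) = (χ a : K0)
        rw [hab, div_mul_eq_mul_div, div_eq_iff]
        · rw [h2, h3]; rfl
        · rw [h2] at hb'; exact hb')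
      (by
        have : ((χ : MvPolynomial {a // a ∈ s} F →+* K0)).comp C = algebraMap F K0 := by
          ext r; simp [← MvPolynomial.algebraMap_eq]
        rw [this]; exact hfsK) x ((hχ0 x).2 hx) (by
      intro d hd
      have hsm : ∀ (r : F) (y : MvPolynomial {a // a ∈ s} F), d (r • y) = (RingHom.id F) r • d y := fun r y => by
        rw [MvPolynomial.smul_eq_C_mul, hd.mul, hd.base r, mul_zero, add_zero, RingHom.id_apply, MvPolynomial.smul_eq_C_mul]
      let D : Derivation F (MvPolynomial {a // a ∈ s} F) (MvPolynomial {a // a ∈ s} F) :=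
        Derivation.mk' { toFun := d, map_add' := hd.add, map_smul' := hsm }
          (fun a b => by simpa using hd.mul a b)
      have hcs : ∀ g : {a // a ∈ s} → Derivation F (MvPolynomial {a // a ∈ s} F) (MvPolynomial {a // a ∈ s} F),
          ∀ y, (∑ i, g i) y = ∑ i, g i y := fun g y => by
        have := map_sum (Derivation.coeFnAddMonoidHom (R := F) (A := MvPolynomial {a // a ∈ s} F) (M := MvPolynomial {a // a ∈ s} F)) g Finset.univ
        have := congrFun this y
        rw [Finset.sum_apply] at this
        exact this
      have hD : D = ∑ i, (d (X i)) • pderiv i := by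
        apply MvPolynomial.derivation_ext
        intro i
        rw [hcs, Finset.sum_eq_single i]
        · simp [D]
        · intro j _ hj; simp [pderiv_X_of_ne hj.symm]
        · simp
      have : d x = ∑ i, (d (X i)) * pderiv i x := by
        have := congrArg (fun (D : Derivation F (MvPolynomial {a // a ∈ s} F) (MvPolynomial {a // a ∈ s} F)) => D x) hD
        simp only [hcs, Derivation.smul_apply, smul_eq_mul] at this
        exact this
      rw [this, map_sum]
      apply Finset.sum_eq_zero
      intro i _
      rw [map_mul]
      have : χ (pderiv i x) = 0 := by
        rw [hχ0, ← pderiv_rename Subtype.val_injective]; exact hpd _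
      simp [this])
  have h1 : rename Subtype.val (t * x) ∈ RingHom.ker (algebraMap (MvPolynomial K F) K) ^ 2 := by
    have : (RingHom.ker (χ : MvPolynomial {a // a ∈ s} F →+* K0)).map (rename Subtype.val : _ →ₐ[F] MvPolynomial K F) ≤ RingHom.ker (algebraMap (MvPolynomial K F) K) := by
      rw [Ideal.map_le_iff_le_comap]; intro y hy; exact (hχ0 y).1 hy
    refine Ideal.pow_right_mono this 2 ?_
    rw [← Ideal.map_pow]
    exact Ideal.mem_map_of_mem _ ht2
  rw [map_mul] at h1
  have ht : algebraMap (MvPolynomial K F) K (rename Subtype.val t) ≠ 0 := fun h => ht1 ((hχ0 t).2 h)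
  obtain ⟨v, hv⟩ := hsurj ((algebraMap (MvPolynomial K F) K (rename Subtype.val t))⁻¹)
  have h2 : 1 - v * rename Subtype.val t ∈ RingHom.ker (algebraMap (MvPolynomial K F) K) := by
    rw [RingHom.mem_ker, map_sub, map_mul, hv, map_one, inv_mul_cancel₀ ht, sub_self]
  have h3 : rename Subtype.val x = v * (rename Subtype.val t * rename Subtype.val x) + (1 - v * rename Subtype.val t) * rename Subtype.val x := by ring
  rw [h3]
  refine add_mem (Ideal.mul_mem_left _ _ h1) ?_
  rw [pow_two]; exact Ideal.mul_mem_mul h2 hx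

theorem field_fs' {F K : Type u} [Field F] [PerfectField F] [Field K] (f : F →+* K) : FS f 1 := by
  letI := f.toAlgebra
  haveI := field_fs F K
  exact FS.of_formallySmooth (R := F) (S := K)

/-- generic smoothness over a perfect field -/
theorem gen_smooth {F k' K0 K : Type u} [Field F] [PerfectField F] [Field k'] [CommRing K0] [Field K] (f : F →+* k')
    (i : k' →+* K0) (hi : i.FiniteType) (j : K0 →+* K) (hj : Function.Injective j) :
    ∃ b, b ≠ 0 ∧ FS (i.comp f) b := by
  classical
  haveI : IsDomain K0 := hj.isDomain j
  obtain ⟨n, p, hp, hpi⟩ := exists_presentation i hi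
  have hfP : FS ((C : k' →+* MvPolynomial (Fin n) k').comp f) 1 := by
    have := FS.comp (field_fs' f) (FS.mvPolynomial (R := k') (Fin n)); rwa [map_one, one_mul] at this
  obtain ⟨χ, hχ⟩ : ∃ χ : MvPolynomial (Fin n) k' →+* FractionRing K0, χ = (algebraMap K0 (FractionRing K0)).comp p := ⟨_, rfl⟩
  have hχ0 : ∀ y, χ y = 0 ↔ p y = 0 := fun y => by
    rw [hχ, RingHom.comp_apply]; exact map_eq_zero_iff _ (IsFractionRing.injective K0 (FractionRing K0))
  haveI hpr : (RingHom.ker χ).IsPrime := RingHom.ker_isPrime χ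
  obtain ⟨ι, _, _, Fl, d, c, hF, hd, hc, hcJ, hdF⟩ := LF ((C : k' →+* MvPolynomial (Fin n) k').comp f) (RingHom.ker χ) (RingHom.ker χ) ⊥ le_rfl (by
    intro x hx hdx
    obtain ⟨s, hs, hs'⟩ := HH hfP χ (by
      intro y
      obtain ⟨a, b, hb, rfl⟩ := IsFractionRing.div_surjective (A := K0) y
      obtain ⟨a, rfl⟩ := hp a
      obtain ⟨b, rfl⟩ := hp b
      have hb0 : χ b ≠ 0 := fun h => nonZeroDivisors.ne_zero hb ((hχ0 b).1 h)
      refine ⟨a, b, hb0, ?_⟩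
      rw [hχ] at hb0 ⊢
      simp only [RingHom.comp_apply] at hb0 ⊢
      rw [div_mul_cancel₀ _ hb0]) (field_fs' _) x hx (fun d hd => hdx d hd)
    exact ⟨s, hs, by rw [bot_sup_eq, ← pow_two]; exact hs'⟩)
  refine ⟨p c, fun h => hc ((hχ0 c).2 h), ?_⟩
  have := FS_of_LF hfP Fl d c hd hdF p hp (fun l => (hχ0 _).1 (hF l)) (fun x hx => by
    have := hcJ x ((hχ0 x).2 hx); rwa [sup_bot_eq] at this)
  rw [← RingHom.comp_assoc] at this
  rw [← hpi]; exact this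

theorem dim_le_of_gens [IsNoetherianRing L] [IsLocalRing L] (s : Finset L) (n : ℕ) (hn : s.card ≤ n)
    (hs : Ideal.span (s : Set L) = IsLocalRing.maximalIdeal L) : ringKrullDim L ≤ n := by
  refine (ringKrullDim_le_spanFinrank_maximalIdeal L).trans ?_
  rw [← hs]
  have := Submodule.spanFinrank_span_le_ncard_of_finite (R := L) (s := (s : Set L)) s.finite_toSet
  rw [Set.ncard_coe_finset] at this
  exact_mod_cast this.trans hn

theorem dim_ge_quot [IsNoetherianRing L] [IsLocalRing L] (s : Finset L) (n m c : ℕ) (hm : s.card ≤ m)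
    (hc : n = c + m) (hs : (s : Set L) ⊆ IsLocalRing.maximalIdeal L) (hn : n ≤ ringKrullDim L) :
    c ≤ ringKrullDim (L ⧸ Ideal.span (s : Set L)) := by
  have h1 := hn.trans (ringKrullDim_le_ringKrullDim_add_card hs)
  have h2 : ((c + m : ℕ) : WithBot ℕ∞) ≤ ringKrullDim (L ⧸ Ideal.span (s : Set L)) + (m : ℕ) := by
    rw [← hc]; refine h1.trans ?_; gcongr;
  push_cast at h2
  revert h2
  generalize ringKrullDim (L ⧸ Ideal.span (s : Set L)) = a
  intro h2
  induction a with
  | bot => simp at h2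
  | coe a =>
    have h3 : (c : ℕ∞) + m ≤ a + m := by exact_mod_cast h2
    have := (ENat.add_le_add_iff_right (ENat.natCast_ne_top m)).1 h3
    exact_mod_cast this

theorem exists_prime_dim  (n : ℕ) (hn : n ≤ ringKrullDim L) :
    ∃ p : Ideal L, p.IsPrime ∧ n ≤ ringKrullDim (L ⧸ p) := by
  rw [ringKrullDim, Order.le_krullDim_iff] at hn
  obtain ⟨l, hl⟩ := hn
  refine ⟨l.head.asIdeal, l.head.2, ?_⟩
  rw [ringKrullDim_quotient, Order.le_krullDim_iff]
  refine ⟨⟨l.length, fun i => ⟨l i, ?_⟩, fun i => ?_⟩, hl⟩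
  · rw [PrimeSpectrum.mem_zeroLocus]
    exact LTSeries.head_le l i
  · exact l.step i

theorem map_max {L L' : Type u} [CommRing L] [IsLocalRing L] [CommRing L'] [IsLocalRing L'] (f : L →+* L')
    (hf : Function.Surjective f) : (IsLocalRing.maximalIdeal L).map f = IsLocalRing.maximalIdeal L' :=
  IsLocalRing.map_maximalIdeal_of_surjective f hf

theorem reg_domain (n : ℕ) : ∀ {L : Type u} [CommRing L] [IsNoetherianRing L] [IsLocalRing L] (s : Finset L), s.card ≤ n →
    Ideal.span (s : Set L) = IsLocalRing.maximalIdeal L → n ≤ ringKrullDim L → IsDomain L := by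
  classical
  induction n with
  | zero =>
    intro L _ _ _ s hs hm _
    have : s = ∅ := by simpa using hs
    rw [this] at hm
    simp at hm
    have := (IsLocalRing.isField_iff_maximalIdeal_eq).2 hm.symm
    exact this.isDomain
  | succ n ih =>
    intro L _ _ _ s hs hm hn
    by_cases hle : s.card ≤ n
    · have := hn.trans (dim_le_of_gens s n hle hm)
      exact absurd this (by simp; exact_mod_cast Nat.lt_succ_self n)
    have hsm : ∀ x ∈ s, x ∈ IsLocalRing.maximalIdeal L := fun x hx => by rw [← hm]; exact Ideal.subset_span hx
    obtain ⟨t, ht⟩ : s.Nonempty := Finset.card_pos.1 (by omega)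
    -- general facts about quotients killing `t`
    have key : ∀ {L' : Type u} [CommRing L'] [IsLocalRing L'] (f : L →+* L'), Function.Surjective f → f t = 0 →
        ∃ s' : Finset L', s'.card ≤ n ∧ Ideal.span (s' : Set L') = IsLocalRing.maximalIdeal L' := by
      intro L' _ _ f hf h0
      refine ⟨(s.erase t).image f, Finset.card_image_le.trans (by rw [Finset.card_erase_of_mem ht]; omega), ?_⟩
      rw [← map_max f hf, ← hm, Ideal.map_span]
      apply le_antisymm
      · apply Ideal.span_mono; rw [Finset.coe_image]; exact Set.image_mono (by simp)
      · rw [Ideal.span_le]; rintro _ ⟨x, hx, rfl⟩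
        by_cases hxt : x = t
        · subst hxt; rw [h0]; exact zero_mem _
        · exact Ideal.subset_span (by rw [Finset.coe_image]; exact ⟨x, by simp; exact ⟨hx, hxt⟩, rfl⟩)
    have hloc : ∀ I : Ideal L, I ≠ ⊤ → IsLocalRing (L ⧸ I) := fun I hI => by
      haveI := Ideal.Quotient.nontrivial_iff.2 hI
      exact IsLocalRing.of_surjective' _ Ideal.Quotient.mk_surjective
    have hI1 : Ideal.span (({t} : Finset L) : Set L) ≠ ⊤ := by
      intro h
      have h2 : Ideal.span (({t} : Finset L) : Set L) ≤ IsLocalRing.maximalIdeal L := by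
        rw [Ideal.span_le]; intro x hx; simp at hx; subst hx; exact hsm x ht
      rw [h] at h2; exact (IsLocalRing.maximalIdeal.isMaximal L).ne_top (top_le_iff.1 h2)
    haveI := hloc _ hI1
    have ht0 : Ideal.Quotient.mk (Ideal.span (({t} : Finset L) : Set L)) t = 0 := by
      rw [Ideal.Quotient.eq_zero_iff_mem]; exact Ideal.subset_span (by simp)
    have hd1 : IsDomain (L ⧸ Ideal.span (({t} : Finset L) : Set L)) := by
      obtain ⟨s', h1, h2⟩ := key _ Ideal.Quotient.mk_surjective ht0
      exact ih s' h1 h2 (dim_ge_quot {t} (n + 1) 1 n (by simp) rfl (by intro x hx; simp at hx; subst hx; exact hsm x ht) hn)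
    have hdim1 : ringKrullDim (L ⧸ Ideal.span (({t} : Finset L) : Set L)) ≤ n := by
      obtain ⟨s', h1, h2⟩ := key _ Ideal.Quotient.mk_surjective ht0
      exact dim_le_of_gens s' n h1 h2
    obtain ⟨p, hp, hpd⟩ := exists_prime_dim (n + 1) hn
    haveI := hloc p hp.ne_top
    have htp : t ∉ p := by
      intro h
      obtain ⟨s', h1, h2⟩ := key (Ideal.Quotient.mk p) Ideal.Quotient.mk_surjective (Ideal.Quotient.eq_zero_iff_mem.2 h)
      have := hpd.trans (dim_le_of_gens s' n h1 h2)
      exact absurd this (by simp; exact_mod_cast Nat.lt_succ_self n)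
    have hpt : p ≤ Ideal.span (({t} : Finset L) : Set L) := by
      intro x hx
      by_contra hxt
      have h1 := dim_ge_quot (L := L ⧸ p) {Ideal.Quotient.mk p t} (n + 1) 1 n (by simp) rfl (by
        intro y hy; simp at hy; subst hy
        rw [← map_max (Ideal.Quotient.mk p) Ideal.Quotient.mk_surjective]
        exact Ideal.mem_map_of_mem _ (hsm t ht)) hpd
      have hsur : Function.Surjective (Ideal.Quotient.lift (Ideal.span (({t} : Finset L) : Set L))
          ((Ideal.Quotient.mk (Ideal.span (({Ideal.Quotient.mk p t} : Finset (L ⧸ p)) : Set (L ⧸ p)))).comp (Ideal.Quotient.mk p)) (by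
            intro a ha
            rw [Finset.coe_singleton, Ideal.mem_span_singleton] at ha
            obtain ⟨b, rfl⟩ := ha
            rw [RingHom.comp_apply, Ideal.Quotient.eq_zero_iff_mem, map_mul]
            exact Ideal.mul_mem_right _ _ (Ideal.subset_span (by simp)))) := by
        apply Ideal.Quotient.lift_surjective_of_surjective
        exact Ideal.Quotient.mk_surjective.comp Ideal.Quotient.mk_surjective
      have h2 := ringKrullDim_succ_le_of_surjective _ hsur (r := Ideal.Quotient.mk _ x) (mem_nonZeroDivisors_of_ne_zero (by
        rw [Ne, Ideal.Quotient.eq_zero_iff_mem]; exact hxt)) (by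
          rw [Ideal.Quotient.lift_mk, RingHom.comp_apply, Ideal.Quotient.eq_zero_iff_mem.2 hx, map_zero])
      have h3 := (add_le_add_left h1 1).trans (h2.trans hdim1)
      have h4 : ((n + 1 : ℕ) : WithBot ℕ∞) ≤ n := by push_cast; exact h3
      exact absurd h4 (by simp; exact_mod_cast Nat.lt_succ_self n)
    have hp0 : p = ⊥ := by
      refine Submodule.eq_bot_of_le_smul_of_le_jacobson_bot (IsLocalRing.maximalIdeal L) p (IsNoetherian.noetherian p) ?_ (IsLocalRing.maximalIdeal_le_jacobson _)
      intro x hx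
      have := hpt hx
      rw [Finset.coe_singleton, Ideal.mem_span_singleton] at this
      obtain ⟨y, rfl⟩ := this
      have hy := (hp.mem_or_mem hx).resolve_left htp
      exact Submodule.smul_mem_smul (hsm t ht) hy
    rw [hp0] at hp
    have : NoZeroDivisors L := ⟨fun {a b} h => by
      rcases hp.mem_or_mem (show a * b ∈ (⊥ : Ideal L) by rw [h]; exact zero_mem _) with h | h
      · exact Or.inl h
      · exact Or.inr h⟩
    exact NoZeroDivisors.to_isDomain L

/-- parameters of a regular local ring are independent in any order -/
theorem reg_nzd [IsNoetherianRing L] [IsLocalRing L] (s : Finset L)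
    (hs : Ideal.span (s : Set L) = IsLocalRing.maximalIdeal L) (hn : s.card ≤ ringKrullDim L) (S : Finset L) (hS : S ⊆ s)
    (t : L) (ht : t ∈ s) (htS : t ∉ S) (x : L) (hx : t * x ∈ Ideal.span (S : Set L)) : x ∈ Ideal.span (S : Set L) := by
  classical
  have hsm : ∀ x ∈ s, x ∈ IsLocalRing.maximalIdeal L := fun x hx => by rw [← hs]; exact Ideal.subset_span hx
  have hI : Ideal.span (S : Set L) ≠ ⊤ := by
    intro h
    have h2 : Ideal.span (S : Set L) ≤ IsLocalRing.maximalIdeal L := by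
      rw [Ideal.span_le]; intro x hx; exact hsm x (hS hx)
    rw [h] at h2; exact (IsLocalRing.maximalIdeal.isMaximal L).ne_top (top_le_iff.1 h2)
  haveI := Ideal.Quotient.nontrivial_iff.2 hI
  haveI : IsLocalRing (L ⧸ Ideal.span (S : Set L)) := IsLocalRing.of_surjective' _ Ideal.Quotient.mk_surjective
  have hle : Ideal.span (((s \ S).image (Ideal.Quotient.mk (Ideal.span (S : Set L))) : Finset _) : Set (L ⧸ Ideal.span (S : Set L))) = IsLocalRing.maximalIdeal _ := by
    rw [← map_max (Ideal.Quotient.mk (Ideal.span (S : Set L))) Ideal.Quotient.mk_surjective, ← hs, Ideal.map_span]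
    apply le_antisymm
    · apply Ideal.span_mono; rw [Finset.coe_image]; exact Set.image_mono (by simp)
    · rw [Ideal.span_le]; rintro _ ⟨x, hx, rfl⟩
      by_cases hxt : x ∈ S
      · rw [Ideal.Quotient.eq_zero_iff_mem.2 (Ideal.subset_span hxt)]; exact zero_mem _
      · exact Ideal.subset_span (by rw [Finset.coe_image]; exact ⟨x, by simp; exact ⟨hx, hxt⟩, rfl⟩)
  have hcard : s.card = (s \ S).card + S.card := by rw [Finset.card_sdiff_add_card_eq_card hS]
  have hdim := dim_ge_quot S s.card S.card (s \ S).card le_rfl hcard (fun x hx => hsm x (hS hx)) hn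
  have hdom := reg_domain (s \ S).card _ Finset.card_image_le hle hdim
  rw [← Ideal.Quotient.eq_zero_iff_mem, map_mul] at hx
  rcases mul_eq_zero.1 hx with h | h
  · exfalso
    have h1 : Ideal.span ((((s \ S).erase t).image (Ideal.Quotient.mk (Ideal.span (S : Set L))) : Finset _) : Set (L ⧸ Ideal.span (S : Set L))) = IsLocalRing.maximalIdeal _ := by
      rw [← hle]
      apply le_antisymm
      · apply Ideal.span_mono; rw [Finset.coe_image, Finset.coe_image]; exact Set.image_mono (by simp)
      · rw [Ideal.span_le]; intro y hy
        rw [Finset.coe_image] at hy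
        obtain ⟨x, hx, rfl⟩ := hy
        by_cases hxt : x = t
        · rw [hxt, h]; exact zero_mem _
        · exact Ideal.subset_span (by rw [Finset.coe_image]; exact ⟨x, by simp at hx ⊢; exact ⟨hx, hxt⟩, rfl⟩)
    have htm : t ∈ s \ S := Finset.mem_sdiff.2 ⟨ht, htS⟩
    have h2 := hdim.trans (dim_le_of_gens _ ((s \ S).card - 1) (Finset.card_image_le.trans (by rw [Finset.card_erase_of_mem htm])) h1)
    have h3 : (s \ S).card ≤ (s \ S).card - 1 := by exact_mod_cast h2
    have := Finset.card_pos.2 ⟨t, htm⟩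
    omega
  · exact Ideal.Quotient.eq_zero_iff_mem.1 h

theorem po_tensor  (a : F →+* K) (α : F →+* R) :
    letI := a.toAlgebra
    letI := α.toAlgebra
    PO a α (algebraMap K (TensorProduct F K R)) (Algebra.TensorProduct.includeRight : R →ₐ[F] TensorProduct F K R) := by
  letI := a.toAlgebra
  letI := α.toAlgebra
  refine ⟨?_, ?_, ?_⟩
  · ext x
    have h1 := (Algebra.TensorProduct.includeRight : R →ₐ[F] TensorProduct F K R).commutes x
    have h2 := (Algebra.TensorProduct.includeLeft : K →ₐ[F] TensorProduct F K R).commutes x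
    exact h2.trans h1.symm
  · intro T _ p q h
    letI : Algebra F T := (p.comp a).toAlgebra
    let p' : K →ₐ[F] T := { p with commutes' := fun x => rfl }
    let q' : R →ₐ[F] T := { q with commutes' := fun x => (RingHom.congr_fun h x).symm }
    refine ⟨(Algebra.TensorProduct.lift p' q' (fun _ _ => Commute.all _ _)).toRingHom, ?_, ?_⟩
    · ext x; exact (Algebra.TensorProduct.lift_tmul p' q' (fun _ _ => Commute.all _ _) x 1).trans (by rw [map_one, mul_one]; rfl)
    · ext x; exact (Algebra.TensorProduct.lift_tmul p' q' (fun _ _ => Commute.all _ _) 1 x).trans (by rw [map_one, one_mul]; rfl)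
  · intro T _ γ γ' h1 h2
    apply RingHom.ext
    intro y
    induction y using TensorProduct.induction_on with
    | zero => simp
    | add x y hx hy => rw [map_add, map_add, hx, hy]
    | tmul x y =>
      have e : x ⊗ₜ[F] y = (x ⊗ₜ[F] 1) * (1 ⊗ₜ[F] y) := by simp
      rw [e, map_mul, map_mul]
      congr 1
      · exact RingHom.congr_fun h1 x
      · exact RingHom.congr_fun h2 y

theorem exists_po  (a : F →+* K) (α : F →+* R) :
    ∃ (B : Type u) (_ : CommRing B) (l : K →+* B) (r : R →+* B), PO a α l r ∧ (α.FiniteType → l.FiniteType) ∧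
      ∀ {J : Type} [Fintype J] (s : J → R), (∀ x, ∃ c : J → F, x = ∑ j, α (c j) * s j) →
        ∀ y, ∃ c : J → K, y = ∑ j, l (c j) * r (s j) := by
  letI := a.toAlgebra
  letI := α.toAlgebra
  refine ⟨TensorProduct F K R, inferInstance, algebraMap K (TensorProduct F K R), (Algebra.TensorProduct.includeRight : R →ₐ[F] TensorProduct F K R), po_tensor a α, ?_, ?_⟩
  · intro h
    haveI : Algebra.FiniteType F R := h
    exact (RingHom.finiteType_algebraMap (A := K) (B := TensorProduct F K R)).2 inferInstance
  · intro J _ s hs y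
    induction y using TensorProduct.induction_on with
    | zero => exact ⟨fun _ => 0, by simp⟩
    | add x y hx hy =>
      obtain ⟨c, hc⟩ := hx
      obtain ⟨d, hd⟩ := hy
      refine ⟨fun j => c j + d j, ?_⟩
      rw [hc, hd, ← Finset.sum_add_distrib]; simp [TensorProduct.add_tmul, add_mul]
    | tmul x y =>
      obtain ⟨c, hc⟩ := hs y
      refine ⟨fun j => x * a (c j), ?_⟩
      rw [hc, TensorProduct.tmul_sum]
      apply Finset.sum_congr rfl
      intro j _
      have e : α (c j) * s j = c j • s j := rfl
      have e2 : x * a (c j) = c j • x := by rw [mul_comm]; rfl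
      beta_reduce
      rw [e, e2, TensorProduct.tmul_smul]
      show _ = (c j • x) ⊗ₜ[F] (1 : R) * (1 : K) ⊗ₜ[F] s j
      rw [Algebra.TensorProduct.tmul_mul_tmul, mul_one, one_mul, TensorProduct.smul_tmul']

/-- hypothesis on coefficient fields -/
def CF {F k K : Type u} [Field F] [Field k] [Field K] (e : F →+* k) (kK : k →+* K) : Prop :=
  ∀ n : ℕ, ∃ (k' : Type u) (_ : Field k') (e' : F →+* k') (ik : k' →+* k), ik.FiniteType ∧ ik.comp e' = e ∧
    ∀ (L : Type u) [CommRing L] (χ : L →+* K) (lam : k →+* L), Function.Surjective χ → (RingHom.ker χ) ^ n = ⊥ → χ.comp lam = kK →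
      ∃ σ : K →+* L, χ.comp σ = RingHom.id K ∧ ∀ x, ∃ y, lam (ik x) = σ y

theorem base_field {F k K R Q L : Type u} [Field F] [PerfectField F] [Field k] [Field K] [CommRing R] [CommRing Q] [CommRing L]
    (e : F →+* k) (kK : k →+* K) (hCF : CF e kK) (f : R →+* Q) (lam : Q →+* L) (α : F →+* R) (β : k →+* Q) (hβ : β.FiniteType)
    (hαβ : f.comp α = β.comp e) (χ : L →+* K) (hχ : χ.comp (lam.comp β) = kK) (hχs : Function.Surjective χ)
    {J : Type} [Fintype J] (r : J → R) (hr : ∀ x, ∃ c : J → F, x = ∑ j, α (c j) * r j) (hnil : ∃ n, (RingHom.ker χ) ^ n = ⊥)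
    (hgen : ∀ σ : K → L, (∀ x, χ (σ x) = x) → ∀ x, ∃ c : J → K, x = ∑ j, σ (c j) * lam (f (r j)))
    (hind : ∀ u : J → L, (∀ j, u j = 0 ∨ χ (u j) ≠ 0) → ∑ j, u j * lam (f (r j)) = 0 → ∀ j, u j = 0) : BaseP f lam := by
  classical
  intro A _ i ψ hi hψ
  obtain ⟨n, hn⟩ := hnil
  obtain ⟨k', _, e', ik, hik, he', hσ⟩ := hCF n
  obtain ⟨σ, hσ1, hσ2⟩ := hσ L χ (lam.comp β) hχs hn hχ
  have hσ1' : ∀ x, χ (σ x) = x := fun x => RingHom.congr_fun hσ1 x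
  have hσ3 : ∀ x, σ (kK (ik x)) = lam (β (ik x)) := by
    intro x
    obtain ⟨y, hy⟩ := hσ2 x
    rw [← hχ]; simp only [RingHom.comp_apply] at hy ⊢; rw [hy, hσ1']
  have hft : ((i.comp β).comp ik).FiniteType := (hi.comp hβ).comp hik
  obtain ⟨m, p, hp, hpi⟩ := exists_presentation _ hft
  choose c hc using fun l : Fin m => hgen σ hσ1' (ψ (p (X l)))
  -- the ring K0
  letI : Algebra k' K := (kK.comp ik).toAlgebra
  obtain ⟨K0, hK0⟩ : ∃ K0 : Subalgebra k' K, K0 = Algebra.adjoin k' (Set.range (fun z : Fin m × J => c z.1 z.2)) := ⟨_, rfl⟩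
  have hK0ft : (algebraMap k' K0).FiniteType := by
    rw [RingHom.finiteType_algebraMap, ← Subalgebra.fg_iff_finiteType, hK0]
    exact ⟨(Set.finite_range (fun z : Fin m × J => c z.1 z.2)).toFinset, by simp⟩
  obtain ⟨b, hb0, hb⟩ := gen_smooth e' (algebraMap k' K0) hK0ft (algebraMap K0 K) Subtype.val_injective
  have hbK : (b : K) ≠ 0 := by simpa using hb0
  obtain ⟨K1, _, l1, μ, hl1, hl1b, hμ, hμi, hl1ft⟩ : ∃ (K1 : Type u) (_ : CommRing K1) (l1 : K0 →+* K1) (μ : K1 →+* K),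
      FS (l1.comp ((algebraMap k' K0).comp e')) 1 ∧ True ∧ μ.comp l1 = algebraMap K0 K ∧ Function.Injective μ ∧ l1.FiniteType := by
    refine ⟨Localization.Away b, inferInstance, algebraMap _ _, IsLocalization.Away.lift (g := algebraMap K0 K) b (isUnit_iff_ne_zero.2 hbK), hb.to_away, trivial,
      IsLocalization.Away.lift_comp _ _, ?_, ?_⟩
    · rw [IsLocalization.Away.lift, IsLocalization.lift_injective_iff]
      intro x y
      rw [(IsLocalization.injective (Localization.Away b) (M := Submonoid.powers b) (powers_le_nonZeroDivisors_of_noZeroDivisors hb0)).eq_iff]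
      exact (Subtype.val_injective.eq_iff).symm
    · rw [RingHom.finiteType_algebraMap]
      exact IsLocalization.finiteType_of_monoid_fg (Submonoid.powers b) _
  obtain ⟨a1, ha1⟩ : ∃ a1, a1 = l1.comp ((algebraMap k' K0).comp e') := ⟨_, rfl⟩
  obtain ⟨B, _, inl, inr, hPO, hinlft, hspan⟩ := exists_po a1 α
  have hinl : inl.FiniteType := hinlft (by
    letI := α.toAlgebra
    haveI : Module.Finite F R := ⟨⟨Finset.univ.image r, by
      rw [eq_top_iff]; intro x _
      obtain ⟨c, hc⟩ := hr x
      rw [hc]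
      exact Submodule.sum_mem _ (fun j _ => Submodule.smul_mem _ (c j) (Submodule.subset_span (by simp)))⟩⟩
    have : Algebra.FiniteType F R := inferInstance
    exact this)
  have hμl : ∀ x, μ (l1 x) = (x : K) := fun x => RingHom.congr_fun hμ x
  obtain ⟨θ, hθ1, hθ2⟩ := hPO.univ L (σ.comp μ) (lam.comp f) (by
    apply RingHom.ext; intro x
    have h1 := RingHom.congr_fun hαβ x
    simp only [RingHom.comp_apply] at h1 ⊢
    rw [h1, ha1, ← he']
    simp only [RingHom.comp_apply]
    rw [← hσ3, hμl]; rfl)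
  have hθ1' : ∀ x, θ (inl x) = σ (μ x) := fun x => RingHom.congr_fun hθ1 x
  have hθ2' : ∀ x, θ (inr x) = lam (f x) := fun x => RingHom.congr_fun hθ2 x
  have hθi : Function.Injective θ := by
    rw [injective_iff_map_eq_zero]
    intro y hy
    obtain ⟨d, rfl⟩ := hspan r hr y
    rw [map_sum] at hy
    have h2 := hind (fun j => σ (μ (d j))) (fun j => by
      by_cases h : μ (d j) = 0
      · left; rw [h, map_zero]
      · right; rwa [hσ1']) (by rw [← hy]; exact Finset.sum_congr rfl (fun j _ => by rw [map_mul, hθ1', hθ2']))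
    apply Finset.sum_eq_zero
    intro j _
    have h3 : d j = 0 := hμi (by rw [← hσ1' (μ (d j)), h2 j, map_zero, map_zero])
    rw [h3, map_zero, zero_mul]
  have hk1 : ∀ x, θ (inl (l1 (algebraMap k' K0 x))) = ψ (i (β (ik x))) := by
    intro x
    rw [hθ1', hμl, ← RingHom.comp_apply ψ, hψ, ← hσ3]; rfl
  have hrange : ∀ y, ψ y ∈ θ.range := by
    intro y
    obtain ⟨y, rfl⟩ := hp y
    induction y using MvPolynomial.induction_on with
    | C a =>
      refine ⟨_, (hk1 a).trans ?_⟩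
      have := RingHom.congr_fun hpi a
      simp only [RingHom.comp_apply] at this
      rw [this]
    | add x y hx hy => rw [map_add, map_add]; exact add_mem hx hy
    | mul_X x l hx =>
      rw [map_mul, map_mul]
      refine mul_mem hx ?_
      rw [hc l]
      refine sum_mem (fun j _ => mul_mem ⟨inl (l1 ⟨c l j, ?_⟩), ?_⟩ ⟨inr (r j), hθ2' _⟩)
      · rw [hK0]; exact Algebra.subset_adjoin ⟨(l, j), rfl⟩
      · rw [hθ1', hμl]
  obtain ⟨j, hj⟩ : ∃ j : A →+* B, θ.comp j = ψ := by
    let E := RingEquiv.ofLeftInverse (Function.leftInverse_invFun hθi)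
    refine ⟨(E.symm : θ.range →+* B).comp (ψ.codRestrict θ.range hrange), ?_⟩
    apply RingHom.ext
    intro x
    have := E.apply_symm_apply (ψ.codRestrict θ.range hrange x)
    exact congrArg Subtype.val this
  have hj' : ∀ x, θ (j x) = ψ x := fun x => RingHom.congr_fun hj x
  refine ⟨B, inferInstance, j, θ, ?_, hj, ?_⟩
  · apply RingHom.FiniteType.of_comp_finiteType (f := (i.comp β).comp ik)
    have : j.comp ((i.comp β).comp ik) = (inl.comp l1).comp (algebraMap k' K0) := by
      apply RingHom.ext; intro x; apply hθi
      simp only [RingHom.comp_apply]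
      rw [hj', hk1]
    rw [this]
    exact (hinl.comp hl1ft).comp hK0ft
  · have : (j.comp i).comp f = inr := by
      apply RingHom.ext; intro x; apply hθi
      simp only [RingHom.comp_apply]
      rw [hj', hθ2', ← RingHom.comp_apply ψ, hψ]
    rw [this]
    have h := hPO.fs (b := 1) (by rw [ha1]; exact hl1)
    rwa [map_one] at h

theorem gen_step {L K J : Type*} [CommRing L] [Fintype J] (σ : K → L) (ρ : J → L) (I : Ideal L) (t : L)
    (h : ∀ x, ∃ c : J → K, ∃ y ∈ I, ∃ z, x - ∑ j, σ (c j) * ρ j = y + t * z) (N : ℕ) :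
    ∀ x, ∃ c : ℕ → J → K, ∃ y ∈ I, ∃ z, x - ∑ a ∈ Finset.range N, ∑ j, σ (c a j) * (ρ j * t ^ a) = y + t ^ N * z := by
  induction N with
  | zero =>
    intro x
    obtain ⟨c, -⟩ := h x
    exact ⟨fun _ => c, 0, I.zero_mem, x, by simp⟩
  | succ N ih =>
    intro x
    obtain ⟨c, y, hy, z, hz⟩ := h x
    obtain ⟨d, y', hy', z', hz'⟩ := ih z
    refine ⟨fun a => Nat.casesOn a c d, y + t * y', I.add_mem hy (I.mul_mem_left _ hy'), z', ?_⟩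
    rw [Finset.sum_range_succ']
    have e : ∑ a ∈ Finset.range N, ∑ j, σ (d a j) * (ρ j * t ^ (a+1)) = t * ∑ a ∈ Finset.range N, ∑ j, σ (d a j) * (ρ j * t ^ a) := by
      simp only [Finset.mul_sum]
      exact Finset.sum_congr rfl fun a _ => Finset.sum_congr rfl fun j _ => by ring
    simp only [pow_zero, mul_one]
    rw [e]
    linear_combination hz + t * hz'

theorem ind_step {L J : Type*} [CommRing L] [Fintype J] (ρ : J → L) (I : Ideal L) (t : L) (P : L → Prop)
    (h : ∀ u : J → L, (∀ j, P (u j)) → ∀ y ∈ I, ∀ z, ∑ j, u j * ρ j = y + t * z → ∀ j, u j = 0)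
    (hnz : ∀ x, t * x ∈ I → x ∈ I) (N : ℕ) :
    ∀ u : ℕ → J → L, (∀ a j, P (u a j)) → ∀ y ∈ I, ∀ z, ∑ a ∈ Finset.range N, ∑ j, u a j * (ρ j * t ^ a) = y + t ^ N * z →
      ∀ a < N, ∀ j, u a j = 0 := by
  induction N with
  | zero => intro u hu y hy z _ a ha; omega
  | succ N ih =>
    intro u hu y hy z hz
    rw [Finset.sum_range_succ'] at hz
    have e : ∑ a ∈ Finset.range N, ∑ j, u (a+1) j * (ρ j * t ^ (a+1)) = t * ∑ a ∈ Finset.range N, ∑ j, u (a+1) j * (ρ j * t ^ a) := by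
      simp only [Finset.mul_sum]
      exact Finset.sum_congr rfl fun a _ => Finset.sum_congr rfl fun j _ => by ring
    rw [e] at hz
    simp only [pow_zero, mul_one] at hz
    have h0 := h (u 0) (hu 0) y hy (t ^ N * z - ∑ a ∈ Finset.range N, ∑ j, u (a+1) j * (ρ j * t ^ a)) (by linear_combination hz)
    have h1 : ∑ j, u 0 j * ρ j = 0 := Finset.sum_eq_zero fun j _ => by rw [h0 j, zero_mul]
    rw [h1] at hz
    have h2 := hnz (∑ a ∈ Finset.range N, ∑ j, u (a+1) j * (ρ j * t ^ a) - t ^ N * z) (by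
      have : t * (∑ a ∈ Finset.range N, ∑ j, u (a+1) j * (ρ j * t ^ a) - t ^ N * z) = y := by linear_combination hz
      rwa [this])
    have h3 := ih (fun a => u (a+1)) (fun a => hu (a+1)) _ h2 z (by ring)
    intro a ha j
    cases a with
    | zero => exact h0 j
    | succ a => exact h3 a (by omega) j

theorem nzd_step {L : Type*} [CommRing L] (I : Ideal L) (t s : L) (h1 : ∀ x, t * x ∈ I → x ∈ I)
    (h2 : ∀ x y z, y ∈ I → s * x = y + t * z → ∃ y' ∈ I, ∃ z', x = y' + t * z') (N : ℕ) :
    ∀ x y z, y ∈ I → s * x = y + t ^ N * z → ∃ y' ∈ I, ∃ z', x = y' + t ^ N * z' := by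
  induction N with
  | zero => intro x y z _ _; exact ⟨0, I.zero_mem, x, by simp⟩
  | succ N ih =>
    intro x y z hy h
    obtain ⟨y', hy', z', rfl⟩ := h2 x y (t ^ N * z) hy (by rw [h]; ring)
    have h3 := h1 (s * z' - t ^ N * z) (by
      have : t * (s * z' - t ^ N * z) = y - s * y' := by linear_combination h
      rw [this]; exact I.sub_mem hy (I.mul_mem_left _ hy'))
    obtain ⟨y2, hy2, z2, rfl⟩ := ih z' _ z h3 (by ring)
    exact ⟨y' + t * y2, I.add_mem hy' (I.mul_mem_left _ hy2), z2, by ring⟩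

theorem trunc_span  {N : ℕ} {p : Polynomial R →+* R'} (h : Trunc N p) (x : Polynomial R) :
    p x = ∑ a ∈ Finset.range N, p (Polynomial.C (x.coeff a) * Polynomial.X ^ a) := by
  rw [← map_sum, ← sub_eq_zero, ← map_sub, h.ker, Polynomial.X_pow_dvd_iff]
  intro d hd
  simp [Polynomial.finset_sum_coeff, Polynomial.coeff_C_mul, Polynomial.coeff_X_pow, hd]

theorem mem_map_span  {ι : Type} (t : ι → L) (pL : L →+* L') (hp : Function.Surjective pL) {t0 : L}
    (hk : ∀ x, pL x = 0 ↔ t0 ∣ x) (S : Set ι) (x : L) :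
    pL x ∈ Ideal.span ((fun i => pL (t i)) '' S) ↔ ∃ y ∈ Ideal.span (t '' S), ∃ z, x = y + t0 * z := by
  have e : (fun i => pL (t i)) '' S = pL '' (t '' S) := by rw [Set.image_image]
  rw [e, ← Ideal.map_span, Ideal.mem_map_iff_of_surjective pL hp]
  constructor
  · rintro ⟨y, hy, h⟩
    obtain ⟨z, hz⟩ := (hk (x - y)).1 (by rw [map_sub, h, sub_self])
    exact ⟨y, hy, z, by linear_combination hz⟩
  · rintro ⟨y, hy, z, rfl⟩
    refine ⟨y, hy, ?_⟩
    have := (hk (t0 * z)).2 (dvd_mul_right _ _)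
    rw [map_add, this, add_zero]

theorem mem_span_ins  {ι : Type} (t : ι → L) (i0 : ι) (S : Set ι) (x : L) :
    x ∈ Ideal.span (t '' (insert i0 S)) ↔ ∃ y ∈ Ideal.span (t '' S), ∃ z, x = y + t i0 * z := by
  rw [Set.image_insert_eq, Ideal.mem_span_insert]
  constructor
  · rintro ⟨a, z, hz, rfl⟩; exact ⟨z, hz, a, by ring⟩
  · rintro ⟨y, hy, z, rfl⟩; exact ⟨z, y, hy, by ring⟩

theorem bh_field {F k K : Type u} [Field F] [PerfectField F] [Field k] [Field K]
    (e : F →+* k) (kK : k →+* K) (hCF : CF e kK) {ι : Type} (idx : List ι) : idx.Nodup →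
    ∀ {R Q L : Type u} [CommRing R] [CommRing Q] [CommRing L] (f : R →+* Q) (lam : Q →+* L) (α : F →+* R) (β : k →+* Q), β.FiniteType →
    f.comp α = β.comp e → ∀ (χ : L →+* K), χ.comp (lam.comp β) = kK → Function.Surjective χ → (∀ x, χ x ≠ 0 → IsUnit x) →
    ∀ (t : ι → L), (∀ i ∈ idx, χ (t i) = 0) →
    ∀ {J : Type} [Fintype J] (r : J → R), (∀ x, ∃ c : J → F, x = ∑ j, α (c j) * r j) →
    (∃ n, (RingHom.ker χ) ^ n ≤ Ideal.span (t '' {i | i ∈ idx})) →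
    (∀ σ : K → L, (∀ x, χ (σ x) = x) → ∀ x, ∃ c : J → K, x - ∑ j, σ (c j) * lam (f (r j)) ∈ Ideal.span (t '' {i | i ∈ idx})) →
    (∀ u : J → L, (∀ j, u j = 0 ∨ χ (u j) ≠ 0) → ∑ j, u j * lam (f (r j)) ∈ Ideal.span (t '' {i | i ∈ idx}) → ∀ j, u j = 0) →
    (∀ S : Set ι, S ⊆ {i | i ∈ idx} → ∀ i ∈ idx, i ∉ S → ∀ x, t i * x ∈ Ideal.span (t '' S) → x ∈ Ideal.span (t '' S)) →
    BH f lam (idx.map t) := by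
  induction idx with
  | nil =>
    intro _ R Q L _ _ _ f lam α β hβ hαβ χ hχ hχs hu t _ J _ r hr hnil hgen hind _
    have e0 : Ideal.span (t '' {i | i ∈ ([] : List ι)}) = ⊥ := by simp
    rw [e0] at hnil hgen hind
    obtain ⟨n, hn⟩ := hnil
    refine BH.nil f lam ?_ ?_
    · intro x
      by_cases hx : χ x = 0
      · right
        refine ⟨n, ?_⟩
        have := hn (Ideal.pow_mem_pow ((RingHom.mem_ker).2 hx) n)
        simpa using this
      · left; exact hu x hx
    · refine base_field e kK hCF f lam α β hβ hαβ χ hχ hχs r hr ⟨n, le_bot_iff.1 hn⟩ ?_ ?_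
      · intro σ hσ x
        obtain ⟨c, hc⟩ := hgen σ hσ x
        exact ⟨c, sub_eq_zero.1 (by simpa using hc)⟩
      · intro u hu h; exact hind u hu (by rw [h]; exact zero_mem _)
  | cons i0 l ih =>
    intro hnd R Q L _ _ _ f lam α β hβ hαβ χ hχ hχs hu t htχ J _ r hr hnil hgen hind hG
    have eset : {i | i ∈ i0 :: l} = insert i0 {i | i ∈ l} := by ext; simp
    rw [eset] at hnil hgen hind hG
    rw [List.nodup_cons] at hnd
    refine BH.cons f lam (t i0) _ ?_
    intro N hN R' Q' L' _ _ _ pR pQ pL f' lam' hR hQ hpL hker hf' hlam'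
    rw [List.map_map]
    have hf'' : ∀ x, f' (pR x) = pQ (Polynomial.mapRingHom f x) := fun x => RingHom.congr_fun hf' x
    have hlam'' : ∀ x, lam' (pQ x) = pL (Polynomial.eval₂RingHom lam (t i0) x) := fun x => RingHom.congr_fun hlam' x
    have ht0 : χ (t i0) = 0 := htχ i0 (by simp)
    obtain ⟨χ', hχ'⟩ := exists_factor pL hpL χ (by
      intro x hx
      obtain ⟨z, rfl⟩ := (hker x).1 hx
      rw [map_mul, map_pow, ht0, zero_pow hN.ne', zero_mul])
    have hχ'' : ∀ x, χ' (pL x) = χ x := fun x => RingHom.congr_fun hχ' x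
    have hρ : ∀ (j : J) (a : ℕ), lam' (f' (pR (Polynomial.C (r j) * Polynomial.X ^ a))) = pL (lam (f (r j)) * t i0 ^ a) := by
      intro j a
      rw [hf'', hlam'']
      simp
    have hnz : ∀ x, t i0 * x ∈ Ideal.span (t '' {i | i ∈ l}) → x ∈ Ideal.span (t '' {i | i ∈ l}) :=
      hG _ (Set.subset_insert _ _) i0 (by simp) hnd.1
    refine ih hnd.2 f' lam' ((pR.comp Polynomial.C).comp α) ((pQ.comp Polynomial.C).comp β) ?_ ?_ χ' ?_ ?_ ?_ (fun i => pL (t i)) ?_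
      (J := J × Fin N) (fun z => pR (Polynomial.C (r z.1) * Polynomial.X ^ (z.2 : ℕ))) ?_ ?_ ?_ ?_ ?_
    · refine RingHom.FiniteType.comp (RingHom.FiniteType.comp (RingHom.FiniteType.of_surjective _ hQ.surj) ?_) hβ
      have : (algebraMap Q (Polynomial Q)).FiniteType := (RingHom.finiteType_algebraMap).2 inferInstance
      exact this
    · apply RingHom.ext; intro x
      have := RingHom.congr_fun hαβ x
      simp only [RingHom.comp_apply] at this ⊢
      rw [hf'', ← this]; simp
    · apply RingHom.ext; intro x
      rw [← hχ]
      simp only [RingHom.comp_apply]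
      rw [hlam'', hχ'']; simp
    · intro x
      obtain ⟨y, hy⟩ := hχs x
      exact ⟨pL y, by rw [hχ'', hy]⟩
    · intro x hx
      obtain ⟨y, rfl⟩ := hpL x
      rw [hχ''] at hx
      exact (hu y hx).map pL
    · intro i hi
      show χ' (pL (t i)) = 0
      rw [hχ'', htχ i (List.mem_cons_of_mem _ hi)]
    · intro x
      obtain ⟨y, rfl⟩ := hR.surj x
      choose c hc using fun a => hr (y.coeff a)
      refine ⟨fun z => c z.2 z.1, ?_⟩
      rw [trunc_span hR, Fintype.sum_prod_type_right, ← Fin.sum_univ_eq_sum_range (fun a => pR (Polynomial.C (y.coeff a) * Polynomial.X ^ a))]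
      refine Finset.sum_congr rfl fun a _ => ?_
      rw [hc a, map_sum, Finset.sum_mul, map_sum]
      refine Finset.sum_congr rfl fun j _ => ?_
      simp [mul_assoc]
    · obtain ⟨n, hn⟩ := hnil
      refine ⟨n * (1 + N), ?_⟩
      have e1 : RingHom.ker χ' = (RingHom.ker χ).map pL := by
        ext x
        obtain ⟨x, rfl⟩ := hpL x
        rw [RingHom.mem_ker, hχ'', Ideal.mem_map_iff_of_surjective pL hpL]
        constructor
        · intro h; exact ⟨x, h, rfl⟩
        · rintro ⟨y, hy, h⟩; rw [← hχ'', ← h, hχ'']; exact hy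
      rw [e1, ← Ideal.map_pow, Ideal.map_le_iff_le_comap]
      have e2 : Ideal.span (t '' insert i0 {i | i ∈ l}) = Ideal.span (t '' {i | i ∈ l}) ⊔ Ideal.span {t i0} := by
        rw [Set.image_insert_eq, Ideal.span_insert, sup_comm]
      rw [e2] at hn
      rw [pow_mul]
      refine (Ideal.pow_right_mono hn _).trans (Ideal.sup_pow_add_le_pow_sup_pow.trans ?_)
      rw [pow_one, Ideal.span_singleton_pow]
      intro x hx
      obtain ⟨y, hy, z, hz, rfl⟩ := Submodule.mem_sup.1 hx
      obtain ⟨z, rfl⟩ := Ideal.mem_span_singleton.1 hz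
      rw [Ideal.mem_comap, mem_map_span t pL hpL hker]
      exact ⟨y, hy, z, rfl⟩
    · intro σ' hσ' x
      choose σ hσ using fun y => hpL (σ' y)
      obtain ⟨x, rfl⟩ := hpL x
      obtain ⟨c, y, hy, z, hz⟩ := gen_step σ (fun j => lam (f (r j))) (Ideal.span (t '' {i | i ∈ l})) (t i0) (fun x => by
        obtain ⟨c, hc⟩ := hgen σ (fun y => by rw [← hχ'', hσ, hσ']) x
        exact ⟨c, (mem_span_ins _ _ _ _).1 hc⟩) N x
      refine ⟨fun w => c w.2 w.1, ?_⟩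
      have e1 : ∑ w : J × Fin N, σ' (c w.2 w.1) * lam' (f' (pR (Polynomial.C (r w.1) * Polynomial.X ^ (w.2 : ℕ)))) =
          pL (∑ a ∈ Finset.range N, ∑ j, σ (c a j) * (lam (f (r j)) * t i0 ^ a)) := by
        rw [Fintype.sum_prod_type_right, ← Fin.sum_univ_eq_sum_range (fun a => ∑ j, σ (c a j) * (lam (f (r j)) * t i0 ^ a)), map_sum]
        refine Finset.sum_congr rfl fun a _ => ?_
        rw [map_sum]
        refine Finset.sum_congr rfl fun j _ => ?_
        rw [hρ, map_mul pL (σ _), hσ]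
      beta_reduce
      rw [e1, ← map_sub, mem_map_span t pL hpL hker]
      exact ⟨y, hy, z, hz⟩
    · intro u hu0 h
      have : ∀ (a : ℕ) (j : J), ∃ v : L, (∀ h : a < N, pL v = u (j, ⟨a, h⟩)) ∧ (v = 0 ∨ χ v ≠ 0) := by
        intro a j
        by_cases ha : a < N
        · rcases hu0 (j, ⟨a, ha⟩) with h0 | h0
          · exact ⟨0, fun _ => by rw [h0, map_zero], Or.inl rfl⟩
          · obtain ⟨v, hv⟩ := hpL (u (j, ⟨a, ha⟩))
            exact ⟨v, fun _ => hv, Or.inr (by rwa [← hχ'', hv])⟩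
        · exact ⟨0, fun h => absurd h ha, Or.inl rfl⟩
      choose v hv1 hv2 using this
      have e1 : ∑ w : J × Fin N, u w * lam' (f' (pR (Polynomial.C (r w.1) * Polynomial.X ^ (w.2 : ℕ)))) =
          pL (∑ a ∈ Finset.range N, ∑ j, v a j * (lam (f (r j)) * t i0 ^ a)) := by
        rw [Fintype.sum_prod_type_right, ← Fin.sum_univ_eq_sum_range (fun a => ∑ j, v a j * (lam (f (r j)) * t i0 ^ a)), map_sum]
        refine Finset.sum_congr rfl fun a _ => ?_
        rw [map_sum]
        refine Finset.sum_congr rfl fun j _ => ?_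
        rw [hρ, map_mul pL (v _ _), hv1 a j a.2]
      rw [e1, mem_map_span t pL hpL hker] at h
      obtain ⟨y, hy, z, hz⟩ := h
      have h3 := ind_step (fun j => lam (f (r j))) (Ideal.span (t '' {i | i ∈ l})) (t i0) (fun x => x = 0 ∨ χ x ≠ 0) (by
        intro u hu y hy z h
        exact hind u hu ((mem_span_ins _ _ _ _).2 ⟨y, hy, z, h⟩)) hnz N v hv2 y hy z hz
      rintro ⟨j, a⟩
      rw [← hv1 a j a.2, h3 a a.2 j, map_zero]
    · intro S hS i hi hiS x hx
      obtain ⟨x, rfl⟩ := hpL x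
      have hi0 : i0 ∉ S := fun h => hnd.1 (hS h)
      have hx' : pL (t i * x) ∈ Ideal.span ((fun i => pL (t i)) '' S) := by rw [map_mul]; exact hx
      rw [mem_map_span t pL hpL hker] at hx' ⊢
      obtain ⟨y, hy, z, hz⟩ := hx'
      refine nzd_step _ (t i0) (t i) (hG S (hS.trans (Set.subset_insert _ _)) i0 (by simp) hi0) ?_ N x y z hy hz
      intro x y z hy h
      rw [← mem_span_ins]
      refine hG (insert i0 S) (Set.insert_subset_insert hS) i (List.mem_cons_of_mem _ hi) ?_ x ((mem_span_ins _ _ _ _).2 ⟨y, hy, z, h⟩)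
      rintro (rfl | h)
      · exact hnd.1 hi
      · exact hiS h

theorem bh_start {F k K L : Type u} [Field F] [PerfectField F] [Field k] [Field K] [CommRing L] [IsLocalRing L] [IsNoetherianRing L]
    (e : F →+* k) (kK : k →+* K) (hCF : CF e kK) (lam : k →+* L) (χ : L →+* K) (hχ : χ.comp lam = kK) (hχs : Function.Surjective χ)
    {d : ℕ} (t : Fin d → L) (ht : Function.Injective t) (hspan : Ideal.span (Set.range t) = IsLocalRing.maximalIdeal L)
    (hd : (d : WithBot ℕ∞) ≤ ringKrullDim L) : BH e lam ((List.finRange d).map t) := by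
  classical
  have hker : RingHom.ker χ = IsLocalRing.maximalIdeal L :=
    IsLocalRing.eq_maximalIdeal (RingHom.ker_isMaximal_of_surjective χ hχs)
  have hm : ∀ x, χ x = 0 ↔ x ∈ IsLocalRing.maximalIdeal L := fun x => by rw [← hker, RingHom.mem_ker]
  have es : {i : Fin d | i ∈ List.finRange d} = Set.univ := by ext; simp
  refine bh_field e kK hCF (List.finRange d) (List.nodup_finRange d) e lam (RingHom.id F) (RingHom.id k) (RingHom.FiniteType.id k) rfl χ
    hχ hχs ?_ t ?_ (J := Unit) (fun _ => 1) ?_ ?_ ?_ ?_ ?_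
  · intro x hx
    by_contra h
    exact hx ((hm x).2 ((IsLocalRing.mem_maximalIdeal x).2 h))
  · intro i _
    rw [hm, ← hspan]; exact Ideal.subset_span ⟨i, rfl⟩
  · intro x; exact ⟨fun _ => x, by simp⟩
  · exact ⟨1, by rw [es, Set.image_univ, hspan, hker, pow_one]⟩
  · intro σ hσ x
    refine ⟨fun _ => χ x, ?_⟩
    rw [es, Set.image_univ, hspan, ← hm]
    simp [hσ]
  · intro u hu h j
    rw [es, Set.image_univ, hspan, ← hm] at h
    rcases hu j with h1 | h1
    · exact h1
    · exact absurd (by simpa using h) h1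
  · intro S _ i _ hiS x hx
    have e1 : ((Finset.univ.filter (· ∈ S)).image t : Set L) = t '' S := by ext; simp
    have := reg_nzd (Finset.univ.image t) (by simpa using hspan) (by rw [Finset.card_image_of_injective _ ht]; simpa using hd)
      ((Finset.univ.filter (· ∈ S)).image t) (Finset.image_subset_image (Finset.filter_subset _ _)) (t := t i) (by simp)
      (by simp only [Finset.mem_image, Finset.mem_filter, not_exists]; rintro j ⟨⟨_, h⟩, h2⟩; exact hiS (ht h2 ▸ h)) x
    rw [e1] at this
    exact this hx

structure DV {A T : Type*} [CommRing A] [CommRing T] (g : A →+* T) (d : A → T) : Prop where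
  add : ∀ x y, d (x + y) = d x + d y
  mul : ∀ x y, d (x * y) = g x * d y + g y * d x

section
variable {A T : Type*} [CommRing A] [CommRing T] {g : A →+* T} {d : A → T}

theorem DV.zero (h : DV g d) : d 0 = 0 := by have := h.add 0 0; simpa using this
theorem DV.one (h : DV g d) : d 1 = 0 := by have := h.mul 1 1; simpa using this
theorem DV.pow (h : DV g d) (x : A) (n : ℕ) : d (x ^ n) = n * g x ^ (n - 1) * d x := by
  induction n with
  | zero => simp [h.one]
  | succ n ih =>
    rw [pow_succ, h.mul, ih]
    cases n with
    | zero => simp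
    | succ n => simp; ring
theorem DV.neg (h : DV g d) (x : A) : d (-x) = - d x := by
  have := h.add x (-x); rw [add_neg_cancel, h.zero] at this; linear_combination -this
theorem DV.sub (h : DV g d) (x y : A) : d (x - y) = d x - d y := by
  rw [sub_eq_add_neg, h.add, h.neg, sub_eq_add_neg]
theorem DV.sum (h : DV g d) {ι : Type*} (s : Finset ι) (f : ι → A) : d (∑ i ∈ s, f i) = ∑ i ∈ s, d (f i) := by
  classical
  induction s using Finset.induction_on with
  | empty => simp [h.zero]
  | insert a s ha ih => rw [Finset.sum_insert ha, Finset.sum_insert ha, h.add, ih]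
theorem DV.comp (h : DV g d) {B : Type*} [CommRing B] (f : B →+* A) : DV (g.comp f) (fun x => d (f x)) :=
  ⟨fun x y => by simp [h.add], fun x y => by simp [h.mul]⟩
end

theorem der_of_section {T κ : Type*} [CommRing T] [Field κ] (q : T →+* κ) (hs : ∀ x y, q x = 0 → q y = 0 → x * y = 0)
    (s : κ →+* T) (hqs : ∀ x, q (s x) = x) (z : T) (hz : q z = 0) (hz0 : z ≠ 0) : ∃ D : T → κ, DV q D ∧ D z = 1 := by
  letI := s.toAlgebra
  obtain ⟨l, hl⟩ := Module.Projective.exists_dual_ne_zero κ hz0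
  have hl2 : ∀ c x, l (s c * x) = c * l x := fun c x => l.map_smul c x
  refine ⟨fun x => (l z)⁻¹ * l (x - s (q x)), ⟨fun x y => ?_, fun x y => ?_⟩, ?_⟩
  · rw [← mul_add, ← map_add]; congr 2; rw [map_add, map_add]; ring
  · have h0 := hs (x - s (q x)) (y - s (q y)) (by simp [hqs]) (by simp [hqs])
    have : x * y - s (q (x * y)) = s (q x) * (y - s (q y)) + s (q y) * (x - s (q x)) := by
      rw [map_mul, map_mul]; linear_combination h0
    rw [this, map_add, hl2, hl2]; ring
  · simp only [hz, map_zero, sub_zero]; exact inv_mul_cancel₀ hl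

theorem not_mem_sq {N N2 : Type u} [CommRing N] [IsNoetherianRing N] [IsLocalRing N] [CommRing N2] [IsLocalRing N2] (g : N)
    (hg : g ∈ IsLocalRing.maximalIdeal N) (hnz : g ∈ nonZeroDivisors N) (p : N →+* N2) (hp : Function.Surjective p)
    (hk : ∀ x, p x = 0 ↔ g ∣ x) (s : Finset N2) (hs : Ideal.span (s : Set N2) = IsLocalRing.maximalIdeal N2)
    (hd : (s.card : WithBot ℕ∞) ≤ ringKrullDim N2) : g ∉ IsLocalRing.maximalIdeal N ^ 2 := by
  classical
  intro hg2
  haveI : IsNoetherianRing N2 := isNoetherianRing_of_surjective N N2 p hp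
  have e1 : ringKrullDim N2 = ringKrullDim (N ⧸ Ideal.span {g}) := by
    have hke : RingHom.ker p = Ideal.span {g} := by
      ext x; rw [RingHom.mem_ker, hk, Ideal.mem_span_singleton]
    exact (ringKrullDim_eq_of_ringEquiv ((Ideal.quotEquivOfEq hke.symm).trans (RingHom.quotientKerEquivOfSurjective hp))).symm
  have e2 := ringKrullDim_quotient_span_singleton_succ_eq_ringKrullDim_of_mem_nonZeroDivisors hnz hg
  rw [← e1] at e2
  choose v hv using hp
  have hm : IsLocalRing.maximalIdeal N ≤ Ideal.span (s.image v : Set N) ⊔ IsLocalRing.maximalIdeal N • IsLocalRing.maximalIdeal N := by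
    intro x hx
    have h1 : p x ∈ Ideal.span (s : Set N2) := by
      rw [hs, IsLocalRing.mem_maximalIdeal]
      intro hu
      haveI : IsLocalHom p := IsLocalHom.of_surjective p (fun y => ⟨v y, hv y⟩)
      exact (IsLocalRing.mem_maximalIdeal x).1 hx (isUnit_of_map_unit p x hu)
    have h2 : Ideal.span (s : Set N2) = (Ideal.span (s.image v : Set N)).map p := by
      rw [Ideal.map_span]; congr 1
      ext y; simp [hv]
    rw [h2, Ideal.mem_map_iff_of_surjective p (fun y => ⟨v y, hv y⟩)] at h1
    obtain ⟨y, hy, hyx⟩ := h1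
    obtain ⟨z, hz⟩ := (hk (x - y)).1 (by rw [map_sub, hyx, sub_self])
    have : x = y + g * z := by linear_combination hz
    rw [this]
    refine Ideal.add_mem _ (Ideal.mem_sup_left hy) (Ideal.mem_sup_right (Ideal.mul_mem_right _ _ ?_))
    rw [smul_eq_mul, ← pow_two]; exact hg2
  have hm2 := Submodule.le_of_le_smul_of_le_jacobson_bot (IsNoetherian.noetherian _) (IsLocalRing.maximalIdeal_le_jacobson ⊥) hm
  have hm3 : Ideal.span (s.image v : Set N) = IsLocalRing.maximalIdeal N := by
    refine le_antisymm ?_ hm2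
    rw [Ideal.span_le]
    intro x hx
    simp only [Finset.coe_image, Set.mem_image, Finset.mem_coe] at hx
    obtain ⟨y, hy, rfl⟩ := hx
    rw [SetLike.mem_coe, IsLocalRing.mem_maximalIdeal]
    intro hu
    have h3 : y ∈ IsLocalRing.maximalIdeal N2 := by rw [← hs]; exact Ideal.subset_span hy
    apply (IsLocalRing.mem_maximalIdeal y).1 h3
    show IsUnit y
    rw [← hv y]; exact hu.map p
  have h4 := dim_le_of_gens (s.image v) s.card Finset.card_image_le hm3
  rw [← e2] at h4
  have h5 := h4.trans hd
  have h6 : ringKrullDim N2 ≤ s.card := dim_le_of_gens s s.card le_rfl hs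
  have h7 : ringKrullDim N2 = s.card := le_antisymm h6 hd
  rw [h7] at h5
  have : ((s.card + 1 : ℕ) : WithBot ℕ∞) ≤ (s.card : ℕ) := by push_cast; exact h5
  rw [Nat.cast_le] at this
  omega

theorem der_exists {F N Ω : Type u} [Field F] [PerfectField F] [CommRing N] [IsLocalRing N] [Field Ω] (f : F →+* N) (χ : N →+* Ω)
    (hχ : ∀ x, χ x = 0 ↔ x ∈ IsLocalRing.maximalIdeal N) (g : N) (hg : g ∈ IsLocalRing.maximalIdeal N)
    (hg2 : g ∉ IsLocalRing.maximalIdeal N ^ 2) : ∃ D : N → Ω, DV χ D ∧ D g ≠ 0 := by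
  obtain ⟨T, _, p, hp, hpk⟩ := exists_quot (IsLocalRing.maximalIdeal N ^ 2)
  obtain ⟨κ, _, r, hr, hrk⟩ : ∃ (κ : Type u) (_ : Field κ) (r : N →+* κ), Function.Surjective r ∧ ∀ x, r x = 0 ↔ x ∈ IsLocalRing.maximalIdeal N :=
    ⟨IsLocalRing.ResidueField N, inferInstance, IsLocalRing.residue N, IsLocalRing.residue_surjective, fun x => IsLocalRing.residue_eq_zero_iff x⟩
  obtain ⟨q, hq⟩ := exists_factor p hp r (fun x hx => (hrk x).2 (Ideal.pow_le_self two_ne_zero ((hpk x).1 hx)))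
  have hq' : ∀ x, q (p x) = r x := fun x => RingHom.congr_fun hq x
  obtain ⟨j, hj⟩ := exists_factor r hr χ (fun x hx => (hχ x).2 ((hrk x).1 hx))
  have hj' : ∀ x, j (r x) = χ x := fun x => RingHom.congr_fun hj x
  have hsq : ∀ x y, q x = 0 → q y = 0 → x * y = 0 := by
    intro x y hx hy
    obtain ⟨x, rfl⟩ := hp x
    obtain ⟨y, rfl⟩ := hp y
    rw [hq', hrk] at hx hy
    rw [← map_mul, hpk, pow_two]; exact Ideal.mul_mem_mul hx hy
  obtain ⟨s, hs1, hs2⟩ := field_fs' (r.comp f) T κ q (fun y => by obtain ⟨x, rfl⟩ := hr y; exact ⟨p x, hq' x⟩) hsq (p.comp f) (RingHom.id κ) (by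
    rw [RingHom.id_comp, ← hq]; rfl) (by simp)
  obtain ⟨D, hD, hDz⟩ := der_of_section q hsq s (fun x => RingHom.congr_fun hs1 x) (p g) (by rw [hq', hrk]; exact hg) (by rwa [Ne, hpk])
  refine ⟨fun x => j (D (p x)), ⟨fun x y => by simp [hD.add], fun x y => by simp [hD.mul, hq', hj']⟩, ?_⟩
  show j (D (p g)) ≠ 0
  rw [hDz, map_one]; exact one_ne_zero

instance botPerfect (k : Type u) [Field k] : PerfectField (⊥ : Subfield k) := by
  obtain ⟨p, hp⟩ := CharP.exists k
  rcases CharP.char_is_prime_or_zero k p with h | h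
  · haveI : Fact p.Prime := ⟨h⟩
    letI := ZMod.algebra k p
    have e : (⊥ : Subfield k) = (algebraMap (ZMod p) k).fieldRange := Subfield.bot_eq_of_zMod_algebra (p := p)
    haveI : Finite (⊥ : Subfield k) := by
      rw [e]; exact (Set.finite_range (algebraMap (ZMod p) k)).to_subtype
    infer_instance
  · subst h
    haveI : CharZero k := CharP.charP_to_charZero k
    infer_instance

def RegAt (L : Type u) [CommRing L] [IsLocalRing L] : Prop :=
  ∃ s : Finset L, Ideal.span (s : Set L) = IsLocalRing.maximalIdeal L ∧ (s.card : WithBot ℕ∞) ≤ ringKrullDim L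

/-- geometrically regular -/
def GReg {k Λ : Type u} [Field k] [CommRing Λ] (φ : k →+* Λ) : Prop :=
  ∀ (k2 : Type u) [Field k2] (a : k →+* k2), a.Finite → ∃ (Λ2 : Type u) (_ : CommRing Λ2) (l : Λ →+* Λ2) (r : k2 →+* Λ2),
    PO φ a l r ∧ ∀ (M : Ideal Λ2) [M.IsPrime], RegAt (Localization.AtPrime M)

theorem po_poly 
    {φ : k →+* Λ} {a1 : k →+* k1} {l1 : Λ →+* Λ1} {r1 : k1 →+* Λ1} (h1 : PO φ a1 l1 r1) (p : Polynomial k1 →+* k2)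
    (hp : Function.Surjective p) (h : Polynomial k1) (hker : ∀ x, p x = 0 ↔ h ∣ x) {l2 : Λ →+* Λ2} {r2 : k2 →+* Λ2}
    (h2 : PO φ ((p.comp Polynomial.C).comp a1) l2 r2) : ∃ π : Polynomial Λ1 →+* Λ2, Function.Surjective π ∧
      (∀ x, π x = 0 ↔ h.map r1 ∣ x) ∧ (π.comp Polynomial.C).comp l1 = l2 ∧ π.comp (Polynomial.mapRingHom r1) = r2.comp p := by
  obtain ⟨m, hm1, hm2⟩ := h1.univ Λ2 l2 (r2.comp (p.comp Polynomial.C)) (by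
    rw [h2.comm]; rfl)
  obtain ⟨π, hπ⟩ : ∃ π, π = Polynomial.eval₂RingHom m (r2 (p Polynomial.X)) := ⟨_, rfl⟩
  have hπC : ∀ x, π (Polynomial.C x) = m x := fun x => by rw [hπ]; simp
  have hπX : π Polynomial.X = r2 (p Polynomial.X) := by rw [hπ]; simp
  have hm2' : ∀ x, m (r1 x) = r2 (p (Polynomial.C x)) := fun x => RingHom.congr_fun hm2 x
  have hπm : π.comp (Polynomial.mapRingHom r1) = r2.comp p := by
    apply Polynomial.ringHom_ext
    · intro x; simp [hπC, hm2']
    · simp [hπX]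
  have hπm' : ∀ x, π (x.map r1) = r2 (p x) := fun x => RingHom.congr_fun hπm x
  obtain ⟨T, _, mk, hmk, hmkk⟩ := exists_quot (Ideal.span {h.map r1})
  obtain ⟨πb, hπb⟩ := exists_factor mk hmk π (by
    intro x hx
    rw [hmkk, Ideal.mem_span_singleton] at hx
    obtain ⟨z, rfl⟩ := hx
    rw [map_mul, hπm', (hker h).2 dvd_rfl, map_zero, zero_mul])
  have hπb' : ∀ x, πb (mk x) = π x := fun x => RingHom.congr_fun hπb x
  obtain ⟨s, hs⟩ := exists_factor p hp (mk.comp (Polynomial.mapRingHom r1)) (by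
    intro x hx
    obtain ⟨z, rfl⟩ := (hker x).1 hx
    rw [RingHom.comp_apply, hmkk, Ideal.mem_span_singleton, Polynomial.coe_mapRingHom, Polynomial.map_mul]
    exact dvd_mul_right _ _)
  have hs' : ∀ x, s (p x) = mk (x.map r1) := fun x => RingHom.congr_fun hs x
  obtain ⟨γ, hγ1, hγ2⟩ := h2.univ T ((mk.comp Polynomial.C).comp l1) s (by
    apply RingHom.ext; intro x
    have := RingHom.congr_fun h1.comm x
    simp only [RingHom.comp_apply] at this ⊢
    rw [hs', this]; simp)
  have hγ1' : ∀ x, γ (l2 x) = mk (Polynomial.C (l1 x)) := fun x => RingHom.congr_fun hγ1 x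
  have hγ2' : ∀ x, γ (r2 x) = s x := fun x => RingHom.congr_fun hγ2 x
  have hm1' : ∀ x, m (l1 x) = l2 x := fun x => RingHom.congr_fun hm1 x
  have hγπ : γ.comp π = mk := by
    have e : γ.comp m = mk.comp Polynomial.C := by
      apply h1.epi
      · apply RingHom.ext; intro x; simp [hm1', hγ1']
      · apply RingHom.ext; intro x; simp [hm2', hγ2', hs']
    apply Polynomial.ringHom_ext
    · intro x; have := RingHom.congr_fun e x; simpa [hπC] using this
    · simp [hπX, hγ2', hs']
  have hid : πb.comp γ = RingHom.id Λ2 := by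
    apply h2.epi
    · apply RingHom.ext; intro x; simp [hγ1', hπb', hπC, hm1']
    · apply RingHom.ext; intro x
      obtain ⟨x, rfl⟩ := hp x
      simp [hγ2', hs', hπb', hπm']
  refine ⟨π, ?_, ?_, ?_, hπm⟩
  · intro y
    obtain ⟨x, hx⟩ := hmk (γ y)
    exact ⟨x, by rw [← hπb', hx]; exact RingHom.congr_fun hid y⟩
  · intro x
    rw [← Ideal.mem_span_singleton, ← hmkk]
    constructor
    · intro h; rw [← hγπ, RingHom.comp_apply, h, map_zero]
    · intro h; rw [← hπb', h, map_zero]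
  · apply RingHom.ext; intro x; simp [hπC, hm1']

/-- localization of a quotient -/
theorem loc_quot  (π : N0 →+* Λ2) (hπ : Function.Surjective π) (g : N0)
    (hk : ∀ x, π x = 0 ↔ g ∣ x) (M : Ideal N0) [M.IsPrime] (M2 : Ideal Λ2) [M2.IsPrime] (hM : M = M2.comap π) :
    ∃ (p : Localization.AtPrime M →+* Localization.AtPrime M2), Function.Surjective p ∧
     (∀ x, p x = 0 ↔ algebraMap _ _ g ∣ x) := by
  obtain ⟨p, hp⟩ : ∃ p : Localization.AtPrime M →+* Localization.AtPrime M2,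
      ∀ x, p (algebraMap _ _ x) = algebraMap _ _ (π x) :=
    ⟨Localization.localRingHom _ _ π hM, fun x => Localization.localRingHom_to_map _ _ π hM x⟩
  have hl1 := IsLoc.of_isLocalization (L := Localization.AtPrime M) M.primeCompl
  have hl2 := IsLoc.of_isLocalization (L := Localization.AtPrime M2) M2.primeCompl
  have hmem : ∀ x, π x ∈ M2.primeCompl → x ∈ M.primeCompl := fun x hx => by show x ∉ M; rw [hM]; exact hx
  refine ⟨p, ?_, ?_⟩
  · intro y
    obtain ⟨v, z, hv, h⟩ := hl2.surj y
    obtain ⟨v, rfl⟩ := hπ v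
    obtain ⟨z, rfl⟩ := hπ z
    obtain ⟨w, hw⟩ := (hl1.unit v (hmem v hv)).exists_right_inv
    refine ⟨w * algebraMap _ _ z, ?_⟩
    rw [map_mul, hp, ← h, ← hp v, ← mul_assoc, mul_comm (p w), ← map_mul, hw, map_one, one_mul]
  · intro x
    constructor
    · intro hx
      obtain ⟨v, z, hv, h⟩ := hl1.surj x
      have h2 : algebraMap Λ2 (Localization.AtPrime M2) (π z) = 0 := by rw [← hp, ← h, map_mul, hx, mul_zero]
      obtain ⟨w, hw, h3⟩ := hl2.ker _ h2
      obtain ⟨w, rfl⟩ := hπ w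
      rw [← map_mul, hk] at h3
      obtain ⟨y, hy⟩ := h3
      have hwv := (hl1.unit w (hmem w hw)).mul (hl1.unit v hv)
      rw [← hwv.dvd_mul_left]
      refine ⟨algebraMap _ _ y, ?_⟩
      rw [mul_assoc, h, ← map_mul, hy, map_mul]
    · rintro ⟨y, rfl⟩
      rw [map_mul, hp, (hk g).2 dvd_rfl, map_zero, zero_mul]

theorem lift_algclosed {k k2 Ω : Type u} [Field k] [Field k2] [Field Ω] [IsAlgClosed Ω] (a : k →+* k2) (ha : a.Finite) (g : k →+* Ω) :
    ∃ g2 : k2 →+* Ω, g2.comp a = g := by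
  letI := a.toAlgebra
  letI := g.toAlgebra
  haveI : Module.Finite k k2 := ha
  exact ⟨(IsAlgClosed.lift : k2 →ₐ[k] Ω), AlgHom.comp_algebraMap _⟩

theorem exists_k2 {k : Type u} [Field k] (p : ℕ) [hp : Fact p.Prime] [CharP k p] (S : Finset k) (a : k)
    (ha : a ∉ Subfield.closure (Set.range (fun x : k => x ^ p) ∪ S)) :
    ∃ (k1 : Type u) (_ : Field k1) (a1 : k →+* k1), a1.Finite ∧ (∀ s ∈ S, ∃ b, a1 s = b ^ p) ∧ ∀ b, b ^ p ≠ a1 a := by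
  classical
  obtain ⟨Ω, _, _, _⟩ : ∃ (Ω : Type u) (_ : Field Ω) (_ : Algebra k Ω), IsAlgClosure k Ω := ⟨AlgebraicClosure k, inferInstance, inferInstance, inferInstance⟩
  haveI : IsAlgClosed Ω := IsAlgClosure.isAlgClosed k
  haveI : CharP Ω p := charP_of_injective_algebraMap (algebraMap k Ω).injective p
  choose b hb using fun s : k => IsAlgClosed.exists_pow_nat_eq (algebraMap k Ω s) hp.out.pos
  refine ⟨IntermediateField.adjoin k (b '' S), inferInstance, algebraMap k _, ?_, ?_, ?_⟩
  · haveI : Finite (b '' (S : Set k)) := (S.finite_toSet.image b).to_subtype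
    have : FiniteDimensional k (IntermediateField.adjoin k (b '' S)) := IntermediateField.finiteDimensional_adjoin
      (fun x _ => (IsAlgClosure.isAlgebraic (R := k) (K := Ω)).isAlgebraic x |>.isIntegral)
    rw [RingHom.finite_algebraMap]; exact this
  · intro s hs
    refine ⟨⟨b s, IntermediateField.subset_adjoin _ _ ⟨s, hs, rfl⟩⟩, ?_⟩
    apply Subtype.ext
    exact (hb s).symm
  · rintro ⟨y, hy⟩ h
    apply ha
    have h1 : y ^ p = algebraMap k Ω a := congrArg Subtype.val h
    have h2 : (IntermediateField.adjoin k (b '' (S : Set k))).toSubfield ≤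
        ((Subfield.closure (Set.range (fun x : k => x ^ p) ∪ S)).map (algebraMap k Ω)).comap (frobenius Ω p) := by
      rw [IntermediateField.adjoin_toSubfield, Subfield.closure_le]
      rintro _ (⟨x, rfl⟩ | ⟨s, hs, rfl⟩)
      · exact ⟨x ^ p, Subfield.subset_closure (Or.inl ⟨x, rfl⟩), by simp [frobenius_def]⟩
      · exact ⟨s, Subfield.subset_closure (Or.inr hs), by simp [frobenius_def, hb]⟩
    obtain ⟨z, hz, hzy⟩ := h2 hy
    have h3 : algebraMap k Ω z = algebraMap k Ω a := by rw [← h1]; exact hzy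
    rw [← (algebraMap k Ω).injective h3]; exact hz

theorem gr2 {k Λ K : Type u} [Field k] [CommRing Λ] [IsNoetherianRing Λ] [Field K] (p : ℕ) [hp : Fact p.Prime] [CharP k p]
    (φ : k →+* Λ) (hreg : GReg φ) (χ : Λ →+* K) (S : Finset k) (a : k)
    (ha : a ∉ Subfield.closure (Set.range (fun x : k => x ^ p) ∪ S)) :
    ∃ D : Λ → K, DV χ D ∧ (∀ s ∈ S, D (φ s) = 0) ∧ D (φ a) = 1 := by
  classical
  obtain ⟨k1, _, a1, ha1, hS, hne⟩ := exists_k2 p S a ha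
  obtain ⟨h, hh⟩ : ∃ h : Polynomial k1, h = Polynomial.X ^ p - Polynomial.C (a1 a) := ⟨_, rfl⟩
  have hirr : Irreducible h := by rw [hh]; exact X_pow_sub_C_irreducible_of_prime hp.out (fun b => hne b)
  have hmon : h.Monic := by rw [hh]; exact Polynomial.monic_X_pow_sub_C _ hp.out.ne_zero
  obtain ⟨k2, _, pp, hpps, hppk, hfin⟩ : ∃ (k2 : Type u) (_ : Field k2) (pp : Polynomial k1 →+* k2), Function.Surjective pp ∧
      (∀ x, pp x = 0 ↔ h ∣ x) ∧ (pp.comp Polynomial.C).Finite := by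
    haveI := Fact.mk hirr
    refine ⟨AdjoinRoot h, inferInstance, AdjoinRoot.mk h, AdjoinRoot.mk_surjective, fun x => AdjoinRoot.mk_eq_zero, ?_⟩
    have : Module.Finite k1 (AdjoinRoot h) := (AdjoinRoot.powerBasis hirr.ne_zero).finite
    have h2 : (algebraMap k1 (AdjoinRoot h)).Finite := by rw [RingHom.finite_algebraMap]; exact this
    exact h2
  have hfin2 := hfin.comp ha1
  obtain ⟨Λ2, _, l2, r2, h2, hR⟩ := hreg k2 _ hfin2
  obtain ⟨Λ1, _, l1, r1, h1, hft, -⟩ := exists_po φ a1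
  haveI : IsNoetherianRing Λ1 := noeth_of_ft l1 (hft ha1.finiteType)
  obtain ⟨π, hπs, hπk, hπ1, hπ2⟩ := po_poly h1 pp hpps h hppk h2
  obtain ⟨Ω, _, _, _, _⟩ : ∃ (Ω : Type u) (_ : Field Ω) (_ : Algebra K Ω), IsAlgClosed Ω ∧ True :=
    ⟨AlgebraicClosure K, inferInstance, inferInstance, inferInstance, trivial⟩
  obtain ⟨g2, hg2⟩ := lift_algclosed _ hfin2 ((algebraMap K Ω).comp (χ.comp φ))
  obtain ⟨ψ, hψ1, hψ2⟩ := h2.univ Ω ((algebraMap K Ω).comp χ) g2 (by rw [hg2]; rfl)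
  obtain ⟨M2, hM2⟩ : ∃ M2, M2 = RingHom.ker ψ := ⟨_, rfl⟩
  haveI : M2.IsPrime := by rw [hM2]; exact RingHom.ker_isPrime ψ
  obtain ⟨M, hM⟩ : ∃ M, M = M2.comap π := ⟨_, rfl⟩
  haveI : M.IsPrime := by rw [hM]; infer_instance
  have hMψ : ∀ x, x ∈ M ↔ ψ (π x) = 0 := fun x => by rw [hM, hM2]; rfl
  obtain ⟨q, hq, hqk⟩ := loc_quot π hπs (h.map r1) hπk M M2 hM
  obtain ⟨s, hs, hsd⟩ := hR M2
  have hloc := IsLoc.of_isLocalization (L := Localization.AtPrime M) M.primeCompl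
  have hgM : h.map r1 ∈ M := by rw [hMψ, (hπk _).2 dvd_rfl, map_zero]
  have hgm : algebraMap _ (Localization.AtPrime M) (h.map r1) ∈ IsLocalRing.maximalIdeal (Localization.AtPrime M) :=
    (IsLocalization.AtPrime.to_map_mem_maximal_iff _ M _).2 hgM
  have hsq := not_mem_sq (algebraMap _ (Localization.AtPrime M) (h.map r1)) hgm
    (IsLocalization.nonZeroDivisors_le_comap M.primeCompl _ (hmon.map r1).mem_nonZeroDivisors) q hq hqk s hs hsd
  obtain ⟨χN, hχN⟩ : ∃ χN : Localization.AtPrime M →+* Ω, ∀ x, χN (algebraMap _ _ x) = ψ (π x) :=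
    ⟨IsLocalization.lift (M := M.primeCompl) (g := ψ.comp π) (fun y => isUnit_iff_ne_zero.2 (fun h => y.2 ((hMψ _).2 h))),
      fun x => IsLocalization.lift_eq _ x⟩
  have hχm : ∀ x, χN x = 0 ↔ x ∈ IsLocalRing.maximalIdeal (Localization.AtPrime M) := by
    intro x
    constructor
    · intro h hu
      exact ((isUnit_iff_ne_zero.1 (IsUnit.map χN hu)) h)
    · intro hx
      obtain ⟨v, z, hv, hz⟩ := hloc.surj x
      have hz1 : z ∈ M := by
        rw [← IsLocalization.AtPrime.to_map_mem_maximal_iff (Localization.AtPrime M) M, ← hz]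
        exact Ideal.mul_mem_left _ _ hx
      have : ψ (π v) * χN x = 0 := by rw [← hχN, ← map_mul, hz, hχN, (hMψ z).1 hz1]
      exact (mul_eq_zero.1 this).resolve_left (fun h => hv ((hMψ _).2 h))
  obtain ⟨D0, hD0, hD0g⟩ := der_exists ((algebraMap _ (Localization.AtPrime M)).comp (((Polynomial.C).comp (l1.comp φ)).comp (⊥ : Subfield k).subtype)) χN hχm _ hgm hsq
  have hD1 := hD0.comp (algebraMap (Polynomial Λ1) (Localization.AtPrime M))
  obtain ⟨D1, hD1e⟩ : ∃ D1 : Polynomial Λ1 → Ω, D1 = fun x => D0 (algebraMap _ (Localization.AtPrime M) x) := ⟨_, rfl⟩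
  rw [← hD1e] at hD1
  have hpΩ : (p : Ω) = 0 := by
    have : ((p : k) : k) = 0 := CharP.cast_eq_zero k p
    have h3 := congrArg ((algebraMap K Ω).comp (χ.comp φ)) this
    rwa [map_natCast, map_zero] at h3
  have hlr : ∀ x, l1 (φ x) = r1 (a1 x) := fun x => RingHom.congr_fun h1.comm x
  have hg1 : D1 (h.map r1) ≠ 0 := by rw [hD1e]; exact hD0g
  have hg2 : D1 (h.map r1) = - D1 (Polynomial.C (l1 (φ a))) := by
    rw [hh, Polynomial.map_sub, Polynomial.map_pow, Polynomial.map_X, Polynomial.map_C, hD1.sub, hD1.pow, hpΩ, hlr]; ring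
  have hDa : D1 (Polynomial.C (l1 (φ a))) ≠ 0 := fun h => hg1 (by rw [hg2, h, neg_zero])
  have hDS : ∀ s ∈ S, D1 (Polynomial.C (l1 (φ s))) = 0 := by
    intro s hs
    obtain ⟨b, hb⟩ := hS s hs
    rw [hlr, hb, map_pow, map_pow, hD1.pow, hpΩ]; ring
  obtain ⟨ℓ, hℓ⟩ := Module.Projective.exists_dual_ne_zero K hDa
  have hψ1' : ∀ x, ψ (π (Polynomial.C (l1 x))) = algebraMap K Ω (χ x) := by
    intro x
    have h3 := RingHom.congr_fun hπ1 x
    have h4 := RingHom.congr_fun hψ1 x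
    simp only [RingHom.comp_apply] at h3 h4
    rw [h3, h4]
  have hmul : ∀ c x, ℓ (algebraMap K Ω c * x) = c * ℓ x := by
    intro c x; rw [← Algebra.smul_def, map_smul, smul_eq_mul]
  refine ⟨fun x => (ℓ (D1 (Polynomial.C (l1 (φ a)))))⁻¹ * ℓ (D1 (Polynomial.C (l1 x))), ⟨fun x y => ?_, fun x y => ?_⟩, fun s hs => ?_, inv_mul_cancel₀ hℓ⟩
  · rw [map_add, map_add, hD1.add, map_add, mul_add]
  · rw [map_mul, map_mul, hD1.mul, map_add, RingHom.comp_apply, RingHom.comp_apply, hχN, hχN, hψ1', hψ1', hmul, hmul]; ring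
  · simp only [hDS s hs, map_zero, mul_zero]

theorem der_ext  (f : A →+* B) (hf : FS f 1) (g : B →+* K) (δ : A → K)
    (hδ : DV (g.comp f) δ) : ∃ D : B → K, DV g D ∧ ∀ x, D (f x) = δ x := by
  obtain ⟨φ0, hφ0⟩ : ∃ φ0 : A →+* TrivSqZeroExt K K, ∀ x, φ0 x = TrivSqZeroExt.inl (g (f x)) + TrivSqZeroExt.inr (δ x) := by
    refine ⟨{ toFun := fun x => TrivSqZeroExt.inl (g (f x)) + TrivSqZeroExt.inr (δ x), map_one' := ?_, map_mul' := ?_, map_zero' := ?_, map_add' := ?_ }, fun x => rfl⟩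
    · ext <;> simp [hδ.one]
    · intro x y; ext <;> simp [hδ.mul, mul_comm]
    · ext <;> simp [hδ.zero]
    · intro x y; ext <;> simp [hδ.add]
  obtain ⟨q, hq⟩ : ∃ q : TrivSqZeroExt K K →+* K, ∀ x, q x = x.fst := ⟨(TrivSqZeroExt.fstHom K K K : TrivSqZeroExt K K →+* K), fun _ => rfl⟩
  obtain ⟨g', h1, h2⟩ := hf (TrivSqZeroExt K K) K q (fun x => ⟨TrivSqZeroExt.inl x, by rw [hq]; simp⟩) (by
    intro x y hx hy
    rw [hq] at hx hy
    ext <;> simp [hx, hy]) φ0 g (by apply RingHom.ext; intro x; simp [hq, hφ0]) (by simp)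
  have h1' : ∀ x, (g' x).fst = g x := fun x => by rw [← hq]; exact RingHom.congr_fun h1 x
  have h2' : ∀ x, g' (f x) = φ0 x := fun x => RingHom.congr_fun h2 x
  refine ⟨fun x => (g' x).snd, ⟨fun x y => by simp, fun x y => ?_⟩, fun x => ?_⟩
  · simp [h1', mul_comm]
  · simp [h2', hφ0]

theorem DV.eq_on_closure {k K : Type u} [Field k] [Field K] (p : ℕ) [hp : Fact p.Prime] [CharP k p] (g : k →+* K) (d d' : k → K)
    (hd : DV g d) (hd' : DV g d') (S : Set k) (h : ∀ s ∈ S, d s = d' s) :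
    ∀ x ∈ Subfield.closure (Set.range (fun x : k => x ^ p) ∪ S), d x = d' x := by
  have hpK : (p : K) = 0 := by
    have := congrArg g (CharP.cast_eq_zero k p); rwa [map_natCast, map_zero] at this
  intro x hx
  induction hx using Subfield.closure_induction with
  | mem x hx =>
    rcases hx with ⟨y, rfl⟩ | hx
    · simp only [hd.pow, hd'.pow, hpK, zero_mul]
    · exact h x hx
  | one => rw [hd.one, hd'.one]
  | add x y _ _ hx hy => rw [hd.add, hd'.add, hx, hy]
  | neg x _ hx => rw [hd.neg, hd'.neg, hx]
  | inv x _ hx =>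
    by_cases h0 : x = 0
    · simp [h0, hd.zero, hd'.zero]
    · have e1 := hd.mul x x⁻¹
      have e2 := hd'.mul x x⁻¹
      rw [mul_inv_cancel₀ h0, hd.one] at e1
      rw [mul_inv_cancel₀ h0, hd'.one, ← hx] at e2
      have h3 : g x ≠ 0 := by simpa using h0
      apply mul_left_cancel₀ h3
      linear_combination e2 - e1
  | mul x y _ _ hx hy => rw [hd.mul, hd'.mul, hx, hy]

theorem gr1 {k Λ K : Type u} [Field k] [CommRing Λ] [IsNoetherianRing Λ] [Field K]
    (φ : k →+* Λ) (hreg : GReg φ) (χ : Λ →+* K) (δ : k → K) (hδ : DV (χ.comp φ) δ) (S : Finset k) :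
    ∃ D : Λ → K, DV χ D ∧ ∀ s ∈ S, D (φ s) = δ s := by
  classical
  obtain ⟨p, hpc⟩ := CharP.exists k
  rcases CharP.char_is_prime_or_zero k p with h | h
  · haveI : Fact p.Prime := ⟨h⟩
    induction S using Finset.induction_on with
    | empty => exact ⟨fun _ => 0, ⟨by simp, by simp⟩, by simp⟩
    | insert a S _ ih =>
      obtain ⟨D, hD, hDS⟩ := ih
      by_cases ha : a ∈ Subfield.closure (Set.range (fun x : k => x ^ p) ∪ S)
      · refine ⟨D, hD, ?_⟩
        intro s hs
        rcases Finset.mem_insert.1 hs with rfl | hs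
        · exact DV.eq_on_closure p (χ.comp φ) _ _ (hD.comp φ) hδ S hDS _ ha
        · exact hDS s hs
      · obtain ⟨D', hD', hD'S, hD'a⟩ := gr2 p φ hreg χ S a ha
        refine ⟨fun x => D x + (δ a - D (φ a)) * D' x, ⟨fun x y => ?_, fun x y => ?_⟩, ?_⟩
        · rw [hD.add, hD'.add]; ring
        · rw [hD.mul, hD'.mul]; ring
        · intro s hs
          rcases Finset.mem_insert.1 hs with rfl | hs
          · beta_reduce; rw [hD'a]; ring
          · simp only [hD'S s hs, hDS s hs, mul_zero, add_zero]
  · subst h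
    haveI : CharZero k := CharP.charP_to_charZero k
    obtain ⟨D, hD, hD2⟩ := der_ext _ (field_fs' (χ.comp φ)) (RingHom.id K) δ hδ
    exact ⟨fun x => D (χ x), hD.comp χ, fun s _ => hD2 s⟩

theorem fin_gen {k L K : Type u} [Field k] [CommRing L] [Field K] (p : ℕ) [hp : Fact p.Prime] [CharP k p]
    (χ : L →+* K) (hχ : Function.Surjective χ) (lam : k →+* L) {d : ℕ} (t : Fin d → L) (hspan : RingHom.ker χ = Ideal.span (Set.range t))
    (hGR : ∀ (S : Finset k) (a : k), a ∉ Subfield.closure (Set.range (fun x : k => x ^ p) ∪ S) →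
      ∃ D : L → K, DV χ D ∧ (∀ s ∈ S, D (lam s) = 0) ∧ D (lam a) = 1)
    (I : Set k) (hI : ∀ x : k, ∃ S0 : Finset k, (S0 : Set k) ⊆ I ∧ ∀ D : K → K, DV (RingHom.id K) D → (∀ s ∈ S0, D (χ (lam s)) = 0) → D (χ (lam x)) = 0) :
    ∃ Y : Finset k, Subfield.closure (Set.range (fun x : k => x ^ p) ∪ (I ∪ Y)) = ⊤ := by
  classical
  by_contra hcon
  push Not at hcon
  have : ∀ Y : Finset k, ∃ x, x ∉ Subfield.closure (Set.range (fun x : k => x ^ p) ∪ (I ∪ Y)) := by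
    intro Y
    by_contra h
    push Not at h
    exact hcon Y (eq_top_iff.2 fun x _ => h x)
  choose ξ hξ using this
  obtain ⟨Y, hY0, hYs⟩ : ∃ Y : ℕ → Finset k, Y 0 = ∅ ∧ ∀ n, Y (n + 1) = insert (ξ (Y n)) (Y n) :=
    ⟨fun n => Nat.rec ∅ (fun _ Y => insert (ξ Y) Y) n, rfl, fun n => rfl⟩
  have hmono : Monotone Y := monotone_nat_of_le_succ fun n => by rw [hYs]; exact Finset.subset_insert _ _
  have hmem : ∀ s t, s < t → ξ (Y s) ∈ Y t := fun s t h => hmono h (by rw [hYs]; exact Finset.mem_insert_self _ _)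
  choose S0 hS0I hS0 using hI
  obtain ⟨T, hT⟩ : ∃ T : Finset k, T = (Finset.univ : Finset (Fin (d+1))).biUnion (fun s => S0 (ξ (Y s))) := ⟨_, rfl⟩
  have hTI : (T : Set k) ⊆ I := by
    intro x hx
    rw [hT] at hx
    simp only [Finset.coe_biUnion, Set.mem_iUnion] at hx
    obtain ⟨s, _, hx⟩ := hx
    exact hS0I _ hx
  have hTs : ∀ s : Fin (d+1), S0 (ξ (Y s)) ⊆ T := fun s => by rw [hT]; exact Finset.subset_biUnion_of_mem (fun s : Fin (d+1) => S0 (ξ (Y s))) (Finset.mem_univ s)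
  choose D hD hDS hD1 using fun s : Fin (d+1) => hGR (T ∪ Y s) (ξ (Y s)) (fun h => hξ (Y s) (by
    refine Subfield.closure_mono ?_ h
    rw [Finset.coe_union]
    exact Set.union_subset_union_right _ (Set.union_subset_union_left _ hTI)))
  -- a relation
  obtain ⟨c, hc, hc0⟩ : ∃ c : Fin (d+1) → K, (∀ i, ∑ s, c s * D s (t i) = 0) ∧ c ≠ 0 := by
    let A : (Fin (d+1) → K) →ₗ[K] (Fin d → K) := (Matrix.of fun i s => D s (t i)).mulVecLin
    have := LinearMap.ker_ne_bot_of_finrank_lt (f := A) (by simp)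
    obtain ⟨c, hc, hc0⟩ := Submodule.exists_mem_ne_zero_of_ne_bot this
    refine ⟨c, fun i => ?_, hc0⟩
    have := congrFun (LinearMap.mem_ker.1 hc) i
    rw [← show A c i = 0 from this]
    show _ = ∑ s, D s (t i) * c s
    exact Finset.sum_congr rfl fun s _ => mul_comm _ _
  obtain ⟨D', hD'⟩ : ∃ D' : L → K, ∀ x, D' x = ∑ s, c s * D s x := ⟨_, fun _ => rfl⟩
  have hDV : DV χ D' := ⟨fun x y => by
    rw [hD', hD', hD', ← Finset.sum_add_distrib]
    exact Finset.sum_congr rfl fun s _ => by rw [(hD s).add]; ring, fun x y => by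
    rw [hD', hD', hD', Finset.mul_sum, Finset.mul_sum, ← Finset.sum_add_distrib]
    exact Finset.sum_congr rfl fun s _ => by rw [(hD s).mul]; ring⟩
  have hker : ∀ x, χ x = 0 → D' x = 0 := by
    intro x hx
    have hx' : x ∈ Ideal.span (Set.range t) := by rw [← hspan]; exact hx
    obtain ⟨a, rfl⟩ := (Ideal.mem_span_range_iff_exists_fun).1 hx'
    rw [hDV.sum]
    refine Finset.sum_eq_zero fun i _ => ?_
    have h1 : χ (t i) = 0 := by
      have : t i ∈ RingHom.ker χ := by rw [hspan]; exact Ideal.subset_span ⟨i, rfl⟩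
      exact this
    rw [hDV.mul, h1, hD' (t i), hc i, mul_zero, zero_mul, add_zero]
  choose v hv using hχ
  have hD'v : ∀ x, D' (v (χ x)) = D' x := fun x => by
    rw [← sub_eq_zero, ← hDV.sub]; exact hker _ (by rw [map_sub, hv, sub_self])
  have hDK : DV (RingHom.id K) (fun y => D' (v y)) := ⟨fun x y => by
    have := hD'v (v x + v y)
    rw [map_add, hv, hv, hDV.add] at this; exact this, fun x y => by
    have := hD'v (v x * v y)
    rw [map_mul, hv, hv, hDV.mul, hv, hv] at this; exact this⟩
  have hz : ∀ s : Fin (d+1), D' (lam (ξ (Y s))) = 0 := by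
    intro s
    have := hS0 (ξ (Y s)) _ hDK (by
      intro x hx
      rw [hD'v, hD']
      refine Finset.sum_eq_zero fun s' _ => ?_
      rw [hDS s' x (Finset.mem_union_left _ (hTs s hx)), mul_zero])
    rwa [hD'v] at this
  apply hc0
  have key : ∀ n : ℕ, ∀ s : Fin (d+1), (s : ℕ) = n → c s = 0 := by
    intro n
    induction n using Nat.strong_induction_on with
    | _ n ih =>
      intro s hs
      have h1 := hz s
      rw [hD', Finset.sum_eq_single s] at h1
      · rwa [hD1, mul_one] at h1
      · intro s' _ hne
        rcases lt_or_gt_of_ne hne with h | h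
        · rw [ih s' (by rw [← hs]; exact h) s' rfl, zero_mul]
        · rw [hDS s' _ (Finset.mem_union_right _ (hmem s s' h)), mul_zero]
      · simp
  ext s; exact key s s rfl

theorem fs_E {k K : Type u} [Field k] [Field K] (kK : k →+* K) {ι : Type u} (a : ι → k)
    (E : Subfield k) (hE : E = Subfield.closure (Set.range a))
    (hli : LinearIndependent K (fun i => KaehlerDifferential.D ℤ K (kK (a i)))) : FS (kK.comp E.subtype) 1 := by
  intro T T' _ _ q hq hs φ g hg _
  obtain ⟨e, he⟩ : ∃ e : (⊥ : Subfield k) →+* k, e = (⊥ : Subfield k).subtype := ⟨_, rfl⟩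
  have heE : ∀ x, e x ∈ E := fun x => by rw [he]; exact (bot_le : (⊥ : Subfield k) ≤ E) x.2
  have haE : ∀ i, a i ∈ E := fun i => by rw [hE]; exact Subfield.subset_closure ⟨i, rfl⟩
  obtain ⟨g0, h1, h2⟩ := field_fs' (kK.comp e) T T' q hq hs (φ.comp (e.codRestrict E heE)) g (by
    have := congrArg (fun r : E →+* T' => r.comp (e.codRestrict E heE)) hg
    exact this) (by simp)
  have h1' : ∀ x, q (g0 x) = g x := fun x => RingHom.congr_fun h1 x
  have hg' : ∀ x : E, g (kK x) = q (φ x) := fun x => RingHom.congr_fun hg x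
  letI := g0.toAlgebra
  obtain ⟨N, hN⟩ : ∃ N : Submodule K T, ∀ x, x ∈ N ↔ q x = 0 := ⟨(RingHom.ker q).restrictScalars K, fun x => Iff.rfl⟩
  obtain ⟨ℓ, hℓ⟩ : ∃ ℓ : Ω[K⁄ℤ] →ₗ[K] N, ∀ i, (ℓ (KaehlerDifferential.D ℤ K (kK (a i))) : T) = φ ⟨a i, haE i⟩ - g0 (kK (a i)) := by
    have hv : ∀ i, φ ⟨a i, haE i⟩ - g0 (kK (a i)) ∈ N := fun i => by
      rw [hN, map_sub, h1', ← hg', sub_self]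
    obtain ⟨ℓ, hℓ⟩ := LinearMap.exists_extend ((Finsupp.linearCombination K (fun i => (⟨_, hv i⟩ : N))).comp hli.repr)
    refine ⟨ℓ, fun i => ?_⟩
    have := LinearMap.congr_fun hℓ ⟨_, Submodule.subset_span ⟨i, rfl⟩⟩
    rw [LinearMap.comp_apply, LinearMap.comp_apply, hli.repr_eq_single i _ rfl, Finsupp.linearCombination_single, one_smul] at this
    exact congrArg Subtype.val this
  obtain ⟨Δ, hΔ⟩ : ∃ Δ : K → T, ∀ x, Δ x = (ℓ (KaehlerDifferential.D ℤ K x) : T) := ⟨_, fun _ => rfl⟩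
  have hΔq : ∀ x, q (Δ x) = 0 := fun x => by rw [hΔ, ← hN]; exact (ℓ _).2
  have hΔadd : ∀ x y, Δ (x + y) = Δ x + Δ y := fun x y => by simp [hΔ]
  have hΔmul : ∀ x y, Δ (x * y) = g0 x * Δ y + g0 y * Δ x := fun x y => by
    rw [hΔ, hΔ, hΔ, Derivation.leibniz, map_add, map_smul, map_smul]; rfl
  have hΔ1 : Δ 1 = 0 := by have := hΔmul 1 1; simpa using this
  obtain ⟨g1, hg1⟩ : ∃ g1 : K →+* T, ∀ x, g1 x = g0 x + Δ x :=
    ⟨{ toFun := fun x => g0 x + Δ x, map_one' := by rw [hΔ1, map_one, add_zero], map_zero' := by have := hΔadd 0 0; simpa using this,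
       map_add' := fun x y => by rw [hΔadd, map_add]; ring,
       map_mul' := fun x y => by rw [hΔmul, map_mul]; linear_combination - hs _ _ (hΔq x) (hΔq y) }, fun x => rfl⟩
  have heq : ∀ x (hx : x ∈ Subfield.closure (Set.range a)), ∀ hx' : x ∈ E, g1 (kK x) = φ ⟨x, hx'⟩ := by
    intro x hx
    induction hx using Subfield.closure_induction with
    | mem x hx =>
      intro hx'
      obtain ⟨i, rfl⟩ := hx
      rw [hg1, hΔ, hℓ]; ring
    | one => intro h; rw [map_one, map_one]; exact (map_one φ).symm
    | add x y hx hy h1 h2 =>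
      rw [← hE] at hx hy
      intro h; rw [map_add, map_add, h1 hx, h2 hy, ← map_add]; rfl
    | neg x hx h1 =>
      rw [← hE] at hx
      intro h; rw [map_neg, map_neg, h1 hx, ← map_neg]; rfl
    | inv x hx h1 =>
      rw [← hE] at hx
      intro h
      by_cases h0 : x = 0
      · subst h0
        have e1 : (⟨0⁻¹, h⟩ : E) = 0 := Subtype.ext inv_zero
        rw [e1, inv_zero, map_zero, map_zero, map_zero]
      · have e1 : φ ⟨x, hx⟩ * φ ⟨x⁻¹, h⟩ = 1 := by
          rw [← map_mul, ← map_one φ]; congr 1; exact Subtype.ext (mul_inv_cancel₀ h0)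
        have e2 : g1 (kK x) * g1 (kK x⁻¹) = 1 := by rw [← map_mul, ← map_mul, mul_inv_cancel₀ h0, map_one, map_one]
        rw [h1 hx] at e2
        calc g1 (kK x⁻¹) = g1 (kK x⁻¹) * (φ ⟨x, hx⟩ * φ ⟨x⁻¹, h⟩) := by rw [e1, mul_one]
          _ = (φ ⟨x, hx⟩ * g1 (kK x⁻¹)) * φ ⟨x⁻¹, h⟩ := by ring
          _ = _ := by rw [e2, one_mul]
    | mul x y hx hy h1 h2 =>
      rw [← hE] at hx hy
      intro h; rw [map_mul, map_mul, h1 hx, h2 hy, ← map_mul]; rfl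
  refine ⟨g1, ?_, ?_⟩
  · apply RingHom.ext; intro x; rw [RingHom.comp_apply, hg1, map_add, h1', hΔq, add_zero]
  · apply RingHom.ext; intro x
    exact heq x (by rw [← hE]; exact x.2) x.2

theorem FS.nil  {f : R →+* B} (hf : FS f 1) (χ : L →+* T')
    (hχ : Function.Surjective χ) (n : ℕ) (hn : (RingHom.ker χ) ^ n = ⊥) (φ : R →+* L) (g : B →+* T') (h : g.comp f = χ.comp φ) :
    ∃ g' : B →+* L, χ.comp g' = g ∧ g'.comp f = φ := by
  let _ := f.toAlgebra
  let _ := φ.toAlgebra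
  let _ := (χ.comp φ).toAlgebra
  have : Algebra.FormallySmooth R B := FS.formallySmooth hf
  let χ' : L →ₐ[R] T' := ⟨χ, fun _ => rfl⟩
  let g' : B →ₐ[R] T' := ⟨g, fun x => RingHom.congr_fun h x⟩
  have hnil : IsNilpotent (RingHom.ker (χ' : L →+* T')) := ⟨n, hn⟩
  refine ⟨(Algebra.FormallySmooth.liftOfSurjective g' χ' hχ hnil : B →ₐ[R] L), ?_, ?_⟩
  · apply RingHom.ext; intro x
    exact Algebra.FormallySmooth.liftOfSurjective_apply g' χ' hχ hnil x
  · apply RingHom.ext; intro x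
    exact (Algebra.FormallySmooth.liftOfSurjective g' χ' hχ hnil).commutes x

theorem frob_top {k : Type u} [Field k] (p : ℕ) [Fact p.Prime] [CharP k p] (T : Set k)
    (h : Subfield.closure (Set.range (fun x : k => x ^ p) ∪ T) = ⊤) (M : ℕ) :
    Subfield.closure (Set.range (fun x : k => x ^ (p ^ M)) ∪ T) = ⊤ := by
  induction M with
  | zero =>
    refine eq_top_iff.2 fun x _ => Subfield.subset_closure (Or.inl ⟨x, by simp⟩)
  | succ M ih =>
    rw [eq_top_iff, ← h, Subfield.closure_le]
    rintro x (⟨y, rfl⟩ | hx)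
    · have h1 : (⊤ : Subfield k) ≤ (Subfield.closure (Set.range (fun x : k => x ^ (p ^ (M+1))) ∪ T)).comap (frobenius k p) := by
        rw [← ih, Subfield.closure_le]
        rintro x (⟨y, rfl⟩ | hx)
        · refine Subfield.subset_closure (Or.inl ⟨y, ?_⟩)
          simp only [frobenius_def]; rw [pow_succ, pow_mul]
        · have h0 : x ∈ Subfield.closure (Set.range (fun x : k => x ^ (p ^ (M+1))) ∪ T) := Subfield.subset_closure (Or.inr hx)
          exact pow_mem h0 p
      exact h1 (show y ∈ (⊤ : Subfield k) from trivial)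
    · exact Subfield.subset_closure (Or.inr hx)

theorem finite_k' {k : Type u} [Field k] (k' : Subfield k) (Y : Finset k) (N : ℕ) (hN : 0 < N) (hY : ∀ y ∈ Y, y ^ N ∈ k')
    (S : Set k) (hS : S ⊆ k') (hc : Subfield.closure (S ∪ Y) = ⊤) : k'.subtype.FiniteType := by
  have h1 : IntermediateField.adjoin k' (Y : Set k) = ⊤ := by
    rw [← top_le_iff]
    intro x _
    have : x ∈ Subfield.closure (S ∪ Y) := by rw [hc]; trivial
    have h2 : Subfield.closure (S ∪ Y) ≤ (IntermediateField.adjoin k' (Y : Set k)).toSubfield := by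
      rw [Subfield.closure_le]
      rintro x (hx | hx)
      · exact (IntermediateField.adjoin k' (Y : Set k)).algebraMap_mem ⟨x, hS hx⟩
      · exact IntermediateField.subset_adjoin k' (Y : Set k) hx
    exact h2 this
  have h2 : FiniteDimensional k' (IntermediateField.adjoin k' (Y : Set k)) := by
    refine IntermediateField.finiteDimensional_adjoin fun y hy => ?_
    refine IsIntegral.of_pow hN ?_
    exact isIntegral_algebraMap (x := (⟨y ^ N, hY y hy⟩ : k'))
  rw [h1] at h2
  have h3 : Module.Finite k' k := Module.Finite.equiv (IntermediateField.topEquiv (F := k') (E := k)).toLinearEquiv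
  exact (RingHom.finite_algebraMap.2 h3).finiteType

theorem dv_lin {K : Type u} [Field K] (D : K → K) (hD : DV (RingHom.id K) D) : ∃ ℓ : Ω[K⁄ℤ] →ₗ[K] K, ∀ x, ℓ (KaehlerDifferential.D ℤ K x) = D x := by
  let D' : Derivation ℤ K K := Derivation.mk' (AddMonoidHom.toIntLinearMap (AddMonoidHom.mk' D hD.add)) (fun x y => hD.mul x y)
  exact ⟨D'.liftKaehlerDifferential, fun x => D'.liftKaehlerDifferential_comp_D x⟩

theorem cf_charp {k L K : Type u} [Field k] [CommRing L] [Field K] (p : ℕ) [hp : Fact p.Prime] [CharP k p]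
    (χ : L →+* K) (hχ : Function.Surjective χ) (lam : k →+* L) {d : ℕ} (t : Fin d → L) (hspan : RingHom.ker χ = Ideal.span (Set.range t))
    (hGR : ∀ (S : Finset k) (a : k), a ∉ Subfield.closure (Set.range (fun x : k => x ^ p) ∪ S) →
      ∃ D : L → K, DV χ D ∧ (∀ s ∈ S, D (lam s) = 0) ∧ D (lam a) = 1) : CF (⊥ : Subfield k).subtype (χ.comp lam) := by
  classical
  obtain ⟨kK, hkK⟩ : ∃ kK : k →+* K, kK = χ.comp lam := ⟨_, rfl⟩
  rw [← hkK]
  obtain ⟨b, hb1, hb2, hb3⟩ := exists_linearIndependent K (Set.range fun x : k => KaehlerDifferential.D ℤ K (kK x))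
  choose a ha using fun i : b => hb1 i.2
  have ha' : ∀ i : b, KaehlerDifferential.D ℤ K (kK (a i)) = i := ha
  have hli : LinearIndependent K (fun i => KaehlerDifferential.D ℤ K (kK (a i))) := by
    simp_rw [ha']; exact hb3
  obtain ⟨E, hE⟩ : ∃ E, E = Subfield.closure (Set.range a) := ⟨_, rfl⟩
  have hFS := fs_E kK a E hE hli
  obtain ⟨Y, hY⟩ := fin_gen p χ hχ lam t hspan hGR (Set.range a) (by
    intro x
    have hx : KaehlerDifferential.D ℤ K (kK x) ∈ Submodule.span K (Set.range fun i => KaehlerDifferential.D ℤ K (kK (a i))) := by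
      have : (Set.range fun i => KaehlerDifferential.D ℤ K (kK (a i))) = b := by
        simp_rw [ha']; exact Subtype.range_coe
      rw [this, hb2]; exact Submodule.subset_span ⟨x, rfl⟩
    obtain ⟨c, hc⟩ := Finsupp.mem_span_range_iff_exists_finsupp.1 hx
    refine ⟨c.support.image a, ?_, fun D hD hD0 => ?_⟩
    · intro y hy
      obtain ⟨i, _, rfl⟩ := Finset.mem_image.1 (Finset.mem_coe.1 hy)
      exact ⟨i, rfl⟩
    · obtain ⟨ℓ, hℓ⟩ := dv_lin D hD
      have e1 : ∀ x, χ (lam x) = kK x := fun x => by rw [hkK]; rfl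
      rw [e1, ← hℓ, ← hc, Finsupp.sum, map_sum]
      refine Finset.sum_eq_zero fun i hi => ?_
      rw [map_smul, hℓ, ← e1, hD0 _ (Finset.mem_image_of_mem a hi), smul_zero])
  intro n
  obtain ⟨M, hM⟩ : ∃ M, n ≤ p ^ M := ⟨n, (Nat.lt_pow_self hp.out.one_lt).le⟩
  obtain ⟨k', hk'⟩ : ∃ k' : Subfield k, k' = Subfield.closure (Set.range (fun x : k => x ^ (p ^ M)) ∪ Set.range a) := ⟨_, rfl⟩
  have hsub : Set.range (fun x : k => x ^ (p ^ M)) ∪ Set.range a ⊆ k' := by rw [hk']; exact Subfield.subset_closure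
  refine ⟨k', inferInstance, (⊥ : Subfield k).subtype.codRestrict k' (fun x => (bot_le : (⊥ : Subfield k) ≤ k') x.2), k'.subtype, ?_, rfl, ?_⟩
  · refine finite_k' k' Y (p ^ M) (pow_pos hp.out.pos _) (fun y _ => hsub (Or.inl ⟨y, rfl⟩)) _ hsub ?_
    rw [Set.union_assoc]; exact frob_top p _ hY M
  · intro L' _ χ' lam' hχ' hn hc
    obtain ⟨σ, hσ1, hσ2⟩ := hFS.nil χ' hχ' n hn (lam'.comp E.subtype) (RingHom.id K) (by rw [← hc]; rfl)
    refine ⟨σ, hσ1, fun x => ⟨kK x, ?_⟩⟩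
    haveI : Nontrivial L' := χ'.domain_nontrivial
    haveI : CharP L' p := charP_of_injective_ringHom lam'.injective p
    have h1 : k' ≤ RingHom.eqLocusField lam' (σ.comp kK) := by
      rw [hk', Subfield.closure_le]
      rintro x (⟨y, rfl⟩ | ⟨i, rfl⟩)
      · show lam' (y ^ (p ^ M)) = σ (kK (y ^ (p ^ M)))
        rw [map_pow, map_pow, map_pow, ← sub_eq_zero, ← sub_pow_char_pow]
        have h2 : lam' y - σ (kK y) ∈ RingHom.ker χ' := by
          rw [RingHom.mem_ker, map_sub, show χ' (σ (kK y)) = kK y from RingHom.congr_fun hσ1 _, ← hc]; simp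
        have h3 : (lam' y - σ (kK y)) ^ n = 0 := by
          have := Ideal.pow_mem_pow h2 n; rwa [hn] at this
        exact pow_eq_zero_of_le hM h3
      · have hi : a i ∈ E := by rw [hE]; exact Subfield.subset_closure ⟨i, rfl⟩
        exact (RingHom.congr_fun hσ2 ⟨a i, hi⟩).symm
    exact h1 x.2

theorem cf {k L K : Type u} [Field k] [CommRing L] [Field K]
    (χ : L →+* K) (hχ : Function.Surjective χ) (lam : k →+* L) {d : ℕ} (t : Fin d → L) (hspan : RingHom.ker χ = Ideal.span (Set.range t))
    (hGR : ∀ (p : ℕ) [Fact p.Prime] [CharP k p] (S : Finset k) (a : k), a ∉ Subfield.closure (Set.range (fun x : k => x ^ p) ∪ S) →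
      ∃ D : L → K, DV χ D ∧ (∀ s ∈ S, D (lam s) = 0) ∧ D (lam a) = 1) : CF (⊥ : Subfield k).subtype (χ.comp lam) := by
  obtain ⟨p, hpc⟩ := CharP.exists k
  rcases CharP.char_is_prime_or_zero k p with h | h
  · haveI : Fact p.Prime := ⟨h⟩
    exact cf_charp p χ hχ lam t hspan (hGR p)
  · subst h
    haveI : CharZero k := CharP.charP_to_charZero k
    intro n
    refine ⟨k, inferInstance, (⊥ : Subfield k).subtype, RingHom.id k, RingHom.FiniteType.id k, rfl, ?_⟩
    intro L' _ χ' lam' hχ' hn hc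
    obtain ⟨σ, hσ1, hσ2⟩ := (field_fs' (χ.comp lam)).nil χ' hχ' n hn lam' (RingHom.id K) (by rw [hc]; rfl)
    exact ⟨σ, hσ1, fun x => ⟨_, (RingHom.congr_fun hσ2 x).symm⟩⟩

theorem DV.mvp {k K : Type u} [CommRing k] [Field K] {n : ℕ} (θ : MvPolynomial (Fin n) k →+* K) (E : MvPolynomial (Fin n) k → K) (hE : DV θ E)
    (x : MvPolynomial (Fin n) k) (hx : ∀ m ∈ x.support, E (C (x.coeff m)) = 0) (hd : ∀ i, θ (pderiv i x) = 0) : E x = 0 := by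
  classical
  obtain ⟨G, hG⟩ : ∃ G : MvPolynomial (Fin n) k → K, ∀ y, G y = E y - ∑ i, θ (pderiv i y) * E (X i) := ⟨_, fun _ => rfl⟩
  have hDV : DV θ G := ⟨fun y z => by
    rw [hG, hG, hG, hE.add]; simp only [map_add, add_mul, Finset.sum_add_distrib]; ring, fun y z => by
    rw [hG, hG, hG, hE.mul]
    simp only [Derivation.leibniz, map_add, smul_eq_mul, map_mul, add_mul, Finset.sum_add_distrib, mul_assoc, ← Finset.mul_sum]; ring⟩
  have hX : ∀ i, G (X i) = 0 := by
    intro i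
    rw [hG, Finset.sum_eq_single i]
    · rw [pderiv_X_self, map_one, one_mul, sub_self]
    · intro j _ hj; rw [pderiv_X_of_ne (Ne.symm hj), map_zero, zero_mul]
    · simp
  obtain ⟨U, hU⟩ : ∃ U : Subring (MvPolynomial (Fin n) k), ∀ y, y ∈ U ↔ G y = 0 :=
    ⟨{ carrier := {y | G y = 0}, mul_mem' := fun {a b} ha hb => by
        show G _ = 0; rw [hDV.mul, show G a = 0 from ha, show G b = 0 from hb]; ring
       one_mem' := hDV.one, zero_mem' := hDV.zero, add_mem' := fun {a b} ha hb => by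
        show G _ = 0; rw [hDV.add, show G a = 0 from ha, show G b = 0 from hb]; ring
       neg_mem' := fun {a} ha => by show G _ = 0; rw [hDV.neg, show G a = 0 from ha]; ring }, fun y => Iff.rfl⟩
  have hm : ∀ m : Fin n →₀ ℕ, G (monomial m 1) = 0 := by
    intro m
    rw [← hU, monomial_eq, map_one, one_mul]
    exact prod_mem fun i _ => pow_mem ((hU _).2 (hX i)) _
  have h0 : G x = 0 := by
    rw [x.as_sum, hDV.sum]
    refine Finset.sum_eq_zero fun m hm' => ?_
    rw [← mul_one (x.coeff m), ← C_mul_monomial, hDV.mul, hm, hG, hx m hm']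
    simp
  rw [hG] at h0
  rw [sub_eq_zero.1 h0]
  exact Finset.sum_eq_zero fun i _ => by rw [hd, zero_mul]

theorem upgrade {k Λ D : Type u} [Field k] [CommRing Λ] [IsNoetherianRing Λ] [CommRing D] (κ : k →+* D) (hκ : κ.FiniteType) (ψ : D →+* Λ)
    (hreg : GReg (ψ.comp κ)) (𝔔 : Ideal Λ) [h𝔔 : 𝔔.IsPrime] (h : SmAt (κ.comp (⊥ : Subfield k).subtype) ψ 𝔔) : SmAt κ ψ 𝔔 := by
  classical
  obtain ⟨n, pB, hpB, hpC⟩ := exists_presentation κ hκ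
  obtain ⟨b, hb, hb𝔔⟩ := h
  obtain ⟨b', rfl⟩ := hpB b
  obtain ⟨χ, hχ⟩ : ∃ χ : Λ →+* 𝔔.ResidueField, ∀ x, χ x = 0 ↔ x ∈ 𝔔 := ⟨algebraMap _ _, fun x => Ideal.algebraMap_residueField_eq_zero⟩
  obtain ⟨θ, hθ⟩ : ∃ θ : MvPolynomial (Fin n) k →+* 𝔔.ResidueField, θ = χ.comp (ψ.comp pB) := ⟨_, rfl⟩
  have hθx : ∀ x, θ x = χ (ψ (pB x)) := fun x => by rw [hθ]; rfl
  obtain ⟨𝔓, h𝔓⟩ : ∃ 𝔓, 𝔓 = RingHom.ker θ := ⟨_, rfl⟩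
  have h𝔓x : ∀ x, x ∈ 𝔓 ↔ θ x = 0 := fun x => by rw [h𝔓]; rfl
  haveI : 𝔓.IsPrime := by rw [h𝔓]; exact RingHom.ker_isPrime θ
  have hJ : RingHom.ker pB ≤ 𝔓 := fun x hx => by rw [h𝔓x, hθx, RingHom.mem_ker.1 hx, map_zero, map_zero]
  have hfF : FS ((C : k →+* MvPolynomial (Fin n) k).comp (⊥ : Subfield k).subtype) 1 :=
    FS.comp' (field_fs' (⊥ : Subfield k).subtype) (FS.mvPolynomial (Fin n)) (by simp)
  have H := H_of_FS hfF (RingHom.ker pB) 𝔓 ⊥ hJ (RingHom.id _) Function.surjective_id (fun r hr => by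
    rw [show r = 0 from hr, map_zero]; exact zero_mem _) pB hpB (fun x => Iff.rfl) (κ.comp (⊥ : Subfield k).subtype) (by
      rw [← hpC]; rfl) b' (by rw [h𝔓x, hθx, hχ]; exact hb𝔔) hb
  obtain ⟨ι, _, _, F, d, c, hF, hd, hc, hcJ, hdF⟩ := LF (C : k →+* MvPolynomial (Fin n) k) (RingHom.ker pB) 𝔓 ⊥ hJ (by
    intro x hx hxd
    refine H x hx fun del hdel => ?_
    have hcomp : ∀ y, θ (C y) = χ (ψ (κ y)) := fun y => by rw [hθx, ← hpC]; rfl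
    obtain ⟨D', hD', hDx⟩ := gr1 (ψ.comp κ) hreg χ (fun y => θ (del (C y))) ⟨fun y z => by rw [map_add, hdel.add, map_add], fun y z => by
      rw [map_mul, hdel.mul, map_add, map_mul, map_mul, hcomp, hcomp]; rfl⟩ (x.support.image x.coeff)
    have hDV : DV θ (fun y => θ (del y) - D' (ψ (pB y))) := ⟨fun y z => by
      rw [hdel.add, map_add, map_add, map_add, hD'.add]; ring, fun y z => by
      rw [hdel.mul, map_add, map_mul, map_mul, map_mul, map_mul, hD'.mul, ← hθx, ← hθx]; ring⟩
    have := hDV.mvp θ _ x (fun m hm => by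
      rw [sub_eq_zero, ← hDx _ (Finset.mem_image_of_mem _ hm), ← hpC]; rfl) (fun i => by
      rw [← h𝔓x]; exact hxd _ ⟨fun y z => map_add _ _ _, fun y z => by rw [Derivation.leibniz]; rfl, fun r => pderiv_C⟩)
    simp only [RingHom.mem_ker.1 hx, map_zero, hD'.zero, sub_zero] at this
    rw [h𝔓x, this])
  refine ⟨pB c, ?_, ?_⟩
  · rw [← hpC]
    exact FS_of_LF (FS.mvPolynomial (Fin n)) F d c hd hdF pB hpB hF (fun x hx => by
      have := hcJ x hx; rwa [sup_bot_eq] at this)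
  · rw [← hχ, ← hθx, ← h𝔓x]; exact hc

theorem RegAt.of_equiv {L L' : Type u} [CommRing L] [IsLocalRing L] [CommRing L'] [IsLocalRing L'] (e : L ≃+* L') (h : RegAt L) : RegAt L' := by
  classical
  obtain ⟨s, hs, hd⟩ := h
  refine ⟨s.image e, ?_, ?_⟩
  · have h1 : Ideal.span ((s.image e : Finset L') : Set L') = (IsLocalRing.maximalIdeal L).map (e : L →+* L') := by
      rw [← hs, Ideal.map_span, Finset.coe_image]; rfl
    rw [h1]
    have : ((IsLocalRing.maximalIdeal L).map (e : L →+* L')).IsMaximal := Ideal.map_isMaximal_of_equiv e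
    exact IsLocalRing.eq_maximalIdeal this
  · rw [← ringKrullDim_eq_of_ringEquiv e]
    exact le_trans (by exact_mod_cast Finset.card_image_le) hd

theorem GReg.reg {k Λ : Type u} [Field k] [CommRing Λ] {φ : k →+* Λ} (h : GReg φ) (q : Ideal Λ) [hq : q.IsPrime] : RegAt (Localization.AtPrime q) := by
  obtain ⟨Λ2, _, l, r, hPO, hM⟩ := h k (RingHom.id k) (RingHom.Finite.id k)
  obtain ⟨γ, hγ1, hγ2⟩ := hPO.univ Λ (RingHom.id Λ) φ rfl
  have h2 : l.comp γ = RingHom.id Λ2 := hPO.epi _ _ _ (by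
    rw [RingHom.comp_assoc, hγ1]; rfl) (by rw [RingHom.comp_assoc, hγ2, hPO.comm]; rfl)
  let e : Λ2 ≃+* Λ := RingEquiv.ofRingHom γ l hγ1 h2
  have hp : (q.comap γ).IsPrime := Ideal.comap_isPrime γ q
  refine RegAt.of_equiv (IsLocalization.ringEquivOfRingEquiv (M := (q.comap γ).primeCompl) (T := q.primeCompl) _ _ e ?_) (hM (q.comap γ))
  ext x
  constructor
  · rintro ⟨y, hy, rfl⟩; exact hy
  · intro hx
    refine ⟨l x, ?_, RingHom.congr_fun hγ1 x⟩
    show γ (l x) ∉ q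
    rw [show γ (l x) = x from RingHom.congr_fun hγ1 x]; exact hx

theorem min_rad  (I q : Ideal Λ) (hI : I.IsRadical) (hq : q ∈ I.minimalPrimes) (x : Λ) (hx : x ∈ q) : ∃ s, s ∉ q ∧ s * x ∈ I := by
  haveI : q.IsPrime := hq.1.1
  have h1 := IsLocalization.AtPrime.radical_map_of_mem_minimalPrimes (A := Localization.AtPrime q) q I hq
  have h2 : algebraMap Λ (Localization.AtPrime q) x ∈ (I.map (algebraMap Λ (Localization.AtPrime q))).radical := by
    rw [h1]; exact Ideal.mem_map_of_mem _ hx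
  obtain ⟨n, hn⟩ := h2
  rw [← map_pow, IsLocalization.algebraMap_mem_map_algebraMap_iff q.primeCompl] at hn
  obtain ⟨s, hs, hsx⟩ := hn
  refine ⟨s, hs, hI ⟨n+1, ?_⟩⟩
  have : (s * x) ^ (n+1) = (s ^ n * x) * (s * x ^ n) := by ring
  rw [this]; exact Ideal.mul_mem_left _ _ hsx

theorem field_step {k Λ A : Type u} [Field k] [CommRing Λ] [IsNoetherianRing Λ] [CommRing A] (i : k →+* A) (hi : i.FiniteType) (ψ : A →+* Λ)
    (hreg : GReg (ψ.comp i)) (I : Ideal Λ) (hI : I.IsRadical) (hIs : ∀ (𝔔 : Ideal Λ) [𝔔.IsPrime], ¬ SmAt i ψ 𝔔 → I ≤ 𝔔)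
    (q : Ideal Λ) [hqp : q.IsPrime] (hq : q ∈ I.minimalPrimes) :
    ∃ (D : Type u) (_ : CommRing D) (κ : A →+* D) (ψD : D →+* Λ), κ.FiniteType ∧ ψD.comp κ = ψ ∧
    ∀ (𝔔 : Ideal Λ) [𝔔.IsPrime], (SmAt i ψ 𝔔 ∨ 𝔔 = q) → SmAt (κ.comp i) ψD 𝔔 := by
  classical
  obtain ⟨s, hs, hd⟩ := hreg.reg q
  obtain ⟨loc, hloc'⟩ : ∃ loc : Λ →+* Localization.AtPrime q, loc = algebraMap _ _ := ⟨_, rfl⟩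
  have hloc : IsLoc loc q.primeCompl := by rw [hloc']; exact IsLoc.of_isLocalization q.primeCompl
  have hlocm : ∀ x, loc x ∈ IsLocalRing.maximalIdeal (Localization.AtPrime q) ↔ x ∈ q := fun x => by
    rw [hloc']; exact IsLocalization.AtPrime.to_map_mem_maximal_iff _ q x
  have hfs : FS loc 1 := by
    rw [hloc']
    haveI : Algebra.FormallySmooth Λ (Localization.AtPrime q) := Algebra.FormallySmooth.of_isLocalization q.primeCompl
    exact FS.of_formallySmooth
  -- choose generators in I
  have hgen : ∀ y ∈ s, ∃ x ∈ I, ∃ v, y = v * loc x := by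
    intro y hy
    have hym : y ∈ IsLocalRing.maximalIdeal (Localization.AtPrime q) := by rw [← hs]; exact Ideal.subset_span hy
    obtain ⟨⟨x, v⟩, hxv⟩ := IsLocalization.surj q.primeCompl y
    rw [← hloc'] at hxv
    have hx : x ∈ q := by
      rw [← hlocm, ← hxv]; exact Ideal.mul_mem_right _ _ hym
    obtain ⟨w, hw, hwx⟩ := min_rad I q hI hq x hx
    obtain ⟨v', hv'⟩ := hloc.unit v v.2
    obtain ⟨w', hw'⟩ := hloc.unit w hw
    refine ⟨w * x, hwx, ↑v'⁻¹ * ↑w'⁻¹, ?_⟩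
    have e1 : loc v * ↑v'⁻¹ = 1 := by rw [← hv']; exact v'.mul_inv
    have e2 : loc w * ↑w'⁻¹ = 1 := by rw [← hw']; exact w'.mul_inv
    have hxv' : y * loc v = loc x := hxv
    rw [map_mul, ← hxv']
    linear_combination (- y * loc w * ↑w'⁻¹) * e1 - y * e2
  choose! x hxI v hv using hgen
  obtain ⟨d, hdd⟩ : ∃ d, d = s.card := ⟨_, rfl⟩
  obtain ⟨en⟩ : Nonempty (Fin d ≃ s) := ⟨(s.equivFinOfCardEq hdd.symm).symm⟩
  obtain ⟨t, ht⟩ : ∃ t : Fin d → Λ, ∀ j, t j = x (en j) := ⟨_, fun _ => rfl⟩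
  have htI : ∀ j, t j ∈ I := fun j => by rw [ht]; exact hxI _ (en j).2
  have hIq : I ≤ q := hq.1.2
  have hspan : Ideal.span (Set.range fun j => loc (t j)) = IsLocalRing.maximalIdeal (Localization.AtPrime q) := by
    apply le_antisymm
    · rw [Ideal.span_le]
      rintro _ ⟨j, rfl⟩
      exact (hlocm _).2 (hIq (htI j))
    · rw [← hs, Ideal.span_le]
      intro y hy
      rw [hv y hy]
      refine Ideal.mul_mem_left _ _ (Ideal.subset_span ⟨en.symm ⟨y, hy⟩, ?_⟩)
      beta_reduce
      rw [ht, Equiv.apply_symm_apply]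
  rw [← hdd] at hd
  have hinj : Function.Injective fun j => loc (t j) := by
    have hc := dim_le_of_gens (Finset.univ.image fun j => loc (t j)) _ le_rfl (by rw [← hspan, Finset.coe_image, Finset.coe_univ, Set.image_univ])
    have h3 := hd.trans hc
    have h4 : d ≤ (Finset.univ.image fun j => loc (t j)).card := by exact_mod_cast h3
    rw [← Set.injOn_univ, ← Finset.coe_univ]
    refine Finset.card_image_iff.1 ?_
    exact le_antisymm Finset.card_image_le (by rw [Finset.card_univ, Fintype.card_fin]; exact h4)
  obtain ⟨χ, hχ⟩ : ∃ χ, χ = IsLocalRing.residue (Localization.AtPrime q) := ⟨_, rfl⟩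
  have hχs : Function.Surjective χ := by rw [hχ]; exact IsLocalRing.residue_surjective
  have hχk : RingHom.ker χ = IsLocalRing.maximalIdeal (Localization.AtPrime q) := by rw [hχ]; exact IsLocalRing.ker_residue
  have hCF := cf χ hχs (loc.comp (ψ.comp i)) (fun j => loc (t j)) (by rw [hχk, hspan]) (by
    intro p _ _ S a ha
    obtain ⟨D, hD, hDS, hDa⟩ := gr2 p (ψ.comp i) hreg (χ.comp loc) S a ha
    obtain ⟨D', hD', hDD⟩ := der_ext loc hfs χ D hD
    exact ⟨D', hD', fun s hs => (hDD _).trans (hDS s hs), (hDD _).trans hDa⟩)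
  have hBH := bh_start _ _ hCF (loc.comp (ψ.comp i)) χ rfl hχs (fun j => loc (t j)) hinj hspan hd
  obtain ⟨D, _, κ, ψD, hκ, hψD, hD⟩ := res hBH Λ A q loc ((List.finRange d).map t) i ψ hloc (by rw [List.map_map]; rfl) (field_fs' _)
    (RingHom.Flat.of_isField (Field.toIsField _) _) hi rfl (by
      intro y hy
      obtain ⟨j, _, rfl⟩ := List.mem_map.1 hy
      exact ⟨hIq (htI j), fun 𝔔 _ h => hIs 𝔔 h (htI j)⟩)
  refine ⟨D, inferInstance, κ, ψD, hκ, hψD, fun 𝔔 _ h => ?_⟩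
  refine upgrade _ (hκ.comp hi) ψD ?_ 𝔔 (hD 𝔔 h)
  rw [← RingHom.comp_assoc, hψD]; exact hreg

theorem field_pt {k Λ : Type u} [Field k] [CommRing Λ] [IsNoetherianRing Λ] (φ : k →+* Λ) (hreg : GReg φ) (A : Type u) [CommRing A] (i : k →+* A)
    (hi : i.FiniteType) (ψ : A →+* Λ) (hψ : ψ.comp i = φ) :
    ∃ (B : Type u) (_ : CommRing B) (j : A →+* B) (ψ' : B →+* Λ), j.FiniteType ∧ ψ'.comp j = ψ ∧ FS (j.comp i) 1 := by
  obtain ⟨I, hI⟩ : ∃ I, I = (Ideal.span (ψ '' {b | FS i b})).radical := ⟨_, rfl⟩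
  induction I using IsNoetherian.induction generalizing A with
  | hgt I ih =>
  have key : ∀ (A : Type u) [CommRing A] (i : k →+* A) (ψ : A →+* Λ) (𝔔 : Ideal Λ) [𝔔.IsPrime], ¬ SmAt i ψ 𝔔 ↔ (Ideal.span (ψ '' {b | FS i b})).radical ≤ 𝔔 := by
    intro A _ i ψ 𝔔 h𝔔
    rw [h𝔔.radical_le_iff, Ideal.span_le]
    constructor
    · rintro h _ ⟨b, hb, rfl⟩
      by_contra hn
      exact h ⟨b, hb, hn⟩
    · rintro h ⟨b, hb, hn⟩
      exact hn (h ⟨b, hb, rfl⟩)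
  by_cases htop : I = ⊤
  · refine step0 i hi ψ fun 𝔔 h𝔔 => ?_
    by_contra h
    rw [key, ← hI, htop] at h
    exact h𝔔.ne_top (top_le_iff.1 h)
  · obtain ⟨M, hM, hIM⟩ := Ideal.exists_le_maximal I htop
    obtain ⟨q, hq, _⟩ := Ideal.exists_minimalPrimes_le (J := M) hIM
    haveI : q.IsPrime := hq.1.1
    obtain ⟨D, _, κ, ψD, hκ, hψD, hD⟩ := field_step i hi ψ (by rw [hψ]; exact hreg) I (by rw [hI]; exact Ideal.radical_isRadical _)
      (fun 𝔔 _ h => by rw [hI]; exact (key A i ψ 𝔔).1 h) q hq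
    have hlt : I < (Ideal.span (ψD '' {b | FS (κ.comp i) b})).radical := by
      refine lt_of_le_of_ne ?_ fun heq => ?_
      · rw [Ideal.radical_eq_sInf]
        refine le_sInf fun 𝔔 h𝔔 => ?_
        haveI := h𝔔.2
        rw [hI, ← key]
        intro h
        exact ((key D (κ.comp i) ψD 𝔔).2 (h𝔔.2.radical_le_iff.2 h𝔔.1)) (hD 𝔔 (Or.inl h))
      · refine (key D (κ.comp i) ψD q).2 ?_ (hD q (Or.inr rfl))
        rw [← heq]; exact hq.1.2
    obtain ⟨B, _, j, ψ', hj, hψ', hB⟩ := ih _ hlt D (κ.comp i) (hκ.comp hi) ψD (by rw [← RingHom.comp_assoc, hψD, hψ]) rfl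
    exact ⟨B, inferInstance, j.comp κ, ψ', hj.comp hκ, by rw [← RingHom.comp_assoc, hψ', hψD], hB⟩

theorem std_lift [IsNoetherianRing R'] (ρ : R →+* R') (hρ : Function.Surjective ρ)
    {ι : Type} [Fintype ι] (J : Ideal (MvPolynomial ι R')) (hJ : SStd J 1) :
    ∃ (D : Type u) (_ : CommRing D) (h : MvPolynomial ι R →+* D), (h.comp C).FiniteType ∧ FS (h.comp C) 1 ∧
      (∀ (T : Type u) [CommRing T] (θ : MvPolynomial ι R →+* T), (∀ x, map ρ x ∈ J → θ x = 0) → ∃ θ' : D →+* T, θ'.comp h = θ) ∧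
      (∀ (T : Type u) [CommRing T] (θ : D →+* T), (∀ a, ρ a = 0 → θ (h (C a)) = 0) → ∀ x, map ρ x ∈ J → θ (h x) = 0) ∧
      ∀ (T : Type u) [CommRing T] (θ θ' : D →+* T), θ.comp h = θ'.comp h → θ = θ' := by
  obtain ⟨m, F', G', hFJ, hgen, hG⟩ := hJ
  have hms := MvPolynomial.map_surjective (σ := ι) ρ hρ
  obtain ⟨g', hg1, hg2⟩ := Submodule.exists_sub_one_mem_and_smul_le_of_fg_of_le_sup (I := J) (N := Ideal.span (Set.range F')) (N' := J) (P := J)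
    (IsNoetherian.noetherian J) le_rfl (fun x hx => by
      have := hgen x hx
      rwa [C_1, one_mul, pow_two] at this)
  choose F hF using fun l => hms (F' l)
  choose G hGG using fun i l => hms (G' i l)
  obtain ⟨g, hg⟩ := hms g'
  obtain ⟨M, hM⟩ : ∃ M : Matrix (Fin m) (Fin m) (MvPolynomial ι R), ∀ j l, M j l = ∑ i, pderiv i (F j) * G i l := ⟨fun j l => _, fun _ _ => rfl⟩
  obtain ⟨c, hc⟩ : ∃ c, c = M.det := ⟨_, rfl⟩
  obtain ⟨B, _, p, hp, hpk⟩ := exists_quot (Ideal.span (Set.range F))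
  have hFS : FS (p.comp C) (p c) := by
    refine FS_of_LF (FS.mvPolynomial ι) F (fun k x => ∑ l, M.adjugate l k * ∑ i, G i l * pderiv i x) c ?_ ?_ p hp ?_ ?_
    · intro k
      refine IsDer.sum _ fun l => IsDer.smul (d := fun x => ∑ i, G i l * pderiv i x) (IsDer.sum _ fun i => IsDer.smul (d := fun x => pderiv i x) ?_ _) _
      refine ⟨fun a b => map_add _ a b, fun a b => ?_, fun a => pderiv_C⟩
      rw [Derivation.leibniz]; simp only [smul_eq_mul]
    · intro k j
      have h1 : ∀ l, ∑ i, G i l * pderiv i (F j) = M j l := fun l => by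
        rw [hM]; exact Finset.sum_congr rfl fun i _ => mul_comm _ _
      have h2 := congrFun (congrFun (Matrix.mul_adjugate M) j) k
      rw [Matrix.mul_apply, Matrix.smul_apply, Matrix.one_apply, ← hc] at h2
      simp only [h1]
      rw [Finset.sum_congr rfl fun l _ => mul_comm _ _, h2]
      by_cases hkj : k = j
      · subst hkj; simp
      · rw [if_neg hkj, if_neg (Ne.symm hkj), smul_zero]
    · exact fun l => (hpk _).2 (Ideal.subset_span ⟨l, rfl⟩)
    · exact fun x hx => Ideal.mul_mem_left _ _ ((hpk x).1 hx)
  have hb := hFS.mono (c := p (c * g)) ⟨p g, map_mul _ _ _⟩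
  refine ⟨Localization.Away (p (c * g)), inferInstance, (algebraMap _ (Localization.Away (p (c * g)))).comp p, ?_, hb.to_away, ?_, ?_, ?_⟩
  · rw [RingHom.comp_assoc]
    refine RingHom.FiniteType.comp ?_ ((RingHom.FiniteType.of_surjective _ hp).comp ?_)
    · exact RingHom.finiteType_algebraMap.2 (IsLocalization.finiteType_of_monoid_fg (Submonoid.powers (p (c * g))) _)
    · exact finiteType_of_presentation C (RingHom.id _) Function.surjective_id rfl
  · intro T _ θ hθ
    obtain ⟨θ1, h1⟩ := exists_factor p hp θ (by
      intro x hx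
      rw [hpk] at hx
      have : Ideal.span (Set.range F) ≤ RingHom.ker θ := by
        rw [Ideal.span_le]
        rintro _ ⟨l, rfl⟩
        exact hθ _ (by rw [hF]; exact hFJ l)
      exact this hx)
    have hg1' : θ g = 1 := by
      have := hθ (g - 1) (by rw [map_sub, hg, map_one]; exact hg1)
      rwa [map_sub, map_one, sub_eq_zero] at this
    have hc1 : θ c = 1 := by
      rw [hc, RingHom.map_det]
      have : θ.mapMatrix M = 1 := by
        ext j l
        rw [RingHom.mapMatrix_apply, Matrix.map_apply]
        have := hθ (M j l - (1 : Matrix _ _ _) j l) (by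
          have h3 := hG j l
          rw [C_1, one_mul] at h3
          rw [map_sub, hM, map_sum]
          convert h3 using 2
          · refine Finset.sum_congr rfl fun i _ => ?_
            rw [map_mul, ← pderiv_map, hF, hGG]
          · rw [Matrix.one_apply, Matrix.one_apply]; split_ifs <;> simp)
        rw [map_sub, sub_eq_zero] at this
        rw [this, Matrix.one_apply, Matrix.one_apply]; split_ifs <;> simp
      rw [this, Matrix.det_one]
    have hu : IsUnit (θ1 (p (c * g))) := by
      have : θ1 (p (c * g)) = θ (c * g) := by rw [← h1]; rfl
      rw [this, map_mul, hg1', hc1, one_mul]; exact isUnit_one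
    refine ⟨IsLocalization.Away.lift _ hu, ?_⟩
    rw [← RingHom.comp_assoc, IsLocalization.Away.lift_comp, h1]
  · intro T _ θ hθ x hx
    obtain ⟨h, hh⟩ : ∃ h, h = (algebraMap _ (Localization.Away (p (c * g)))).comp p := ⟨_, rfl⟩
    rw [← hh] at hθ ⊢
    have hpF : ∀ l, h (F l) = 0 := fun l => by
      rw [hh, RingHom.comp_apply, (hpk _).2 (Ideal.subset_span ⟨l, rfl⟩), map_zero]
    obtain ⟨θ1, h1⟩ := exists_factor (map ρ) hms (θ.comp h) (by
      intro y hy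
      have hy : y ∈ RingHom.ker (map ρ) := hy
      rw [MvPolynomial.ker_map] at hy
      have : (RingHom.ker ρ).map C ≤ RingHom.ker (θ.comp h) := by
        rw [Ideal.map_le_iff_le_comap]
        exact fun a ha => hθ a ha
      exact this hy)
    have h2 : θ1 (g' * map ρ x) = 0 := by
      have h3 : g' * map ρ x ∈ Ideal.span (Set.range F') := hg2 (Submodule.smul_mem_pointwise_smul _ _ _ hx)
      have : Ideal.span (Set.range F') ≤ RingHom.ker θ1 := by
        rw [Ideal.span_le]
        rintro _ ⟨l, rfl⟩
        have := congrArg (fun f => f (F l)) h1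
        simp only [RingHom.comp_apply, hF, hpF, map_zero] at this
        exact this
      exact this h3
    have h4 : θ1 (g' * map ρ x) = θ (h g) * θ (h x) := by
      rw [← map_mul, ← map_mul, ← hg, ← map_mul, ← RingHom.comp_apply θ1, h1]; rfl
    have hu : IsUnit (θ (h g)) := by
      have : IsUnit (h c * h g) := by
        rw [← map_mul h, hh]; exact IsLocalization.Away.algebraMap_isUnit (p (c * g))
      exact (isUnit_of_mul_isUnit_right this).map θ
    rw [h4] at h2
    exact (hu.mul_right_eq_zero).1 h2
  · intro T _ θ θ' h
    refine IsLocalization.ringHom_ext (Submonoid.powers (p (c * g))) ?_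
    refine RingHom.ext fun x => ?_
    obtain ⟨y, rfl⟩ := hp x
    exact congrArg (fun f => f y) h

theorem smooth_lift [IsNoetherianRing R] (ρ : R →+* R') (hρ : Function.Surjective ρ)
    (i : R' →+* C') (hi : i.FiniteType) (h : FS i 1) : ∃ (D D' : Type u) (_ : CommRing D) (_ : CommRing D') (e : R →+* D) (q : D →+* D') (s : C' →+* D')
      (r : D' →+* C'), e.FiniteType ∧ FS e 1 ∧ Function.Surjective q ∧ (∀ x, q x = 0 ↔ x ∈ (RingHom.ker ρ).map e) ∧
      r.comp s = RingHom.id _ ∧ s.comp (i.comp ρ) = q.comp e ∧ r.comp (q.comp e) = i.comp ρ := by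
  haveI : IsNoetherianRing R' := isNoetherianRing_of_surjective R R' ρ hρ
  obtain ⟨n, pC, hpC, hpCi⟩ := exists_presentation i hi
  obtain ⟨N, hQ⟩ := (FS_iff_QS pC hpC hpCi 1).1 (by rwa [map_one])
  rw [one_pow, ← C_1] at hQ
  obtain ⟨m, J, hS, hJ1, hJ2⟩ := elkik (IsNoetherian.noetherian _) 1 hQ
  rw [one_pow] at hS
  obtain ⟨D, _, h, hft, hFS, hA, hB, hE⟩ := std_lift ρ hρ J hS
  obtain ⟨D', _, q, hq, hqk⟩ := exists_quot ((RingHom.ker ρ).map (h.comp C))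
  obtain ⟨w, hw⟩ : ∃ w : MvPolynomial (Fin n ⊕ Fin m) R' →+* C', w = pC.comp (aeval (Sum.elim X (fun _ => (0 : MvPolynomial (Fin n) R')))).toRingHom := ⟨_, rfl⟩
  have hwJ : ∀ x ∈ J, w x = 0 := fun x hx => by rw [hw]; exact hJ2 x hx
  have hwC : ∀ a, w (C a) = i a := fun a => by
    rw [hw, ← hpCi]
    simp
  obtain ⟨r0, hr0⟩ := hA C' (w.comp (map ρ)) (fun x hx => hwJ _ hx)
  have hr0' : ∀ x, r0 (h x) = w (map ρ x) := fun x => by rw [← RingHom.comp_apply, hr0]; rfl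
  obtain ⟨r, hr⟩ := exists_factor q hq r0 (by
    intro x hx
    rw [hqk] at hx
    have : (RingHom.ker ρ).map (h.comp C) ≤ RingHom.ker r0 := by
      rw [Ideal.map_le_iff_le_comap]
      intro a ha
      rw [Ideal.mem_comap, RingHom.mem_ker, RingHom.comp_apply, hr0', map_C, (show ρ a = 0 from ha), map_zero, map_zero]
    exact this hx)
  have hqC : ∀ a, ρ a = 0 → q (h (C a)) = 0 := fun a ha => (hqk _).2 (Ideal.mem_map_of_mem (h.comp C) ha)
  obtain ⟨v, hv⟩ := exists_factor ρ hρ (q.comp (h.comp C)) hqC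
  have hv' : ∀ a, v (ρ a) = q (h (C a)) := fun a => by rw [← RingHom.comp_apply, hv]; rfl
  obtain ⟨u, hu⟩ : ∃ u : MvPolynomial (Fin n ⊕ Fin m) R' →+* D', u = eval₂Hom v (fun k => q (h (X k))) := ⟨_, rfl⟩
  have hum : ∀ x, u (map ρ x) = q (h x) := by
    have : u.comp (map ρ) = q.comp h := by
      rw [hu]
      refine MvPolynomial.ringHom_ext (fun a => ?_) (fun k => ?_)
      · simp [hv']
      · simp
    exact fun x => congrArg (fun f => f x) this
  have hms := MvPolynomial.map_surjective (σ := Fin n ⊕ Fin m) ρ hρ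
  have huJ : ∀ x ∈ J, u x = 0 := by
    intro x hx
    obtain ⟨y, rfl⟩ := hms x
    rw [hum]
    exact hB D' q hqC y hx
  obtain ⟨s, hs⟩ := exists_factor pC hpC (u.comp (rename Sum.inl).toRingHom) (fun x hx => huJ _ (hJ1 x hx))
  have hs' : ∀ x, s (pC x) = u (rename Sum.inl x) := fun x => by rw [← RingHom.comp_apply, hs]; rfl
  have hru : ∀ x, r (u x) = w x := fun x => by
    obtain ⟨y, rfl⟩ := hms x
    rw [hum, ← hr0', ← hr]; rfl
  refine ⟨D, D', inferInstance, inferInstance, h.comp C, q, s, r, hft, hFS, hq, hqk, ?_, ?_, ?_⟩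
  · refine RingHom.ext fun x => ?_
    obtain ⟨x, rfl⟩ := hpC x
    rw [RingHom.comp_apply, hs', hru, hw]
    have : aeval (Sum.elim X (fun _ => (0 : MvPolynomial (Fin n) R'))) (rename (Sum.inl : Fin n → Fin n ⊕ Fin m) x) = x := by
      rw [aeval_rename, Sum.elim_comp_inl, aeval_X_left_apply]
    exact congrArg pC this
  · refine RingHom.ext fun x => ?_
    rw [RingHom.comp_apply, RingHom.comp_apply, ← hpCi, RingHom.comp_apply, hs', rename_C, ← map_C, hum]; rfl
  · refine RingHom.ext fun x => ?_
    rw [RingHom.comp_apply, RingHom.comp_apply, RingHom.comp_apply, ← hum, hru, map_C, hwC]; rfl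

def PT {R Λ : Type u} [CommRing R] [CommRing Λ] (f : R →+* Λ) : Prop :=
  ∀ (A : Type u) [CommRing A] (i : R →+* A), i.FiniteType → ∀ ψ : A →+* Λ, ψ.comp i = f →
    ∃ (B : Type u) (_ : CommRing B) (j : A →+* B) (ψ' : B →+* Λ), j.FiniteType ∧ ψ'.comp j = ψ ∧ FS (j.comp i) 1

theorem lift2 [IsNoetherianRing R] (f : R →+* Λ)
    (ε : R) (hε : ε * ε = 0) (ρ : R →+* R') (hρ : Function.Surjective ρ) (hρk : ∀ r, ρ r = 0 ↔ ε ∣ r) (pΛ : Λ →+* Λ')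
    (hpΛ : Function.Surjective pΛ) (hpk : ∀ x, pΛ x = 0 ↔ f ε ∣ x) (f' : R' →+* Λ') (hf' : f'.comp ρ = pΛ.comp f) (hPT : PT f')
    (i : R →+* A) (hi : i.FiniteType) (ψ : A →+* Λ) (hψ : ψ.comp i = f) :
    ∃ (D D' : Type u) (_ : CommRing D) (_ : CommRing D') (e : R →+* D) (τ : D →+* Λ) (q : D →+* D') (σ : A →+* D'),
      e.FiniteType ∧ FS e 1 ∧ τ.comp e = f ∧ Function.Surjective q ∧ (∀ x, q x = 0 ↔ e ε ∣ x) ∧ σ.comp i = q.comp e ∧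
      ∀ a d, q d = σ a → ∃ ν, ψ a = τ d + f ε * ν := by
  obtain ⟨A', _, pA, hpA, hpAk⟩ := exists_quot (Ideal.span {i ε})
  simp only [Ideal.mem_span_singleton] at hpAk
  obtain ⟨i', hi'⟩ := exists_factor ρ hρ (pA.comp i) (fun r hr => (hpAk _).2 (map_dvd i ((hρk r).1 hr)))
  obtain ⟨ψ', hψ'⟩ := exists_factor pA hpA (pΛ.comp ψ) (fun x hx => by
    rw [RingHom.comp_apply, hpk, ← hψ]
    exact map_dvd ψ ((hpAk x).1 hx))
  have hi'f : i'.FiniteType := by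
    refine RingHom.FiniteType.of_comp_finiteType (f := ρ) ?_
    rw [hi']; exact (RingHom.FiniteType.of_surjective _ hpA).comp hi
  obtain ⟨C', _, j, ψC, hj, hψC, hFS⟩ := hPT A' i' hi'f ψ' (by
    refine RingHom.ext fun x => ?_
    obtain ⟨x, rfl⟩ := hρ x
    have h1 := congrArg (fun g => ψ' (g x)) hi'
    have h2 := congrArg (fun g => g (i x)) hψ'
    have h3 := congrArg (fun g => g x) hf'
    simp only [RingHom.comp_apply] at h1 h2 h3 ⊢
    rw [h1, h2, h3, ← hψ]; rfl)
  obtain ⟨D, D', _, _, e, q, s, r, he, heF, hq, hqk, hrs, hs, hr⟩ := smooth_lift ρ hρ (j.comp i') (hj.comp hi'f) hFS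
  have hsq : ∀ x y, pΛ x = 0 → pΛ y = 0 → x * y = 0 := by
    intro x y hx hy
    obtain ⟨a, rfl⟩ := (hpk x).1 hx
    obtain ⟨b, rfl⟩ := (hpk y).1 hy
    calc _ = f (ε * ε) * (a * b) := by rw [map_mul]; ring
      _ = 0 := by rw [hε, map_zero, zero_mul]
  obtain ⟨τ, hτ1, hτ2⟩ := heF Λ Λ' pΛ hpΛ hsq f (ψC.comp (r.comp q)) (by
    rw [RingHom.comp_assoc, RingHom.comp_assoc, hr, ← RingHom.comp_assoc, ← RingHom.comp_assoc, hψC, RingHom.comp_assoc, hi', ← RingHom.comp_assoc, hψ',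
      RingHom.comp_assoc, hψ]) (by rw [map_one]; exact isUnit_one)
  have hker : RingHom.ker ρ = Ideal.span {ε} := by
    ext x; rw [RingHom.mem_ker, hρk, Ideal.mem_span_singleton]
  refine ⟨D, D', inferInstance, inferInstance, e, τ, q, s.comp (j.comp pA), he, heF, hτ2, hq, fun x => ?_, ?_, fun a d hd => ?_⟩
  · rw [hqk, hker, Ideal.map_span, Set.image_singleton, Ideal.mem_span_singleton]
  · rw [← hs, RingHom.comp_assoc, RingHom.comp_assoc, ← hi']; rfl
  · have h1 : pΛ (τ d) = pΛ (ψ a) := by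
      have h2 := congrArg (fun g => g d) hτ1
      have h3 := congrArg (fun g => g a) hψ'
      have h4 := congrArg (fun g => ψC (g (j (pA a)))) hrs
      have h5 := congrArg (fun g => g (pA a)) hψC
      simp only [RingHom.comp_apply, RingHom.id_apply] at h2 h3 h4 h5 hd
      rw [h2, hd, h4, h5, h3]
    obtain ⟨ν, hν⟩ := (hpk (ψ a - τ d)).1 (by rw [map_sub, h1, sub_self])
    exact ⟨ν, by rw [← hν]; ring⟩

theorem LL  (e1 : R →+* D1) (h1 : e1.FiniteType) (hF : FS e1 1) (e2 : R →+* D2)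
    (τ1 : D1 →+* Λ) (τ2 : D2 →+* Λ) (hτ : τ1.comp e1 = τ2.comp e2) (ε : R) (hε : ε * ε = 0) (ρ0 : D1 →+* D2) (hρ0 : ρ0.comp e1 = e2)
    (hd : ∀ x, ∃ l, τ1 x = τ2 (ρ0 x) + τ2 (e2 ε) * l) :
    ∃ (n : ℕ) (τ' : MvPolynomial (Fin n) D2 →+* Λ) (ρ : D1 →+* MvPolynomial (Fin n) D2), τ'.comp C = τ2 ∧ τ'.comp ρ = τ1 ∧ ρ.comp e1 = (C.comp e2) ∧
      ∀ x, ∃ t, ρ x = (C (ρ0 x) : MvPolynomial (Fin n) D2) + (C (e2 ε) : MvPolynomial (Fin n) D2) * t := by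
  obtain ⟨n, p, hp, hpe⟩ := exists_presentation e1 h1
  choose l hl using hd
  obtain ⟨τ', hτ'⟩ : ∃ τ', τ' = eval₂Hom τ2 (fun k : Fin n => l (p (X k))) := ⟨_, rfl⟩
  have hτC : ∀ x, τ' (C x) = τ2 x := fun x => by rw [hτ', eval₂Hom_C]
  have hτX : ∀ k, τ' (X k) = l (p (X k)) := fun x => by rw [hτ', eval₂Hom_X']
  obtain ⟨T', _, m, hm, hmk⟩ := exists_quot (Ideal.span {(C (e2 ε) : MvPolynomial (Fin n) D2)})
  simp only [Ideal.mem_span_singleton] at hmk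
  obtain ⟨S, hS⟩ : ∃ S : Subring (MvPolynomial (Fin n) D2), ∀ x, x ∈ S ↔ m x = m (C (constantCoeff x)) :=
    ⟨RingHom.eqLocus m (m.comp (C.comp constantCoeff)), fun x => Iff.rfl⟩
  obtain ⟨χ, hχ⟩ : ∃ χ : S →+* D2 × Λ, χ = ((constantCoeff.comp S.subtype).prod (τ'.comp S.subtype)) := ⟨_, rfl⟩
  have hχ' : ∀ x : S, χ x = (constantCoeff x.1, τ' x.1) := fun x => by rw [hχ]; rfl
  obtain ⟨η, hη⟩ : ∃ η, η = ρ0.prod τ1 := ⟨_, rfl⟩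
  have hη' : ∀ x, η x = (ρ0 x, τ1 x) := fun x => by rw [hη]; rfl
  have hmε : m (C (e2 ε)) = 0 := (hmk _).2 dvd_rfl
  have hSC : ∀ x, (C x : MvPolynomial (Fin n) D2) ∈ S := fun x => by rw [hS, constantCoeff_C]
  have hηr : ∀ x, η x ∈ χ.range := by
    intro x
    obtain ⟨x, rfl⟩ := hp x
    induction x using MvPolynomial.induction_on with
    | C a =>
      refine ⟨⟨C (e2 a), hSC _⟩, ?_⟩
      have : p (C a) = e1 a := by rw [← hpe]; rfl
      rw [hχ', hη', constantCoeff_C, hτC, this, ← RingHom.comp_apply ρ0, hρ0, ← RingHom.comp_apply τ1, hτ]; rfl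
    | add a b ha hb => rw [map_add, map_add]; exact add_mem ha hb
    | mul_X a k ha =>
      rw [map_mul, map_mul]
      refine mul_mem ha ⟨⟨C (ρ0 (p (X k))) + C (e2 ε) * X k, ?_⟩, ?_⟩
      · rw [hS]; simp [hmε]
      · rw [hχ', hη']
        simp [hτC, hτX, hl]
  obtain ⟨η1, hη1⟩ : ∃ η1 : D1 →+* χ.range, ∀ x, (η1 x : D2 × Λ) = η x := ⟨η.codRestrict _ hηr, fun _ => rfl⟩
  obtain ⟨φ, hφ⟩ : ∃ φ : R →+* S, ∀ r, (φ r : MvPolynomial (Fin n) D2) = C (e2 r) := ⟨((C : D2 →+* MvPolynomial (Fin n) D2).comp e2).codRestrict _ (fun r => hSC _), fun _ => rfl⟩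
  obtain ⟨g, hg1, hg2⟩ := hF S χ.range χ.rangeRestrict χ.rangeRestrict_surjective (by
    have key : ∀ x : S, χ.rangeRestrict x = 0 → ∃ t, x.1 = C (e2 ε) * t := by
      intro x hx
      have hx : χ x = 0 := congrArg Subtype.val hx
      rw [hχ', Prod.mk_eq_zero] at hx
      have := (hS _).1 x.2
      rw [hx.1, map_zero, map_zero, hmk] at this
      exact this
    intro x y hx hy
    obtain ⟨a, ha⟩ := key x hx
    obtain ⟨b, hb⟩ := key y hy
    refine Subtype.ext ?_
    rw [Subring.coe_mul, ha, hb]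
    calc _ = C (e2 (ε * ε)) * (a * b) := by rw [map_mul, map_mul]; ring
      _ = 0 := by rw [hε, map_zero, map_zero, zero_mul]) φ η1 (by
    refine RingHom.ext fun r => Subtype.ext ?_
    rw [RingHom.comp_apply, hη1, RingHom.comp_apply, RingHom.coe_rangeRestrict, hχ', hη', hφ, constantCoeff_C, hτC, ← RingHom.comp_apply ρ0, hρ0, ← RingHom.comp_apply τ1, hτ]
    rfl) (by rw [map_one]; exact isUnit_one)
  have hg1' : ∀ x, constantCoeff (g x).1 = ρ0 x ∧ τ' (g x).1 = τ1 x := fun x => by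
    have := congrArg (fun h => (h x).1) hg1
    beta_reduce at this
    rw [RingHom.comp_apply, hη1, RingHom.coe_rangeRestrict, hχ', hη', Prod.mk.injEq] at this
    exact this
  refine ⟨n, τ', S.subtype.comp g, RingHom.ext hτC, RingHom.ext fun x => (hg1' x).2, RingHom.ext fun r => ?_, fun x => ?_⟩
  · have := congrArg (fun h => (h r).1) hg2
    beta_reduce at this
    rw [hφ] at this
    exact this
  · have h3 := (hS _).1 (g x).2
    rw [(hg1' x).1, ← sub_eq_zero, ← map_sub, hmk] at h3
    obtain ⟨t, ht⟩ := h3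
    exact ⟨t, by rw [← ht]; exact (add_sub_cancel _ _).symm⟩

theorem flat_rel  (f : R →+* Λ) (hf : f.Flat) (ε : R) (x : Λ) (hx : f ε * x = 0) :
    ∃ (k : ℕ) (a : Fin k → R) (y : Fin k → Λ), x = ∑ j, f (a j) * y j ∧ ∀ j, ε * a j = 0 := by
  letI := f.toAlgebra
  haveI : Module.Flat R Λ := hf
  have ham : ∀ x, algebraMap R Λ x = f x := fun _ => rfl
  obtain ⟨k, a, y, h1, h2⟩ := Module.Flat.isTrivialRelation_of_sum_smul_eq_zero (R := R) (ι := Fin 1) (f := fun _ => ε) (x := fun _ => x) (by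
    simpa [Algebra.smul_def, ham] using hx)
  refine ⟨k, a 0, y, ?_, fun j => ?_⟩
  · simpa [Algebra.smul_def, ham] using h1 0
  · simpa using h2 j

theorem lin_many  (f : R →+* Λ) (hf : f.Flat) (ε : R) (e1 : R →+* D1) (τ1 : D1 →+* Λ)
    (hτ : τ1.comp e1 = f) (I : Ideal R) (hI : ∀ r, ε * r = 0 → r ∈ I) (S : Finset D1) (hS : ∀ g ∈ S, f ε * τ1 g = 0) :
    ∃ (A2 : Type u) (_ : CommRing A2) (κ : D1 →+* A2) (ψ : A2 →+* Λ), κ.FiniteType ∧ ψ.comp κ = τ1 ∧ ∀ g ∈ S, κ g ∈ I.map (κ.comp e1) := by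
  classical
  induction S using Finset.induction_on with
  | empty => exact ⟨D1, inferInstance, RingHom.id _, τ1, RingHom.FiniteType.id _, rfl, by simp⟩
  | insert g S hg ih =>
    obtain ⟨A, _, κ, ψ, hκ, hψ, hA⟩ := ih (fun g hg => hS g (Finset.mem_insert_of_mem hg))
    obtain ⟨k, a, y, h1, h2⟩ := flat_rel f hf ε _ (hS g (Finset.mem_insert_self _ _))
    obtain ⟨B, _, j, z, hj, hz, -, hB⟩ := linEq (fun l => κ (e1 (a l))) (κ g)
    have hψ' : ∀ x, ψ (κ x) = τ1 x := fun x => by rw [← hψ]; rfl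
    obtain ⟨ψ', hψ1, hψ2⟩ := hB Λ ψ y (by simp only [hψ', h1, ← hτ]; rfl)
    refine ⟨B, inferInstance, j.comp κ, ψ', hj.comp hκ, by rw [← RingHom.comp_assoc, hψ1, hψ], fun g' hg' => ?_⟩
    rcases Finset.mem_insert.1 hg' with rfl | h
    · rw [RingHom.comp_apply, hz]
      exact Ideal.sum_mem _ fun l _ => Ideal.mul_mem_right _ _ (Ideal.mem_map_of_mem ((j.comp κ).comp e1) (hI _ (h2 l)))
    · have := Ideal.mem_map_of_mem j (hA g' h)
      rwa [Ideal.map_map] at this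

theorem nil_step [IsNoetherianRing R] (f : R →+* Λ) (hf : f.Flat)
    (ε : R) (hε : ε * ε = 0) (ρ : R →+* R') (hρ : Function.Surjective ρ) (hρk : ∀ r, ρ r = 0 ↔ ε ∣ r) (pΛ : Λ →+* Λ')
    (hpΛ : Function.Surjective pΛ) (hpk : ∀ x, pΛ x = 0 ↔ f ε ∣ x) (f' : R' →+* Λ') (hf' : f'.comp ρ = pΛ.comp f) (hPT : PT f') : PT f := by
  intro A _ i hi ψ hψ
  obtain ⟨n, p, hp, hpi⟩ := exists_presentation i hi
  obtain ⟨D0, D0', _, _, e0, τ0, q0, σ0, he0, heF0, hτe0, hq0, hqk0, hσi0, hν0⟩ := lift2 f ε hε ρ hρ hρk pΛ hpΛ hpk f' hf' hPT i hi ψ hψ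
  choose d hd using fun k => hq0 (σ0 (p (X k)))
  choose ν hν using fun k => hν0 (p (X k)) (d k) (hd k)
  obtain ⟨D1, _, c, hcp⟩ : ∃ (D1 : Type u) (_ : CommRing D1) (c : D0 →+* D1), ∃ (τ1 : D1 →+* Λ) (δ : Fin n → D1), c.FiniteType ∧ FS c 1 ∧ τ1.comp c = τ0 ∧
      (∀ k, ∃ z, δ k = c (d k) + c (e0 ε) * z) ∧ ∀ k, τ1 (δ k) = ψ (p (X k)) := by
    refine ⟨MvPolynomial (Fin n) D0, inferInstance, C, eval₂Hom τ0 ν, fun k => C (d k) + C (e0 ε) * X k, ?_, FS.mvPolynomial _, ?_, fun k => ⟨X k, rfl⟩, fun k => ?_⟩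
    · exact finiteType_of_presentation C (RingHom.id _) Function.surjective_id rfl
    · exact RingHom.ext fun x => eval₂Hom_C _ _ _
    · rw [map_add, map_mul, eval₂Hom_C, eval₂Hom_C, eval₂Hom_X', hν, ← hτe0]; rfl
  obtain ⟨τ1, δ, hc, hcF, hτc, hδ, hδψ⟩ := hcp
  obtain ⟨e1, he1⟩ : ∃ e1, e1 = c.comp e0 := ⟨_, rfl⟩
  have heF1 : FS e1 1 := by rw [he1]; exact heF0.comp' hcF (by rw [map_one, one_mul])
  have heft1 : e1.FiniteType := by rw [he1]; exact hc.comp he0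
  have hτe1 : τ1.comp e1 = f := by rw [he1, ← RingHom.comp_assoc, hτc, hτe0]
  have hτe1' : ∀ x, τ1 (e1 x) = f x := fun x => by rw [← hτe1]; rfl
  have hδe : ∀ x, τ1 (eval₂ e1 δ x) = ψ (p x) := by
    have : τ1.comp (eval₂Hom e1 δ) = ψ.comp p := by
      refine MvPolynomial.ringHom_ext (fun a => ?_) (fun k => ?_)
      · rw [RingHom.comp_apply, eval₂Hom_C, hτe1', RingHom.comp_apply, ← hψ, ← hpi]; rfl
      · rw [RingHom.comp_apply, eval₂Hom_X', hδψ]; rfl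
    exact fun x => congrArg (fun g => g x) this
  have hg : ∀ x, p x = 0 → ∃ g, eval₂ e1 δ x = e1 ε * g := by
    intro x hx
    obtain ⟨T, _, m, hm, hmk⟩ := exists_quot (Ideal.span {e1 ε})
    simp only [Ideal.mem_span_singleton] at hmk
    change e1 ε ∣ _
    rw [← hmk]
    obtain ⟨v, hv⟩ := exists_factor q0 hq0 (m.comp c) (fun y hy => (hmk _).2 (by rw [he1]; exact map_dvd c ((hqk0 y).1 hy)))
    have hv' : ∀ y, v (q0 y) = m (c y) := fun y => congrArg (fun g => g y) hv
    have : m.comp (eval₂Hom e1 δ) = v.comp (σ0.comp p) := by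
      refine MvPolynomial.ringHom_ext (fun a => ?_) (fun k => ?_)
      · have h1 := congrArg (fun g => g a) hσi0
        have h2 : p (C a) = i a := by rw [← hpi]; rfl
        simp only [RingHom.comp_apply] at h1
        rw [RingHom.comp_apply, eval₂Hom_C, he1, RingHom.comp_apply, RingHom.comp_apply, RingHom.comp_apply, h2, h1, hv']
      · obtain ⟨z, hz⟩ := hδ k
        have h3 : m (c (e0 ε)) = 0 := (hmk _).2 (by rw [he1]; exact dvd_rfl)
        rw [RingHom.comp_apply, eval₂Hom_X', hz, RingHom.comp_apply, RingHom.comp_apply, ← hd, hv', map_add, map_mul, h3, zero_mul, add_zero]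
    have := congrArg (fun g => g x) this
    simp only [RingHom.comp_apply, hx, map_zero] at this
    exact this
  choose! g hg using hg
  obtain ⟨S0, hS0⟩ := (isNoetherianRing_iff_ideal_fg (MvPolynomial (Fin n) R)).1 inferInstance (RingHom.ker p)
  have hS0k : ∀ x ∈ S0, p x = 0 := fun x hx => by
    have : x ∈ RingHom.ker p := by rw [← hS0]; exact Ideal.subset_span hx
    exact this
  obtain ⟨I, hI⟩ : ∃ I : Ideal R, ∀ r, r ∈ I ↔ ε * r = 0 := ⟨LinearMap.ker (LinearMap.mulLeft R ε : R →ₗ[R] R), fun r => Iff.rfl⟩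
  classical
  obtain ⟨A2, _, κ, ψ2, hκ, hψ2, hA2⟩ := lin_many f hf ε e1 τ1 hτe1 I (fun r => (hI r).2) (S0.image g) (by
    intro y hy
    obtain ⟨x, hx, rfl⟩ := Finset.mem_image.1 hy
    rw [← hτe1', ← map_mul, ← hg x (hS0k x hx), hδe, hS0k x hx, map_zero])
  obtain ⟨D2, D2', _, _, e2, τ2, q2, σ2, he2, heF2, hτe2, hq2, hqk2, hσi2, hν2⟩ := lift2 f ε hε ρ hρ hρk pΛ hpΛ hpk f' hf' hPT
    (κ.comp e1) (hκ.comp heft1) ψ2 (by rw [← RingHom.comp_assoc, hψ2, hτe1])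
  have hεε : e2 ε * e2 ε = 0 := by rw [← map_mul, hε, map_zero]
  obtain ⟨ρ0, hρ1, hρ2⟩ := heF1 D2 D2' q2 hq2 (by
    intro x y hx hy
    obtain ⟨a, rfl⟩ := (hqk2 x).1 hx
    obtain ⟨b, rfl⟩ := (hqk2 y).1 hy
    rw [mul_mul_mul_comm, hεε, zero_mul]) e2 (σ2.comp κ) (by rw [RingHom.comp_assoc, hσi2]) (by rw [map_one]; exact isUnit_one)
  have hρ1' : ∀ x, q2 (ρ0 x) = σ2 (κ x) := fun x => congrArg (fun g => g x) hρ1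
  have hψ2' : ∀ x, ψ2 (κ x) = τ1 x := fun x => congrArg (fun g => g x) hψ2
  have hτe2' : ∀ x, τ2 (e2 x) = f x := fun x => congrArg (fun g => g x) hτe2
  obtain ⟨N, τ', θ, hτ'C, hτ'θ, hθe, hθ⟩ := LL e1 heft1 heF1 e2 τ1 τ2 (by rw [hτe1, hτe2]) ε hε ρ0 hρ2 (fun x => by
    obtain ⟨l, hl⟩ := hν2 (κ x) (ρ0 x) (hρ1' x)
    exact ⟨l, by rw [← hψ2', hl, hτe2']⟩)
  have hkill : ∀ x, p x = 0 → θ (eval₂ e1 δ x) = 0 := by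
    intro x hx
    have hle : RingHom.ker p ≤ RingHom.ker (θ.comp (eval₂Hom e1 δ)) := by
      rw [← hS0, Ideal.span_le]
      intro x hx
      change θ (eval₂ e1 δ x) = 0
      obtain ⟨t, ht⟩ := hθ (g x)
      have h0 : e2 ε * ρ0 (g x) = 0 := by
        have h1 := Ideal.mem_map_of_mem σ2 (hA2 (g x) (Finset.mem_image_of_mem g hx))
        rw [Ideal.map_map, hσi2, ← hρ1', ← Ideal.map_map, Ideal.mem_map_iff_of_surjective q2 hq2] at h1
        obtain ⟨y, hy, hyq⟩ := h1
        obtain ⟨z, hz⟩ := (hqk2 (ρ0 (g x) - y)).1 (by rw [map_sub, hyq, sub_self])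
        have h2 : I.map e2 ≤ LinearMap.ker (LinearMap.mulLeft D2 (e2 ε) : D2 →ₗ[D2] D2) := by
          rw [Ideal.map_le_iff_le_comap]
          intro r hr
          change e2 ε * e2 r = 0
          rw [← map_mul, (hI r).1 hr, map_zero]
        have h3 : e2 ε * y = 0 := h2 hy
        rw [sub_eq_iff_eq_add.1 hz, mul_add, h3, add_zero, ← mul_assoc, hεε, zero_mul]
      have h4 : θ (e1 ε) = C (e2 ε) := congrArg (fun g => g ε) hθe
      rw [hg x (hS0k x hx), map_mul, ht, h4, mul_add, ← map_mul, h0, ← mul_assoc, ← map_mul, hεε, map_zero, zero_mul, add_zero]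
    exact hle hx
  obtain ⟨j, hj⟩ := exists_factor p hp (θ.comp (eval₂Hom e1 δ)) hkill
  have hji : j.comp i = (C : D2 →+* MvPolynomial (Fin N) D2).comp e2 := by
    rw [← hpi, ← RingHom.comp_assoc, hj, ← hθe, RingHom.comp_assoc]
    congr 1
    exact RingHom.ext fun a => eval₂Hom_C _ _ _
  refine ⟨_, inferInstance, j, τ', ?_, ?_, ?_⟩
  · refine RingHom.FiniteType.of_comp_finiteType (f := i) ?_
    rw [hji]
    exact (finiteType_of_presentation C (RingHom.id _) Function.surjective_id rfl).comp he2
  · refine RingHom.ext fun x => ?_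
    obtain ⟨x, rfl⟩ := hp x
    have h1 : j (p x) = θ (eval₂ e1 δ x) := congrArg (fun g => g x) hj
    rw [RingHom.comp_apply, h1, ← RingHom.comp_apply τ', hτ'θ, hδe]
  · rw [hji]
    exact heF2.comp' (FS.mvPolynomial _) (by rw [map_one, one_mul])

theorem PO.paste  {f : R →+* Λ} {a : R →+* R1}
    {l : Λ →+* Λ1} {r : R1 →+* Λ1} (h : PO f a l r) {b : R1 →+* R2} {l' : Λ →+* Λ2} {r' : R2 →+* Λ2} (h' : PO f (b.comp a) l' r') :
    ∃ γ : Λ1 →+* Λ2, PO r b γ r' := by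
  obtain ⟨γ, h1, h2⟩ := h.univ Λ2 l' (r'.comp b) h'.comm
  refine ⟨γ, h2, fun T _ α β hαβ => ?_, fun T _ η η' e1 e2 => ?_⟩
  · obtain ⟨δ, h3, h4⟩ := h'.univ T (α.comp l) β (by rw [RingHom.comp_assoc, h.comm, ← RingHom.comp_assoc, hαβ, RingHom.comp_assoc])
    refine ⟨δ, h.epi T _ _ ?_ ?_, h4⟩
    · rw [RingHom.comp_assoc, h1, h3]
    · rw [RingHom.comp_assoc, h2, ← RingHom.comp_assoc, h4, hαβ]
  · exact h'.epi T _ _ (by rw [← h1, ← RingHom.comp_assoc, e1, RingHom.comp_assoc]) e2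

theorem IsLoc.isLocalization  {a : R →+* K} {M : Submonoid R} (ha : IsLoc a M) :
    @IsLocalization R _ M K _ a.toAlgebra := by
  letI := a.toAlgebra
  refine ⟨⟨fun y => ha.unit y y.2, fun z => ?_, fun {x y} h => ?_⟩⟩
  · obtain ⟨v, z', hv, h⟩ := ha.surj z
    exact ⟨(z', ⟨v, hv⟩), by rw [mul_comm]; exact h⟩
  · obtain ⟨w, hw, h⟩ := ha.ker (x - y) (by rw [map_sub, sub_eq_zero]; exact h)
    exact ⟨⟨w, hw⟩, by rwa [mul_sub, sub_eq_zero] at h⟩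

theorem loc_po  (f : R →+* Λ) (a : R →+* K) (M : Submonoid R) (ha : IsLoc a M) :
    ∃ (r : K →+* Localization (M.map f)), PO f a (algebraMap Λ (Localization (M.map f))) r := by
  letI := a.toAlgebra
  haveI : IsLocalization M K := ha.isLocalization
  have hu : ∀ y : M, IsUnit (((algebraMap Λ (Localization (M.map f))).comp f) y) := fun y =>
    IsLocalization.map_units (Localization (M.map f)) (⟨f y, ⟨y, y.2, rfl⟩⟩ : M.map f)
  have hl : (IsLocalization.lift hu).comp a = (algebraMap Λ (Localization (M.map f))).comp f := IsLocalization.lift_comp hu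
  refine ⟨IsLocalization.lift hu, hl.symm, fun T _ α β h => ?_, fun T _ η η' h1 _ => IsLocalization.ringHom_ext (M.map f) h1⟩
  have hα : ∀ y : M.map f, IsUnit (α y) := by
    rintro ⟨_, x, hx, rfl⟩
    have := (ha.unit x hx).map β
    rw [← RingHom.comp_apply, ← h] at this
    exact this
  have h1 : (IsLocalization.lift (S := Localization (M.map f)) hα).comp (algebraMap _ _) = α := IsLocalization.lift_comp hα
  refine ⟨IsLocalization.lift hα, h1, IsLocalization.ringHom_ext M ?_⟩
  rw [RingHom.comp_assoc]
  change RingHom.comp _ ((IsLocalization.lift hu).comp a) = β.comp a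
  rw [hl, ← RingHom.comp_assoc, h1, h]

/-- regular homomorphisms, in terms of pushouts -/
def Rg {R Λ : Type u} [CommRing R] [CommRing Λ] (f : R →+* Λ) : Prop :=
  f.Flat ∧ ∀ (k k2 : Type u) [Field k] [Field k2] (a0 : R →+* k) (a1 : k →+* k2), a1.Finite → (∀ x, ∃ y z, a0 z ≠ 0 ∧ a0 z * x = a0 y) →
    ∃ (Λ2 : Type u) (_ : CommRing Λ2) (l : Λ →+* Λ2) (r : k2 →+* Λ2), PO f (a1.comp a0) l r ∧ ∀ (M : Ideal Λ2) [M.IsPrime], RegAt (Localization.AtPrime M)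

theorem Rg.quot  {f : R →+* Λ} (hf : Rg f) {ρ : R →+* R'} (hρ : Function.Surjective ρ)
    {l : Λ →+* Λ'} {f' : R' →+* Λ'} (h : PO f ρ l f') : Rg f' := by
  refine ⟨h.flat hf.1, fun k k2 _ _ a0 a1 h1 h2 => ?_⟩
  obtain ⟨Λ2, _, l', r', h3, h4⟩ := hf.2 k k2 (a0.comp ρ) a1 h1 (fun x => by
    obtain ⟨y, z, hz, hy⟩ := h2 x
    obtain ⟨y, rfl⟩ := hρ y
    obtain ⟨z, rfl⟩ := hρ z
    exact ⟨y, z, hz, hy⟩)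
  have h3' : PO f ((a1.comp a0).comp ρ) l' r' := h3
  obtain ⟨γ, hγ⟩ := h.paste h3'
  exact ⟨Λ2, inferInstance, γ, r', hγ, h4⟩

theorem Rg.greg {R Λ K L : Type u} [CommRing R] [CommRing Λ] [Field K] [CommRing L] {f : R →+* Λ} (hf : Rg f) {a : R →+* K}
    (ha : ∀ x, ∃ y z, a z ≠ 0 ∧ a z * x = a y) {l : Λ →+* L} {r : K →+* L} (h : PO f a l r) : GReg r := by
  intro k2 _ b hb
  obtain ⟨Λ2, _, l', r', h3, h4⟩ := hf.2 K k2 a b hb ha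
  obtain ⟨γ, hγ⟩ := h.paste h3
  exact ⟨Λ2, inferInstance, γ, r', hγ, h4⟩

theorem desc [IsNoetherianRing R]  (i : R →+* B0) (hi : i.FiniteType) (M : Submonoid R) (loc : B0 →+* B)
    (hu : ∀ m ∈ M, IsUnit (loc (i m))) (hs : ∀ y, ∃ m ∈ M, ∃ z, loc (i m) * y = loc z) (hk : ∀ x, loc x = 0 → x = 0)
    (hF : FS (loc.comp i) 1) : ∃ m ∈ M, FS i (i m) := by
  by_contra hcon
  push Not at hcon
  obtain ⟨𝔓, _, h𝔓, hd⟩ := Ideal.exists_le_prime_disjoint (smIdeal i hi) (M.map i) (by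
    rw [Set.disjoint_left]
    rintro _ h ⟨m, hm, rfl⟩
    exact hcon m hm h)
  letI := i.toAlgebra
  haveI : IsNoetherianRing B0 := noeth_of_ft i hi
  haveI : Algebra.FiniteType R B0 := hi
  haveI : Algebra.FinitePresentation R B0 := Algebra.FinitePresentation.of_finiteType.1 inferInstance
  have hmp : ∀ m ∈ M, i m ∉ 𝔓 := fun m hm h => Set.disjoint_left.1 hd h ⟨m, hm, rfl⟩
  have hFL : FS (algebraMap R (Localization.AtPrime 𝔓)) 1 := by
    obtain ⟨u, hu'⟩ : ∃ u : B →+* Localization.AtPrime 𝔓, u.comp loc = algebraMap B0 _ := by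
      letI := loc.toAlgebra
      haveI : IsLocalization (M.map i) B := IsLoc.isLocalization (a := loc) ⟨by rintro _ ⟨m, hm, rfl⟩; exact hu m hm, fun y => by
        obtain ⟨m, hm, z, h⟩ := hs y; exact ⟨i m, z, ⟨m, hm, rfl⟩, h⟩, fun x h => ⟨1, one_mem _, by rw [hk x h, mul_zero]⟩⟩
      have hv : ∀ y : M.map i, IsUnit (algebraMap B0 (Localization.AtPrime 𝔓) y) := by
        rintro ⟨_, m, hm, rfl⟩
        exact IsLocalization.map_units (Localization.AtPrime 𝔓) (⟨i m, hmp m hm⟩ : 𝔓.primeCompl)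
      exact ⟨IsLocalization.lift hv, IsLocalization.lift_comp hv⟩
    intro T T' _ _ q hq hsq φ g hg _
    have hcomp : algebraMap R (Localization.AtPrime 𝔓) = (algebraMap B0 _).comp i := rfl
    obtain ⟨g1, h1, h2⟩ := hF T T' q hq hsq φ (g.comp u) (by
      rw [← hg, hcomp, ← hu']; rfl) (by rw [map_one]; exact isUnit_one)
    have h3 : ∀ x, q (g1 (loc x)) = g (algebraMap B0 _ x) := fun x => by
      rw [← hu', ← RingHom.comp_apply q, h1]; rfl
    have hun : ∀ y : 𝔓.primeCompl, IsUnit ((g1.comp loc) y) := fun y => by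
      refine isUnit_of_sq_zero q hq hsq ?_
      rw [RingHom.comp_apply, h3]
      exact (IsLocalization.map_units (Localization.AtPrime 𝔓) y).map g
    have hlc : (IsLocalization.lift (S := Localization.AtPrime 𝔓) hun).comp (algebraMap B0 _) = g1.comp loc := IsLocalization.lift_comp hun
    refine ⟨IsLocalization.lift hun, IsLocalization.ringHom_ext 𝔓.primeCompl ?_, ?_⟩
    · rw [RingHom.comp_assoc, hlc]
      exact RingHom.ext h3
    · rw [hcomp, ← RingHom.comp_assoc, hlc, RingHom.comp_assoc, h2]
  haveI : Algebra.IsSmoothAt R 𝔓 := hFL.formallySmooth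
  obtain ⟨b, hb, hbs⟩ := Algebra.IsSmoothAt.exists_notMem_smooth R 𝔓
  haveI := hbs.formallySmooth
  have hFb : FS (algebraMap R (Localization.Away b)) 1 := FS.of_formallySmooth
  have : FS i b := by
    intro T T' _ _ q hq hsq φ g hg hgb
    have hlc : (IsLocalization.Away.lift (S := Localization.Away b) b hgb).comp (algebraMap B0 _) = g := IsLocalization.Away.lift_comp b hgb
    have hcomp : algebraMap R (Localization.Away b) = (algebraMap B0 _).comp i := rfl
    obtain ⟨g1, h1, h2⟩ := hFb T T' q hq hsq φ (IsLocalization.Away.lift b hgb) (by rw [hcomp, ← RingHom.comp_assoc, hlc, hg])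
       (by rw [map_one]; exact isUnit_one)
    exact ⟨g1.comp (algebraMap B0 _), by rw [← RingHom.comp_assoc, h1, hlc], by rw [RingHom.comp_assoc, ← hcomp, h2]⟩
  exact hb (h𝔓 this)

theorem loc_ft {R A K : Type u} [CommRing R] [CommRing A] [Field K] (i : R →+* A) (hi : i.FiniteType) (a : R →+* K) (M : Submonoid R) (ha : IsLoc a M)
    (r : K →+* Localization (M.map i)) (hr : PO i a (algebraMap A (Localization (M.map i))) r) : r.FiniteType := by
  obtain ⟨n, p, hp, hpi⟩ := exists_presentation i hi
  have key : ∀ P : MvPolynomial (Fin n) R, eval₂Hom r (fun k => algebraMap A (Localization (M.map i)) (p (X k))) (map a P) = algebraMap A _ (p P) := fun P => by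
    have : (eval₂Hom r (fun k => algebraMap A (Localization (M.map i)) (p (X k)))).comp (map a) = (algebraMap A _).comp p := by
      refine MvPolynomial.ringHom_ext (fun x => ?_) (fun k => by simp)
      have h1 := congrArg (fun g => g x) hr.comm
      have h2 := congrArg (fun g => g x) hpi
      simp only [RingHom.comp_apply] at h1 h2 ⊢
      rw [map_C, coe_eval₂Hom, eval₂_C, h2, h1]
    exact congrArg (fun g => g P) this
  refine finiteType_of_presentation r (eval₂Hom r (fun k => algebraMap A (Localization (M.map i)) (p (X k)))) (fun y => ?_) (RingHom.ext fun x => by simp)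
  obtain ⟨⟨x, _, m, hm, rfl⟩, h⟩ := IsLocalization.surj (M.map i) y
  obtain ⟨P, rfl⟩ := hp x
  have hu := ha.unit m hm
  refine ⟨C (a m)⁻¹ * map a P, ?_⟩
  rw [map_mul, key]
  have h1 := congrArg (fun g => g m) hr.comm
  simp only [RingHom.comp_apply] at h1 h
  rw [← h, coe_eval₂Hom, eval₂_C, h1, mul_left_comm, ← map_mul, inv_mul_cancel₀ hu.ne_zero, map_one, mul_one]

theorem red_step [IsNoetherianRing R] [IsNoetherianRing Λ]  {f : R →+* Λ} (hf : Rg f)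
    (p : Ideal R) [hp : p.IsPrime] (w : R) (hw : w ∉ p) (hwp : ∀ x ∈ p, w * x = 0) (i : R →+* A) (hi : i.FiniteType) (ψ : A →+* Λ) (hψ : ψ.comp i = f) :
    ∃ (A' : Type u) (_ : CommRing A') (κ : A →+* A') (ψ' : A' →+* Λ), κ.FiniteType ∧ ψ'.comp κ = ψ ∧
      (∃ b m, FS (κ.comp i) b ∧ m ∉ p ∧ ψ' b = f m) ∧ ∀ x ∈ p, FS κ (κ (i x)) := by
  obtain ⟨K, _, a, ha, hap⟩ : ∃ (K : Type u) (_ : Field K) (a : R →+* K), IsLoc a p.primeCompl ∧ ∀ x ∈ p, a x = 0 := by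
    have h0 : ∀ x, algebraMap (R ⧸ p) (FractionRing (R ⧸ p)) (Ideal.Quotient.mk p x) = 0 ↔ x ∈ p := fun x => by
      rw [IsFractionRing.to_map_eq_zero_iff, Ideal.Quotient.eq_zero_iff_mem]
    refine ⟨FractionRing (R ⧸ p), inferInstance, (algebraMap _ _).comp (Ideal.Quotient.mk p), ⟨fun x hx => ?_, fun y => ?_, fun x hx => ?_⟩, fun x hx => (h0 x).2 hx⟩
    · exact isUnit_iff_ne_zero.2 (fun h => hx ((h0 x).1 h))
    · obtain ⟨⟨x, s, hs⟩, h⟩ := IsLocalization.surj (nonZeroDivisors (R ⧸ p)) y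
      obtain ⟨x, rfl⟩ := Ideal.Quotient.mk_surjective x
      obtain ⟨s, rfl⟩ := Ideal.Quotient.mk_surjective s
      refine ⟨s, x, fun h' => nonZeroDivisors.ne_zero hs (Ideal.Quotient.eq_zero_iff_mem.2 h'), ?_⟩
      rw [mul_comm]; exact h
    · exact ⟨w, hw, hwp x ((h0 x).1 hx)⟩
  obtain ⟨r, hr⟩ := loc_po f a p.primeCompl ha
  obtain ⟨rA, hrA⟩ := loc_po i a p.primeCompl ha
  haveI : IsNoetherianRing (Localization (p.primeCompl.map f)) := IsLocalization.isNoetherianRing (p.primeCompl.map f) _ inferInstance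
  have hreg := hf.greg (fun x => by
    obtain ⟨v, z, hv, h⟩ := ha.surj x
    exact ⟨z, v, (ha.unit v hv).ne_zero, h⟩) hr
  obtain ⟨ψK, hK1, hK2⟩ := hrA.univ _ ((algebraMap Λ (Localization (p.primeCompl.map f))).comp ψ) r (by rw [RingHom.comp_assoc, hψ, hr.comm])
  obtain ⟨B, _, j, ψB, hj, hψB, hFB⟩ := field_pt r hreg _ rA (loc_ft i hi a _ ha rA hrA) ψK hK2
  have hFa : FS a 1 := by
    letI := a.toAlgebra
    haveI : IsLocalization p.primeCompl K := ha.isLocalization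
    haveI : Algebra.FormallySmooth R K := Algebra.FormallySmooth.of_isLocalization p.primeCompl
    exact FS.of_formallySmooth
  obtain ⟨n, q, hq, hqj⟩ := exists_presentation j hj
  obtain ⟨B0, _, loc0, j0, hinj, hj0, hlj, hX⟩ : ∃ (B0 : Type u) (_ : CommRing B0) (loc0 : B0 →+* B) (j0 : A →+* B0), (∀ x, loc0 x = 0 → x = 0) ∧ j0.FiniteType ∧
      loc0.comp j0 = j.comp (algebraMap A _) ∧ ∀ k, ∃ x, loc0 x = q (X k) := by
    refine ⟨(eval₂Hom (j.comp (algebraMap A _)) (fun k => q (X k))).range, inferInstance, Subring.subtype _,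
      (RingHom.rangeRestrict (eval₂Hom (j.comp (algebraMap A _)) (fun k => q (X k)))).comp C, fun x h => Subtype.ext h,
      finiteType_of_presentation _ _ (RingHom.rangeRestrict_surjective _) rfl, RingHom.ext fun x => by simp, fun k => ⟨⟨q (X k), X k, by simp⟩, rfl⟩⟩
  have hcom : loc0.comp (j0.comp i) = (j.comp rA).comp a := by rw [← RingHom.comp_assoc, hlj, RingHom.comp_assoc, hrA.comm]; rfl
  have hcom' : ∀ x, loc0 (j0 (i x)) = j (rA (a x)) := fun x => congrArg (fun g => g x) hcom
  obtain ⟨s, hs, hFs⟩ := desc (j0.comp i) (hj0.comp hi) p.primeCompl loc0 (fun m hm => by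
      rw [RingHom.comp_apply, hcom']
      exact ((ha.unit m hm).map rA).map j) (fun y => by
      obtain ⟨y, rfl⟩ := hq y
      induction y using MvPolynomial.induction_on with
      | C x =>
        obtain ⟨⟨x', _, m, hm, rfl⟩, h⟩ := IsLocalization.surj (p.primeCompl.map i) x
        refine ⟨m, hm, j0 x', ?_⟩
        have h1 : q (C x) = j x := congrArg (fun g => g x) hqj
        have h2 : ∀ x, loc0 (j0 x) = j (algebraMap A _ x) := fun x => congrArg (fun g => g x) hlj
        rw [h1, h2, RingHom.comp_apply, h2, ← map_mul, mul_comm]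
        exact congrArg j h
      | add y z hy hz =>
        obtain ⟨m, hm, y', hy⟩ := hy
        obtain ⟨m', hm', z', hz⟩ := hz
        refine ⟨m * m', mul_mem hm hm', j0 (i m') * y' + j0 (i m) * z', ?_⟩
        simp only [map_add, map_mul, ← hy, ← hz, RingHom.comp_apply]
        ring
      | mul_X y k hy =>
        obtain ⟨m, hm, y', hy⟩ := hy
        obtain ⟨x, hx⟩ := hX k
        exact ⟨m, hm, y' * x, by rw [map_mul, map_mul, ← hy, hx, mul_assoc]⟩) hinj (by
      rw [hcom]
      simpa using hFa.comp hFB)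
  have hψj : (ψB.comp loc0).comp j0 = (algebraMap Λ (Localization (p.primeCompl.map f))).comp ψ := by
    rw [RingHom.comp_assoc, hlj, ← RingHom.comp_assoc, hψB, hK1]
  have hun : IsUnit ((ψB.comp loc0) (j0 (i s))) := by
    rw [RingHom.comp_apply, hcom']
    exact (((ha.unit s hs).map rA).map j).map ψB
  have hθ : (IsLocalization.Away.lift (S := Localization.Away (j0 (i s))) (j0 (i s)) hun).comp (algebraMap B0 _) = ψB.comp loc0 := IsLocalization.Away.lift_comp _ hun
  haveI : IsNoetherianRing A := noeth_of_ft i hi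
  obtain ⟨D, _, κ, ψ', h1, h2, h3, h4⟩ := spread ψ (p.primeCompl.map f) (algebraMap Λ (Localization (p.primeCompl.map f))) (IsLoc.of_isLocalization _)
    ((algebraMap B0 (Localization.Away (j0 (i s)))).comp j0) (RingHom.FiniteType.comp
      (RingHom.finiteType_algebraMap.2 (IsLocalization.finiteType_of_monoid_fg (Submonoid.powers (j0 (i s))) _)) hj0)
    (IsLocalization.Away.lift (S := Localization.Away (j0 (i s))) (j0 (i s)) hun) (by rw [← RingHom.comp_assoc, hθ, hψj])
  obtain ⟨b, hb, m, hm, hbm⟩ := h3 R i hFs.to_away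
  refine ⟨D, inferInstance, κ, ψ', h1, h2, ⟨b, m, hb, hm, hbm.symm⟩, fun x hx => h4 _ ?_⟩
  rw [RingHom.comp_apply, hinj (j0 (i x)) (by rw [hcom', hap x hx, map_zero, map_zero]), map_zero]

theorem red_all [IsNoetherianRing R] [IsReduced R] [IsNoetherianRing Λ]  {f : R →+* Λ} (hf : Rg f)
    (i : R →+* A) (hi : i.FiniteType) (ψ : A →+* Λ) (hψ : ψ.comp i = f) :
    ∃ (A' : Type u) (_ : CommRing A') (κ : A →+* A') (ψ' : A' →+* Λ) (π : R), κ.FiniteType ∧ ψ'.comp κ = ψ ∧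
      (∀ x, π * x = 0 → x = 0) ∧ FS (κ.comp i) (κ (i π)) := by
  classical
  have hfin : (minimalPrimes R).Finite := minimalPrimes.finite_of_isNoetherianRing R
  have hz : ∀ x : R, (∀ p ∈ minimalPrimes R, x ∈ p) → x = 0 := fun x h => by
    have h1 : x ∈ sInf (⊥ : Ideal R).minimalPrimes := (Submodule.mem_sInf).2 h
    rw [Ideal.sInf_minimalPrimes] at h1
    obtain ⟨n, hn⟩ := h1
    exact eq_zero_of_pow_eq_zero hn
  have hP : ∀ p ∈ minimalPrimes R, p.IsPrime := fun p h => h.1.1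
  have hw : ∀ p : Ideal R, ∃ w, p ∈ minimalPrimes R → w ∉ p ∧ ∀ p' ∈ minimalPrimes R, p' ≠ p → w ∈ p' := fun p => by
    by_cases h : p ∈ minimalPrimes R
    · haveI := hP p h
      have h1 : ¬ (hfin.toFinset.erase p).inf id ≤ p := fun h1 => by
        obtain ⟨p', hp', h2⟩ := (Ideal.IsPrime.inf_le' (hP p h)).1 h1
        rw [Finset.mem_erase, Set.Finite.mem_toFinset] at hp'
        exact hp'.1 (le_antisymm h2 (h.2 hp'.2.1 h2))
      obtain ⟨w, hw1, hw2⟩ := SetLike.not_le_iff_exists.1 h1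
      refine ⟨w, fun _ => ⟨hw2, fun p' hp' hne => ?_⟩⟩
      exact (Finset.inf_le (f := id) (Finset.mem_erase.2 ⟨hne, hfin.mem_toFinset.2 hp'⟩) : _ ≤ p') hw1
    · exact ⟨0, fun h' => absurd h' h⟩
  choose w hw using hw
  have main : ∀ T : Finset (Ideal R), (∀ p ∈ T, p ∈ minimalPrimes R) → ∃ (A' : Type u) (_ : CommRing A') (κ : A →+* A') (ψ' : A' →+* Λ), κ.FiniteType ∧
      ψ'.comp κ = ψ ∧ ∀ p ∈ T, ∃ b m, FS (κ.comp i) b ∧ κ (i (w p)) ∣ b ∧ m ∉ p ∧ ψ' b = f (m * w p) := by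
    intro T
    induction T using Finset.induction_on with
    | empty => exact fun _ => ⟨A, inferInstance, RingHom.id A, ψ, RingHom.FiniteType.id A, rfl, fun p hp => absurd hp (Finset.notMem_empty p)⟩
    | insert l T hl ih =>
      intro hT
      obtain ⟨A1, _, κ1, ψ1, h1, h2, h3⟩ := ih (fun p hp => hT p (Finset.mem_insert_of_mem hp))
      have hlm := hT l (Finset.mem_insert_self _ _)
      haveI := hP l hlm
      obtain ⟨A2, _, κ2, ψ2, h4, h5, ⟨b0, m0, hb0, hm0, hbm⟩, h6⟩ := red_step hf l (w l) (hw l hlm).1 (fun x hx => hz _ fun p hp => by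
        by_cases hpl : p = l
        · rw [hpl]; exact l.mul_mem_left _ hx
        · exact p.mul_mem_right _ ((hw l hlm).2 p hp hpl)) (κ1.comp i) (h1.comp hi) ψ1 (by rw [← RingHom.comp_assoc, h2, hψ])
      have h7 : ∀ x, ψ2 (κ2 (κ1 (i x))) = f x := fun x => by rw [← hψ, ← h2, ← h5]; rfl
      refine ⟨A2, inferInstance, κ2.comp κ1, ψ2, h4.comp h1, by rw [← RingHom.comp_assoc, h5, h2], fun p hp => ?_⟩
      by_cases hpl : p = l
      · subst hpl
        refine ⟨κ2 (κ1 (i (w p))) * b0, m0, hb0.mono (dvd_mul_left _ _), dvd_mul_right _ _, hm0, ?_⟩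
        rw [map_mul, h7, hbm, map_mul, mul_comm]
      · obtain ⟨b, m, hb, hbd, hm, hbm⟩ := h3 p (Finset.mem_of_mem_insert_of_ne hp hpl)
        have hpm := hT p hp
        refine ⟨κ2 b, m, hb.comp_base ((h6 (w p) ((hw p hpm).2 l hlm (Ne.symm hpl))).mono (map_dvd κ2 hbd)), map_dvd κ2 hbd, hm, ?_⟩
        rw [← hbm, ← h5]; rfl
  obtain ⟨A1, _, κ, ψ1, h1, h2, h3⟩ := main hfin.toFinset (fun p hp => hfin.mem_toFinset.1 hp)
  have h3' : ∀ p : Ideal R, ∃ b m, p ∈ hfin.toFinset → FS (κ.comp i) b ∧ κ (i (w p)) ∣ b ∧ m ∉ p ∧ ψ1 b = f (m * w p) := fun p => by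
    by_cases h : p ∈ hfin.toFinset
    · obtain ⟨b, m, h⟩ := h3 p h
      exact ⟨b, m, fun _ => h⟩
    · exact ⟨0, 0, fun h' => absurd h' h⟩
  choose b m hbm using h3'
  have h7 : ∀ x, ψ1 (κ (i x)) = f x := fun x => by rw [← hψ, ← h2]; rfl
  obtain ⟨π, hπ⟩ : ∃ π, π = ∑ p ∈ hfin.toFinset, m p * w p := ⟨_, rfl⟩
  obtain ⟨B, _, j, ψ', h4, h5, h6, -⟩ := GND.A1 (κ.comp i) (h1.comp hi) ψ1 π ⟨1, by
    rw [pow_one, RingHom.comp_apply, h7, hπ, map_sum]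
    refine Ideal.sum_mem _ fun p hp => Ideal.subset_span ⟨b p, (hbm p hp).1, (hbm p hp).2.2.2⟩⟩
  refine ⟨B, inferInstance, j.comp κ, ψ', π, h4.comp h1, by rw [← RingHom.comp_assoc, h5, h2], fun x hx => hz x fun p hp => ?_, h6⟩
  haveI := hP p hp
  have hps := hfin.mem_toFinset.2 hp
  have h8 : π * x ∈ p := by rw [hx]; exact p.zero_mem
  refine (Ideal.IsPrime.mem_or_mem inferInstance h8).resolve_left fun h9 => ?_
  rw [hπ, ← Finset.add_sum_erase _ _ hps] at h9
  have h10 := (Ideal.add_mem_iff_left p (Ideal.sum_mem _ fun p' hp' => p.mul_mem_left _ ((hw p' (hfin.mem_toFinset.1 (Finset.mem_of_mem_erase hp'))).2 p hp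
    (Finset.ne_of_mem_erase hp').symm))).1 h9
  exact (Ideal.IsPrime.mem_or_mem inferInstance h10).elim (hbm p hps).2.2.1 (hw p hp).1

/-- all quotients by a nonzero element satisfy the conclusion of the theorem -/
def QD {R Λ : Type u} [CommRing R] [CommRing Λ] (f : R →+* Λ) : Prop :=
  ∀ ε : R, ε ≠ 0 → ∃ (R' Λ' : Type u) (_ : CommRing R') (_ : CommRing Λ') (ρ : R →+* R') (pΛ : Λ →+* Λ') (f' : R' →+* Λ'), Function.Surjective ρ ∧
    (∀ r, ρ r = 0 ↔ ε ∣ r) ∧ Function.Surjective pΛ ∧ (∀ x, pΛ x = 0 ↔ f ε ∣ x) ∧ f'.comp ρ = pΛ.comp f ∧ PT f'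

theorem main_step [IsNoetherianRing R] [Nontrivial R]  (f : R →+* Λ) (hfl : f.Flat) (hQD : QD f)
    (i : R →+* A) (hi : i.FiniteType) (ψ : A →+* Λ) (hψ : ψ.comp i = f) (π0 : R) (hπ0 : ∀ x, π0 * x = 0 → x = 0) (hF : FS i (i π0)) :
    ∃ (B : Type u) (_ : CommRing B) (j : A →+* B) (ψ' : B →+* Λ), j.FiniteType ∧ ψ'.comp j = ψ ∧ FS (j.comp i) 1 := by
  obtain ⟨n, p, hp, hpi⟩ := exists_presentation i hi
  have hpi' : ∀ x, p (C x) = i x := fun x => congrArg (fun g => g x) hpi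
  rw [← hpi', FS_iff_QS p hp hpi] at hF
  obtain ⟨N, hQS⟩ := hF
  rw [← C_pow] at hQS
  obtain ⟨m, J', hS, hinl, hinr⟩ := elkik (IsNoetherian.noetherian _) _ hQS
  have hpow : ∀ (k : ℕ) x, π0 ^ k * x = 0 → x = 0 := fun k => by
    induction k with
    | zero => intro x h; simpa using h
    | succ k ih => intro x h; exact hπ0 x (ih _ (by rw [← mul_assoc, ← pow_succ]; exact h))
  obtain ⟨π, hπe⟩ : ∃ π, π = (π0 ^ N) ^ 6 := ⟨_, rfl⟩
  rw [← hπe] at hS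
  have hπ : ∀ x, π * x = 0 → x = 0 := by rw [hπe, ← pow_mul]; exact hpow _
  have hπ6 : π ^ 6 ≠ 0 := fun h => one_ne_zero (hpow (N * 6 * 6) (1 : R) (by rw [mul_one, pow_mul, pow_mul, ← hπe, h]))
  have hfπ : ∀ x, f π * x = 0 → x = 0 := fun x hx => by
    obtain ⟨k, a, y, rfl, h⟩ := flat_rel f hfl π x hx
    exact Finset.sum_eq_zero fun j _ => by rw [hπ _ (h j), map_zero, zero_mul]
  have hΛ : ∀ x, f π ^ 2 * x = 0 → f π * x = 0 := fun x hx => hfπ _ (by rw [← hx]; ring)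
  obtain ⟨R', Λ', _, _, ρ, pΛ, f', hρ, hρk, hpΛ, hpk, hf', hPT⟩ := hQD _ hπ6
  obtain ⟨A', _, qA, hqA, hqk⟩ := exists_quot (Ideal.span {i (π ^ 6)})
  obtain ⟨i', hi'⟩ := exists_factor ρ hρ (qA.comp i) (fun x hx => (hqk _).2 (Ideal.mem_span_singleton.2 (map_dvd i ((hρk x).1 hx))))
  have hψ' : ∀ x, ψ (i x) = f x := fun x => congrArg (fun g => g x) hψ
  obtain ⟨ψA, hψA⟩ := exists_factor qA hqA (pΛ.comp ψ) (fun x hx => (hpk _).2 (by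
    rw [← hψ']; exact map_dvd ψ (Ideal.mem_span_singleton.1 ((hqk x).1 hx))))
  obtain ⟨Cb, _, j, ψC, hj, hψC, hFC⟩ := hPT A' i' (RingHom.FiniteType.of_comp_finiteType (f := ρ) (by
    rw [hi']; exact (RingHom.FiniteType.of_surjective _ hqA).comp hi)) ψA (by
    refine RingHom.cancel_right hρ |>.1 ?_
    rw [RingHom.comp_assoc, hi', ← RingHom.comp_assoc, hψA, RingHom.comp_assoc, hψ, hf'])
  have hc : (j.comp (qA.comp p)).FiniteType := hj.comp ((RingHom.FiniteType.of_surjective _ hqA).comp (RingHom.FiniteType.of_surjective _ hp))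
  obtain ⟨P, _, _, CP, pP, ev, hpP, hpc, hCPft, hCPfs, hCPfl, hevC0, hpev⟩ := abs_pres (j.comp (qA.comp p)) hc pΛ hpΛ ψC (ψ.comp p) (by
    rw [← RingHom.comp_assoc, hψC, ← RingHom.comp_assoc, hψA]; rfl)
  have hpc' : ∀ x, pP (CP x) = j (qA (p x)) := fun x => congrArg (fun g => g x) hpc
  have hevC : ∀ x, ev (CP x) = ψ (p x) := fun x => congrArg (fun g => g x) hevC0
  obtain ⟨CC, hCC⟩ : ∃ CC : R →+* P, CC = CP.comp C := ⟨_, rfl⟩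
  have hCC' : ∀ x, CC x = CP (C x) := fun x => by rw [hCC]; rfl
  have hFSCC : FS CC 1 := by
    have := FS.comp (FS.mvPolynomial (R := R) (Fin n)) hCPfs
    rw [map_one, one_mul] at this; rw [hCC]; exact this
  have hev' : ∀ x, ev (CC x) = f x := fun x => by rw [hCC', hevC, hpi', hψ']
  obtain ⟨D, _, β, τ, hβ, hτβ, hD1, hD2, hD3⟩ := lemmaD CC hFSCC (by rw [hCC]; exact (flat_C _).comp hCPfl) π hπ pP hpP ρ hρ
    (fun r hr => (hρk r).1 hr) (j.comp i') (by
      rw [RingHom.comp_assoc, hi', hCC, ← hpi]; exact congrArg (fun g => g.comp C) hpc.symm) ev (fun x hx => by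
      rw [hev', ← map_pow]
      refine (hpk _).1 ?_
      have := congrArg (fun g => g x) hpev
      simp only [RingHom.comp_apply] at this
      rw [this, hx, map_zero]) (by rw [hev']; exact hΛ)
  rw [hev'] at hD3
  have hτβ' : ∀ x, τ (β x) = ev x := fun x => congrArg (fun g => g x) hτβ
  haveI : IsNoetherianRing D := noeth_of_ft β hβ
  have hτπ : τ ((β.comp CC) π) = f π := by rw [RingHom.comp_apply, hτβ', hev']
  have hev2 : ∀ g : MvPolynomial (Fin n) R, eval₂ (τ.comp (β.comp CC)) (fun k => ψ (p (X k))) g = ψ (p g) := by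
    intro g
    have : eval₂Hom (τ.comp (β.comp CC)) (fun k => ψ (p (X k))) = ψ.comp p :=
      MvPolynomial.ringHom_ext (fun x => by simp [hτβ', hev', hpi', hψ']) (fun k => by simp)
    exact congrArg (fun h => h g) this
  have hβC : ∀ g : MvPolynomial (Fin n) R, eval₂ (β.comp CC) (fun k => β (CP (X k))) g = β (CP g) := by
    intro g
    have : eval₂Hom (β.comp CC) (fun k => β (CP (X k))) = β.comp CP :=
      MvPolynomial.ringHom_ext (fun x => by simp [hCC']) (fun k => by simp)
    exact congrArg (fun h => h g) this
  obtain ⟨B, _, β2, σ, τ', γ, hβ2, hτ', hσ, hσJ, hN1, ⟨c', hc'⟩, hN2⟩ := newton hS (β.comp CC) τ (Sum.elim (fun k => ψ (p (X k))) (fun _ => 0))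
    (fun g hg => by rw [eval_retr, hev2, RingHom.mem_ker.1 (hinr g hg), map_zero])
    (Sum.elim (fun k => β (CP (X k))) (fun _ => 0)) (fun g hg => by
      rw [eval_retr, hβC]
      exact hD1 _ (by rw [hpc', RingHom.mem_ker.1 (hinr g hg), map_zero, map_zero])) (fun _ => 0) (fun k => by
      cases k with
      | inl k => simp [hτβ', hevC]
      | inr k => simp) (by rw [hτπ]; exact hΛ)
  have hτ'' : ∀ x, τ' (β2 x) = τ x := fun x => congrArg (fun g => g x) hτ'
  obtain ⟨κ, hκ⟩ := exists_factor p hp (eval₂Hom (β2.comp (β.comp CC)) (fun k => σ (Sum.inl k))) (fun x hx => by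
    have := hσJ _ (hinl x hx)
    rw [eval₂_rename] at this
    exact this)
  have hκi : κ.comp i = β2.comp (β.comp CC) := by rw [← hpi, ← RingHom.comp_assoc, hκ]; exact RingHom.ext fun x => by simp
  have hCft : (C : R →+* MvPolynomial (Fin n) R).FiniteType := finiteType_of_presentation _ (RingHom.id _) Function.surjective_id rfl
  have hκft : κ.FiniteType := RingHom.FiniteType.of_comp_finiteType (f := i) (by
    rw [hκi, hCC]; exact hβ2.comp (hβ.comp (hCPft.comp hCft)))
  have hτκ : τ'.comp κ = ψ := by
    refine RingHom.cancel_right hp |>.1 ?_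
    rw [RingHom.comp_assoc, hκ]
    refine MvPolynomial.ringHom_ext (fun x => ?_) (fun k => ?_)
    · simp [hτ'', hτβ', hev', hpi', hψ']
    · simp [hσ]
  obtain ⟨E, _, jE, ψE, h1, h2, h3⟩ := step0 (κ.comp i) (hκft.comp hi) τ' (fun 𝔔 _ => by
    by_cases hmem : f π ∈ 𝔔
    · obtain ⟨δ, hδ1, hδ2, hδ3⟩ := hD3 𝔔 1 hmem (by rw [map_one]; exact hFC) (by rw [map_one]; exact (Ideal.ne_top_iff_one _).1 (Ideal.IsPrime.ne_top inferInstance))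
      refine ⟨β2 δ * γ, ?_, ?_⟩
      · have := hN2 _ _ δ hδ2 (fun x hx => hδ3 _ (by
          rw [RingHom.comp_apply] at hx ⊢; rw [← hx]; ring))
        rw [hκi]; exact this
      · rw [map_mul, hτ'', hc']
        intro hh
        refine (Ideal.IsPrime.mem_or_mem ‹_› hh).elim hδ1 fun hh => Ideal.IsPrime.ne_top (I := 𝔔) inferInstance ?_
        rw [Ideal.eq_top_iff_one]
        have e1 : τ' (1 + β2 ((β.comp CC) π) * c') - f π * τ' c' = 1 := by
          rw [map_add, map_mul, hτ'', hτπ, map_one]; ring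
        rw [← e1]
        exact Ideal.sub_mem _ hh (Ideal.mul_mem_right _ _ hmem)
    · refine ⟨β2 ((β.comp CC) π), ?_, by rwa [hτ'', hτπ]⟩
      rw [hκi]
      refine hN1 ?_
      have := FS.comp hFSCC hD2
      rwa [map_one, one_mul] at this)
  exact ⟨E, inferInstance, jE.comp κ, ψE, h1.comp hκft, by rw [← RingHom.comp_assoc, h2, hτκ], h3⟩

theorem main_pt [IsNoetherianRing R] [IsNoetherianRing Λ] (f : R →+* Λ) (hf : Rg f) (hQD : QD f) : PT f := by
  by_cases hred : IsReduced R
  · intro A _ i hi ψ hψ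
    cases subsingleton_or_nontrivial R with
    | inl h => exact step0 i hi ψ fun 𝔔 h𝔔 => absurd (by
        rw [Ideal.eq_top_iff_one, ← map_one f, Subsingleton.elim (1 : R) 0, map_zero]; exact 𝔔.zero_mem) h𝔔.ne_top
    | inr h =>
      obtain ⟨A', _, κ, ψ', π, h1, h2, h3, h4⟩ := red_all hf i hi ψ hψ
      obtain ⟨B, _, j, ψB, h5, h6, h7⟩ := main_step f hf.1 hQD (κ.comp i) (h1.comp hi) ψ' (by rw [← RingHom.comp_assoc, h2, hψ]) π h3 h4
      exact ⟨B, inferInstance, j.comp κ, ψB, h5.comp h1, by rw [← RingHom.comp_assoc, h6, h2], h7⟩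
  · rw [isReduced_iff_pow_one_lt 2 one_lt_two] at hred
    push Not at hred
    obtain ⟨ε, h1, h2⟩ := hred
    obtain ⟨R', Λ', _, _, ρ, pΛ, f', hρ, hρk, hpΛ, hpk, hf', hPT⟩ := hQD ε h2
    exact nil_step f hf.1 ε (by rw [← sq, h1]) ρ hρ hρk pΛ hpΛ hpk f' hf' hPT

theorem popescu [IsNoetherianRing R0] (I : Ideal R0) : ∀ (R Λ : Type u) [CommRing R] [CommRing Λ] [IsNoetherianRing Λ] (ρ : R0 →+* R)
    (f : R →+* Λ), Function.Surjective ρ → RingHom.ker ρ = I → Rg f → PT f := by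
  induction I using IsNoetherian.induction with
  | hgt I ih =>
    intro R Λ _ _ _ ρ f hρ hI hf
    haveI : IsNoetherianRing R := isNoetherianRing_of_surjective R0 R ρ hρ
    refine main_pt f hf fun ε hε => ?_
    obtain ⟨R', _, q, hq, hqk⟩ := exists_quot (Ideal.span {ε})
    obtain ⟨Λ', _, l, hl, hlk⟩ := exists_quot (Ideal.span {f ε})
    have hqk' : ∀ r, q r = 0 ↔ ε ∣ r := fun r => (hqk r).trans Ideal.mem_span_singleton
    have hlk' : ∀ r, l r = 0 ↔ f ε ∣ r := fun r => (hlk r).trans Ideal.mem_span_singleton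
    obtain ⟨f', hf'⟩ := exists_factor q hq (l.comp f) (fun x hx => (hlk' _).2 (map_dvd f ((hqk' x).1 hx)))
    haveI : IsNoetherianRing Λ' := isNoetherianRing_of_surjective Λ Λ' l hl
    refine ⟨R', Λ', inferInstance, inferInstance, q, l, f', hq, hqk', hl, hlk', hf', ?_⟩
    obtain ⟨ε0, rfl⟩ := hρ ε
    refine ih (RingHom.ker (q.comp ρ)) (lt_of_le_of_ne (fun x hx => ?_) fun h => hε ?_) R' Λ' (q.comp ρ) f' (hq.comp hρ) rfl
      (hf.quot hq (PO.quot f q hq l hl f' hf'.symm fun x hx => ?_))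
    · rw [← hI, RingHom.mem_ker] at hx
      rw [RingHom.mem_ker, RingHom.comp_apply, hx, map_zero]
    · have : ε0 ∈ RingHom.ker (q.comp ρ) := (hqk' _).2 dvd_rfl
      rwa [← h, ← hI] at this
    · obtain ⟨y, rfl⟩ := (hlk' x).1 hx
      exact Ideal.mul_mem_right _ _ (Ideal.subset_span ⟨_, (hqk' _).2 dvd_rfl, rfl⟩)

end GND

namespace GND

theorem Rg.of_regular {A B : Type u} [CommRing A] [CommRing B] (φ : A →+* B) (h : RingHomIsRegular φ) : Rg φ := by
  refine ⟨h.1, fun k k2 _ _ a0 a1 h1 h2 => ?_⟩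
  haveI hp : (RingHom.ker a0).IsPrime := RingHom.ker_isPrime a0
  have hinj : Function.Injective (RingHom.kerLift a0) := RingHom.kerLift_injective a0
  obtain ⟨e, he⟩ : ∃ e : FractionRing (A ⧸ RingHom.ker a0) →+* k, ∀ x, e (algebraMap _ _ x) = RingHom.kerLift a0 x :=
    ⟨IsFractionRing.lift hinj, fun x => IsFractionRing.lift_algebraMap hinj x⟩
  have he0 : ∀ x, e (residueFieldHom (RingHom.ker a0) x) = a0 x := fun x => he _
  have hes : Function.Surjective e := fun x => by
    obtain ⟨y, z, hz, hx⟩ := h2 x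
    refine ⟨(residueFieldHom (RingHom.ker a0) z)⁻¹ * residueFieldHom (RingHom.ker a0) y, ?_⟩
    rw [map_mul, map_inv₀, he0, he0, ← hx, inv_mul_cancel_left₀ hz]
  letI : Algebra (FractionRing (A ⧸ RingHom.ker a0)) k2 := (a1.comp e).toAlgebra
  have hfin : (a1.comp e).Finite := h1.comp (RingHom.Finite.of_surjective e hes)
  haveI : FiniteDimensional (FractionRing (A ⧸ RingHom.ker a0)) k2 := hfin
  have hα : (a1.comp e).comp (residueFieldHom (RingHom.ker a0)) = a1.comp a0 := RingHom.ext fun x => congrArg a1 (he0 x)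
  have hreg := h.2 (RingHom.ker a0) k2
  have hpo := po_tensor φ ((a1.comp e).comp (residueFieldHom (RingHom.ker a0)))
  letI : Algebra A B := φ.toAlgebra
  letI : Algebra A k2 := ((a1.comp e).comp (residueFieldHom (RingHom.ker a0))).toAlgebra
  refine ⟨TensorProduct A B k2, inferInstance, algebraMap B (TensorProduct A B k2), 
    ((Algebra.TensorProduct.includeRight : k2 →ₐ[A] TensorProduct A B k2) : k2 →+* TensorProduct A B k2), ?_, fun M _ => ?_⟩
  · rw [← hα]; exact hpo
  · obtain ⟨-, hl, s, hs1, hs2⟩ := hreg.2 M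
    exact ⟨s, hs1, le_of_eq hs2⟩

end GND

/-- **General Néron Desingularization** (D. Popescu).  Let `φ : A → B` be a regular morphism
of Noetherian commutative rings, `C` a finitely generated `A`-algebra and `ψ : C → B` a
morphism of `A`-algebras.  Then `ψ` factors through a finitely generated `A`-algebra `D`
which is smooth over `A`. -/
theorem general_neron_desingularization {A B C : Type u}
    [CommRing A] [CommRing B] [CommRing C]
    [IsNoetherianRing A] [IsNoetherianRing B]
    (φ : A →+* B) (hφ : RingHomIsRegular φ)
    [Algebra A C] (hC : Algebra.FiniteType A C)
    (ψ : C →+* B) (hψ : ψ.comp (algebraMap A C) = φ) :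
    ∃ (D : Type u) (_ : CommRing D) (_ : Algebra A D),
      Algebra.FiniteType A D ∧ Algebra.Smooth A D ∧
      ∃ (σ : C →+* D) (τ : D →+* B),
        σ.comp (algebraMap A C) = algebraMap A D ∧
        τ.comp (algebraMap A D) = φ ∧
        τ.comp σ = ψ := by
  obtain ⟨D, _, j, τ, hj, hτ, hF⟩ := GND.popescu ⊥ A B (RingHom.id A) φ Function.surjective_id (by ext; simp) (GND.Rg.of_regular φ hφ) C
    (algebraMap A C) (RingHom.finiteType_algebraMap.2 hC) ψ hψ
  letI : Algebra A D := (j.comp (algebraMap A C)).toAlgebra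
  have hft : Algebra.FiniteType A D := hj.comp (RingHom.finiteType_algebraMap.2 hC)
  have hsm : Algebra.FormallySmooth A D := GND.FS.formallySmooth hF
  exact ⟨D, inferInstance, inferInstance, hft, ⟨hsm, Algebra.FinitePresentation.of_finiteType.1 hft⟩, j, τ, rfl,
    (congrArg (fun g => g.comp (algebraMap A C)) hτ).trans hψ, hτ⟩
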